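/- Let d ≥ 1, let P(ξ) = ⟨ξ⟩ = √(1+|ξ|²), fix 0 < δ < 1/2 and 0 < ε < 1, and let χ ∈ C_c^∞(ℝ^d) be real-valued, radial, and equal to 1 near 0. Define A(t) = Op(a^{KG}(t)) and A_±(t) = Op(a^{KG}_±(t)), where a^{KG}(t,x,ξ) = 1_{|x| > |t|·|ξ|/⟨ξ⟩} · χ(ξ/|t|^ε) and a^{KG}_±(t,x,ξ) = χ((x ± t ξ/⟨ξ⟩)/|t|^{1/2+δ}) · 1_{|x| > |t|·|ξ|/⟨ξ⟩} · χ(ξ/|t|^ε). Then there exist a constant C > 0 and a time t₀ ≥ 1, both independent of t, such that for every t > t₀, the operators A(t), A_+(t) and A_−(t) are bounded on L²(ℝ^d) with operator norm at most C. -/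

import Mathlib

open MeasureTheory Filter Topology
open scoped RealInnerProductSpace ENNReal

noncomputable section

abbrev Euc (d : ℕ) := EuclideanSpace ℝ (Fin d)

/-- Fourier transform `f̂(ξ) = ∫ e^{-i x·ξ} f(x) dx`. -/
def FT {d : ℕ} (f : Euc d → ℂ) (ξ : Euc d) : ℂ :=
  ∫ x : Euc d, Complex.exp (-(Complex.I * ((⟪x, ξ⟫ : ℝ) : ℂ))) * f x

/-- `v` is the (distributional) Fourier transform of `u`: tested against Schwartz functions,
`∫ v·g = ∫ u·ĝ`. For `u ∈ L²` this characterizes `v` almost everywhere. -/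
def IsFourierTransformOf {d : ℕ} (u v : Euc d → ℂ) : Prop :=
  ∀ g : SchwartzMap (Euc d) ℂ, ∫ ξ : Euc d, v ξ * g ξ = ∫ x : Euc d, u x * FT (⇑g) x

/-- A function on `ℝ^d` is radial if it only depends on the norm. -/
def IsRadial {d : ℕ} {α : Type*} (f : Euc d → α) : Prop :=
  ∀ x y : Euc d, ‖x‖ = ‖y‖ → f x = f y

/-- A function equals `1` in a neighbourhood of `0`. -/
def EqOneNearZero {d : ℕ} (f : Euc d → ℝ) : Prop :=
  ∃ r : ℝ, 0 < r ∧ ∀ x : Euc d, ‖x‖ < r → f x = 1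

/-- The japanese bracket `⟨ξ⟩ = √(1+|ξ|²)`. -/
def jap {d : ℕ} (ξ : Euc d) : ℝ := Real.sqrt (1 + ‖ξ‖ ^ 2)

/-- The Klein–Gordon truncation symbol
`a^{KG}_ε(t,x,ξ) = 1_{|x| > |t||ξ|/⟨ξ⟩} · χ(ξ/|t|^ε)`. -/
def aKG {d : ℕ} (χ : Euc d → ℝ) (ε t : ℝ) (x ξ : Euc d) : ℂ :=
  (if |t| * (‖ξ‖ / jap ξ) < ‖x‖ then (1:ℂ) else 0) * ((χ ((|t| ^ ε)⁻¹ • ξ) : ℝ) : ℂ)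

/-- `Op(a)` applied to the `L²` function with Fourier transform `g`:
`(2π)^{-d} ∫ e^{i x·ξ} a(x,ξ) g(ξ) dξ` (absolutely convergent when `a` is compactly
supported in `ξ` and `g ∈ L²`). -/
def OpF {d : ℕ} (a : Euc d → Euc d → ℂ) (g : Euc d → ℂ) (x : Euc d) : ℂ :=
  (((2 * Real.pi) ^ d : ℝ) : ℂ)⁻¹ *
    ∫ ξ : Euc d, Complex.exp (Complex.I * ((⟪x, ξ⟫ : ℝ) : ℂ)) * a x ξ * g ξ


/-- The signed Klein–Gordon truncation symbol
`a^{KG}_±(t,x,ξ) = χ((x ± tξ/⟨ξ⟩)/|t|^{1/2+δ}) · 1_{|x| > |t||ξ|/⟨ξ⟩} · χ(ξ/|t|^ε)`,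
with `s = ±1`. -/
def aKGpm {d : ℕ} (χ : Euc d → ℝ) (δ ε s t : ℝ) (x ξ : Euc d) : ℂ :=
  ((χ ((|t| ^ ((1:ℝ)/2 + δ))⁻¹ • (x + (s * t / jap ξ) • ξ)) : ℝ) : ℂ) *
    (if |t| * (‖ξ‖ / jap ξ) < ‖x‖ then (1:ℂ) else 0) *
    ((χ ((|t| ^ ε)⁻¹ • ξ) : ℝ) : ℂ)

open Real (sqrt norm_eq_abs sqrt_eq_rpow sqrt_mul sqrt_sq mul_self_sqrt rpow_neg le_sqrt_of_sq_le sqrt_pos sq_sqrt sqrt_nonneg pi_pos rpow_pos_of_pos exp_le_one_iff mul_rpow exp_neg add_one_le_exp abs_sin_le_one arctan cos hasDerivAt_arctan pow_div_factorial_le_exp exp_one_lt_d9 exp_le_exp rpow_natCast rpow_neg_one rpow_add hasDerivAt_cosh hasDerivAt_sinh arsinh cosh_arsinh sinh_arsinh rpow_le_rpow_of_nonpos sqrt_le_iff pi_gt_three HolderConjugate arctan_lt_pi_div_two arctan_pos tan_arctan log exp_nat_mul)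
open Set (Icc indicator mem_prod indicator_of_mem indicator_of_notMem mem_Icc uIoc_of_le uIcc_of_le uIcc Ioc Ioi univ Ioi_inter_Iic indicator_le_indicator)
open Complex (norm_I norm_exp_ofReal_mul_I ofRealCLM exp_eq_exp_ℂ coe_algebraMap re_le_norm conj_I continuous_conj real_smul norm_exp ofReal_exp I_sq continuous_ofReal ofReal_sub ofReal_re norm_exp_le_exp_norm re_mul_ofReal exp_conj conj_ofReal normSq_eq_norm_sq normSq_apply mul_conj re_ofReal_mul)
open intervalIntegral (integral_of_le integral_eq_sub_of_hasDerivAt integral_add_adjacent_intervals)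
open ContinuousLinearMap (mul adjoint_inner_left opNorm_le_bound star_eq_adjoint adjoint)
open RCLike (norm_conj im)
open ENNReal (toReal_nonneg toReal_mono ofReal_ne_top ofReal_eq_zero ofReal_le_ofReal mul_rpow_of_nonneg rpow_le_rpow mul_ne_top toReal_mul toReal_ofReal ofReal_pow)
open Metric (closedBall)
open Finset (range)
local notation "tPi" => (2 * Real.pi)
local notation "rE" => Real.exp
local notation "cE" => Complex.exp
local notation "iI" => Complex.I
local notation "rpi" => Real.pi
local notation "eR" => ENNReal.ofReal
local notation "SA" => IsSelfAdjoint
local notation "mll" => mul_le_mul_of_nonneg_left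
local notation "mlr" => mul_le_mul_of_nonneg_right
local notation "aea" => ae_of_all _
local notation "ica" => integral_congr_ae
local notation "icm" => integral_const_mul
local notation "rno" => Real.norm_of_nonneg
local notation "cnr" => Complex.norm_real
local notation "cjj" => starRingEnd ℂ
local notation "rxp" => Real.exp_pos
local notation "rSin" => Real.sin
local notation "mCst" => measurable_const
local notation "zR" => (0:ℝ)
local notation "oR" => (1:ℝ)
local notation "wR" => (2:ℝ)
local notation "pO" => (by positivity)
local notation "fP" => (by fun_prop)
local notation "nU" => (by norm_num)
local notation "nN" => (norm_nonneg _)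
local notation "oC" => Complex.ofReal
local notation "lI" => (by linarith)

section ThmL
variable {A : Type*} [CStarAlgebra A]
variable {x y : A} {a b : ℝ}

def EE (x : A) (s : ℝ) : A := NormedSpace.exp ((iI * s) • x)

lemma EE_zero (x : A) : EE x 0 = 1 := by simp [EE, NormedSpace.exp_zero]

lemma EE_add (x : A) (s t : ℝ) : EE x (s + t) = EE x s * EE x t := by
  letI : NormedAlgebra ℚ A := NormedAlgebra.restrictScalars ℚ ℂ A
  unfold EE
  rw [← NormedSpace.exp_add_of_commute]
  · congr 1; push_cast; rw [mul_add, add_smul]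
  · exact ((Commute.refl x).smul_left _).smul_right _

lemma EE_mul_neg (x : A) (s : ℝ) : EE x s * EE x (-s) = 1 := by
  rw [← EE_add, add_neg_cancel, EE_zero]

lemma EE_neg_mul (x : A) (s : ℝ) : EE x (-s) * EE x s = 1 := by
  rw [← EE_add, neg_add_cancel, EE_zero]

lemma EE_neg (x : A) (s : ℝ) : EE (-x) s = EE x (-s) := by
  simp [EE]

lemma EE_star (hx : SA x) (s : ℝ) : star (EE x s) = EE x (-s) := by
  letI : NormedAlgebra ℚ A := NormedAlgebra.restrictScalars ℚ ℂ A
  unfold EE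
  rw [NormedSpace.star_exp]; congr 1; simp [hx.star_eq]

lemma EE_norm (hx : SA x) (s : ℝ) : ‖EE x s‖ ≤ 1 := by
  have h : ‖EE x s‖ * ‖EE x s‖ = ‖(1 : A)‖ := by
    rw [← CStarRing.norm_star_mul_self, EE_star hx, EE_neg_mul]
  have h1 : ‖(1 : A)‖ ≤ 1 := by
    rcases subsingleton_or_nontrivial A with h | h
    · simp [Subsingleton.elim (1 : A) 0]
    · simp
  nlinarith [norm_nonneg (EE x s)]

lemma EE_comm (h : Commute y x) (s : ℝ) : Commute y (EE x s) := by
  letI : NormedAlgebra ℚ A := NormedAlgebra.restrictScalars ℚ ℂ A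
  exact (h.smul_right _).exp_right

lemma EE_deriv (x : A) (s : ℝ) : HasDerivAt (EE x) (iI • (EE x s * x)) s := by
  have h := hasDerivAt_exp_smul_const (𝕂 := ℝ) (iI • x) s
  have e : (fun u : ℝ => NormedSpace.exp (u • (iI • x))) = EE x := by
    funext u; unfold EE; congr 1
    rw [mul_comm, mul_smul]; simp
  rw [e] at h
  have e2 : NormedSpace.exp (s • (iI • x)) = EE x s := congrFun e s
  rw [e2] at h
  simpa using h

lemma EE_cont (x : A) : Continuous (EE x) :=
  continuous_iff_continuousAt.2 fun s => (EE_deriv x s).continuousAt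

lemma EE_deriv_neg (x : A) (s : ℝ) :
    HasDerivAt (fun u => EE x (-u)) (-(iI • (EE x (-s) * x))) s := by
  have := (EE_deriv x (-s)).scomp s (hasDerivAt_neg s)
  exact this.congr_deriv (by simp)

/-- mean value bound from 0 -/
lemma mv0 {V : Type*} [NormedAddCommGroup V] [NormedSpace ℝ V] {f f' : ℝ → V} {M : ℝ} (s : ℝ)
    (h : ∀ u, HasDerivAt f (f' u) u) (hb : ∀ u, |u| ≤ |s| → ‖f' u‖ ≤ M) :
    ‖f s - f 0‖ ≤ M * |s| := by
  have := Convex.norm_image_sub_le_of_norm_hasDerivWithin_le (𝕜 := ℝ) (f := f) (f' := f')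
    (s := Icc (-|s|) |s|) (x := 0) (y := s) (C := M)
    (fun x _ => (h x).hasDerivWithinAt) (fun x hx => hb x (abs_le.2 hx)) (convex_Icc _ _)
    ⟨by simp, by simp⟩ ⟨neg_abs_le s, le_abs_self s⟩
  simpa using this

lemma norm_mul3 {z : A} {c : ℝ} (hx : ‖x‖ ≤ a) (hy : ‖y‖ ≤ b) (hz : ‖z‖ ≤ c) :
    ‖x * y * z‖ ≤ a * b * c := by
  have ha := (norm_nonneg x).trans hx
  have hb := (norm_nonneg y).trans hy
  calc ‖x * y * z‖ ≤ ‖x‖ * ‖y‖ * ‖z‖ := (norm_mul_le _ _).trans (by gcongr; exact norm_mul_le _ _)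
    _ ≤ _ := by gcongr

lemma norm_mul2 (hx : ‖x‖ ≤ a) (hy : ‖y‖ ≤ b) :
    ‖x * y‖ ≤ a * b := by
  have ha := (norm_nonneg x).trans hx
  exact (norm_mul_le _ _).trans (by gcongr)

lemma EE_conj_deriv (x y : A) (s : ℝ) :
    HasDerivAt (fun u => EE x u * y * EE x (-u))
      (iI • (EE x s * (x * y - y * x) * EE x (-s))) s := by
  have h := ((EE_deriv x s).mul_const y).mul (EE_deriv_neg x s)
  have hc : EE x (-s) * x = x * EE x (-s) := (EE_comm (Commute.refl x) (-s)).eq.symm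
  refine h.congr_deriv ?_
  rw [hc]
  simp only [smul_mul_assoc, mul_neg, mul_smul_comm, ← smul_neg, ← smul_add]
  congr 1; noncomm_ring

lemma EE_conj_bound (hx : SA x) (y : A) (s : ℝ) :
    ‖EE x s * y * EE x (-s) - y‖ ≤ ‖x * y - y * x‖ * |s| := by
  have := mv0 s (EE_conj_deriv x y) (M := ‖x * y - y * x‖) (fun u _ => by
    rw [norm_smul, norm_I, one_mul]
    simpa using norm_mul3 (EE_norm hx u) le_rfl (EE_norm hx (-u)))
  simpa [EE_zero] using this

lemma EE_comm_bound (hx : SA x) (y : A) (s : ℝ) :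
    ‖EE x s * y - y * EE x s‖ ≤ ‖x * y - y * x‖ * |s| := by
  have e : EE x s * y - y * EE x s = (EE x s * y * EE x (-s) - y) * EE x s := by
    rw [sub_mul, mul_assoc (EE x s * y), EE_neg_mul, mul_one]
  rw [e]
  simpa using norm_mul2 (EE_conj_bound hx y s) (EE_norm hx s)

lemma EE_sub_one_mul (x p : A) (hx : SA x) (s : ℝ) :
    ‖EE x s * p - p‖ ≤ ‖x * p‖ * |s| := by
  have := mv0 (f := fun u => EE x u * p) s (fun u => (EE_deriv x u).mul_const p) (M := ‖x * p‖)
    (fun u _ => by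
      rw [smul_mul_assoc, norm_smul, norm_I, one_mul, mul_assoc]
      simpa using norm_mul2 (EE_norm hx u) (le_refl ‖x * p‖))
  simpa [EE_zero] using this

/-- step a) -/
lemma W_approx {R G : A} (hR : SA R) (hG : SA G)
    (C : A) (hC : C = iI • (G * R - R * G)) (hCs : SA C)
    (h1 : ‖R * C - C * R‖ ≤ 1) (h2 : ‖G * C - C * G‖ ≤ 1) (s : ℝ) :
    ‖EE R s * EE G (-s) - EE (R - G) s * EE C (s ^ 2 / 2)‖ ≤ 3 * |s| ^ 3 := by
  set X := R - G with hX
  have hXs : SA X := hR.sub hG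
  have hXC : ‖X * C - C * X‖ ≤ 2 := by
    have : X * C - C * X = (R * C - C * R) - (G * C - C * G) := by rw [hX]; noncomm_ring
    rw [this]; exact (norm_sub_le _ _).trans lI

  have hQd : ∀ u, HasDerivAt (fun u => G - EE R u * G * EE R (-u) - u • C)
      (EE R u * C * EE R (-u) - C) u := fun u => by
    have h := (((EE_conj_deriv R G u).const_sub G)).sub ((hasDerivAt_id u).smul_const C)
    refine h.congr_deriv ?_
    rw [hC]; simp only [one_smul, mul_smul_comm, smul_mul_assoc]
    congr 1
    rw [← smul_neg]; congr 1; noncomm_ring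
  have hQ : ∀ u, ‖G - EE R u * G * EE R (-u) - u • C‖ ≤ |u| ^ 2 := fun u => by
    have := mv0 u hQd (M := |u|) (fun v hv => (EE_conj_bound hR C v).trans (by
      nlinarith [abs_nonneg v, norm_nonneg (R * C - C * R)]))
    simp [EE_zero] at this
    linarith [this, sq_abs u]

  let N : ℝ → A := fun u => EE C (-(u ^ 2 / 2)) * (EE X (-u) * (EE R u * EE G (-u)))
  let err : ℝ → A := fun u => EE X (-u) * (G - EE R u * G * EE R (-u) - u • C) * (EE R u * EE G (-u))
     + u • ((EE X (-u) * C * EE X (-(-u)) - C) * (EE X (-u) * (EE R u * EE G (-u))))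
  have hNd : ∀ u, HasDerivAt N (iI • (EE C (-(u ^ 2 / 2)) * err u)) u := fun u => by
    have hq : HasDerivAt (fun u : ℝ => -(u ^ 2 / 2)) (-u) u := by
      have := ((hasDerivAt_pow 2 u).div_const 2).neg
      exact this.congr_deriv (by simp)
    have hc := (EE_deriv C (-(u ^ 2 / 2))).scomp u hq
    have h := hc.mul ((EE_deriv_neg X u).mul ((EE_deriv R u).mul (EE_deriv_neg G u)))
    have hcG : EE G (-u) * G = G * EE G (-u) := (EE_comm (Commute.refl G) (-u)).eq.symm
    have hcR : EE R u * R = R * EE R u := (EE_comm (Commute.refl R) u).eq.symm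
    refine h.congr_deriv ?_
    simp only [err, Function.comp, Pi.mul_apply, hcG, hcR]
    have e1 : EE X (-u) * (G - EE R u * G * EE R (-u) - u • C) * (EE R u * EE G (-u))
       = EE X (-u) * G * EE R u * EE G (-u) - EE X (-u) * (EE R u * G * EE G (-u))
        - u • (EE X (-u) * C * (EE R u * EE G (-u))) := by
      have : EE R u * G * EE R (-u) * (EE R u * EE G (-u)) = EE R u * G * EE G (-u) := by
        rw [← mul_assoc, mul_assoc (EE R u * G), EE_neg_mul, mul_one]
      simp only [mul_assoc, sub_mul, mul_sub, smul_mul_assoc, mul_smul_comm] at this ⊢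
      rw [this]
    have e2 : u • ((EE X (-u) * C * EE X (-(-u)) - C) * (EE X (-u) * (EE R u * EE G (-u))))
       = u • (EE X (-u) * C * (EE R u * EE G (-u)))
         - u • (C * (EE X (-u) * (EE R u * EE G (-u)))) := by
      have : EE X (-(-u)) * EE X (-u) = 1 := by
        rw [← EE_add]; simp [EE_zero]
      rw [← smul_sub, sub_mul]; congr 2
      rw [mul_assoc, ← mul_assoc (EE X (-(-u))), this, one_mul]
    rw [e1, e2, hX]
    simp only [smul_mul_assoc, mul_neg, mul_smul_comm, neg_smul, neg_mul, smul_comm u iI,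
      ← smul_neg, ← smul_add]
    congr 1
    simp only [mul_add, mul_sub, sub_mul, mul_assoc, mul_smul_comm, mul_neg, smul_neg]
    abel
  have hb : ∀ u, |u| ≤ |s| → ‖iI • (EE C (-(u ^ 2 / 2)) * err u)‖ ≤ 3 * |s| ^ 2 := fun u hu => by
    rw [norm_smul, norm_I, one_mul]
    have hRG : ‖EE R u * EE G (-u)‖ ≤ 1 := by simpa using norm_mul2 (EE_norm hR u) (EE_norm hG (-u))
    have k1 := norm_mul3 (EE_norm hXs (-u)) (hQ u) hRG
    have k2 : ‖EE X (-u) * C * EE X (-(-u)) - C‖ ≤ 2 * |u| := by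
      have := EE_conj_bound hXs C (-u)
      rw [abs_neg] at this
      exact this.trans (by gcongr)
    have k3 := norm_mul2 k2 (norm_mul2 (EE_norm hXs (-u)) hRG)
    have k4 : ‖err u‖ ≤ 3 * |u| ^ 2 := by
      refine (norm_add_le _ _).trans ?_
      rw [norm_smul, norm_eq_abs]
      nlinarith [abs_nonneg u]
    calc _ ≤ 1 * (3 * |u| ^ 2) := norm_mul2 (EE_norm hCs _) k4
      _ ≤ _ := by rw [one_mul]; gcongr
  have hN := mv0 s hNd hb
  have hN0 : N 0 = 1 := by simp [N, EE_zero]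
  have e : EE R s * EE G (-s) - EE X s * EE C (s ^ 2 / 2) =
      EE X s * EE C (s ^ 2 / 2) * (N s - N 0) := by
    rw [hN0, mul_sub, mul_one]; congr 1
    simp only [N]
    rw [mul_assoc, ← mul_assoc (EE C _), EE_mul_neg, one_mul, ← mul_assoc, EE_mul_neg, one_mul]
  rw [e]
  have := norm_mul3 (EE_norm hXs s) (EE_norm hCs (s ^ 2 / 2)) hN
  linarith [this]

end ThmL

section ThmLb
variable {A : Type*} [CStarAlgebra A]
variable {α s : ℝ} {C p : A}

lemma dbl_int (Φ : ℝ → ℝ → A) (hΦ : Continuous (Function.uncurry Φ)) (h0 : 0 ≤ α) (hs : α ≤ s)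
    (B : ℝ → ℝ) (hB : IntegrableOn B (Icc (-s) s)) (hB0 : ∀ h, 0 ≤ B h)
    (hb : ∀ h a b, h ≠ 0 → |h| ≤ s → a ≤ b → 0 ≤ a → b ≤ s → ‖∫ u in a..b, Φ (u + h) u‖ ≤ B h) :
    ‖∫ v in α..s, ∫ u in α..s, Φ u v‖ ≤ ∫ h in Icc (-s) s, B h := by
  set S := Icc α s with hS
  let F : ℝ → ℝ → A := fun v u => (S ×ˢ S).indicator (fun z : ℝ × ℝ => Φ z.1 z.2) (u, v)
  have hFi : Integrable (Function.uncurry F) (volume.prod volume) := by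
    have h1 : IntegrableOn (fun z : ℝ × ℝ => Φ z.2 z.1) (S ×ˢ S) (volume.prod volume) := by
      have : IsCompact (S ×ˢ S) := isCompact_Icc.prod isCompact_Icc
      exact (hΦ.comp (continuous_snd.prodMk continuous_fst)).continuousOn.integrableOn_compact this
    rw [← integrable_indicator_iff (measurableSet_Icc.prod measurableSet_Icc)] at h1
    refine h1.congr (Eventually.of_forall fun z => ?_)
    simp only [Function.uncurry, F, indicator, mem_prod]
    exact if_congr and_comm rfl rfl
  have e1 : ∫ v in α..s, ∫ u in α..s, Φ u v = ∫ v, ∫ u, F v u := by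
    rw [integral_of_le hs, ← integral_Icc_eq_integral_Ioc,
      ← integral_indicator measurableSet_Icc]
    congr 1; funext v
    by_cases hv : v ∈ S
    · rw [indicator_of_mem hv, integral_of_le hs, ← integral_Icc_eq_integral_Ioc,
        ← integral_indicator measurableSet_Icc]
      congr 1; funext u
      simp only [F, indicator, mem_prod]
      exact if_congr (by rw [hS] at hv ⊢; exact (and_iff_left hv).symm) rfl rfl
    · rw [indicator_of_notMem hv]
      simp [F, hv]
  have e2 : ∫ v, ∫ u, F v u = ∫ v, ∫ h, F v (h + v) := by
    congr 1; funext v; rw [integral_add_right_eq_self (F v)]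
  have hFi' : Integrable (Function.uncurry fun v h => F v (h + v)) (volume.prod volume) := by
    have := (measurePreserving_prod_add (volume : Measure ℝ) (volume : Measure ℝ))
    have h2 := this.integrable_comp_of_integrable hFi
    refine h2.congr (Eventually.of_forall fun z => ?_)
    simp [Function.uncurry, add_comm]
  rw [e1, e2, integral_integral_swap hFi', ← integral_indicator measurableSet_Icc]
  refine norm_integral_le_of_norm_le (hB.integrable_indicator measurableSet_Icc)
    (((Measure.ae_ne volume zR)).mono fun h hne => ?_)
  by_cases hh : h ∈ Icc (-s) s
  · rw [indicator_of_mem hh]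
    have e3 : ∫ v, F v (h + v) = ∫ v in Icc (max α (α - h)) (min s (s - h)), Φ (v + h) v := by
      rw [← integral_indicator measurableSet_Icc]
      congr 1; funext v
      simp only [F, indicator, mem_prod, hS, mem_Icc, max_le_iff, le_min_iff]
      refine if_congr ?_ (by rw [add_comm]) rfl
      constructor
      · rintro ⟨⟨_, _⟩, _, _⟩; refine ⟨⟨?_, ?_⟩, ?_, ?_⟩ <;> linarith
      · rintro ⟨⟨_, _⟩, _, _⟩; refine ⟨⟨?_, ?_⟩, ?_, ?_⟩ <;> linarith
    rw [e3]
    by_cases hle : max α (α - h) ≤ min s (s - h)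
    · rw [integral_Icc_eq_integral_Ioc, ← integral_of_le hle]
      exact hb h _ _ hne (abs_le.2 hh) hle (h0.trans (le_max_left _ _)) (min_le_left _ _)
    · rw [Set.Icc_eq_empty hle]; simpa using hB0 h
  · rw [indicator_of_notMem hh]
    have : ∀ v, F v (h + v) = 0 := fun v => by
      simp only [F, indicator, mem_prod, hS, mem_Icc]
      rw [if_neg]
      rintro ⟨⟨_, _⟩, _, _⟩
      exact hh ⟨by linarith, by linarith⟩
    simp [this]

lemma star_mul_integral (f : ℝ → A) (hf : Continuous f) (α s : ℝ) :
    star (∫ u in α..s, f u) * (∫ u in α..s, f u) = ∫ v in α..s, ∫ u in α..s, star (f v) * f u := by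
  have h1 : star (∫ u in α..s, f u) = ∫ v in α..s, star (f v) :=
    ((starL' ℝ : A ≃L[ℝ] A).toContinuousLinearMap.intervalIntegral_comp_comm
      (hf.intervalIntegrable α s)).symm
  have h2 : ∀ y : A, y * (∫ u in α..s, f u) = ∫ u in α..s, y * f u := fun y =>
    (((mul ℝ A) y).intervalIntegral_comp_comm (hf.intervalIntegrable α s)).symm
  have h3 : ∀ y : A, (∫ u in α..s, star (f u)) * y = ∫ u in α..s, star (f u) * y := fun y =>
    (((mul ℝ A).flip y).intervalIntegral_comp_comm
      (hf.star.intervalIntegrable α s)).symm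
  rw [h1, h3]
  congr 1; funext v; rw [h2]

lemma EE_cont2 (x : A) {f : ℝ → ℝ} (hf : Continuous f) : Continuous fun u => EE x (f u) :=
  (EE_cont x).comp hf

lemma main_osc (hC : SA C) (h : ℝ) (hh : h ≠ 0) (e : ℝ) (a b : ℝ) :
    ‖∫ u in a..b, EE C (h * u + e) * (C * p)‖ ≤ 2 * ‖p‖ / |h| := by
  have hd : ∀ u, HasDerivAt (fun u => (iI * h)⁻¹ • (EE C (h * u + e) * p))
      (EE C (h * u + e) * (C * p)) u := fun u => by
    have h1 : HasDerivAt (fun u : ℝ => h * u + e) h u := by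
      simpa using ((hasDerivAt_id u).const_mul h).add_const e
    have h2 := (((EE_deriv C (h * u + e)).scomp u h1).mul_const p).const_smul (iI * h : ℂ)⁻¹
    refine h2.congr_deriv ?_
    rw [← Complex.coe_smul, smul_mul_assoc, smul_mul_assoc, smul_smul, smul_smul, ← mul_assoc]
    have : (iI * (h:ℂ))⁻¹ * h * iI = 1 := by
      have : (h:ℂ) ≠ 0 := by exact_mod_cast hh
      field_simp
    rw [this, one_smul, mul_assoc]
  rw [integral_eq_sub_of_hasDerivAt (fun u _ => hd u)
    (Continuous.intervalIntegrable ((EE_cont2 C fP).mul continuous_const) _ _),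
    ← smul_sub, norm_smul]
  have k : ∀ u, ‖EE C (h * u + e) * p‖ ≤ ‖p‖ := fun u => by
    simpa using norm_mul2 (EE_norm hC (h * u + e)) (le_refl ‖p‖)
  have : ‖(iI * (h:ℂ))⁻¹‖ = |h|⁻¹ := by simp
  rw [this, div_eq_inv_mul]
  gcongr
  exact (norm_sub_le _ _).trans (by linarith [k a, k b])

lemma int_rpow_half (hs : 0 ≤ s) : IntegrableOn (fun h : ℝ => |h| ^ (-(1/2) : ℝ)) (Icc (-s) s) ∧
    ∫ h in Icc (-s) s, |h| ^ (-(1/2) : ℝ) = 4 * sqrt s := by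
  have i0 : IntervalIntegrable (fun h : ℝ => |h| ^ (-(1/2) : ℝ)) volume 0 s := by
    have := intervalIntegral.intervalIntegrable_rpow' (a := 0) (b := s) (r := -(1/2)) nU
    refine this.congr ?_
    intro x hx
    rw [uIoc_of_le hs] at hx
    simp only [abs_of_pos hx.1]
  have i1 : IntervalIntegrable (fun h : ℝ => |h| ^ (-(1/2) : ℝ)) volume (-s) 0 := by
    have := (IntervalIntegrable.iff_comp_neg (f := fun h : ℝ => |h| ^ (-(1/2) : ℝ)) (a := 0) (b := s)).1 i0
    simpa using this.symm
  have hle : -s ≤ s := by linarith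
  have v0 : ∫ h in zR..s, |h| ^ (-(1/2) : ℝ) = 2 * sqrt s := by
    have : ∫ h in zR..s, |h| ^ (-(1/2) : ℝ) = ∫ h in zR..s, h ^ (-(1/2) : ℝ) := by
      refine intervalIntegral.integral_congr fun x hx => ?_
      rw [uIcc_of_le hs] at hx
      simp only [abs_of_nonneg hx.1]
    rw [this, integral_rpow (Or.inl nU), sqrt_eq_rpow]
    norm_num; ring
  have v1 : ∫ h in (-s)..0, |h| ^ (-(1/2) : ℝ) = 2 * sqrt s := by
    rw [← v0]; have := intervalIntegral.integral_comp_neg (a := 0) (b := s) (fun h : ℝ => |h| ^ (-(1/2) : ℝ)); simpa using this.symm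
  have itot := i1.trans i0
  constructor
  · rw [integrableOn_Icc_iff_integrableOn_Ioc]
    exact (intervalIntegrable_iff_integrableOn_Ioc_of_le hle).1 itot
  · rw [integral_Icc_eq_integral_Ioc, ← integral_of_le hle,
      ← integral_add_adjacent_intervals i1 i0, v0, v1]; ring

/-- the D lemma -/
lemma D_bound {X q : A} {c0 σ : ℝ} (hX : SA X) (hC : SA C)
    (hXC : ‖X * C - C * X‖ ≤ 2) (hq : SA q) (hq1 : ‖q‖ ≤ 1) (hqC : Commute q C)
    (hXq : ‖X * q - q * X‖ ≤ c0 * σ ^ 2) (hqq : q * q = C * p) (hp : ‖p‖ ≤ σ ^ 2) (hc0 : 0 ≤ c0)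
    (hσ : 0 ≤ σ) (hα : 0 ≤ α) (hαs : α ≤ s) (hσs : σ ≤ s) :
    ‖∫ u in α..s, EE X u * EE C (u ^ 2 / 2) * q‖ ^ 2 ≤ 6 * (s * σ) + 2 * (c0 + 1) * s ^ 5 := by
  have hs : 0 ≤ s := hα.trans hαs
  set f : ℝ → A := fun u => EE X u * EE C (u ^ 2 / 2) * q with hf
  have hfc : Continuous f := by
    exact ((EE_cont X).mul (EE_cont2 C fP)).mul continuous_const
  have e0 : ‖∫ u in α..s, f u‖ ^ 2 = ‖∫ v in α..s, ∫ u in α..s, star (f v) * f u‖ := by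
    rw [← star_mul_integral f hfc, CStarRing.norm_star_mul_self, sq]
  rw [e0]
  set B : ℝ → ℝ := fun h => (c0 + 1) * s ^ 3 * s + sqrt (2 * s * σ ^ 2) * |h| ^ (-(1/2) : ℝ) with hB
  have hir := int_rpow_half hs
  have hBi : IntegrableOn B (Icc (-s) s) := (integrableOn_const (by simp)).add (hir.1.const_mul _)
  have hBv : ∫ h in Icc (-s) s, B h ≤ 6 * (s * σ) + 2 * (c0 + 1) * s ^ 5 := by
    rw [hB, integral_add (integrable_const _) (hir.1.const_mul _), icm (sqrt _), hir.2]
    simp only [integral_const, smul_eq_mul, MeasurableSet.univ, measureReal_restrict_apply, Set.univ_inter,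
      Real.volume_real_Icc]
    rw [max_eq_left lI, sqrt_mul pO, sqrt_sq hσ, sqrt_mul nU]
    have h1 := mul_self_sqrt hs
    have h2 : sqrt 2 ≤ 3 / 2 := by
      rw [Real.sqrt_le_left nU]; norm_num
    have h3 : √2 * √s * σ * (4 * √s) = 4 * √2 * (s * σ) := by linear_combination 4 * √2 * σ * h1
    rw [h3]
    have : 0 ≤ s * σ := by positivity
    nlinarith
  refine (dbl_int (fun u v => star (f v) * f u) ?_ hα hαs B hBi (fun h => by positivity) ?_).trans hBv
  · exact (hfc.star.comp continuous_snd).mul (hfc.comp continuous_fst)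
  intro h a b h0 hh hab ha hb

  have hpt : ∀ u, |u| ≤ s → ‖star (f u) * f (u + h) - EE X h * (EE C (h * u + h ^ 2 / 2) * (C * p))‖
      ≤ (c0 + 1) * s ^ 2 * |h| := fun u hu => by
    set y := q * EE C (-(u ^ 2 / 2)) with hy
    have e1 : star (f u) * f (u + h) = y * EE X h * (EE C ((u + h) ^ 2 / 2) * q) := by
      simp only [hf, star_mul, EE_star hX, EE_star hC, hq.star_eq, hy]
      rw [show EE X h = EE X (-u) * EE X (u + h) by rw [← EE_add]; simp]
      simp only [mul_assoc]
    have e2 : EE X h * (EE C (h * u + h ^ 2 / 2) * (C * p)) = EE X h * y * (EE C ((u + h) ^ 2 / 2) * q) := by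
      rw [hy, ← hqq]
      have c1 : ∀ r, q * EE C r = EE C r * q := fun r => (EE_comm hqC r).eq
      have c2 : EE C (h * u + h ^ 2 / 2) = EE C (-(u ^ 2 / 2)) * EE C ((u + h) ^ 2 / 2) := by
        rw [← EE_add]; congr 1; ring
      rw [c2]
      calc _ = EE X h * (EE C (-(u ^ 2 / 2)) * (EE C ((u + h) ^ 2 / 2) * q) * q) := by simp only [mul_assoc]
        _ = EE X h * (EE C (-(u ^ 2 / 2)) * q * (EE C ((u + h) ^ 2 / 2) * q)) := by
          rw [← c1 ((u + h) ^ 2 / 2)]; simp only [mul_assoc]; rw [c1]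
        _ = _ := by rw [← c1]; simp only [mul_assoc]
    rw [e1, e2, ← sub_mul]
    have k1 := EE_comm_bound hX y h
    have k2 : ‖X * y - y * X‖ ≤ (c0 + 1) * s ^ 2 := by
      have : X * y - y * X = (X * q - q * X) * EE C (-(u ^ 2 / 2)) +
          -(q * (EE C (-(u ^ 2 / 2)) * X - X * EE C (-(u ^ 2 / 2)))) := by rw [hy]; noncomm_ring
      rw [this]
      have k3 := norm_mul2 hXq (EE_norm hC (-(u ^ 2 / 2)))
      have k4 := norm_mul2 hq1 (EE_comm_bound hC X (-(u ^ 2 / 2)))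
      have k5 : ‖C * X - X * C‖ ≤ 2 := by rw [norm_sub_rev]; exact hXC
      have k6 : |(-(u ^ 2 / 2))| ≤ s ^ 2 / 2 := by
        rw [abs_neg, abs_of_nonneg pO]
        have := sq_le_sq' (by linarith [abs_nonneg u]) hu
        rw [sq_abs] at this; linarith
      have k7 : σ ^ 2 ≤ s ^ 2 := by gcongr
      refine (norm_add_le _ _).trans ?_
      rw [norm_neg]
      have k8 : ‖C * X - X * C‖ * |(-(u ^ 2 / 2))| ≤ 2 * (s ^ 2 / 2) := by gcongr
      have := mll k7 hc0
      linarith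
    have k9 : ‖EE C ((u + h) ^ 2 / 2) * q‖ ≤ 1 := by simpa using norm_mul2 (EE_norm hC _) hq1
    have k10 : ‖y * EE X h - EE X h * y‖ ≤ (c0 + 1) * s ^ 2 * |h| := by
      rw [norm_sub_rev]; exact k1.trans (by gcongr)
    simpa using norm_mul2 k10 k9
  have hd : ∫ u in a..b, star (f u) * f (u + h) =
      (∫ u in a..b, (star (f u) * f (u + h) - EE X h * (EE C (h * u + h ^ 2 / 2) * (C * p))))
      + EE X h * ∫ u in a..b, EE C (h * u + h ^ 2 / 2) * (C * p) := by
    have hc1 : Continuous fun u => EE C (h * u + h ^ 2 / 2) * (C * p) :=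
      (EE_cont2 C fP).mul continuous_const
    have hc2 : Continuous fun u => star (f u) * f (u + h) := hfc.star.mul (hfc.comp fP)
    have := (((mul ℝ A) (EE X h)).intervalIntegral_comp_comm
      (hc1.intervalIntegrable a b) (μ := volume))
    simp only [ContinuousLinearMap.mul_apply'] at this
    rw [← this, ← intervalIntegral.integral_add]
    · simp
    · exact (hc2.sub (continuous_const.mul hc1)).intervalIntegrable _ _
    · exact (continuous_const.mul hc1).intervalIntegrable _ _
  rw [hd]
  have hba : |b - a| ≤ s := by rw [abs_of_nonneg lI]; linarith
  have j1 : ‖∫ u in a..b, (star (f u) * f (u + h) - EE X h * (EE C (h * u + h ^ 2 / 2) * (C * p)))‖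
      ≤ (c0 + 1) * s ^ 3 * s := by
    refine (intervalIntegral.norm_integral_le_of_norm_le_const (C := (c0 + 1) * s ^ 2 * |h|) ?_).trans ?_
    · intro u hu
      rw [uIoc_of_le hab] at hu
      exact hpt u (by rw [abs_of_nonneg (by linarith [hu.1])]; linarith [hu.2])
    · calc _ ≤ (c0 + 1) * s ^ 2 * s * s := by gcongr
        _ = _ := by ring
  have j2 : ‖EE X h * ∫ u in a..b, EE C (h * u + h ^ 2 / 2) * (C * p)‖ ≤
      sqrt (2 * s * σ ^ 2) * |h| ^ (-(1/2) : ℝ) := by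
    have m1 := main_osc hC h h0 (h ^ 2 / 2) a b (p := p)
    have m2 : ‖∫ u in a..b, EE C (h * u + h ^ 2 / 2) * (C * p)‖ ≤ s := by
      refine (intervalIntegral.norm_integral_le_of_norm_le_const (C := 1) ?_).trans lI
      intro u _
      rw [← hqq]
      simpa using norm_mul2 (EE_norm hC _) (norm_mul2 hq1 hq1)
    set N := ‖∫ u in a..b, EE C (h * u + h ^ 2 / 2) * (C * p)‖
    have hN : 0 ≤ N := norm_nonneg _
    have habs : 0 < |h| := abs_pos.2 h0
    have m3 : N ≤ sqrt (2 * s * σ ^ 2) * |h| ^ (-(1/2) : ℝ) := by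
      rw [rpow_neg habs.le, ← sqrt_eq_rpow, ← div_eq_mul_inv, ← Real.sqrt_div pO]
      apply le_sqrt_of_sq_le
      calc N ^ 2 = N * N := sq N
        _ ≤ s * (2 * ‖p‖ / |h|) := by gcongr
        _ ≤ s * (2 * σ ^ 2 / |h|) := by gcongr
        _ = _ := by ring
    have := norm_mul2 (EE_norm hX h) m3
    linarith
  exact (norm_add_le _ _).trans (add_le_add j1 j2)

end ThmLb

section ThmLc

lemma ibp_bound {V : Type*} [NormedAddCommGroup V] [NormedSpace ℝ V] [CompleteSpace V] {f : ℝ → V}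
    (hf : Continuous f) (ha : 0 < a) (hab : a ≤ b) {B : ℝ → ℝ}
    (hB : ∀ s ∈ Icc a b, ‖∫ u in a..s, f u‖ ≤ B s) (hBc : ContinuousOn B (Icc a b)) :
    ‖∫ u in a..b, u⁻¹ • f u‖ ≤ b⁻¹ * B b + ∫ u in a..b, (u ^ 2)⁻¹ * B u := by
  have hpos : ∀ x ∈ uIcc a b, 0 < x := fun x hx => by
    rw [uIcc_of_le hab] at hx; exact ha.trans_le hx.1
  have hc2 : ContinuousOn (fun x : ℝ => (x ^ 2)⁻¹) (uIcc a b) :=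
    ContinuousOn.inv₀ fP (fun x hx => by have := hpos x hx; positivity)
  have h := intervalIntegral.integral_smul_deriv_eq_deriv_smul (a := a) (b := b)
    (u := fun x : ℝ => x⁻¹) (u' := fun x => -(x ^ 2)⁻¹) (v := fun s => ∫ u in a..s, f u) (v' := f)
    (fun x hx => hasDerivAt_inv (hpos x hx).ne')
    (fun x hx => intervalIntegral.integral_hasDerivAt_right (hf.intervalIntegrable _ _)
      (hf.stronglyMeasurableAtFilter _ _) hf.continuousAt)
    hc2.neg.intervalIntegrable (hf.intervalIntegrable _ _)
  rw [h]
  simp only [intervalIntegral.integral_same, smul_zero, sub_zero, neg_smul, intervalIntegral.integral_neg,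
    sub_neg_eq_add]
  have hb : 0 < b := ha.trans_le hab
  refine (norm_add_le _ _).trans (add_le_add ?_ ?_)
  · rw [norm_smul, norm_inv, rno hb.le]
    gcongr; exact hB b ⟨hab, le_rfl⟩
  · refine intervalIntegral.norm_integral_le_of_norm_le hab (Eventually.of_forall fun x hx => ?_) ?_
    · rw [norm_smul, norm_inv, norm_pow, norm_eq_abs, sq_abs]
      gcongr; exact hB x ⟨hx.1.le, hx.2⟩
    · rw [← uIcc_of_le hab] at hBc
      exact (hc2.mul hBc).intervalIntegrable

lemma int_inv_sq (ha : 0 < a) (hab : a ≤ b) : ∫ u in a..b, (u ^ 2)⁻¹ = a⁻¹ - b⁻¹ := by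
  have hpos : ∀ x ∈ uIcc a b, 0 < x := fun x hx => by
    rw [uIcc_of_le hab] at hx; exact ha.trans_le hx.1
  have hc2 : ContinuousOn (fun x : ℝ => (x ^ 2)⁻¹) (uIcc a b) :=
    ContinuousOn.inv₀ fP (fun x hx => by have := hpos x hx; positivity)
  have := integral_eq_sub_of_hasDerivAt (a := a) (b := b) (f := fun x : ℝ => -x⁻¹)
    (f' := fun x => (x ^ 2)⁻¹) (fun x hx => ((hasDerivAt_inv (hpos x hx).ne').neg).congr_deriv (by ring))
    hc2.intervalIntegrable
  rw [this]; ring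

/-- scalar sine integral -/
lemma scalar_Y (x : ℝ) (ha : 0 < a) (hab : a ≤ b) :
    ‖∫ u in a..b, u⁻¹ • (cE (iI * u * x) - cE (-(iI * u * x)))‖ ≤ 6 := by
  have hen : ∀ u : ℝ, ‖cE (iI * u * x)‖ = 1 := fun u => by
    rw [show iI * u * x = (oC (u * x)) * iI by push_cast; ring]
    exact norm_exp_ofReal_mul_I _
  have hen' : ∀ u : ℝ, ‖cE (-(iI * u * x))‖ = 1 := fun u => by
    rw [show -(iI * u * x) = (oC (-(u * x))) * iI by push_cast; ring]
    exact norm_exp_ofReal_mul_I _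
  set f : ℝ → ℂ := fun u => cE (iI * u * x) - cE (-(iI * u * x)) with hf
  have hfc : Continuous f := by fun_prop
  rcases eq_or_ne x 0 with rfl | hx
  · simp
  have hx' : 0 < |x| := abs_pos.2 hx
  have hg : ∀ u : ℝ, HasDerivAt (fun u : ℝ => (iI * x)⁻¹ *
      (cE (iI * u * x) + cE (-(iI * u * x)))) (f u) u := fun u => by
    have h1 : HasDerivAt (fun u : ℝ => iI * (u:ℂ) * x) (iI * x) u := by
      simpa using ((ofRealCLM.hasDerivAt (x := u)).const_mul iI).mul_const (x:ℂ)
    have h2 : HasDerivAt (fun u : ℝ => -(iI * (u:ℂ) * x)) (-(iI * x)) u := h1.neg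
    refine ((h1.cexp.add h2.cexp).const_mul _).congr_deriv ?_
    have : (x:ℂ) ≠ 0 := by exact_mod_cast hx
    simp only [hf]; field_simp; ring
  have hsmall : ∀ u, ‖f u‖ ≤ 2 * |x| * |u| := fun u => by
    have := mv0 (f := f) (f' := fun u => iI * x * cE (iI * u * x)
      + iI * x * cE (-(iI * u * x))) (M := 2 * |x|) u (fun u => by
        have h1 : HasDerivAt (fun u : ℝ => iI * (u:ℂ) * x) (iI * x) u := by
          simpa using ((ofRealCLM.hasDerivAt (x := u)).const_mul iI).mul_const (x:ℂ)
        have h2 : HasDerivAt (fun u : ℝ => -(iI * (u:ℂ) * x)) (-(iI * x)) u := h1.neg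
        refine (h1.cexp.sub h2.cexp).congr_deriv ?_
        ring) (fun v _ => by
        refine (norm_add_le _ _).trans ?_
        rw [norm_mul, norm_mul, hen, norm_mul, hen']; simp; linarith)
    simpa [hf] using this
  have P1 : ∀ a b : ℝ, 0 < a → a ≤ b → b ≤ |x|⁻¹ → ‖∫ u in a..b, u⁻¹ • f u‖ ≤ 2 := fun a b ha hab hb => by
    refine (intervalIntegral.norm_integral_le_of_norm_le_const (C := 2 * |x|) ?_).trans ?_
    · intro u hu
      rw [uIoc_of_le hab] at hu
      have hu0 : 0 < u := ha.trans hu.1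
      rw [norm_smul, norm_inv, rno hu0.le]
      have := hsmall u
      rw [abs_of_pos hu0] at this
      rw [inv_mul_le_iff₀ hu0]; linarith
    · rw [abs_of_nonneg (sub_nonneg.2 hab)]
      have : |x| * (b - a) ≤ |x| * |x|⁻¹ := by gcongr; linarith
      rw [mul_inv_cancel₀ hx'.ne'] at this; linarith
  have P2 : ∀ a b : ℝ, 0 < a → a ≤ b → |x|⁻¹ ≤ a → ‖∫ u in a..b, u⁻¹ • f u‖ ≤ 4 := fun a b ha hab hb => by
    have := ibp_bound hfc ha hab (B := fun _ => 4 * |x|⁻¹) (fun s hs => by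
      rw [integral_eq_sub_of_hasDerivAt (fun u _ => hg u) (hfc.intervalIntegrable _ _),
        ← mul_sub, norm_mul]
      have e : ‖(iI * (x:ℂ))⁻¹‖ = |x|⁻¹ := by simp
      rw [e, mul_comm]
      gcongr
      refine (norm_sub_le _ _).trans ?_
      have k : ∀ u : ℝ, ‖cE (iI * u * x) + cE (-(iI * u * x))‖ ≤ 2 := fun u =>
        (norm_add_le _ _).trans (by rw [hen, hen']; norm_num)
      linarith [k s, k a]) continuousOn_const
    refine this.trans ?_
    rw [intervalIntegral.integral_mul_const, int_inv_sq ha hab]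
    have e : b⁻¹ * (4 * |x|⁻¹) + (a⁻¹ - b⁻¹) * (4 * |x|⁻¹) = 4 * (a⁻¹ * |x|⁻¹) := by ring
    rw [e]
    have : a⁻¹ * |x|⁻¹ ≤ a⁻¹ * a := by gcongr
    rw [inv_mul_cancel₀ ha.ne'] at this; linarith
  by_cases h1 : b ≤ |x|⁻¹
  · linarith [P1 a b ha hab h1]
  by_cases h2 : |x|⁻¹ ≤ a
  · linarith [P2 a b ha hab h2]
  push Not at h1 h2
  have hi : ∀ a b : ℝ, 0 < a → a ≤ b → IntervalIntegrable (fun u => u⁻¹ • f u) volume a b := fun a b ha hab =>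
    ContinuousOn.intervalIntegrable (ContinuousOn.smul (f := fun u : ℝ => u⁻¹) (ContinuousOn.inv₀ continuousOn_id (fun x hx => by
      rw [uIcc_of_le hab] at hx; exact (ha.trans_le hx.1).ne')) hfc.continuousOn)
  have hm : 0 < |x|⁻¹ := by positivity
  rw [← integral_add_adjacent_intervals (hi a _ ha h2.le) (hi _ b hm h1.le)]
  exact (norm_add_le _ _).trans (by linarith [P1 a _ ha h2.le le_rfl, P2 _ b hm h1.le le_rfl])

variable {A : Type*} [CStarAlgebra A]
variable {a b : ℝ} {X : A}

lemma EE_cfc (hX : SA X) (u : ℝ) :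
    EE X u = cfc (fun z : ℂ => cE (iI * u * z)) X := by
  have hn : IsStarNormal X := hX.isStarNormal
  have hn2 : IsStarNormal ((iI * (u:ℂ)) • X) := by
    constructor
    rw [star_smul, hX.star_eq]
    exact ((Commute.refl X).smul_left _).smul_right _
  unfold EE
  rw [← CFC.exp_eq_normedSpace_exp (𝕜 := ℂ), ← cfc_comp_smul (R := ℂ) (iI * (u:ℂ)) _ X, ← exp_eq_exp_ℂ]
  · rfl

lemma Y_bound (hX : SA X) (ha : 0 < a) (hab : a ≤ b) :
    ‖∫ u in a..b, u⁻¹ • (EE X u - EE X (-u))‖ ≤ 6 := by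
  have hn : IsStarNormal X := hX.isStarNormal
  let F : ℝ → ℂ → ℂ := fun u z => u⁻¹ • (cE (iI * u * z) - cE (-(iI * u * z)))
  have e1 : ∀ u, u⁻¹ • (EE X u - EE X (-u)) = cfc (F u) X := fun u => by
    rw [EE_cfc hX, EE_cfc hX, ← cfc_sub _ _ X, ← cfc_smul u⁻¹ _ X]
    congr 1; funext z; simp [F]
  have hFc : ContinuousOn (Function.uncurry F) (Icc a b ×ˢ spectrum ℂ X) := by
    simp only [F, Function.uncurry]
    refine ContinuousOn.smul (f := fun x : ℝ × ℂ => x.1⁻¹) (g := fun x : ℝ × ℂ => cE (iI * x.1 * x.2) - cE (-(iI * x.1 * x.2))) (ContinuousOn.inv₀ continuousOn_fst ?_) fP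
    rintro ⟨u, z⟩ ⟨h, _⟩
    exact (ha.trans_le h.1).ne'
  have hcomp : IsCompact (Icc a b ×ˢ spectrum ℂ X) := isCompact_Icc.prod (spectrum.isCompact X)
  obtain ⟨M, hM⟩ := hcomp.exists_bound_of_continuousOn hFc
  rw [integral_of_le hab, ← integral_Icc_eq_integral_Ioc]
  simp_rw [e1]
  rw [← cfc_setIntegral measurableSet_Icc F (fun _ => M) X hFc
    ((ae_restrict_mem measurableSet_Icc).mono fun u hu z hz => hM (u, z) ⟨hu, hz⟩)
    (by exact (integrable_const M).2) hn]
  refine norm_cfc_le nU fun z hz => ?_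
  have hz0 := hX.im_eq_zero_of_mem_spectrum hz
  have : z = (z.re : ℂ) := by apply Complex.ext <;> simp [hz0]
  rw [this, integral_Icc_eq_integral_Ioc, ← integral_of_le hab]
  exact scalar_Y z.re ha hab

end ThmLc

section ThmLd
variable {A : Type*} [CStarAlgebra A]
variable {C X : A} {f : ℝ → A} {a b σ : ℝ}

def KK (C : A) (σ : ℝ) : A := cfc (fun c : ℝ => (1 + σ ^ 4 * c ^ 2)⁻¹) C
def kap (C : A) (σ : ℝ) : A := (σ ^ 2) • (C * KK C σ)

lemma KK_den_pos (σ c : ℝ) : 0 < 1 + σ ^ 4 * c ^ 2 := by positivity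

lemma KK_cont (σ : ℝ) : Continuous (fun c : ℝ => (1 + σ ^ 4 * c ^ 2)⁻¹) :=
  Continuous.inv₀ fP (fun c => (KK_den_pos σ c).ne')

lemma KK_sa (C : A) (σ : ℝ) : SA (KK C σ) := cfc_predicate _ _

lemma KK_comm (hC : SA C) (σ : ℝ) : Commute (KK C σ) C := by
  have := cfc_commute_cfc (fun c : ℝ => (1 + σ ^ 4 * c ^ 2)⁻¹) (id : ℝ → ℝ) C
  rwa [cfc_id ℝ C] at this

lemma KK_inv (hC : SA C) (σ : ℝ) : (1 + σ ^ 4 • (C * C)) * KK C σ = 1 := by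
  have hc := KK_cont σ
  have e : (1 + σ ^ 4 • (C * C)) = cfc (fun c : ℝ => 1 + σ ^ 4 * c ^ 2) C := by
    rw [cfc_add C (fun _ => oR) (fun c => σ ^ 4 * c ^ 2) fP fP,
      cfc_const_mul (σ ^ 4) (fun c => c ^ 2) C fP, cfc_pow_id C 2 hC, cfc_const_one ℝ C, sq]
  rw [e, KK, ← cfc_mul _ _ C fP hc.continuousOn]
  rw [show (fun c : ℝ => (1 + σ ^ 4 * c ^ 2) * (1 + σ ^ 4 * c ^ 2)⁻¹) = fun _ => 1 from
    funext fun c => mul_inv_cancel₀ (KK_den_pos σ c).ne', cfc_const_one ℝ C]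

lemma KK_norm (C : A) (σ : ℝ) : ‖KK C σ‖ ≤ 1 := by
  refine norm_cfc_le nU fun c _ => ?_
  rw [rno (inv_nonneg.2 (KK_den_pos σ c).le)]
  exact inv_le_one_of_one_le₀ (by linarith [KK_den_pos σ c, (by positivity : 0 ≤ σ ^ 4 * c ^ 2)])

lemma one_sub_KK (hC : SA C) (σ : ℝ) : σ ^ 4 • (C * C * KK C σ) = 1 - KK C σ := by
  have := KK_inv hC σ
  rw [add_mul, one_mul, smul_mul_assoc] at this
  exact eq_sub_of_add_eq' this

lemma one_sub_KK_norm (hC : SA C) (σ : ℝ) : ‖1 - KK C σ‖ ≤ 1 := by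
  rw [KK, ← cfc_const_one ℝ C, ← cfc_sub _ _ C fP (KK_cont σ).continuousOn]
  refine norm_cfc_le nU fun c _ => ?_
  have h1 := inv_nonneg.2 (KK_den_pos σ c).le
  have h2 := inv_le_one_of_one_le₀ (show 1 ≤ 1 + σ ^ 4 * c ^ 2 by linarith [(by positivity : 0 ≤ σ ^ 4 * c ^ 2)])
  rw [norm_eq_abs, abs_le]; constructor <;> linarith

lemma kap_sa (hC : SA C) (σ : ℝ) : SA (kap C σ) := by
  unfold kap
  refine IsSelfAdjoint.smul (by simp [IsSelfAdjoint]) ?_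
  rw [IsSelfAdjoint, star_mul, hC.star_eq, (KK_sa C σ).star_eq, (KK_comm hC σ).eq]

lemma kap_comm (hC : SA C) (σ : ℝ) : Commute (kap C σ) C :=
  (((Commute.refl C).mul_left (KK_comm hC σ)).smul_left _)

lemma kap_KK (hC : SA C) (σ : ℝ) : Commute (kap C σ) (KK C σ) :=
  (((KK_comm hC σ).symm.mul_left (Commute.refl _)).smul_left _)

lemma kap_sq (hC : SA C) (σ : ℝ) : kap C σ * kap C σ = KK C σ - KK C σ * KK C σ := by
  have h := one_sub_KK hC σ
  have : kap C σ * kap C σ = (σ ^ 4 • (C * C * KK C σ)) * KK C σ := by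
    unfold kap
    rw [smul_mul_smul_comm, smul_mul_assoc, ← pow_add, mul_assoc C, ← mul_assoc (KK C σ) C, (KK_comm hC σ).eq]
    simp only [mul_assoc]
  rw [this, h, sub_mul, one_mul]

lemma kap_norm (hC : SA C) (σ : ℝ) : ‖kap C σ‖ ≤ 1 / 2 := by
  have e : kap C σ = cfc (fun c : ℝ => σ ^ 2 * (c * (1 + σ ^ 4 * c ^ 2)⁻¹)) C := by
    have hc := KK_cont σ
    rw [cfc_const_mul (σ ^ 2) _ C fP, cfc_mul (fun c => c) _ C fP hc.continuousOn, cfc_id' ℝ C]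
    rfl
  rw [e]
  refine norm_cfc_le nU fun c _ => ?_
  have := KK_den_pos σ c
  rw [norm_eq_abs, ← mul_assoc, ← div_eq_mul_inv, abs_div, abs_of_pos this, div_le_iff₀ this, abs_le]
  constructor <;> linarith [sq_nonneg (σ ^ 2 * c - 1), sq_nonneg (σ ^ 2 * c + 1)]

lemma sC_kap (hC : SA C) (σ : ℝ) : σ ^ 2 • (C * kap C σ) = 1 - KK C σ := by
  rw [← one_sub_KK hC σ, kap, mul_smul_comm, smul_smul, ← pow_add, ← mul_assoc]

lemma kap_commutator (hC : SA C) (σ : ℝ) (Y : A) :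
    ‖Y * kap C σ - kap C σ * Y‖ ≤ 9 / 4 * σ ^ 2 * ‖C * Y - Y * C‖ := by
  set K := KK C σ with hK
  set k := kap C σ with hk
  set Q := C * Y - Y * C with hQ
  have i1 : (1 + σ ^ 4 • (C * C)) * K = 1 := KK_inv hC σ
  have cKC : K * C = C * K := (KK_comm hC σ).eq
  have i2 : K * (1 + σ ^ 4 • (C * C)) = 1 := by
    refine Eq.trans ?_ i1
    rw [mul_add, add_mul, mul_one, one_mul]; congr 1
    rw [mul_smul_comm, smul_mul_assoc]; congr 1
    rw [← mul_assoc, cKC, mul_assoc, cKC, ← mul_assoc]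
  have h1 : Y * K - K * Y = σ ^ 4 • (K * (C * Q + Q * C) * K) := by
    have : Y * K - K * Y = K * ((1 + σ ^ 4 • (C * C)) * Y - Y * (1 + σ ^ 4 • (C * C))) * K := by
      have a1 : K * (1 + σ ^ 4 • (C * C)) * Y * K = Y * K := by rw [i2, one_mul]
      have a2 : K * Y * ((1 + σ ^ 4 • (C * C)) * K) = K * Y := by rw [i1, mul_one]
      rw [mul_sub, sub_mul, ← mul_assoc K, a1, ← mul_assoc K, mul_assoc (K * Y), a2]
    rw [this, show σ ^ 4 • (K * (C * Q + Q * C) * K) = K * (σ ^ 4 • (C * Q + Q * C)) * K by rw [mul_smul_comm, smul_mul_assoc]]; congr 2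
    rw [hQ]
    simp only [add_mul, mul_add, one_mul, mul_one, smul_mul_assoc, mul_smul_comm, smul_add, smul_sub, mul_sub, sub_mul, mul_assoc]
    abel
  have h2 : Y * k - k * Y = σ ^ 2 • (-(Q * K) + ((1 - K) * Q * K + k * Q * k)) := by
    have b1 : Y * k - k * Y = σ ^ 2 • (-(Q * K) + C * (Y * K - K * Y)) := by
      rw [hk, kap, mul_smul_comm, smul_mul_assoc, ← smul_sub]; congr 1
      rw [hQ]; noncomm_ring
    rw [b1, h1]; congr 2
    have b2 : (1 - K) * Q * K = σ ^ 4 • (C * (K * (C * Q) * K)) := by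
      rw [← one_sub_KK hC σ, smul_mul_assoc, smul_mul_assoc]; congr 1
      rw [← hK, mul_assoc C C K, ← cKC]; simp only [mul_assoc]
    have b3 : k * Q * k = σ ^ 4 • (C * (K * (Q * C) * K)) := by
      rw [hk, kap, smul_mul_assoc, smul_mul_smul_comm, ← pow_add]; congr 1
      simp only [mul_assoc, hK]
    rw [b2, b3, ← smul_add, mul_smul_comm]; congr 1
    noncomm_ring
  rw [h2, norm_smul, rno pO]
  have n1 := norm_mul2 (le_refl ‖Q‖) (KK_norm C σ)
  have n2 := norm_mul3 (one_sub_KK_norm hC σ) (le_refl ‖Q‖) (KK_norm C σ)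
  have n3 := norm_mul3 (kap_norm hC σ) (le_refl ‖Q‖) (kap_norm hC σ)
  have n4 : ‖-(Q * K) + ((1 - K) * Q * K + k * Q * k)‖ ≤ 9 / 4 * ‖Q‖ := by
    refine (norm_add_le _ _).trans ?_
    rw [norm_neg]
    have := norm_add_le ((1 - K) * Q * K) (k * Q * k)
    linarith
  calc _ ≤ σ ^ 2 * (9 / 4 * ‖Q‖) := by gcongr
    _ = _ := by ring

def ZZ (X C : A) (u : ℝ) : A := (EE X u - EE X (-u)) * EE C (u ^ 2 / 2)

lemma ZZ_cont (X C : A) : Continuous (ZZ X C) :=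
  ((EE_cont X).sub (EE_cont2 X continuous_neg)).mul (EE_cont2 C fP)

lemma inv_smul_ii (hf : Continuous f) (ha : 0 < a) (hab : a ≤ b) :
    IntervalIntegrable (fun u => u⁻¹ • f u) volume a b :=
  ContinuousOn.intervalIntegrable (ContinuousOn.smul (f := fun u : ℝ => u⁻¹)
    (ContinuousOn.inv₀ continuousOn_id (fun x hx => by
      rw [uIcc_of_le hab] at hx; exact (ha.trans_le hx.1).ne')) hf.continuousOn)

lemma ii_mul_const (hf : IntervalIntegrable f volume a b) (y : A) :
    (∫ u in a..b, f u) * y = ∫ u in a..b, f u * y :=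
  (((mul ℝ A).flip y).intervalIntegral_comp_comm hf).symm

lemma ii_const_mul (hf : IntervalIntegrable f volume a b) (y : A) :
    y * (∫ u in a..b, f u) = ∫ u in a..b, y * f u :=
  (((mul ℝ A) y).intervalIntegral_comp_comm hf).symm

lemma low_r {r : A} (hX : SA X) (hC : SA C) {M : ℝ} (hr : ‖r‖ ≤ 1)
    (hCr : ‖C * r‖ ≤ M) (ha : 0 < a) (hab : a ≤ b) :
    ‖∫ u in a..b, u⁻¹ • (ZZ X C u * r)‖ ≤ 6 + M * b ^ 2 := by
  have hM : 0 ≤ M := (norm_nonneg _).trans hCr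
  have hc1 : Continuous fun u => EE X u - EE X (-u) := (EE_cont X).sub (EE_cont2 X continuous_neg)
  have hc2 : Continuous fun u => ZZ X C u * r - (EE X u - EE X (-u)) * r :=
    ((ZZ_cont X C).mul continuous_const).sub (hc1.mul continuous_const)
  have e : ∫ u in a..b, u⁻¹ • (ZZ X C u * r) = (∫ u in a..b, u⁻¹ • (EE X u - EE X (-u))) * r +
      ∫ u in a..b, u⁻¹ • (ZZ X C u * r - (EE X u - EE X (-u)) * r) := by
    rw [ii_mul_const (inv_smul_ii hc1 ha hab), ← intervalIntegral.integral_add]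
    · congr 1; funext u; rw [smul_mul_assoc, ← smul_add]; simp
    · have := inv_smul_ii (hc1.mul (continuous_const (y := r))) ha hab
      simpa [smul_mul_assoc] using this
    · exact inv_smul_ii hc2 ha hab
  rw [e]
  refine (norm_add_le _ _).trans (add_le_add ?_ ?_)
  · simpa using norm_mul2 (Y_bound hX ha hab) hr
  · have hb : 0 < b := ha.trans_le hab
    refine (intervalIntegral.norm_integral_le_of_norm_le_const (C := M * b) ?_).trans ?_
    · intro u hu
      rw [uIoc_of_le hab] at hu
      have hu0 : 0 < u := ha.trans hu.1
      rw [norm_smul, norm_inv, rno hu0.le, ZZ, mul_assoc, ← mul_sub]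
      have k1 : ‖EE X u - EE X (-u)‖ ≤ 2 := (norm_sub_le _ _).trans (by linarith [EE_norm hX u, EE_norm hX (-u)])
      have k2 := EE_sub_one_mul C r hC (u ^ 2 / 2)
      rw [abs_of_nonneg pO] at k2
      have k3 := norm_mul2 k1 k2
      rw [inv_mul_le_iff₀ hu0]
      refine k3.trans ?_
      calc 2 * (‖C * r‖ * (u ^ 2 / 2)) ≤ 2 * (M * (u ^ 2 / 2)) := by gcongr
        _ = u * (M * u) := by ring
        _ ≤ _ := by gcongr; exact hu.2
    · rw [abs_of_nonneg lI, sq, ← mul_assoc]; gcongr; linarith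

lemma high_one {q p : A} {s0 : ℝ} (hX : SA X) (hC : SA C)
    (hXC : ‖X * C - C * X‖ ≤ 2) (hq : SA q) (hq1 : ‖q‖ ≤ 1) (hqC : Commute q C)
    (hXq : ‖X * q - q * X‖ ≤ 9 / 2 * σ ^ 2) (hqq : q * q = C * p) (hp : ‖p‖ ≤ σ ^ 2)
    (hσ : 0 < σ) (hs0 : σ ≤ s0) (hs1 : s0 ≤ 1) :
    ‖∫ u in s0..1, u⁻¹ • (EE X u * EE C (u ^ 2 / 2) * q)‖ ≤ 17 := by
  have hs0p : 0 < s0 := hσ.trans_le hs0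
  have hfc : Continuous fun u => EE X u * EE C (u ^ 2 / 2) * q :=
    ((EE_cont X).mul (EE_cont2 C fP)).mul continuous_const
  have hb := ibp_bound hfc hs0p hs1 (B := fun s => 3 * √σ * √s + 4 * s ^ 2) (fun s hs => by
    have hsp : 0 < s := hs0p.trans_le hs.1
    have := D_bound hX hC hXC hq hq1 hqC hXq hqq hp nU hσ.le hs0p.le hs.1 (hs0.trans hs.1)
    refine abs_le_of_sq_le_sq' (this.trans ?_) pO |>.2
    have e1 := mul_self_sqrt hσ.le
    have e2 := mul_self_sqrt hsp.le
    have e3 : (3 * √σ * √s) * (3 * √σ * √s) = 9 * (s * σ) := by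
      calc _ = 9 * (√s * √s) * (√σ * √σ) := by ring
        _ = _ := by rw [e1, e2]; ring
    have e4 : s ^ 5 ≤ s ^ 4 := pow_le_pow_of_le_one hsp.le hs.2 nU
    have e5 : 0 ≤ 3 * √σ * √s * (4 * s ^ 2) := by positivity
    have e6 : 0 ≤ s * σ := by positivity
    have e7 : 0 ≤ s ^ 4 := by positivity
    linarith) fP
  refine hb.trans ?_
  have hpos : ∀ x ∈ uIcc s0 1, 0 < x := fun x hx => by
    rw [uIcc_of_le hs1] at hx; exact hs0p.trans_le hx.1
  have hint : ∫ u in s0..1, (u ^ 2)⁻¹ * (3 * √σ * √u + 4 * u ^ 2) =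
      (3 * √σ * (-2 * (√1)⁻¹) + 4 * 1) - (3 * √σ * (-2 * (√s0)⁻¹) + 4 * s0) := by
    refine integral_eq_sub_of_hasDerivAt (f := fun u => 3 * √σ * (-2 * (√u)⁻¹) + 4 * u)
      (fun x hx => ?_) ?_
    · have hx0 := hpos x hx
      have h1 := (((((Real.hasDerivAt_sqrt hx0.ne').inv (sqrt_pos.2 hx0).ne').const_mul (-2)).const_mul
        (3 * √σ))).add ((hasDerivAt_id x).const_mul 4)
      refine h1.congr_deriv ?_
      have e2 := sq_sqrt hx0.le
      have : √x ≠ 0 := (sqrt_pos.2 hx0).ne'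
      have hx2 : x ^ 2 = (√x) ^ 4 := by rw [show (√x) ^ 4 = ((√x) ^ 2) ^ 2 by ring, e2]
      rw [hx2]; field_simp
    · refine ContinuousOn.intervalIntegrable (ContinuousOn.mul (ContinuousOn.inv₀ fP
        (fun x hx => by have := hpos x hx; positivity)) fP)
  rw [hint]
  have h1 : √σ * (√s0)⁻¹ ≤ 1 := by
    rw [← div_eq_mul_inv, div_le_one (sqrt_pos.2 hs0p)]; exact Real.sqrt_le_sqrt hs0
  have h2 : √σ ≤ 1 := Real.sqrt_le_one.2 lI
  have h3 := sqrt_nonneg σ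
  rw [Real.sqrt_one]; norm_num; linarith

lemma J_bound {δ : ℝ} (hX : SA X) (hC : SA C)
    (hXC : ‖X * C - C * X‖ ≤ 2) (hσ : 0 < σ) (hσ1 : σ ≤ 1) (hδ : 0 < δ) (hδ1 : δ ≤ 1) :
    ‖∫ u in δ..1, u⁻¹ • (ZZ X C u * (kap C σ * kap C σ))‖ ≤ 41 := by
  set k := kap C σ with hk
  set q := k * k with hq
  have hks : SA k := kap_sa hC σ
  have hkn := kap_norm hC σ
  have hqs : SA q := by rw [hq, IsSelfAdjoint, star_mul, hks.star_eq]
  have hqn : ‖q‖ ≤ 1 := (norm_mul2 hkn hkn).trans nU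
  have hkC : Commute k C := kap_comm hC σ
  have hqC : Commute q C := hkC.mul_left hkC
  have hCX : ‖C * X - X * C‖ ≤ 2 := by rw [norm_sub_rev]; exact hXC
  have hXq : ‖X * q - q * X‖ ≤ 9 / 2 * σ ^ 2 := by
    have h1 := kap_commutator hC σ X
    have h2 : ‖X * k - k * X‖ ≤ 9 / 2 * σ ^ 2 := h1.trans (by nlinarith [sq_nonneg σ])
    have e : X * q - q * X = (X * k - k * X) * k + k * (X * k - k * X) := by rw [hq]; noncomm_ring
    rw [e]
    have h3 := norm_mul2 h2 hkn
    have h4 := norm_mul2 hkn h2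
    exact (norm_add_le _ _).trans lI
  have hqq : q * q = C * (σ ^ 2 • (KK C σ * (k * q))) := by
    have : C * (σ ^ 2 • (KK C σ * (k * q))) = k * (k * q) := by
      conv_rhs => rw [hk, kap]
      rw [mul_smul_comm, smul_mul_assoc, ← mul_assoc, hk, kap]
    rw [this, hq]; simp only [mul_assoc]
  have hp : ‖σ ^ 2 • (KK C σ * (k * q))‖ ≤ σ ^ 2 := by
    rw [norm_smul, rno pO]
    have := norm_mul2 (KK_norm C σ) (norm_mul2 hkn hqn)
    nlinarith [sq_nonneg σ]
  have hCq : ‖C * q‖ ≤ (σ ^ 2)⁻¹ := by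
    have : C * q = (σ ^ 2)⁻¹ • ((1 - KK C σ) * k) := by
      rw [← sC_kap hC σ, smul_mul_assoc, smul_smul, inv_mul_cancel₀ pO, one_smul, mul_assoc]
    rw [this, norm_smul, rno pO]
    have := norm_mul2 (one_sub_KK_norm hC σ) hkn
    have h0 : 0 ≤ (σ ^ 2)⁻¹ := by positivity
    nlinarith
  have hfc : Continuous fun u => ZZ X C u * q := (ZZ_cont X C).mul continuous_const
  have high : ∀ s0, σ ≤ s0 → s0 ≤ 1 → ‖∫ u in s0..1, u⁻¹ • (ZZ X C u * q)‖ ≤ 34 := fun s0 h0 h1 => by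
    have p0 : 0 < s0 := hσ.trans_le h0
    have a1 := high_one hX hC hXC hqs hqn hqC hXq hqq hp hσ h0 h1
    have a2 := high_one (X := -X) hX.neg hC (by
      rw [show -X * C - C * -X = -(X * C - C * X) by noncomm_ring, norm_neg]; exact hXC) hqs hqn hqC (by
      rw [show -X * q - q * -X = -(X * q - q * X) by noncomm_ring, norm_neg]; exact hXq) hqq hp hσ h0 h1
    have c1 : Continuous fun u => EE X u * EE C (u ^ 2 / 2) * q :=
      ((EE_cont X).mul (EE_cont2 C fP)).mul continuous_const
    have c2 : Continuous fun u => EE (-X) u * EE C (u ^ 2 / 2) * q :=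
      ((EE_cont _).mul (EE_cont2 C fP)).mul continuous_const
    have e : ∫ u in s0..1, u⁻¹ • (ZZ X C u * q) = (∫ u in s0..1, u⁻¹ • (EE X u * EE C (u ^ 2 / 2) * q))
        - ∫ u in s0..1, u⁻¹ • (EE (-X) u * EE C (u ^ 2 / 2) * q) := by
      rw [← intervalIntegral.integral_sub (inv_smul_ii c1 p0 h1) (inv_smul_ii c2 p0 h1)]
      congr 1; funext u
      rw [← smul_sub, ZZ, EE_neg]; congr 1; noncomm_ring
    rw [e]
    exact (norm_sub_le _ _).trans lI
  by_cases h : σ ≤ δ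
  · linarith [high δ h hδ1]
  push Not at h
  rw [← integral_add_adjacent_intervals (inv_smul_ii hfc hδ h.le) (inv_smul_ii hfc hσ hσ1)]
  have b1 := low_r hX hC hqn hCq hδ h.le
  rw [inv_mul_cancel₀ pO] at b1
  exact (norm_add_le _ _).trans (by linarith [high σ le_rfl hσ1])

end ThmLd

section ThmLe
variable {A : Type*} [CStarAlgebra A]
variable {C : A} {σ : ℝ}

def DD (C : A) (σ : ℝ) : A := (σ ^ 3) • (C * C * (KK C σ * KK C σ))

lemma KK_inv' (hC : SA C) (σ : ℝ) : KK C σ * (1 + σ ^ 4 • (C * C)) = 1 := by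
  refine Eq.trans ?_ (KK_inv hC σ)
  have := KK_comm hC σ
  exact ((Commute.one_right _).add_right ((this.mul_right this).smul_right _)).eq

lemma KK_ring (hC : SA C) (σ : ℝ) : KK C σ = Ring.inverse (1 + σ ^ 4 • (C * C)) := by
  let x : Aˣ := ⟨1 + σ ^ 4 • (C * C), KK C σ, KK_inv hC σ, KK_inv' hC σ⟩
  exact (Ring.inverse_unit x).symm

lemma KK_deriv (hC : SA C) (σ : ℝ) :
    HasDerivAt (KK C) ((-4 : ℝ) • DD C σ) σ := by
  let x : Aˣ := ⟨1 + σ ^ 4 • (C * C), KK C σ, KK_inv hC σ, KK_inv' hC σ⟩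
  have h1 : HasDerivAt (fun τ : ℝ => 1 + τ ^ 4 • (C * C)) (((4:ℝ) * σ ^ 3) • (C * C)) σ := by
    have := ((hasDerivAt_pow 4 σ).smul_const (C * C)).const_add 1
    exact this.congr_deriv nU
  have h2 : HasFDerivAt Ring.inverse (-(ContinuousLinearMap.mulLeftRight ℝ A ↑x⁻¹ ↑x⁻¹)) (1 + σ ^ 4 • (C * C)) :=
    hasFDerivAt_ringInverse (𝕜 := ℝ) x
  have h3 := h2.comp_hasDerivAt σ h1
  have e : KK C = Ring.inverse ∘ fun τ : ℝ => 1 + τ ^ 4 • (C * C) := by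
    funext τ; exact KK_ring hC τ
  rw [e]
  refine h3.congr_deriv ?_
  have hx : (↑x⁻¹ : A) = KK C σ := rfl
  simp only [hx, ContinuousLinearMap.neg_apply, ContinuousLinearMap.mulLeftRight_apply]
  rw [DD, mul_smul_comm, smul_mul_assoc, smul_smul, ← neg_smul]
  have := (KK_comm hC σ)
  have e2 : KK C σ * (C * C) * KK C σ = C * C * (KK C σ * KK C σ) := by
    rw [(this.mul_right this).eq, mul_assoc]
  rw [e2]; congr 1; ring

lemma KK_cont' (hC : SA C) : Continuous (KK C) :=
  continuous_iff_continuousAt.2 fun σ => (KK_deriv hC σ).continuousAt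

lemma kap_cont' (hC : SA C) : Continuous (kap C) := by
  have := KK_cont' hC
  unfold kap; fun_prop

lemma DD_cont (hC : SA C) : Continuous (DD C) := by
  have := KK_cont' hC
  unfold DD; fun_prop

lemma DD_comm (hC : SA C) (σ : ℝ) : Commute (KK C σ) (DD C σ) := by
  have := KK_comm hC σ
  exact ((this.mul_right this).mul_right ((Commute.refl _).mul_right (Commute.refl _))).smul_right _

lemma DD_eq (hC : SA C) (σ : ℝ) : σ • DD C σ = kap C σ * kap C σ := by
  have h := (KK_comm hC σ).eq
  rw [DD, kap, smul_mul_smul_comm, smul_smul]; congr 1; · ring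
  rw [mul_assoc C (KK C σ), ← mul_assoc (KK C σ) C, h]; simp only [mul_assoc]

lemma DD_eq' (hC : SA C) (hσ : 0 < σ) : DD C σ = σ⁻¹ • (kap C σ * kap C σ) := by
  rw [← DD_eq hC, smul_smul, inv_mul_cancel₀ hσ.ne', one_smul]

lemma KK_zero (hC : SA C) : KK C 0 = 1 := by
  have := KK_inv hC 0
  simpa using this

lemma int_DD (hC : SA C) : ∫ σ in zR..1, DD C σ = (1/4 : ℝ) • (1 - KK C 1) := by
  have h := integral_eq_sub_of_hasDerivAt (f := KK C) (a := 0) (b := 1)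
    (fun σ _ => KK_deriv hC σ) (((DD_cont hC).const_smul _).intervalIntegrable _ _)
  rw [intervalIntegral.integral_smul, KK_zero hC] at h
  have : ∫ σ in zR..1, DD C σ = (-1/4:ℝ) • ((-4:ℝ) • ∫ σ in zR..1, DD C σ) := by
    rw [smul_smul]; norm_num
  rw [this, h, ← neg_sub, smul_neg, ← neg_smul]; norm_num

def FK (C : A) (σ : ℝ) : A := (1/2:ℝ) • (KK C σ * KK C σ) - (1/3:ℝ) • (KK C σ * KK C σ * KK C σ)

lemma int_DDk (hC : SA C) :
    (1:A) = (6:ℝ) • FK C 1 + (24:ℝ) • ∫ σ in zR..1, DD C σ * (kap C σ * kap C σ) := by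
  have hd : ∀ σ, HasDerivAt (FK C) ((-4:ℝ) • (DD C σ * (kap C σ * kap C σ))) σ := fun σ => by
    have h := KK_deriv hC σ
    have h2 := h.mul h
    have h3 := h2.mul h
    have h4 := (h2.const_smul (1/2:ℝ)).sub (h3.const_smul (1/3:ℝ))
    refine HasDerivAt.congr_deriv (f' := _) h4 ?_
    have c := (DD_comm hC σ).eq
    rw [kap_sq hC]
    set K := KK C σ
    set D := DD C σ
    have c2 : K * K * D = D * (K * K) := by rw [mul_assoc, c, ← mul_assoc, c, mul_assoc]
    simp only [smul_mul_assoc, mul_smul_comm, add_mul, smul_add, mul_sub, smul_sub, c, c2, smul_smul]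
    rw [show (KK C * KK C) σ = K * K from rfl, c2, mul_assoc D K K]
    module
  have hc : Continuous fun σ => (DD C σ * (kap C σ * kap C σ)) :=
    (DD_cont hC).mul ((kap_cont' hC).mul (kap_cont' hC))
  have h := integral_eq_sub_of_hasDerivAt (f := FK C) (a := 0) (b := 1)
    (fun σ _ => hd σ) ((hc.const_smul _).intervalIntegrable _ _)
  rw [intervalIntegral.integral_smul] at h
  have : (24:ℝ) • ∫ σ in zR..1, DD C σ * (kap C σ * kap C σ) = (-6:ℝ) • ((-4:ℝ) • ∫ σ in zR..1, DD C σ * (kap C σ * kap C σ)) := by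
    rw [smul_smul]; norm_num
  rw [this, h]
  have h0 : FK C 0 = (1/6:ℝ) • 1 := by
    rw [FK, KK_zero hC]; simp only [mul_one]; module
  rw [h0]; module

lemma comm_I {X : A} {δ : ℝ} (hX : SA X) (hC : SA C)
    (hXC : ‖X * C - C * X‖ ≤ 2) (hδ : 0 < δ) (hδ1 : δ ≤ 1) :
    ‖(∫ u in δ..1, u⁻¹ • ZZ X C u) * kap C σ - kap C σ * ∫ u in δ..1, u⁻¹ • ZZ X C u‖ ≤ 9 * σ ^ 2 := by
  have hi := inv_smul_ii (ZZ_cont X C) hδ hδ1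
  have hi1 : IntervalIntegrable (fun u => (u⁻¹ • ZZ X C u) * kap C σ) volume δ 1 := by
    simpa only [smul_mul_assoc] using inv_smul_ii (f := fun u => ZZ X C u * kap C σ) ((ZZ_cont X C).mul continuous_const) hδ hδ1
  have hi2 : IntervalIntegrable (fun u => kap C σ * (u⁻¹ • ZZ X C u)) volume δ 1 := by
    simpa only [mul_smul_comm] using inv_smul_ii (f := fun u => kap C σ * ZZ X C u) (continuous_const.mul (ZZ_cont X C)) hδ hδ1
  rw [ii_mul_const hi, ii_const_mul hi, ← intervalIntegral.integral_sub hi1 hi2]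
  have hX2 : ‖X * kap C σ - kap C σ * X‖ ≤ 9 / 2 * σ ^ 2 := by
    have := kap_commutator hC σ X
    rw [norm_sub_rev (C * X)] at this
    nlinarith [sq_nonneg σ]
  have := intervalIntegral.norm_integral_le_of_norm_le_const (a := δ) (b := 1) (C := 9 * σ ^ 2)
    (f := fun u => (u⁻¹ • ZZ X C u) * kap C σ - kap C σ * (u⁻¹ • ZZ X C u)) (fun u hu => by
      rw [uIoc_of_le hδ1] at hu
      have hu0 : 0 < u := hδ.trans hu.1
      rw [smul_mul_assoc, mul_smul_comm, ← smul_sub, norm_smul, rno pO]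
      have cc : EE C (u^2/2) * kap C σ = kap C σ * EE C (u^2/2) :=
        (EE_comm (kap_comm hC σ) (u^2/2)).eq.symm
      have e : ZZ X C u * kap C σ - kap C σ * ZZ X C u =
        ((EE X u * kap C σ - kap C σ * EE X u) - (EE X (-u) * kap C σ - kap C σ * EE X (-u))) * EE C (u^2/2) := by
        rw [ZZ, mul_assoc, cc]; noncomm_ring
      rw [e]
      have b1 := (EE_comm_bound hX (kap C σ) u)
      have b2 := (EE_comm_bound hX (kap C σ) (-u))
      rw [abs_neg] at b2
      rw [abs_of_pos hu0] at b1 b2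
      have b3 := norm_mul2 ((norm_sub_le _ _).trans (add_le_add b1 b2)) (EE_norm hC (u^2/2))
      rw [inv_mul_le_iff₀ hu0]
      refine b3.trans ?_
      nlinarith)
  refine this.trans ?_
  rw [abs_of_nonneg lI]
  nlinarith [sq_nonneg σ]
end ThmLe

section ThmLf
variable {H : Type*} [NormedAddCommGroup H] [InnerProductSpace ℂ H] [CompleteSpace H]
variable {δ : ℝ}

lemma opNorm_weak {T : H →L[ℂ] H} {M : ℝ} (hM : 0 ≤ M)
    (h : ∀ u v : H, ‖u‖ = 1 → ‖v‖ = 1 → ‖inner ℂ v (T u)‖ ≤ M) : ‖T‖ ≤ M := by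
  refine T.opNorm_le_bound hM fun u => ?_
  by_cases hu : u = 0
  · simp [hu]
  by_cases hT : T u = 0
  · rw [hT, norm_zero]; positivity
  have nu : 0 < ‖u‖ := norm_pos_iff.2 hu
  have nT : 0 < ‖T u‖ := norm_pos_iff.2 hT
  have := h ((oC (‖u‖⁻¹)) • u) ((oC (‖T u‖⁻¹)) • T u)
    (by rw [norm_smul, cnr, norm_inv, norm_norm, inv_mul_cancel₀ nu.ne'])
    (by rw [norm_smul, cnr, norm_inv, norm_norm, inv_mul_cancel₀ nT.ne'])
  rw [map_smul, inner_smul_left, inner_smul_right, inner_self_eq_norm_sq_to_K] at this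
  simp only [norm_mul, cnr, norm_conj, norm_inv, norm_norm, norm_pow, coe_algebraMap] at this
  have e : ‖T u‖⁻¹ * (‖u‖⁻¹ * ‖T u‖ ^ 2) = ‖T u‖ / ‖u‖ := by field_simp
  have this2 : ‖T u‖⁻¹ * (‖u‖⁻¹ * ‖T u‖ ^ 2) ≤ M := by simpa using this
  rw [e, div_le_iff₀ nu] at this2
  exact this2

lemma I_bound {X C : H →L[ℂ] H} (hX : SA X) (hC : SA C)
    (hXC : ‖X * C - C * X‖ ≤ 2) (hδ : 0 < δ) (hδ1 : δ ≤ 1) :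
    ‖∫ u in δ..1, u⁻¹ • ZZ X C u‖ ≤ 400 := by
  set I := ∫ u in δ..1, u⁻¹ • ZZ X C u with hI
  have hi := inv_smul_ii (ZZ_cont X C) hδ hδ1
  have hk := kap_cont' hC
  have hD := DD_cont hC

  have l1 : ‖I * FK C 1‖ ≤ 8 := by
    have kn := KK_norm C 1
    have ck : ‖C * KK C 1‖ ≤ 1/2 := by simpa [kap] using kap_norm hC 1
    have e1 : ‖FK C 1‖ ≤ 1 := by
      rw [FK]; refine (norm_sub_le _ _).trans ?_
      rw [norm_smul, norm_smul]
      have := norm_mul2 kn kn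
      have := norm_mul3 kn kn kn
      norm_num at *; linarith
    have e2 : ‖C * FK C 1‖ ≤ 1 := by
      rw [FK, mul_sub, mul_smul_comm, mul_smul_comm, ← mul_assoc, ← mul_assoc, ← mul_assoc]
      refine (norm_sub_le _ _).trans ?_
      rw [norm_smul, norm_smul]
      have := norm_mul2 ck kn
      have := norm_mul3 ck kn kn
      norm_num at *; linarith
    have := low_r hX hC e1 e2 hδ hδ1
    rw [ii_mul_const hi]
    simp only [smul_mul_assoc]
    linarith
  have hint : Continuous fun σ => DD C σ * (kap C σ * kap C σ) := hD.mul (hk.mul hk)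
  have l2 : ‖I * ∫ σ in zR..1, DD C σ * (kap C σ * kap C σ)‖ ≤ 12 := by
    rw [ii_const_mul (hint.intervalIntegrable _ _)]
    refine opNorm_weak nU fun u v hu hv => ?_
    have hcI : Continuous fun σ => I * (DD C σ * (kap C σ * kap C σ)) := continuous_const.mul hint
    let L : (H →L[ℂ] H) →L[ℝ] ℂ :=
      ((innerSL ℂ v).comp (ContinuousLinearMap.apply ℂ H u)).restrictScalars ℝ
    have hL : ∀ T, L T = inner ℂ v (T u) := fun T => rfl
    let Lr : H → (H →L[ℂ] H) →L[ℝ] ℝ := fun w =>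
      Complex.reCLM.comp (((innerSL ℂ w).comp (ContinuousLinearMap.apply ℂ H w)).restrictScalars ℝ)
    have hLr : ∀ w T, Lr w T = (inner ℂ w (T w)).re := fun w T => rfl
    rw [← hL, ← L.intervalIntegral_comp_comm (hcI.intervalIntegrable _ _)]
    have q : ∀ w : H, ‖w‖ = 1 → ∫ σ in zR..1, Lr w (DD C σ) ≤ 1/4 := fun w hw => by
      rw [(Lr w).intervalIntegral_comp_comm (hD.intervalIntegrable _ _), int_DD hC, map_smul, smul_eq_mul]
      have : Lr w (1 - KK C 1) ≤ 1 := by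
        rw [hLr]
        refine (re_le_norm _).trans ((norm_inner_le_norm _ _).trans ?_)
        have := ((1 - KK C 1).le_opNorm w).trans (mlr (one_sub_KK_norm hC 1) nN)
        rw [hw] at *; linarith
      linarith
    have b : ‖∫ σ in zR..1, L (I * (DD C σ * (kap C σ * kap C σ)))‖ ≤
        ∫ σ in zR..1, (41/2 * Lr v (DD C σ) + 41/2 * Lr u (DD C σ) + 9/8) := by
      refine intervalIntegral.norm_integral_le_of_norm_le nU ?_
        (Continuous.intervalIntegrable fP _ _)
      refine aea fun σ hσ => ?_
      have hσ0 : 0 < σ := hσ.1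
      set k := kap C σ with hkk
      have ks : SA k := kap_sa hC σ
      have kn : ‖k‖ ≤ 1/2 := kap_norm hC σ
      have e1 : I * (DD C σ * (k * k)) = σ⁻¹ • (k * (I * (k * k)) * k + (I * k - k * I) * (k * k * k)) := by
        rw [DD_eq' hC hσ0, smul_mul_assoc, mul_smul_comm]; congr 1
        noncomm_ring
      have jb : ‖I * (k * k)‖ ≤ 41 := by
        have := J_bound hX hC hXC hσ0 hσ.2 hδ hδ1
        rw [hI, ii_mul_const hi]; simpa only [smul_mul_assoc] using this
      have kadj : ∀ x y : H, inner ℂ x (k y) = inner ℂ (k x) y := fun x y => by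
        have := adjoint_inner_left k y x
        rw [ks.adjoint_eq] at this; exact this.symm
      have sq : ∀ w : H, Lr w (DD C σ) = σ⁻¹ * ‖k w‖ ^ 2 := fun w => by
        rw [DD_eq' hC hσ0, map_smul, smul_eq_mul, hLr, ContinuousLinearMap.mul_apply, kadj, inner_self_eq_norm_sq_to_K]
        norm_cast
      have e2 : ‖inner ℂ v ((k * (I * (k * k)) * k) u)‖ ≤ 41 * (‖k v‖ * ‖k u‖) := by
        rw [ContinuousLinearMap.mul_apply, ContinuousLinearMap.mul_apply, kadj]
        refine (norm_inner_le_norm _ _).trans ?_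
        have := ((I * (k * k)).le_opNorm (k u)).trans (mlr jb nN)
        nlinarith [norm_nonneg (k v)]
      have e3 : ‖inner ℂ v (((I * k - k * I) * (k * k * k)) u)‖ ≤ 9/8 * σ ^ 2 := by
        refine (norm_inner_le_norm _ _).trans ?_
        have c1 := norm_mul2 (comm_I (σ := σ) hX hC hXC hδ hδ1) (norm_mul3 kn kn kn)
        have := (((I * k - k * I) * (k * k * k)).le_opNorm u).trans (mlr c1 nN)
        rw [hu] at this; rw [hv]; linarith
      rw [e1, map_smul, norm_smul, rno pO, hL, ContinuousLinearMap.add_apply, inner_add_right, sq, sq]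
      have e4 := (norm_add_le _ _).trans (add_le_add e2 e3)
      have e5 := mll e4 (by positivity : 0 ≤ σ⁻¹)
      refine e5.trans ?_
      have e6 : σ⁻¹ * (41 * (‖k v‖ * ‖k u‖) + 9/8 * σ ^ 2) = σ⁻¹ * (41 * (‖k v‖ * ‖k u‖)) + 9/8 * σ := by
        field_simp
      have e7 : 41 * (‖k v‖ * ‖k u‖) ≤ 41/2 * ‖k v‖^2 + 41/2 * ‖k u‖^2 := by linarith [sq_nonneg (‖k v‖ - ‖k u‖)]
      have e8 := mll e7 (by positivity : 0 ≤ σ⁻¹)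
      rw [e6]
      have := hσ.2
      linarith
    refine b.trans ?_
    have i1 : IntervalIntegrable (fun σ => 41/2 * Lr v (DD C σ)) volume 0 1 := Continuous.intervalIntegrable fP _ _
    have i2 : IntervalIntegrable (fun σ => 41/2 * Lr u (DD C σ)) volume 0 1 := Continuous.intervalIntegrable fP _ _
    rw [intervalIntegral.integral_add (i1.add i2) (by simp), intervalIntegral.integral_add i1 i2,
      intervalIntegral.integral_const_mul, intervalIntegral.integral_const_mul]
    have := q u hu
    have := q v hv
    simp; linarith
  have e : I = (6:ℝ) • (I * FK C 1) + (24:ℝ) • (I * ∫ σ in zR..1, DD C σ * (kap C σ * kap C σ)) := by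
    rw [← mul_smul_comm, ← mul_smul_comm, ← mul_add, ← int_DDk hC, mul_one]
  rw [e]
  refine (norm_add_le _ _).trans ?_
  rw [norm_smul, norm_smul]
  norm_num; linarith

def WW (R G : H →L[ℂ] H) (u : ℝ) : H →L[ℂ] H := EE R u * EE G (-u)

lemma WW_cont (R G : H →L[ℂ] H) : Continuous (WW R G) :=
  (EE_cont R).mul (EE_cont2 G continuous_neg)

/-- Theorem L. -/
theorem thmL {R G : H →L[ℂ] H} (hR : SA R) (hG : SA G)
    (h1 : ‖R * (G * R - R * G) - (G * R - R * G) * R‖ ≤ 1)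
    (h2 : ‖G * (G * R - R * G) - (G * R - R * G) * G‖ ≤ 1)
    (hδ : 0 < δ) (hδ1 : δ ≤ 1) :
    ‖∫ u in δ..1, u⁻¹ • (WW R G u - WW R G (-u))‖ ≤ 406 := by
  set C := iI • (G * R - R * G) with hC
  have hCs : SA C := by
    rw [IsSelfAdjoint, hC, star_smul, star_sub, star_mul, star_mul, hR.star_eq, hG.star_eq]
    rw [show star iI = -iI from conj_I, neg_smul, ← smul_neg, neg_sub]
  have h1' : ‖R * C - C * R‖ ≤ 1 := by
    rw [hC, mul_smul_comm, smul_mul_assoc, ← smul_sub, norm_smul, norm_I, one_mul]; exact h1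
  have h2' : ‖G * C - C * G‖ ≤ 1 := by
    rw [hC, mul_smul_comm, smul_mul_assoc, ← smul_sub, norm_smul, norm_I, one_mul]; exact h2
  have hXC : ‖(R - G) * C - C * (R - G)‖ ≤ 2 := by
    have : (R - G) * C - C * (R - G) = (R * C - C * R) - (G * C - C * G) := by noncomm_ring
    rw [this]; exact (norm_sub_le _ _).trans lI
  have hI := I_bound (hR.sub hG) hCs hXC hδ hδ1
  have hWc := WW_cont R G
  have c1 : Continuous fun u => WW R G u - WW R G (-u) := by fun_prop
  have c2 := ZZ_cont (R - G) C
  have j1 := inv_smul_ii c1 hδ hδ1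
  have j2 := inv_smul_ii c2 hδ hδ1
  have hd : ‖(∫ u in δ..1, u⁻¹ • (WW R G u - WW R G (-u))) - ∫ u in δ..1, u⁻¹ • ZZ (R - G) C u‖ ≤ 6 := by
    rw [← intervalIntegral.integral_sub j1 j2]
    have := intervalIntegral.norm_integral_le_of_norm_le_const (a := δ) (b := 1) (C := 6)
      (f := fun u => u⁻¹ • (WW R G u - WW R G (-u)) - u⁻¹ • ZZ (R - G) C u) (fun u hu => by
        rw [uIoc_of_le hδ1] at hu
        have hu0 : 0 < u := hδ.trans hu.1
        rw [← smul_sub, norm_smul, rno pO, inv_mul_le_iff₀ hu0]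
        have a1 := W_approx hR hG C hC hCs h1' h2' u
        have a2 := W_approx hR hG C hC hCs h1' h2' (-u)
        rw [abs_neg, neg_sq] at a2
        rw [abs_of_pos hu0] at a1 a2
        have e : WW R G u - WW R G (-u) - ZZ (R - G) C u =
          (EE R u * EE G (-u) - EE (R - G) u * EE C (u ^ 2 / 2)) -
          (EE R (-u) * EE G (-(-u)) - EE (R - G) (-u) * EE C (u ^ 2 / 2)) := by
          rw [ZZ, WW, WW]; noncomm_ring
        rw [e]
        refine (norm_sub_le _ _).trans ((add_le_add a1 a2).trans ?_)
        have : u ^ 3 ≤ u := by nlinarith [hu.2, mul_pos hu0 hu0]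
        linarith)
    refine this.trans ?_
    rw [abs_of_nonneg lI]; linarith
  have := norm_add_le ((∫ u in δ..1, u⁻¹ • (WW R G u - WW R G (-u))) - ∫ u in δ..1, u⁻¹ • ZZ (R - G) C u) (∫ u in δ..1, u⁻¹ • ZZ (R - G) C u)
  rw [sub_add_cancel] at this
  linarith
end ThmLf

abbrev VV (d : ℕ) := EuclideanSpace ℝ (Fin d)
abbrev HH (d : ℕ) := Lp ℂ 2 (volume : Measure (VV d))
local notation:max "HL" d:max => (HH d →L[ℂ] HH d)
local notation:max "VD" d:max => (VV d → VV d → ℂ)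
local notation:max "VC" d:max => (VV d → ℂ)

section N1
variable {d : ℕ}
variable {φ ψ : VC d} {T : HL d}


def BM (φ : VC d) : Prop := Measurable φ ∧ ∃ c : ℝ, ∀ x, ‖φ x‖ ≤ c

lemma BM.memLp (h : BM φ) : MemLp φ ∞ volume := by
  obtain ⟨hm, c, hc⟩ := h
  exact memLp_top_of_bound hm.aestronglyMeasurable c (aea hc)

lemma BM.mul (h : BM φ) (h' : BM ψ) : BM (fun x => φ x * ψ x) := by
  obtain ⟨hm, c, hc⟩ := h
  obtain ⟨hm', c', hc'⟩ := h'
  refine ⟨hm.mul hm', c * c', fun x => ?_⟩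
  rw [norm_mul]
  exact mul_le_mul (hc x) (hc' x) nN ((norm_nonneg _).trans (hc x))

lemma BM.add (h : BM φ) (h' : BM ψ) : BM (fun x => φ x + ψ x) := by
  obtain ⟨hm, c, hc⟩ := h
  obtain ⟨hm', c', hc'⟩ := h'
  exact ⟨hm.add hm', c + c', fun x => (norm_add_le _ _).trans (add_le_add (hc x) (hc' x))⟩

lemma BM.const (c : ℂ) : BM (fun _ : VV d => c) := ⟨mCst, ‖c‖, fun _ => le_rfl⟩

lemma BM.conj (h : BM φ) : BM (fun x => cjj (φ x)) := by
  obtain ⟨hm, c, hc⟩ := h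
  exact ⟨continuous_conj.measurable.comp hm, c, fun x => by simpa using hc x⟩

open Classical in
/-- multiplication operator -/
def MM (φ : VC d) : HL d :=
  if h : BM φ then (mul ℂ ℂ).holderL volume ∞ 2 2 h.memLp.toLp else 0

lemma MM_coe (h : BM φ) (f : HH d) : ∀ᵐ x, (MM φ f : VC d) x = φ x * f x := by
  rw [MM, dif_pos h]
  have h1 := (mul ℂ ℂ).coeFn_holder (r := 2) h.memLp.toLp f
  filter_upwards [h1, h.memLp.coeFn_toLp] with x h1 h2
  exact h1.trans (by rw [h2]; rfl)

lemma MM_ext {S : HL d} (h : ∀ f : HH d, ∀ᵐ x, (T f : VC d) x = (S f : VC d) x) : T = S :=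
  ContinuousLinearMap.ext fun f => Lp.ext (h f)

lemma MM_norm_le {c : ℝ} (hc : 0 ≤ c) (h : ∀ x, ‖φ x‖ ≤ c) : ‖MM φ‖ ≤ c := by
  by_cases hb : BM φ
  · refine opNorm_le_bound _ hc fun f => ?_
    refine Lp.norm_le_mul_norm_of_ae_le_mul ?_
    filter_upwards [MM_coe hb f] with x hx
    rw [hx, norm_mul]; exact mlr (h x) nN
  · rw [MM, dif_neg hb, norm_zero]; exact hc

lemma MM_mul (h : BM φ) (h' : BM ψ) : MM φ * MM ψ = MM (fun x => φ x * ψ x) :=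
  MM_ext fun f => by
    rw [ContinuousLinearMap.mul_apply]
    filter_upwards [MM_coe h (MM ψ f), MM_coe h' f, MM_coe (h.mul h') f] with x a b c
    rw [a, b, c, mul_assoc]

lemma MM_add (h : BM φ) (h' : BM ψ) : MM φ + MM ψ = MM (fun x => φ x + ψ x) :=
  MM_ext fun f => by
    rw [ContinuousLinearMap.add_apply]
    filter_upwards [MM_coe h f, MM_coe h' f, MM_coe (h.add h') f, Lp.coeFn_add (MM φ f) (MM ψ f)] with x a b c e
    rw [e, Pi.add_apply, a, b, c, add_mul]

lemma MM_const (c : ℂ) : MM (fun _ : VV d => c) = c • (1 : HL d) :=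
  MM_ext fun f => by
    rw [ContinuousLinearMap.smul_apply, ContinuousLinearMap.one_apply]
    filter_upwards [MM_coe (BM.const c) f, Lp.coeFn_smul c f] with x a b
    rw [a, b]; rfl

lemma MM_smul (h : BM φ) (c : ℂ) : c • MM φ = MM (fun x => c * φ x) := by
  rw [← MM_mul (BM.const c) h, MM_const, smul_mul_assoc, one_mul]

lemma MM_inner (h : BM φ) (f g : HH d) :
    inner ℂ f (MM φ g) = inner ℂ (MM (fun x => cjj (φ x)) f) g := by
  rw [L2.inner_def, L2.inner_def]
  refine ica ?_
  filter_upwards [MM_coe h g, MM_coe h.conj f] with x a b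
  rw [a, b]; simp; ring

lemma MM_star (h : BM φ) : star (MM φ) = MM (fun x => cjj (φ x)) := by
  refine ContinuousLinearMap.ext fun f => ext_inner_right ℂ fun g => ?_
  rw [star_eq_adjoint, adjoint_inner_left, MM_inner h]

lemma MM_sa {φ : VV d → ℝ} (h : BM (fun x => (φ x : ℂ))) : SA (MM fun x => (φ x : ℂ)) := by
  rw [IsSelfAdjoint, MM_star h]; simp

lemma BCF_BM (f : BoundedContinuousFunction (VV d) ℂ) : BM f := ⟨f.continuous.measurable, ‖f‖, f.norm_coe_le_norm⟩

def mulHom : BoundedContinuousFunction (VV d) ℂ →ₐ[ℂ] HL d where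
  toFun f := MM f
  map_one' := by
    have := MM_const (d := d) 1
    rw [one_smul] at this; exact this
  map_mul' f g := (MM_mul (BCF_BM f) (BCF_BM g)).symm
  map_zero' := by
    have := MM_const (d := d) 0
    rw [zero_smul] at this; exact this
  map_add' f g := (MM_add (BCF_BM f) (BCF_BM g)).symm
  commutes' c := by
    rw [Algebra.algebraMap_eq_smul_one, Algebra.algebraMap_eq_smul_one]
    have := MM_const (d := d) c
    rw [← this]; congr 1; ext x; simp

lemma mulHom_cont : Continuous (mulHom (d := d)) := by
  refine AddMonoidHomClass.continuous_of_bound (mulHom (d := d)) 1 fun f => ?_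
  rw [one_mul]
  exact MM_norm_le nN f.norm_coe_le_norm

lemma BCF_exp_apply (f : BoundedContinuousFunction (VV d) ℂ) (x : VV d) :
    (NormedSpace.exp f) x = cE (f x) := by
  letI : NormedAlgebra ℚ (BoundedContinuousFunction (VV d) ℂ) := NormedAlgebra.restrictScalars ℚ ℂ _
  let ev : BoundedContinuousFunction (VV d) ℂ →+* ℂ :=
    { toFun := fun f => f x, map_one' := rfl, map_mul' := fun _ _ => rfl, map_zero' := rfl, map_add' := fun _ _ => rfl }
  have hc : Continuous ev := (BoundedContinuousFunction.evalCLM ℂ x).continuous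
  have := NormedSpace.map_exp ev hc f
  rw [exp_eq_exp_ℂ]; exact this

/-- conjugation of an alghom by exp -/
lemma EE_hom (Ψ : BoundedContinuousFunction (VV d) ℂ →ₐ[ℂ] HL d) (hΨ : Continuous Ψ)
    (f g : BoundedContinuousFunction (VV d) ℂ) (s : ℝ) (hg : ∀ x, g x = cE (iI * s * f x)) :
    EE (Ψ f) s = Ψ g := by
  letI : NormedAlgebra ℚ (BoundedContinuousFunction (VV d) ℂ) := NormedAlgebra.restrictScalars ℚ ℂ _
  letI : NormedAlgebra ℚ HL d := NormedAlgebra.restrictScalars ℚ ℂ _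
  have : g = NormedSpace.exp ((iI * s) • f) := by
    ext x; rw [BCF_exp_apply, hg]; rfl
  rw [this, NormedSpace.map_exp Ψ hΨ, map_smul, EE]

/-- Fourier conjugation -/
def FL (d : ℕ) : HH d ≃ₗᵢ[ℂ] HH d := Lp.fourierTransformₗᵢ (VV d) ℂ

def FM (T : HL d) : HL d :=
  ((FL d).symm : HL d) * T * ((FL d) : HL d)

lemma FM_apply (T : HL d) (f : HH d) : FM T f = (FL d).symm (T (FL d f)) := rfl

lemma FM_mul (T S : HL d) : FM T * FM S = FM (T * S) :=
  ContinuousLinearMap.ext fun f => by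
    simp [FM_apply, ContinuousLinearMap.mul_apply]

lemma FM_norm (T : HL d) : ‖FM T‖ ≤ ‖T‖ := by
  refine opNorm_le_bound _ nN fun f => ?_
  rw [FM_apply, LinearIsometryEquiv.norm_map]
  exact (T.le_opNorm _).trans (by rw [LinearIsometryEquiv.norm_map])

lemma FM_inner (T : HL d) (f g : HH d) :
    inner ℂ f (FM T g) = inner ℂ (FL d f) (T (FL d g)) := by
  rw [FM_apply, ← (FL d).inner_map_map, LinearIsometryEquiv.apply_symm_apply]

lemma FM_sa (hT : SA T) : SA (FM T) := by
  refine ContinuousLinearMap.ext fun f => ext_inner_right ℂ fun g => ?_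
  rw [star_eq_adjoint, adjoint_inner_left, FM_inner, FM_apply,
    ← (FL d).inner_map_map ((FL d).symm _) g, LinearIsometryEquiv.apply_symm_apply, ← adjoint_inner_left]
  rw [hT.adjoint_eq]

def fmulHom : BoundedContinuousFunction (VV d) ℂ →ₐ[ℂ] HL d where
  toFun f := FM (mulHom f)
  map_one' := by ext1 f; simp [FM_apply]
  map_mul' f g := by rw [map_mul, FM_mul]
  map_zero' := by ext1 f; simp [FM_apply]
  map_add' f g := by ext1 f; simp [FM_apply]
  commutes' c := by
    rw [AlgHom.commutes]; ext1 f; simp [FM_apply, Algebra.algebraMap_eq_smul_one]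

lemma fmulHom_cont : Continuous (fmulHom (d := d)) := by
  refine AddMonoidHomClass.continuous_of_bound (fmulHom (d := d)) 1 fun f => ?_
  rw [one_mul]
  exact (FM_norm _).trans (MM_norm_le nN f.norm_coe_le_norm)
end N1

section N2
variable {d : ℕ}
variable {h g p q : VC d} {a b : VD d} {C C' : ℝ}
open scoped FourierTransform SchwartzMap ContDiff

def ex (x ξ : VV d) : ℂ := cE ((oC (2 * rpi * ⟪x, ξ⟫)) * iI)

lemma ex_norm (x ξ : VV d) : ‖ex x ξ‖ = 1 := norm_exp_ofReal_mul_I _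

lemma ex_symm (x ξ : VV d) : ex x ξ = ex ξ x := by rw [ex, ex, real_inner_comm]

lemma ex_cont : Continuous fun z : VV d × VV d => ex z.1 z.2 := by unfold ex; fun_prop

lemma finv_eq (g : VC d) (x : VV d) : 𝓕⁻ g x = ∫ ξ, ex x ξ * g ξ := by
  rw [Real.fourierInv_eq']
  refine ica (aea fun ξ => ?_)
  show _ = ex x ξ * g ξ
  rw [ex_symm]; rfl

structure Nice (h : VC d) : Prop where
  m : Measurable h
  i : Integrable h volume
  l : MemLp h 2 volume

def nn (h : VC d) : ℝ := (eLpNorm h 2 volume).toReal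

lemma nn_nonneg (h : VC d) : 0 ≤ nn h := toReal_nonneg

lemma nn_toLp (hh : MemLp h 2 volume) : ‖hh.toLp‖ = nn h := Lp.norm_toLp _ _

lemma fubini_ex {φ : VC d} (hg : Integrable g volume) (hφ : Integrable φ volume) :
    ∫ x, φ x * ∫ ξ, ex x ξ * g ξ = ∫ ξ, g ξ * ∫ x, ex ξ x * φ x := by
  have hi : Integrable (fun z : VV d × VV d => φ z.1 * (ex z.1 z.2 * g z.2)) (volume.prod volume) := by
    have := (hφ.mul_prod hg).bdd_mul (c := 1) (f := fun z : VV d × VV d => ex z.1 z.2) ex_cont.aestronglyMeasurable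
      (aea fun z => (ex_norm _ _).le)
    refine this.congr (aea fun z => ?_)
    simp only []; ring
  calc ∫ x, φ x * ∫ ξ, ex x ξ * g ξ = ∫ x, ∫ ξ, φ x * (ex x ξ * g ξ) := by
        simp only [icm]
    _ = ∫ ξ, ∫ x, φ x * (ex x ξ * g ξ) := integral_integral_swap hi
    _ = _ := by
        refine ica (aea fun ξ => ?_)
        simp only []
        rw [← icm]
        refine ica (aea fun x => ?_)
        simp only [ex_symm x ξ]; ring

lemma FLsymm_weak (G : HH d) (φ : 𝓢(VV d, ℂ)) :
    ∫ x, φ x * ((FL d).symm G : VC d) x = ∫ ξ, G ξ * ∫ x, ex ξ x * φ x := by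
  have h := congrArg (fun T => T φ) (Lp.fourierInv_toTemperedDistribution_eq G)
  simp only [TemperedDistribution.fourierInv_apply, Lp.toTemperedDistribution_apply, smul_eq_mul] at h
  refine Eq.trans h.symm ?_
  refine ica (aea fun ξ => ?_)
  simp only []
  rw [SchwartzMap.fourierInv_coe, finv_eq, mul_comm]

lemma finv_cont (hg : Integrable g volume) : Continuous fun x => ∫ ξ, ex x ξ * g ξ := by
  refine continuous_of_dominated (bound := fun ξ => ‖g ξ‖) ?_ ?_ hg.norm ?_
  · intro x
    exact ((ex_cont.comp (Continuous.prodMk_right x)).aestronglyMeasurable).mul hg.1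
  · intro x; refine aea fun ξ => ?_
    rw [norm_mul, ex_norm, one_mul]
  · refine aea fun ξ => ?_
    exact (ex_cont.comp (Continuous.prodMk_left ξ)).mul continuous_const

lemma FLsymm_coe (hg : Integrable g volume) (hg2 : MemLp g 2 volume) :
    ∀ᵐ x, ((FL d).symm hg2.toLp : VC d) x = ∫ ξ, ex x ξ * g ξ := by
  refine ae_eq_of_integral_contDiff_smul_eq ((Lp.memLp _).locallyIntegrable nU)
    (finv_cont hg).locallyIntegrable fun φ hφ hφc => ?_
  let Φ : 𝓢(VV d, ℂ) := (hφc.comp_left (g := fun r : ℝ => (r : ℂ)) (by simp)).toSchwartzMap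
    (ofRealCLM.contDiff.comp hφ)
  have hΦ : ∀ x, Φ x = (φ x : ℂ) := fun x => rfl
  have h1 := FLsymm_weak hg2.toLp Φ
  have h2 := fubini_ex hg Φ.integrable
  simp only [hΦ] at h1 h2
  simp only [real_smul]
  rw [h1, h2]
  refine ica ?_
  filter_upwards [hg2.coeFn_toLp] with ξ hξ
  rw [hξ]

/-- bounded symbols -/
def BS (a : VD d) : Prop :=
  Measurable (fun z : VV d × VV d => a z.1 z.2) ∧ ∃ c : ℝ, ∀ x ξ, ‖a x ξ‖ ≤ c

def BF (a : VD d) (h g : VC d) : ℂ :=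
  ∫ z : VV d × VV d, h z.1 * a z.1 z.2 * ex z.1 z.2 * g z.2

def OB (a : VD d) (C : ℝ) : Prop :=
  BS a ∧ ∀ h g, Nice h → Nice g → ‖BF a h g‖ ≤ C * (nn h * nn g)

lemma BF_int (ha : BS a) (hh : Integrable h volume) (hg : Integrable g volume) :
    Integrable (fun z : VV d × VV d => h z.1 * a z.1 z.2 * ex z.1 z.2 * g z.2) volume := by
  obtain ⟨hm, c, hc⟩ := ha
  have := (hh.mul_prod hg).bdd_mul (c := c) (f := fun z : VV d × VV d => a z.1 z.2 * ex z.1 z.2)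
    (hm.aestronglyMeasurable.mul ex_cont.aestronglyMeasurable)
    (aea fun z => by rw [norm_mul, ex_norm, mul_one]; exact hc _ _)
  refine this.congr (aea fun z => ?_)
  simp only []; ring

lemma BF_iter (ha : BS a) (hh : Integrable h volume) (hg : Integrable g volume) :
    BF a h g = ∫ x, h x * ∫ ξ, a x ξ * ex x ξ * g ξ := by
  have hi := BF_int ha hh hg
  rw [BF, show (volume : Measure (VV d × VV d)) = volume.prod volume from rfl, integral_prod _ hi]
  refine ica (aea fun x => ?_)
  simp only []
  rw [← icm]
  refine ica (aea fun ξ => ?_)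
  simp only []; ring

lemma BF_iter' (ha : BS a) (hh : Integrable h volume) (hg : Integrable g volume) :
    BF a h g = ∫ ξ, g ξ * ∫ x, a x ξ * ex x ξ * h x := by
  have hi := BF_int ha hh hg
  rw [BF, show (volume : Measure (VV d × VV d)) = volume.prod volume from rfl, integral_prod_symm _ hi]
  refine ica (aea fun x => ?_)
  simp only []
  rw [← icm]
  refine ica (aea fun ξ => ?_)
  simp only []; ring

lemma BS.add (ha : BS a) (hb : BS b) : BS (fun x ξ => a x ξ + b x ξ) := by
  obtain ⟨hm, c, hc⟩ := ha
  obtain ⟨hm', c', hc'⟩ := hb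
  exact ⟨hm.add hm', c + c', fun x ξ => (norm_add_le _ _).trans (add_le_add (hc x ξ) (hc' x ξ))⟩

lemma BS.mul (ha : BS a) (hb : BS b) : BS (fun x ξ => a x ξ * b x ξ) := by
  obtain ⟨hm, c, hc⟩ := ha
  obtain ⟨hm', c', hc'⟩ := hb
  refine ⟨hm.mul hm', c * c', fun x ξ => ?_⟩
  rw [norm_mul]
  exact mul_le_mul (hc x ξ) (hc' x ξ) nN ((norm_nonneg _).trans (hc x ξ))

lemma BS.const (c : ℂ) : BS (fun _ _ : VV d => c) := ⟨mCst, ‖c‖, fun _ _ => le_rfl⟩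

lemma BS.left (hp : BM p) : BS (fun x _ : VV d => p x) := by
  obtain ⟨hm, c, hc⟩ := hp
  exact ⟨hm.comp measurable_fst, c, fun x _ => hc x⟩

lemma BS.right (hp : BM p) : BS (fun _ ξ : VV d => p ξ) := by
  obtain ⟨hm, c, hc⟩ := hp
  exact ⟨hm.comp measurable_snd, c, fun _ x => hc x⟩

lemma OB.nonneg_mono (h : OB a C) (hC : C ≤ C') : OB a C' :=
  ⟨h.1, fun f g hf hg => (h.2 f g hf hg).trans (mlr hC (mul_nonneg (nn_nonneg _) (nn_nonneg _)))⟩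

lemma BF_add (ha : BS a) (hb : BS b) (hh : Nice h) (hg : Nice g) :
    BF (fun x ξ => a x ξ + b x ξ) h g = BF a h g + BF b h g := by
  rw [BF, BF, BF, ← integral_add (BF_int ha hh.i hg.i) (BF_int hb hh.i hg.i)]
  refine ica (aea fun z => ?_)
  simp only []; ring

lemma OB.add (ha : OB a C) (hb : OB b C') :
    OB (fun x ξ => a x ξ + b x ξ) (C + C') := by
  refine ⟨ha.1.add hb.1, fun h g hh hg => ?_⟩
  rw [BF_add ha.1 hb.1 hh hg, add_mul]
  exact (norm_add_le _ _).trans (add_le_add (ha.2 h g hh hg) (hb.2 h g hh hg))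

lemma OB.smul (ha : OB a C) (c : ℂ) :
    OB (fun x ξ => c * a x ξ) (‖c‖ * C) := by
  refine ⟨(BS.const c).mul ha.1, fun h g hh hg => ?_⟩
  have : BF (fun x ξ => c * a x ξ) h g = c * BF a h g := by
    rw [BF, BF, ← icm]
    refine ica (aea fun z => ?_)
    simp only []; ring
  rw [this, norm_mul, mul_assoc]
  exact mll (ha.2 h g hh hg) nN

lemma Nice.bmul (hp : BM p) (hh : Nice h) : Nice (fun x => p x * h x) := by
  obtain ⟨hm, c, hc⟩ := hp
  refine ⟨hm.mul hh.m, hh.i.bdd_mul hm.aestronglyMeasurable (aea hc), ?_⟩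
  exact MemLp.of_le_mul (c := c) hh.l (hm.mul hh.m).aestronglyMeasurable (aea fun x => by
    rw [norm_mul]; exact mlr (hc x) nN)

lemma nn_mono (hg : MemLp g 2 volume) (hle : ∀ x, ‖h x‖ ≤ ‖g x‖) : nn h ≤ nn g :=
  toReal_mono hg.2.ne (eLpNorm_mono hle)

lemma nn_bmul (hp : ∀ x, ‖p x‖ ≤ 1) (hh : Nice h) : nn (fun x => p x * h x) ≤ nn h :=
  nn_mono hh.l fun x => by
    rw [norm_mul]; exact mul_le_of_le_one_left nN (hp x)

lemma BF_lr (a : VD d) (p q h g : VC d) :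
    BF (fun x ξ => p x * a x ξ * q ξ) h g = BF a (fun x => p x * h x) (fun x => q x * g x) := by
  refine ica (aea fun z => ?_)
  simp only []; ring

lemma OB.lr (ha : OB a C) (hC : 0 ≤ C) (hp : Measurable p) (hq : Measurable q)
    (hp1 : ∀ x, ‖p x‖ ≤ 1) (hq1 : ∀ x, ‖q x‖ ≤ 1) : OB (fun x ξ => p x * a x ξ * q ξ) C := by
  have bp : BM p := ⟨hp, 1, hp1⟩
  have bq : BM q := ⟨hq, 1, hq1⟩
  refine ⟨((BS.left bp).mul ha.1).mul (BS.right bq), fun h g hh hg => ?_⟩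
  rw [BF_lr]
  refine (ha.2 _ _ (hh.bmul bp) (hg.bmul bq)).trans ?_
  exact mll (mul_le_mul (nn_bmul hp1 hh) (nn_bmul hq1 hg) (nn_nonneg _) (nn_nonneg _)) hC

/-- bridge -/
lemma BF_op (hp : BM p) (hq : BM q) (hh : Nice h) (hg : Nice g) :
    BF (fun x ξ => p x * q ξ) h g =
      inner ℂ ((hh.l.star).toLp) (MM p ((FL d).symm (MM q hg.l.toLp))) := by
  have e1 : MM q hg.l.toLp = (hg.bmul hq).l.toLp := by
    refine Lp.ext ?_
    filter_upwards [MM_coe hq hg.l.toLp, hg.l.coeFn_toLp, (hg.bmul hq).l.coeFn_toLp] with x a b c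
    rw [a, b, c]
  rw [e1, L2.inner_def, BF_iter ((BS.left hp).mul (BS.right hq)) hh.i hg.i]
  refine ica ?_
  filter_upwards [MM_coe hp ((FL d).symm (hg.bmul hq).l.toLp), FLsymm_coe (hg.bmul hq).i (hg.bmul hq).l,
    hh.l.star.coeFn_toLp] with x a b c
  rw [a, b, c]
  simp only [Pi.star_apply, RCLike.inner_apply, RCLike.star_def, Complex.conj_conj]
  rw [mul_comm (p x * _), ← icm, ← icm, ← icm]
  refine ica (aea fun ξ => ?_)
  simp only []; ring

lemma op_bound {T : HL d} (hT : ‖T‖ ≤ C) (hh : Nice h) (hg : Nice g) :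
    ‖inner ℂ ((hh.l.star).toLp) (T ((FL d).symm hg.l.toLp))‖ ≤ C * (nn h * nn g) := by
  refine (norm_inner_le_norm _ _).trans ?_
  have e1 : ‖(hh.l.star).toLp‖ = nn h := by
    rw [Lp.norm_toLp, nn]; congr 1
    exact eLpNorm_congr_norm_ae (aea fun x => by simp)
  have e2 : ‖T ((FL d).symm hg.l.toLp)‖ ≤ C * nn g := by
    refine (T.le_opNorm _).trans ?_
    rw [LinearIsometryEquiv.norm_map, nn_toLp]
    exact mlr hT (nn_nonneg _)
  rw [e1]
  calc _ ≤ nn h * (C * nn g) := mll e2 (nn_nonneg _)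
    _ = _ := by ring

lemma OB_one : OB (fun _ _ : VV d => (1:ℂ)) 1 := by
  refine ⟨BS.const 1, fun h g hh hg => ?_⟩
  have := BF_op (BM.const (d := d) 1) (BM.const 1) hh hg
  rw [MM_const, one_smul] at this
  simp only [mul_one] at this
  rw [this]
  exact op_bound (T := 1) (ContinuousLinearMap.norm_id_le) hh hg

lemma OB_pq (hp : Measurable p) (hq : Measurable q)
    (hp1 : ∀ x, ‖p x‖ ≤ 1) (hq1 : ∀ x, ‖q x‖ ≤ 1) : OB (fun x ξ => p x * q ξ) 1 := by
  have := OB_one.lr zero_le_one hp hq hp1 hq1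
  simpa only [mul_one] using this

lemma OB_lim {a : ℕ → VV d → VC d} {c : ℝ} (ha : ∀ n, OB (a n) C)
    (hc : ∀ n x ξ, ‖a n x ξ‖ ≤ c) (hl : ∀ x ξ, Tendsto (fun n => a n x ξ) atTop (𝓝 (b x ξ))) : OB b C := by
  have hb : BS b := ⟨measurable_of_tendsto_metrizable (fun n => (ha n).1.1) (tendsto_pi_nhds.2 fun z => hl z.1 z.2), c,
    fun x ξ => le_of_tendsto (hl x ξ).norm (Eventually.of_forall fun n => hc n x ξ)⟩
  refine ⟨hb, fun h g hh hg => ?_⟩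
  have : Tendsto (fun n => BF (a n) h g) atTop (𝓝 (BF b h g)) := by
    refine tendsto_integral_of_dominated_convergence (fun z : VV d × VV d => c * ‖h z.1 * g z.2‖)
      (fun n => (BF_int (ha n).1 hh.i hg.i).1) ((hh.i.mul_prod hg.i).norm.const_mul c) (fun n => aea fun z => ?_)
      (aea fun z => ?_)
    · rw [norm_mul, norm_mul, norm_mul, ex_norm, mul_one, norm_mul]
      linarith [mlr (hc n z.1 z.2) (mul_nonneg (norm_nonneg (h z.1)) (norm_nonneg (g z.2)))]
    · exact ((tendsto_const_nhds.mul (hl z.1 z.2)).mul tendsto_const_nhds).mul tendsto_const_nhds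
  exact le_of_tendsto this.norm (Eventually.of_forall fun n => (ha n).2 h g hh hg)

/-- superposition -/
lemma BF_integral {Y : Type*} [MeasurableSpace Y] {μ : Measure Y} [SFinite μ] {a : Y → VV d → VC d} {n : Y → ℝ}
        (ham : Measurable fun w : Y × (VV d × VV d) => a w.1 w.2.1 w.2.2)
    (hn : Integrable n μ) (hc : ∀ᵐ y ∂μ, ∀ x ξ, ‖a y x ξ‖ ≤ n y)
    (hba : ∀ x ξ, b x ξ = ∫ y, a y x ξ ∂μ) (hh : Nice h) (hg : Nice g) :
    BF b h g = ∫ y, BF (a y) h g ∂μ := by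
  have hi : Integrable (fun w : Y × (VV d × VV d) => h w.2.1 * a w.1 w.2.1 w.2.2 * ex w.2.1 w.2.2 * g w.2.2) (μ.prod volume) := by
    have h0 : Integrable (fun z : VV d × VV d => h z.1 * g z.2) volume := hh.i.mul_prod hg.i
    have h1 : Integrable (fun w : Y × (VV d × VV d) => n w.1 * ‖h w.2.1 * g w.2.2‖) (μ.prod volume) :=
      hn.mul_prod h0.norm
    refine h1.mono' ?_ ?_
    · have := ex_cont (d := d) |>.measurable
      exact ((((hh.m.comp (measurable_fst.comp measurable_snd)).mul ham).mul
        (this.comp measurable_snd)).mul (hg.m.comp (measurable_snd.comp measurable_snd))).aestronglyMeasurable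
    · have hc' : ∀ᵐ w ∂(μ.prod (volume : Measure (VV d × VV d))), ∀ x ξ, ‖a w.1 x ξ‖ ≤ n w.1 :=
        Measure.quasiMeasurePreserving_fst.ae hc
      filter_upwards [hc'] with w hw
      rw [norm_mul, norm_mul, norm_mul, ex_norm, mul_one, norm_mul]
      linarith [mlr (hw w.2.1 w.2.2) (mul_nonneg (norm_nonneg (h w.2.1)) (norm_nonneg (g w.2.2)))]
  have e1 : ∀ z : VV d × VV d, h z.1 * b z.1 z.2 * ex z.1 z.2 * g z.2
        = ∫ y, h z.1 * a y z.1 z.2 * ex z.1 z.2 * g z.2 ∂μ := fun z => by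
      rw [hba, integral_mul_const, integral_mul_const, icm]
  simp only [BF, e1]
  exact (integral_integral_swap hi).symm

lemma OB_integral {Y : Type*} [MeasurableSpace Y] {μ : Measure Y} [SFinite μ] {a : Y → VV d → VC d} {n : Y → ℝ}
        (ham : Measurable fun w : Y × (VV d × VV d) => a w.1 w.2.1 w.2.2)
    (hn : Integrable n μ) (hc : ∀ᵐ y ∂μ, ∀ x ξ, ‖a y x ξ‖ ≤ n y) {m : Y → ℝ} (hm : Integrable m μ)
    (ha : ∀ᵐ y ∂μ, OB (a y) (m y))
    (hb : BS b) (hba : ∀ x ξ, b x ξ = ∫ y, a y x ξ ∂μ) : OB b (∫ y, m y ∂μ) := by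
  refine ⟨hb, fun h g hh hg => ?_⟩
  rw [BF_integral ham hn hc hba hh hg, ← integral_mul_const]
  refine norm_integral_le_of_norm_le (hm.mul_const _) ?_
  filter_upwards [ha] with y hy
  exact hy.2 h g hh hg
end N2

section N3
variable {d : ℕ}
variable {φ : VC d} {B : ℝ}
open scoped FourierTransform SchwartzMap ContDiff

lemma ex_add (a x ξ : VV d) : ex (x + a) ξ = ex x ξ * ex a ξ := by
  rw [ex, ex, ex, ← Complex.exp_add]; congr 1; rw [inner_add_left]; push_cast; ring

lemma BM_ex (a : VV d) : BM (ex a) :=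
  ⟨(ex_cont.comp (Continuous.prodMk_right a)).measurable, 1, fun x => (ex_norm a x).le⟩

def tau (a : VV d) : HL d := FM (MM (ex a))

lemma tau_norm (a : VV d) : ‖tau a‖ ≤ 1 :=
  (FM_norm _).trans (MM_norm_le zero_le_one fun x => (ex_norm a x).le)

lemma mp_add (a : VV d) : MeasurePreserving (fun x : VV d => x + a) volume volume :=
  measurePreserving_add_right volume a

lemma Schw_nice (φ : 𝓢(VV d, ℂ)) : Nice φ := ⟨φ.continuous.measurable, φ.integrable, φ.memLp 2⟩

lemma FLsymm_tau (a : VV d) (g : HH d) :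
    (FL d).symm (MM (ex a) g) = Lp.compMeasurePreserving (fun x : VV d => x + a) (mp_add a) ((FL d).symm g) := by
  have hd : DenseRange (SchwartzMap.toLpCLM ℝ ℂ 2 (volume : Measure (VV d))) :=
    SchwartzMap.denseRange_toLpCLM nU
  refine congrFun (hd.equalizer (g := fun g : HH d => (FL d).symm (MM (ex a) g))
    (h := fun g => Lp.compMeasurePreserving (fun x : VV d => x + a) (mp_add a) ((FL d).symm g)) ?_ ?_ ?_) g
  · exact (FL d).symm.continuous.comp (MM (ex a)).continuous
  · exact (Lp.isometry_compMeasurePreserving (mp_add a)).continuous.comp (FL d).symm.continuous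
  · funext φ
    have hn := Schw_nice φ
    have e0 : SchwartzMap.toLpCLM ℝ ℂ 2 volume φ = hn.l.toLp := rfl
    simp only [Function.comp, e0]
    have e1 : MM (ex a) hn.l.toLp = (hn.bmul (BM_ex a)).l.toLp := by
      refine Lp.ext ?_
      filter_upwards [MM_coe (BM_ex a) hn.l.toLp, hn.l.coeFn_toLp, (hn.bmul (BM_ex a)).l.coeFn_toLp] with x a b c
      rw [a, b, c]
    rw [e1]
    refine Lp.ext ?_
    filter_upwards [FLsymm_coe (hn.bmul (BM_ex a)).i (hn.bmul (BM_ex a)).l,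
      (mp_add a).quasiMeasurePreserving.ae (FLsymm_coe hn.i hn.l),
      Lp.coeFn_compMeasurePreserving ((FL d).symm hn.l.toLp) (mp_add a)] with x h1 h2 h3
    rw [h1, h3, Function.comp, h2]
    simp only [ex_add]
    refine ica (aea fun ξ => ?_)
    simp only []; ring

lemma tau_coe (a : VV d) (u : HH d) : ∀ᵐ x, (tau a u : VC d) x = u (x + a) := by
  rw [tau, FM_apply, FLsymm_tau, LinearIsometryEquiv.symm_apply_apply]
  exact Lp.coeFn_compMeasurePreserving u (mp_add a)

lemma BM.shift (h : BM φ) (a : VV d) : BM (fun x => φ (x + a)) := by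
  obtain ⟨hm, c, hc⟩ := h
  exact ⟨hm.comp (measurable_add_const a), c, fun x => hc _⟩

lemma tau_MM (a : VV d) (h : BM φ) : tau a * MM φ = MM (fun x => φ (x + a)) * tau a :=
  MM_ext fun u => by
    rw [ContinuousLinearMap.mul_apply, ContinuousLinearMap.mul_apply]
    filter_upwards [tau_coe a (MM φ u), (mp_add a).quasiMeasurePreserving.ae (MM_coe h u),
      MM_coe (h.shift a) (tau a u), tau_coe a u] with x h1 h2 h3 h4
    rw [h1, h2, h3, h4]

/-- Gaussian multiplier -/
def GG (B : ℝ) (ξ : VV d) : ℝ := rE (-(rpi ^ 2 * ‖ξ‖ ^ 2 / B))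
def gk (B : ℝ) (a : VV d) : ℝ := (rpi / B) ^ (-(d / 2 : ℝ)) * rE (-B * ‖a‖ ^ 2)

lemma gk_nonneg (hB : 0 < B) (a : VV d) : 0 ≤ gk B a := by unfold gk; have := pi_pos; positivity

lemma gauss_int (hB : 0 < B) : Integrable (fun a : VV d => rE (-B * ‖a‖ ^ 2)) volume := by
  have := (GaussianFourier.integrable_cexp_neg_mul_sq_norm_add (V := VV d) (b := B) (by simpa using hB) 0 0).norm
  refine this.congr (aea fun a => ?_)
  simp only [zero_mul, add_zero, norm_exp]
  norm_cast

lemma gk_int (hB : 0 < B) : Integrable (gk B : VV d → ℝ) volume := (gauss_int hB).const_mul _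

lemma GG_eq (hB : 0 < B) (ξ : VV d) : (GG B ξ : ℂ) = ∫ a, (gk B a : ℂ) * ex a ξ := by
  have h := GaussianFourier.integral_cexp_neg_mul_sq_norm_add (V := VV d) (b := B) (by simpa using hB)
    (2 * rpi * iI) ξ
  have e : ∀ a : VV d, (gk B a : ℂ) * ex a ξ = (oC ((rpi / B) ^ (-(d / 2 : ℝ)))) *
      cE (-B * ‖a‖ ^ 2 + 2 * rpi * iI * ⟪ξ, a⟫) := by
    intro a
    rw [gk, ex, Complex.exp_add, real_inner_comm ξ a]; push_cast
    rw [mul_assoc]; congr 3; ring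
  simp only [e]
  rw [icm, h, ← mul_assoc, GG]
  have hpb : 0 < rpi / B := div_pos pi_pos hB
  have e2 : ((rpi:ℂ) / B) ^ (Module.finrank ℝ (VV d) / 2 : ℂ) = (oC ((rpi / B) ^ (d / 2 : ℝ))) := by
    rw [Complex.ofReal_cpow hpb.le]; simp
  rw [e2, ← Complex.ofReal_mul, rpow_neg hpb.le, inv_mul_cancel₀ (rpow_pos_of_pos hpb _).ne',
    Complex.ofReal_one, one_mul, ofReal_exp]
  congr 1
  push_cast
  have : (B:ℂ) ≠ 0 := by exact_mod_cast hB.ne'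
  field_simp
  ring_nf; rw [I_sq]; ring

lemma GG_pos (B : ℝ) (ξ : VV d) : 0 < GG B ξ := rxp _
lemma GG_le (hB : 0 < B) (ξ : VV d) : GG B ξ ≤ 1 := by
  rw [GG, exp_le_one_iff]; have : 0 ≤ rpi ^ 2 * ‖ξ‖ ^ 2 / B := by positivity
  linarith
lemma GG_cont (B : ℝ) : Continuous (GG B : VV d → ℝ) := by unfold GG; fun_prop

lemma GG_BM (hB : 0 < B) : BM (fun ξ : VV d => (GG B ξ : ℂ)) :=
  ⟨(continuous_ofReal.comp (GG_cont B)).measurable, 1, fun ξ => by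
    rw [cnr, rno (GG_pos B ξ).le]; exact GG_le hB ξ⟩

def Gop (B : ℝ) : HL d := FM (MM fun ξ => (GG B ξ : ℂ))

lemma Gop_weak (hB : 0 < B) (v u : HH d) :
    Integrable (fun a : VV d => (gk B a : ℂ) * inner ℂ v (tau a u)) volume ∧
    inner ℂ v (Gop B u) = ∫ a : VV d, (gk B a : ℂ) * inner ℂ v (tau a u) := by
  set V := FL d v
  set U := FL d u
  have hVU : Integrable (fun ξ => cjj (V ξ) * U ξ) volume := by
    have := L2.integrable_inner (𝕜 := ℂ) V U
    refine this.congr (aea fun ξ => ?_)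
    simp [mul_comm]
  have hi : Integrable (fun z : VV d × VV d => ((gk B z.1 : ℂ) * ex z.1 z.2) * (cjj (V z.2) * U z.2))
      (volume.prod volume) := by
    have h1 := ((gk_int (d := d) hB).ofReal (𝕜 := ℂ)).mul_prod hVU
    have h2 := h1.bdd_mul (c := 1) (f := fun z : VV d × VV d => ex z.1 z.2) ex_cont.aestronglyMeasurable
      (aea fun z => (ex_norm _ _).le)
    refine h2.congr (aea fun z => ?_)
    simp only [coe_algebraMap]; ring
  have e : ∀ a : VV d, (gk B a : ℂ) * inner ℂ v (tau a u) =
      ∫ ξ, ((gk B a : ℂ) * ex a ξ) * (cjj (V ξ) * U ξ) := by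
    intro a
    rw [tau, FM_inner, L2.inner_def, ← icm]
    refine ica ?_
    filter_upwards [MM_coe (BM_ex a) U] with ξ h
    rw [h]; simp [V]; ring
  simp only [e]
  refine ⟨hi.integral_prod_left, ?_⟩
  rw [integral_integral_swap hi, Gop, FM_inner, L2.inner_def]
  refine ica ?_
  filter_upwards [MM_coe (GG_BM hB) U] with ξ h
  rw [h, integral_mul_const, ← GG_eq hB]; simp [V]; ring
end N3

section N3b
variable {d : ℕ}
variable {B K κ : ℝ} {w : VV d → ℝ} {φ ψ R : VC d}

def cd (d : ℕ) : ℝ := wR ^ (d / 2 : ℝ)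
lemma cd_pos (d : ℕ) : 0 < cd d := rpow_pos_of_pos two_pos _
lemma cd_ge (d : ℕ) : 1 ≤ cd d := Real.one_le_rpow nU pO

lemma gk_half (hB : 0 < B) (hw : Measurable w) (hw0 : ∀ a, 0 ≤ w a)     (h : ∀ a, w a * rE (-(B / 2) * ‖a‖ ^ 2) ≤ K) :
    Integrable (fun a => gk B a * w a) volume ∧ ∫ a, gk B a * w a ≤ cd d * K := by
  have hpb : 0 < rpi / B := div_pos pi_pos hB
  have hle : ∀ a : VV d, gk B a * w a ≤ K * ((rpi / B) ^ (-(d / 2 : ℝ)) * rE (-(B/2) * ‖a‖ ^ 2)) := by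
    intro a
    have e : gk B a = (rpi / B) ^ (-(d / 2 : ℝ)) * rE (-(B/2) * ‖a‖ ^ 2) * rE (-(B/2) * ‖a‖ ^ 2) := by
      rw [gk, mul_assoc, ← Real.exp_add]; congr 2; ring
    have p : 0 ≤ (rpi / B) ^ (-(d / 2 : ℝ)) * rE (-(B/2) * ‖a‖ ^ 2) := by positivity
    rw [e]
    linarith [mll (h a) p]
  have hI : Integrable (fun a : VV d => K * ((rpi / B) ^ (-(d / 2 : ℝ)) * rE (-(B/2) * ‖a‖ ^ 2))) volume :=
    ((gauss_int (half_pos hB)).const_mul _).const_mul _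
  have hi : Integrable (fun a => gk B a * w a) volume := by
    refine hI.mono' (((gk_int hB).1.mul hw.aestronglyMeasurable)) (aea fun a => ?_)
    rw [rno (mul_nonneg (gk_nonneg hB a) (hw0 a))]; exact hle a
  refine ⟨hi, (integral_mono hi hI hle).trans ?_⟩
  rw [icm, icm, GaussianFourier.integral_rexp_neg_mul_sq_norm (half_pos hB)]
  have : (rpi / (B/2)) = 2 * (rpi / B) := by field_simp
  rw [this, mul_rpow two_pos.le hpb.le, rpow_neg hpb.le, cd]
  have hh := (rpow_pos_of_pos hpb (d / 2 : ℝ)).ne'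
  have e3 : (Module.finrank ℝ (VV d) / 2 : ℝ) = (d/2 : ℝ) := by simp
  rw [e3]
  apply le_of_eq; field_simp

lemma mom1 (hB : 0 < B) : Integrable (fun a : VV d => gk B a * ‖a‖) volume ∧
    ∫ a : VV d, gk B a * ‖a‖ ≤ cd d * (1 / √B) := by
  refine gk_half hB measurable_norm (fun a => norm_nonneg a) fun a => ?_
  have hs := sqrt_pos.2 hB
  have h1 : √B ^ 2 = B := sq_sqrt hB.le
  rw [neg_mul, exp_neg, ← div_eq_mul_inv, div_le_div_iff₀ (rxp _) hs, one_mul]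
  have := add_one_le_exp (B / 2 * ‖a‖ ^ 2)
  nlinarith [sq_nonneg (√B * ‖a‖ - 1)]

lemma mom2 (hB : 0 < B) : Integrable (fun a : VV d => gk B a * ‖a‖ ^ 2) volume ∧
    ∫ a : VV d, gk B a * ‖a‖ ^ 2 ≤ cd d * (2 / B) := by
  refine gk_half hB (measurable_norm.pow_const 2) (fun a => sq_nonneg _) fun a => ?_
  rw [neg_mul, exp_neg, ← div_eq_mul_inv, div_le_div_iff₀ (rxp _) hB]
  have := add_one_le_exp (B / 2 * ‖a‖ ^ 2)
  linarith

lemma weak_bound (hB : 0 < B) {T : HL d} {S : VV d → HH d →L[ℂ] HH d}     (hK : 0 ≤ K) (hw : Integrable (fun a => gk B a * w a) volume) (hwK : ∫ a, gk B a * w a ≤ K)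
    (hS : ∀ a, ‖S a‖ ≤ w a)
    (h : ∀ v u, inner ℂ v (T u) = ∫ a : VV d, (gk B a : ℂ) * inner ℂ v (S a u)) : ‖T‖ ≤ K := by
  refine opNorm_weak hK fun u v hu hv => ?_
  rw [h]
  refine (norm_integral_le_of_norm_le hw (aea fun a => ?_)).trans hwK
  rw [norm_mul, cnr, rno (gk_nonneg hB a)]
  refine mll ?_ (gk_nonneg hB a)
  refine (norm_inner_le_norm _ _).trans ?_
  rw [hv, one_mul]
  refine ((S a).le_opNorm u).trans ?_
  rw [hu, mul_one]; exact hS a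

lemma adj_inner (Z : HL d) (v u : HH d) : inner ℂ v (Z u) = inner ℂ (adjoint Z v) u :=
  (adjoint_inner_left _ _ _).symm

lemma BM.sub (h : BM φ) (h' : BM ψ) : BM (fun x => φ x - ψ x) := by
  obtain ⟨hm, c, hc⟩ := h
  obtain ⟨hm', c', hc'⟩ := h'
  exact ⟨hm.sub hm', c + c', fun x => (norm_sub_le _ _).trans (add_le_add (hc x) (hc' x))⟩

lemma MM_sub (h : BM φ) (h' : BM ψ) : MM (fun x => φ x - ψ x) = MM φ - MM ψ := by
  rw [eq_sub_iff_add_eq, MM_add (h.sub h') h']; simp only [sub_add_cancel]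

lemma comm_tau (a : VV d) (hR : BM R) :
    tau a * MM R - MM R * tau a = MM (fun x => R (x + a) - R x) * tau a := by
  rw [tau_MM a hR, MM_sub (hR.shift a) hR, sub_mul]

lemma ring_aux1 {A : Type*} [Ring A] {t G r p : A} (c : t * G = G * t) (h : t * r - r * t = p * t) :
    t * (G * r - r * G) - (G * r - r * G) * t = (G * p - p * G) * t := by
  have e1 : (G * p - p * G) * t = G * (p * t) - (p * t) * G := by
    rw [sub_mul, mul_assoc, mul_assoc, mul_assoc, c]
  have e2 : t * (G * r) = G * (t * r) := by rw [← mul_assoc, c, mul_assoc]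
  have e3 : r * G * t = r * t * G := by rw [mul_assoc, ← c, mul_assoc]
  rw [e1, ← h, mul_sub, e2, sub_mul, e3]; noncomm_ring

lemma ring_aux2 {A : Type*} [Ring A] {t r p : A} (c : r * p = p * r) (h : t * r - r * t = p * t) :
    r * (t * r - r * t) - (t * r - r * t) * r = - (p * (p * t)) := by
  have e : r * (p * t) = p * (r * t) := by rw [← mul_assoc, c, mul_assoc]
  rw [h, e, ← h]
  have : (t * r - r * t) * r = p * (t * r) := by rw [h, mul_assoc]
  rw [this]; noncomm_ring

lemma aux_inner (Z G : HL d) (v u : HH d) : inner ℂ v ((G * Z - Z * G) u) =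
    inner ℂ v (G (Z u)) - inner ℂ (adjoint Z v) (G u) := by
  have := adj_inner Z v (G u)
  rw [ContinuousLinearMap.sub_apply, inner_sub_right, ContinuousLinearMap.mul_apply, ContinuousLinearMap.mul_apply]
  linear_combination -this

lemma aux_inner2 (r Z : HL d) (v u : HH d) :
    inner ℂ v ((r * (Z * r - r * Z) - (Z * r - r * Z) * r) u) =
       2 * inner ℂ (adjoint r v) (Z (r u))
        - inner ℂ (adjoint r (adjoint r v)) (Z u) - inner ℂ v (Z (r (r u))) := by
  simp only [ContinuousLinearMap.sub_apply, ContinuousLinearMap.mul_apply, map_sub, inner_sub_right, adj_inner r]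
  ring

/-- commutator with the Gaussian multiplier -/
lemma comm_G (hB : 0 < B) (Z : HL d) (hκ : 0 ≤ κ)
    (h : ∀ a : VV d, ‖tau a * Z - Z * tau a‖ ≤ κ * ‖a‖) :
    ‖Gop B * Z - Z * Gop B‖ ≤ κ * (cd d * (1 / √B)) := by
  have m := mom1 (d := d) hB
  refine weak_bound hB (S := fun a => tau a * Z - Z * tau a) (w := fun a => κ * ‖a‖)
    (mul_nonneg hκ (mul_nonneg (cd_pos d).le pO)) ?_ ?_ h ?_
  · exact (m.1.const_mul κ).congr (aea fun a => by simp only []; ring)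
  · have : ∀ a : VV d, gk B a * (κ * ‖a‖) = κ * (gk B a * ‖a‖) := fun a => by ring
    simp only [this]
    rw [icm]; exact mll m.2 hκ
  · intro v u
    obtain ⟨i1, e1⟩ := Gop_weak hB v (Z u)
    obtain ⟨i2, e2⟩ := Gop_weak hB (adjoint Z v) u
    simp only [aux_inner]
    rw [e1, e2]
    refine (integral_sub i1 i2).symm.trans (ica (aea fun a => ?_))
    simp only []; ring

lemma comm_G_MM (hB : 0 < B) (hφ : BM φ) (hκ : 0 ≤ κ)
    (h : ∀ x a : VV d, ‖φ (x + a) - φ x‖ ≤ κ * ‖a‖) :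
    ‖Gop B * MM φ - MM φ * Gop B‖ ≤ κ * (cd d * (1 / √B)) := by
  refine comm_G hB _ hκ fun a => ?_
  rw [comm_tau a hφ]
  refine (norm_mul_le _ _).trans ?_
  refine (mul_le_mul (MM_norm_le (c := κ * ‖a‖) pO fun x => h x a) (tau_norm a) nN pO).trans (mul_one _).le

lemma tau_Gop (B : ℝ) (hB : 0 < B) (a : VV d) : tau a * Gop B = Gop B * tau a := by
  rw [tau, Gop, FM_mul, FM_mul, MM_mul (BM_ex a) (GG_BM hB), MM_mul (GG_BM hB) (BM_ex a)]
  simp only [mul_comm]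

lemma comm_GGR (hB : 0 < B) (hR : BM R) (hκ : 0 ≤ κ)
    (h : ∀ x a b : VV d, ‖(R (x + a + b) - R (x + a)) - (R (x + b) - R x)‖ ≤ κ * (‖a‖ * ‖b‖)) :
    ‖Gop B * (Gop B * MM R - MM R * Gop B) - (Gop B * MM R - MM R * Gop B) * Gop B‖ ≤
      κ * (cd d * (1 / √B)) * (cd d * (1 / √B)) := by
  have hc := cd_pos d
  refine comm_G hB _ pO fun b => ?_
  rw [ring_aux1 (tau_Gop B hB b) (comm_tau b hR)]
  refine (norm_mul_le _ _).trans ?_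
  have := comm_G_MM hB ((hR.shift b).sub hR) (κ := κ * ‖b‖) pO fun x a => by
    have := h x a b
    refine le_trans (le_of_eq ?_) (this.trans (le_of_eq (by ring)))
    congr 1
  calc _ ≤ (κ * ‖b‖ * (cd d * (1 / √B))) * 1 := mul_le_mul this (tau_norm b) nN pO
    _ = _ := by ring

lemma comm_RRG (hB : 0 < B) (hR : BM R) (hκ : 0 ≤ κ)
    (h : ∀ x a : VV d, ‖R (x + a) - R x‖ ≤ κ * ‖a‖) :
    ‖MM R * (Gop B * MM R - MM R * Gop B) - (Gop B * MM R - MM R * Gop B) * MM R‖ ≤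
      κ ^ 2 * (cd d * (2 / B)) := by
  have hc := cd_pos d
  have m := mom2 (d := d) hB
  refine weak_bound hB (S := fun a => MM R * (tau a * MM R - MM R * tau a) - (tau a * MM R - MM R * tau a) * MM R)
    (w := fun a => κ ^ 2 * ‖a‖ ^ 2) pO ?_ ?_ ?_ ?_
  · exact (m.1.const_mul (κ ^ 2)).congr (aea fun a => by simp only []; ring)
  · have : ∀ a : VV d, gk B a * (κ ^ 2 * ‖a‖ ^ 2) = κ ^ 2 * (gk B a * ‖a‖ ^ 2) := fun a => by ring
    simp only [this]
    rw [icm]; exact mll m.2 pO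
  · intro a
    have hφ := (hR.shift a).sub hR
    have hφ2 : MM R * MM (fun x => R (x + a) - R x) = MM (fun x => R (x + a) - R x) * MM R := by
      rw [MM_mul hR hφ, MM_mul hφ hR]; congr 1; funext x; ring
    rw [ring_aux2 hφ2 (comm_tau a hR), norm_neg]
    have n1 : ‖MM (fun x => R (x + a) - R x)‖ ≤ κ * ‖a‖ := MM_norm_le pO fun x => h x a
    calc _ ≤ (κ * ‖a‖) * ((κ * ‖a‖) * 1) := (norm_mul_le _ _).trans (mul_le_mul n1 ((norm_mul_le _ _).trans
          (mul_le_mul n1 (tau_norm a) nN pO)) nN pO)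
      _ = _ := by ring
  · intro v u
    obtain ⟨i1, e1⟩ := Gop_weak hB (adjoint (MM R) v) (MM R u)
    obtain ⟨i2, e2⟩ := Gop_weak hB (adjoint (MM R) (adjoint (MM R) v)) u
    obtain ⟨i3, e3⟩ := Gop_weak hB v (MM R (MM R u))
    simp only [aux_inner2]
    refine Eq.trans (congrArg₂ (fun a b => a - b) (congrArg₂ (fun a b => 2 * a - b) e1 e2) e3) ?_
    have q1 := integral_sub (i1.const_mul 2) i2
    have q2 := integral_sub ((i1.const_mul 2).sub i2) i3
    have q0 := integral_const_mul (μ := (volume : Measure (VV d))) (2:ℂ) (fun a => (gk B a : ℂ) *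
      inner ℂ (adjoint (MM R) v) (tau a (MM R u)))
    refine Eq.trans ?_ (q2.symm.trans (ica (aea fun a => ?_)))
    · refine Eq.trans ?_ (congrArg (fun z => z - _) q1.symm)
      refine congrArg (fun z => z - _ - _) q0.symm
    · simp only [Pi.sub_apply]; ring
end N3b

section N3c
variable {d : ℕ}
variable {φ R G : VV d → ℝ} {c : ℝ}

def bcf (f : VC d) (hf : Continuous f) (C : ℝ) (h : ∀ x, ‖f x‖ ≤ C) : BoundedContinuousFunction (VV d) ℂ :=
  BoundedContinuousFunction.ofNormedAddCommGroup f hf C h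

def pe (φ : VV d → ℝ) (u : ℝ) (x : VV d) : ℂ := cE (iI * u * (φ x : ℂ))

lemma pe_norm (φ : VV d → ℝ) (u : ℝ) (x : VV d) : ‖pe φ u x‖ = 1 := by
  rw [pe, mul_assoc, mul_comm, ← Complex.ofReal_mul, norm_exp_ofReal_mul_I]

lemma pe_cont (h : Continuous φ) (u : ℝ) : Continuous (pe φ u) := by unfold pe; fun_prop

lemma EE_MM (h : Continuous φ) (hc : ∀ x, |φ x| ≤ c) (u : ℝ) :
    EE (MM fun x => (φ x : ℂ)) u = MM (pe φ u) := by
  have := EE_hom mulHom mulHom_cont (bcf (fun x => (φ x : ℂ)) (continuous_ofReal.comp h) c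
    (fun x => by rw [cnr]; exact hc x)) (bcf (pe φ u) (pe_cont h u) 1 fun x => (pe_norm φ u x).le) u
    (fun x => rfl)
  exact this

lemma EE_FM (h : Continuous φ) (hc : ∀ x, |φ x| ≤ c) (u : ℝ) :
    EE (FM (MM fun x => (φ x : ℂ))) u = FM (MM (pe φ u)) := by
  have := EE_hom fmulHom fmulHom_cont (bcf (fun x => (φ x : ℂ)) (continuous_ofReal.comp h) c
    (fun x => by rw [cnr]; exact hc x)) (bcf (pe φ u) (pe_cont h u) 1 fun x => (pe_norm φ u x).le) u
    (fun x => rfl)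
  exact this

lemma pe_BM (h : Continuous φ) (u : ℝ) : BM (pe φ u) :=
  ⟨(pe_cont h u).measurable, 1, fun x => (pe_norm φ u x).le⟩

lemma BF_WW (hR : Continuous R) (hG : Continuous G) (hRc : ∀ x, |R x| ≤ c)
    (hGc : ∀ x, |G x| ≤ c) (u : ℝ) {h g : VC d} (hh : Nice h) (hg : Nice g) :
    BF (fun x ξ => pe R u x * pe G (-u) ξ) h g =
      inner ℂ ((hh.l.star).toLp) (WW (MM fun x => (R x : ℂ)) (FM (MM fun x => (G x : ℂ))) u ((FL d).symm hg.l.toLp)) := by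
  rw [BF_op (pe_BM hR u) (pe_BM hG (-u)) hh hg, WW, EE_MM hR hRc, EE_FM hG hGc, ContinuousLinearMap.mul_apply,
    FM_apply, LinearIsometryEquiv.apply_symm_apply]

lemma WW_symb (R G : VV d → ℝ) (u : ℝ) (x ξ : VV d) :
    pe R u x * pe G (-u) ξ - pe R (-u) x * pe G (-(-u)) ξ = 2 * iI * (rSin (u * (R x - G ξ)) : ℂ) := by
  rw [pe, pe, pe, pe, ← Complex.exp_add, ← Complex.exp_add, Complex.ofReal_sin, Complex.sin]
  push_cast
  have e1 : iI * ↑u * ↑(R x) + iI * -↑u * ↑(G ξ) = u * (R x - G ξ) * iI := by ring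
  have e2 : iI * -↑u * ↑(R x) + iI * -(-↑u) * ↑(G ξ) = -(u * (R x - G ξ)) * iI := by ring
  rw [e1, e2]
  linear_combination -(cE (-(u * (R x - G ξ)) * iI) - cE (u * (R x - G ξ) * iI)) * I_sq

lemma sin_OB (hR : Continuous R) (hG : Continuous G) (u : ℝ) :
    OB (fun x ξ => (rSin (u * (R x - G ξ)) : ℂ)) 1 := by
  have h1 := OB_pq (pe_cont hR u).measurable (pe_cont hG (-u)).measurable (fun x => (pe_norm R u x).le) (fun x => (pe_norm G (-u) x).le)
  have h2 := OB_pq (pe_cont hR (-u)).measurable (pe_cont hG (-(-u))).measurable (fun x => (pe_norm R (-u) x).le) (fun x => (pe_norm G (-(-u)) x).le)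
  have := ((h1.add (h2.smul (-1))).smul ((2 * iI)⁻¹))
  have e : (fun x ξ => (rSin (u * (R x - G ξ)) : ℂ)) = (fun x ξ : VV d => (2 * iI)⁻¹ *
    (pe R u x * pe G (-u) ξ + -1 * (pe R (-u) x * pe G (-(-u)) ξ))) := by
    funext x ξ
    rw [neg_one_mul, ← sub_eq_add_neg, WW_symb]
    field_simp
  rw [e]
  refine this.nonneg_mono ?_
  simp; norm_num

set_option maxHeartbeats 1000000 in
lemma sinint_OB (hR : Continuous R) (hG : Continuous G) (hRc : ∀ x, |R x| ≤ c)
    (hGc : ∀ x, |G x| ≤ c)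
    {RR GO : HL d} (hRR : RR = MM fun x => (R x : ℂ)) (hGO : GO = FM (MM fun x => (G x : ℂ)))
    (h1 : ‖RR * (GO * RR - RR * GO) - (GO * RR - RR * GO) * RR‖ ≤ 1)
    (h2 : ‖GO * (GO * RR - RR * GO) - (GO * RR - RR * GO) * GO‖ ≤ 1)
    {δ : ℝ} (hδ : 0 < δ) (hδ1 : δ ≤ 1) :
    OB (fun x ξ => (oC (∫ u in δ..1, u⁻¹ * rSin (u * (R x - G ξ))))) 203 := by
  have bR : BM (fun x => (R x : ℂ)) := ⟨(continuous_ofReal.comp hR).measurable, c, fun x => by rw [cnr]; exact hRc x⟩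
  have bG : BM (fun x => (G x : ℂ)) := ⟨(continuous_ofReal.comp hG).measurable, c, fun x => by rw [cnr]; exact hGc x⟩
  have hT := thmL (hRR ▸ MM_sa bR) (hGO ▸ FM_sa (MM_sa bG)) h1 h2 hδ hδ1
  have hc0 : 0 ≤ c := (abs_nonneg _).trans (hRc 0)
  have hcont : ∀ y : ℝ, ContinuousOn (fun u : ℝ => u⁻¹ * rSin (u * y)) (uIcc δ 1) := by
    intro y
    refine ContinuousOn.mul (continuousOn_id.inv₀ fun u hu => ?_) fP
    rw [uIcc_of_le hδ1] at hu; simp only [id]; linarith [hu.1]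
  have hbd : ∀ u : ℝ, u ∈ Ioc δ 1 → ∀ x ξ, ‖(oC (u⁻¹ * rSin (u * (R x - G ξ))))‖ ≤ 1 / δ := by
    intro u hu x ξ
    have hu0 : 0 < u := hδ.trans hu.1
    rw [cnr, norm_mul, norm_inv, rno hu0.le, one_div]
    have := inv_anti₀ hδ hu.1.le
    have h3 : ‖rSin (u * (R x - G ξ))‖ ≤ 1 := abs_sin_le_one _
    calc u⁻¹ * ‖rSin (u * (R x - G ξ))‖ ≤ δ⁻¹ * 1 := mul_le_mul this h3 nN pO
      _ = _ := mul_one _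
  have hmeas : Measurable fun w : ℝ × (VV d × VV d) => (oC (w.1⁻¹ * rSin (w.1 * (R w.2.1 - G w.2.2)))) := by
    have := hR.measurable; have := hG.measurable; fun_prop
  have hba : ∀ x ξ : VV d, (oC (∫ u in δ..1, u⁻¹ * rSin (u * (R x - G ξ)))) =
      ∫ u in Ioc δ 1, (oC (u⁻¹ * rSin (u * (R x - G ξ)))) := fun x ξ => by
    rw [integral_of_le hδ1]; exact integral_complex_ofReal.symm
  have hbs : BS (fun x ξ => (oC (∫ u in δ..1, u⁻¹ * rSin (u * (R x - G ξ))))) := by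
    refine ⟨?_, 1 / δ * (1 - δ), fun x ξ => ?_⟩
    · simp only [hba]
      exact (hmeas.comp measurable_swap).stronglyMeasurable.integral_prod_right'.measurable
    · beta_reduce
      rw [hba]
      have := norm_setIntegral_le_of_norm_le_const (μ := volume) (s := Ioc δ 1) (C := 1 / δ) (f := fun u => (oC (u⁻¹ * rSin (u * (R x - G ξ))))) (by simp) (fun u hu => hbd u hu x ξ)
      simpa [hδ1] using this
  refine ⟨hbs, fun h g hh hg => ?_⟩
  have hF := BF_integral (μ := volume.restrict (Ioc δ 1)) (n := fun _ => 1 / δ) hmeas (integrable_const _)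
    ((ae_restrict_iff' measurableSet_Ioc).2 (aea hbd)) hba hh hg
  set v := (hh.l.star).toLp
  set w := (FL d).symm hg.l.toLp
  have e1 : ∀ u : ℝ, BF (fun x ξ => (oC (u⁻¹ * rSin (u * (R x - G ξ))))) h g =
      (2 * iI)⁻¹ * inner ℂ v ((u⁻¹ • (WW RR GO u - WW RR GO (-u))) w) := by
    intro u
    have q1 := BF_WW hR hG hRc hGc u hh hg
    have q2 := BF_WW hR hG hRc hGc (-u) hh hg
    rw [← hRR, ← hGO] at q1 q2
    rw [ContinuousLinearMap.smul_apply, ContinuousLinearMap.sub_apply, RCLike.real_smul_eq_coe_smul (K := ℂ), inner_smul_right, inner_sub_right]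
    rw [← q1, ← q2]
    show _ = (2 * iI)⁻¹ * ((oC (u⁻¹)) * _)
    have o1 := (OB_pq (pe_cont hR u).measurable (pe_cont hG (-u)).measurable (fun x => (pe_norm R u x).le) (fun x => (pe_norm G (-u) x).le)).1
    have o2 := (OB_pq (pe_cont hR (-u)).measurable (pe_cont hG (-(-u))).measurable (fun x => (pe_norm R (-u) x).le) (fun x => (pe_norm G (-(-u)) x).le)).1
    rw [BF, BF, BF, ← integral_sub (BF_int o1 hh.i hg.i) (BF_int o2 hh.i hg.i), ← icm, ← icm]
    refine ica (aea fun z => ?_)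
    simp only []
    have := WW_symb R G u z.1 z.2
    rw [Complex.ofReal_mul, show (rSin (u * (R z.1 - G z.2)) : ℂ) = (2 * iI)⁻¹ * (pe R u z.1 * pe G (-u) z.2 - pe R (-u) z.1 * pe G (-(-u)) z.2) by rw [this]; field_simp]
    ring
  have hIi : IntervalIntegrable (fun u : ℝ => u⁻¹ • (WW RR GO u - WW RR GO (-u))) volume δ 1 := by
    refine ContinuousOn.intervalIntegrable ?_
    refine ContinuousOn.smul (f := fun u : ℝ => u⁻¹) (continuousOn_id.inv₀ fun u hu => ?_)
      (((WW_cont RR GO).sub ((WW_cont RR GO).comp continuous_neg)).continuousOn)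
    rw [uIcc_of_le hδ1] at hu; simp only [id]; linarith [hu.1]
  have e2 : ∫ u in Ioc δ 1, inner ℂ v ((u⁻¹ • (WW RR GO u - WW RR GO (-u))) w)
      = inner ℂ v ((∫ u in δ..1, u⁻¹ • (WW RR GO u - WW RR GO (-u))) w) := by
    let Lf : HL d →L[ℂ] ℂ := (innerSL ℂ v).comp (ContinuousLinearMap.apply ℂ (HH d) w)
    have := Lf.intervalIntegral_comp_comm hIi
    rw [integral_of_le hδ1] at this
    exact this
  rw [hF]
  simp only [e1]
  rw [icm, e2, norm_mul]
  have := op_bound hT hh hg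
  calc _ ≤ ‖(2 * iI)⁻¹‖ * (406 * (nn h * nn g)) := mll this nN
    _ = _ := by simp; ring
end N3c

section N3d
variable {d : ℕ}
variable {R : VV d → ℝ} {b : ℝ}

def phi (y : ℝ) : ℝ := arctan y + y / (1 + y ^ 2)
def nk (η : ℝ) : ℝ := η⁻¹ * ((1 + η) * rE (-η) - if η ≤ 1 then 1 else 0)

lemma exp_int : IntegrableOn (fun η : ℝ => rE (-η)) (Ioi 0) := integrableOn_exp_neg_Ioi 0

lemma cexp_int (y : ℝ) : IntegrableOn (fun η : ℝ => cE ((-1 + y * iI) * η)) (Ioi 0) :=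
  integrableOn_exp_mul_complex_Ioi (by simp) 0

lemma cexp_val (y : ℝ) : ∫ η in Ioi zR, cE ((-1 + y * iI) * η) =
    (oC (1 / (1 + y ^ 2))) + (oC (y / (1 + y ^ 2))) * iI := by
  rw [integral_exp_mul_complex_Ioi (by simp)]
  have h0 : (-1 + y * iI : ℂ) ≠ 0 := fun h => by
    have := congrArg Complex.re h; simp at this
  have h1 : (1 + (y:ℂ) ^ 2) ≠ 0 := by
    have : zR < 1 + y ^ 2 := by positivity
    exact_mod_cast this.ne'
  push_cast
  simp only [mul_zero, Complex.exp_zero]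
  field_simp
  linear_combination -(y:ℂ) ^ 2 * I_sq

lemma cexp_parts (y η : ℝ) : cE ((-1 + y * iI) * η) =
    (oC (rE (-η) * cos (η * y))) + (oC (rE (-η) * rSin (η * y))) * iI := by
  have : (-1 + y * iI) * η = (oC (-η)) + (oC (η * y)) * iI := by push_cast; ring
  rw [this, Complex.exp_add, Complex.exp_mul_I]; push_cast; ring

lemma re_aux (a b : ℝ) : RCLike.re ((a : ℂ) + (b : ℂ) * iI) = a := by simp
lemma im_aux (a b : ℝ) : im ((a : ℂ) + (b : ℂ) * iI) = b := by simp

lemma cos_int (y : ℝ) : IntegrableOn (fun η => rE (-η) * cos (η * y)) (Ioi 0) ∧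
    ∫ η in Ioi zR, rE (-η) * cos (η * y) = 1 / (1 + y ^ 2) := by
  have h := cexp_int y
  have e : ∀ η : ℝ, rE (-η) * cos (η * y) = RCLike.re (cE ((-1 + y * iI) * η)) := by
    intro η; rw [cexp_parts]; exact (re_aux _ _).symm
  simp only [e]
  refine ⟨h.re, ?_⟩
  rw [integral_re h, cexp_val]; exact re_aux _ _

lemma sin_int (y : ℝ) : IntegrableOn (fun η => rE (-η) * rSin (η * y)) (Ioi 0) ∧
    ∫ η in Ioi zR, rE (-η) * rSin (η * y) = y / (1 + y ^ 2) := by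
  have h := cexp_int y
  have e : ∀ η : ℝ, rE (-η) * rSin (η * y) = im (cE ((-1 + y * iI) * η)) := by
    intro η; rw [cexp_parts]; exact (im_aux _ _).symm
  simp only [e]
  refine ⟨h.im, ?_⟩
  rw [integral_im h, cexp_val]; exact im_aux _ _

lemma sinc_bd (η y : ℝ) : |η⁻¹ * rSin (η * y)| ≤ |y| := by
  rcases eq_or_ne η 0 with rfl | h
  · simp
  rw [abs_mul, abs_inv, inv_mul_le_iff₀ (abs_pos.2 h), ← abs_mul]
  exact Real.abs_sin_le_abs

lemma sinc_int (y : ℝ) : IntegrableOn (fun η => rE (-η) * (η⁻¹ * rSin (η * y))) (Ioi 0) := by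
  refine (exp_int.mul_const |y|).mono' fP (aea fun η => ?_)
  rw [norm_mul, rno (rxp _).le]
  exact mll (sinc_bd η y) (rxp _).le

lemma sinc_val (y : ℝ) : ∫ η in Ioi zR, rE (-η) * (η⁻¹ * rSin (η * y)) = arctan y := by
  have hd : ∀ y : ℝ, HasDerivAt (fun y => ∫ η in Ioi zR, rE (-η) * (η⁻¹ * rSin (η * y))) (1 / (1 + y ^ 2)) y := by
    intro y
    have := hasDerivAt_integral_of_dominated_loc_of_deriv_le (μ := volume.restrict (Ioi zR))
      (F := fun y η => rE (-η) * (η⁻¹ * rSin (η * y))) (F' := fun y η => rE (-η) * cos (η * y))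
      (x₀ := y) (s := univ) (bound := fun η => rE (-η)) univ_mem (Eventually.of_forall fun y => (sinc_int y).1) (sinc_int y)
      (cos_int y).1.1 (aea fun η y _ => by
        rw [norm_mul, rno (rxp _).le]
        exact mul_le_of_le_one_right (rxp _).le (Real.abs_cos_le_one _)) exp_int
      ((ae_restrict_iff' measurableSet_Ioi).2 (aea fun η hη y _ => by
        have hη : η ≠ 0 := ne_of_gt hη
        have h1 : HasDerivAt (fun y => η * y) η y := by simpa using (hasDerivAt_id y).const_mul η
        exact ((h1.sin.const_mul η⁻¹).const_mul (rE (-η))).congr_deriv (by field_simp)))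
    rw [← (cos_int y).2]; exact this.2
  have hc := is_const_of_deriv_eq_zero (f := fun y => (∫ η in Ioi zR, rE (-η) * (η⁻¹ * rSin (η * y))) - arctan y)
    (fun y => ((hd y).sub (hasDerivAt_arctan y)).differentiableAt)
    (fun y => by
      have h : HasDerivAt (fun y => (∫ η in Ioi zR, rE (-η) * (η⁻¹ * rSin (η * y))) - arctan y) _ y :=
        (hd y).sub (hasDerivAt_arctan y)
      rw [h.deriv]; ring) y 0
  simp at hc; linarith

lemma nk_meas : Measurable nk := by
  unfold nk
  exact measurable_inv.mul (Measurable.sub fP (Measurable.ite measurableSet_Iic mCst mCst))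

lemma nk_int : IntegrableOn nk (Ioi 0) := by
  refine (exp_int.const_mul 4).mono' nk_meas.aestronglyMeasurable ((ae_restrict_iff' measurableSet_Ioi).2 (aea fun η hη => ?_))
  have hη : 0 < η := hη
  rw [nk, norm_mul, norm_inv, rno hη.le, inv_mul_le_iff₀ hη]
  have e0 := rxp (-η)
  split_ifs with h
  · have h1 := add_one_le_exp (-η)
    have h2 := add_one_le_exp η
    have h3 : rE (-η) * rE η = 1 := by rw [← Real.exp_add]; simp
    rw [norm_eq_abs, abs_le]
    have h4 : rE η ≤ 1 + 2 * η := by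
      have := Real.abs_exp_sub_one_sub_id_le (x := η) (by rw [abs_of_pos hη]; exact h)
      have := (abs_le.1 this).2; nlinarith
    constructor
    · nlinarith [mll h4 e0.le]
    · nlinarith [mll h2 e0.le]
  · push Not at h
    rw [sub_zero, rno pO]; nlinarith

lemma nk_sin_int (y : ℝ) : IntegrableOn (fun η => nk η * rSin (η * y)) (Ioi 0) := by
  refine nk_int.norm.mono' (nk_meas.mul fP).aestronglyMeasurable (aea fun η => ?_)
  rw [norm_mul]
  exact mul_le_of_le_one_right nN (abs_sin_le_one _)

lemma phi_eq (y : ℝ) : phi y = (∫ u in zR..1, u⁻¹ * rSin (u * y)) + ∫ η in Ioi zR, nk η * rSin (η * y) := by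
  rw [phi, ← sinc_val, ← (sin_int y).2, ← integral_add (sinc_int y) (sin_int y).1]
  have e1 : (∫ u in zR..1, u⁻¹ * rSin (u * y)) = ∫ η in Ioi zR, (if η ≤ 1 then η⁻¹ * rSin (η * y) else 0) := by
    rw [integral_of_le zero_le_one, ← Ioi_inter_Iic, ← setIntegral_indicator measurableSet_Iic]; rfl
  have i1 : IntegrableOn (fun η => if η ≤ 1 then η⁻¹ * rSin (η * y) else 0) (Ioi 0) := by
    have := ((sinc_int y).add (sin_int y).1).sub (nk_sin_int y)
    refine this.congr_fun (fun η hη => ?_) measurableSet_Ioi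
    have hη : η ≠ 0 := ne_of_gt hη
    simp only [Pi.sub_apply, Pi.add_apply, nk]
    split_ifs <;> field_simp <;> ring
  rw [e1, ← integral_add i1 (nk_sin_int y)]
  refine setIntegral_congr_fun measurableSet_Ioi fun η hη => ?_
  have hη : η ≠ 0 := ne_of_gt hη
  simp only [nk]
  split_ifs <;> field_simp <;> ring

lemma sinint_lim (y : ℝ) : Tendsto (fun n : ℕ => ∫ u in (1 / ((n:ℝ) + 1))..1, u⁻¹ * rSin (u * y)) atTop
    (𝓝 (∫ u in zR..1, u⁻¹ * rSin (u * y))) := by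
  have hi : ∀ a b : ℝ, IntervalIntegrable (fun u => u⁻¹ * rSin (u * y)) volume a b := fun a b =>
    (intervalIntegrable_const (c := |y|)).mono_fun' fP (aea fun η => sinc_bd η y)
  have h := intervalIntegral.continuous_primitive (μ := volume) hi 1
  have h2 : Continuous fun b => ∫ u in b..1, u⁻¹ * rSin (u * y) := by
    simp only [intervalIntegral.integral_symm 1]; exact h.neg
  exact (h2.tendsto 0).comp tendsto_one_div_add_atTop_nhds_zero_nat

def CL : ℝ := 203 + ∫ η in Ioi zR, |nk η|

lemma phi_OB {G : VV d → ℝ} (hR : Continuous R) (hG : Continuous G) {c : ℝ} (hRc : ∀ x, |R x| ≤ c)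
    (hGc : ∀ x, |G x| ≤ c)
    {RR GO : HL d} (hRR : RR = MM fun x => (R x : ℂ)) (hGO : GO = FM (MM fun x => (G x : ℂ)))
    (h1 : ‖RR * (GO * RR - RR * GO) - (GO * RR - RR * GO) * RR‖ ≤ 1)
    (h2 : ‖GO * (GO * RR - RR * GO) - (GO * RR - RR * GO) * GO‖ ≤ 1) :
    OB (fun x ξ => (oC (phi (R x - G ξ)))) CL := by
  have hy : ∀ x ξ, |R x - G ξ| ≤ 2 * c := fun x ξ => (abs_sub _ _).trans (by linarith [hRc x, hGc ξ])
  have a1 : OB (fun x ξ => (oC (∫ u in zR..1, u⁻¹ * rSin (u * (R x - G ξ))))) 203 := by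
    refine OB_lim (c := 2 * c) (a := fun n x ξ => (oC (∫ u in (1 / ((n:ℝ) + 1))..1, u⁻¹ * rSin (u * (R x - G ξ))))) (fun n => ?_) (fun n x ξ => ?_) fun x ξ => ?_
    · have p : zR < (n:ℝ) + 1 := by positivity
      exact sinint_OB hR hG hRc hGc hRR hGO h1 h2 pO (by rw [div_le_one p]; linarith [(n.cast_nonneg : zR ≤ n)])
    · have p : zR < (n:ℝ) + 1 := by positivity
      have q : 1 / ((n:ℝ) + 1) ≤ 1 := by rw [div_le_one p]; linarith [(n.cast_nonneg : zR ≤ n)]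
      have q2 : 0 < 1 / ((n:ℝ) + 1) := by positivity
      rw [cnr]
      refine (intervalIntegral.norm_integral_le_of_norm_le_const (C := 2 * c) fun u _ => (sinc_bd u _).trans (hy x ξ)).trans ?_
      have c0 : 0 ≤ 2 * c := (abs_nonneg _).trans (hy 0 0)
      rw [abs_of_nonneg lI]; linarith [mul_nonneg c0 q2.le]
    · exact (continuous_ofReal.tendsto _).comp (sinint_lim _)
  have hmm : Measurable fun w : ℝ × (VV d × VV d) => (oC (nk w.1 * rSin (w.1 * (R w.2.1 - G w.2.2)))) := by
    have := hR.measurable; have := hG.measurable; have := nk_meas; fun_prop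
  have hba : ∀ x ξ : VV d, (oC (∫ η in Ioi zR, nk η * rSin (η * (R x - G ξ)))) =
      ∫ η in Ioi zR, (oC (nk η * rSin (η * (R x - G ξ)))) := fun x ξ => integral_complex_ofReal.symm
  have hbd : ∀ η : ℝ, ∀ x ξ, ‖(oC (nk η * rSin (η * (R x - G ξ))))‖ ≤ |nk η| := fun η x ξ => by
    rw [cnr, norm_mul]; exact mul_le_of_le_one_right nN (abs_sin_le_one _)
  have a2 : OB (fun x ξ => (oC (∫ η in Ioi zR, nk η * rSin (η * (R x - G ξ))))) (∫ η in Ioi zR, |nk η|) := by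
    refine OB_integral hmm nk_int.norm (aea hbd) nk_int.norm (aea fun η => ?_) ⟨?_, ∫ η in Ioi zR, |nk η|, fun x ξ => ?_⟩ hba
    · have := (sin_OB hR hG η).smul (nk η : ℂ)
      rw [mul_one, cnr] at this
      refine (congrArg (fun f => OB f |nk η|) ?_).mpr this
      funext x ξ; push_cast; ring
    · simp only [hba]
      exact (hmm.comp measurable_swap).stronglyMeasurable.integral_prod_right'.measurable
    · beta_reduce
      rw [hba]
      exact norm_integral_le_of_norm_le nk_int.norm (aea fun η => hbd η x ξ)
  have := a1.add a2
  refine (congrArg (fun f => OB f CL) ?_).mpr this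
  funext x ξ
  rw [phi_eq]; push_cast; rfl

lemma smul3 {A : Type*} [NormedRing A] [NormedAlgebra ℂ A] (hb : 0 < b) {β : ℂ} (hβ : ‖β‖ = b⁻¹) (q r G : A)
    {k : ℝ} (h : ‖q * (G * r - r * G) - (G * r - r * G) * q‖ ≤ k) (hk : k ≤ b ^ 3) :
    ‖β • q * (β • G * β • r - β • r * β • G) - (β • G * β • r - β • r * β • G) * β • q‖ ≤ 1 := by
  have : β • q * (β • G * β • r - β • r * β • G) - (β • G * β • r - β • r * β • G) * β • q
      = β ^ 3 • (q * (G * r - r * G) - (G * r - r * G) * q) := by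
    simp only [smul_mul_assoc, mul_smul_comm, ← smul_sub, smul_smul]; rw [smul_sub]; congr 2 <;> ring
  have hb3 : b⁻¹ ^ 3 * b ^ 3 = 1 := by rw [← mul_pow, inv_mul_cancel₀ hb.ne', one_pow]
  rw [this, norm_smul, norm_pow, hβ, ← hb3]
  exact mll (h.trans hk) pO

lemma low_OB (hR : Continuous R) (hR1 : ∀ x, |R x| ≤ 1) {B κ κ' : ℝ} (hb : 0 < b) (hB : 0 < B)
    (hκ : 0 ≤ κ) (hκ' : 0 ≤ κ') (h1 : ∀ x a : VV d, |R (x + a) - R x| ≤ κ * ‖a‖)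
    (h2 : ∀ x a c : VV d, |(R (x + a + c) - R (x + a)) - (R (x + c) - R x)| ≤ κ' * (‖a‖ * ‖c‖))
    (c1 : κ ^ 2 * (cd d * (2 / B)) ≤ b ^ 3) (c2 : κ' * (cd d * (1 / √B)) * (cd d * (1 / √B)) ≤ b ^ 3) :
    OB (fun x ξ => (oC (phi ((R x - GG B ξ) / b)))) CL := by
  have bR : BM (fun x => (R x : ℂ)) := ⟨(continuous_ofReal.comp hR).measurable, 1, fun x => by rw [cnr]; exact hR1 x⟩
  have n1 := comm_RRG hB bR hκ (fun x a => by rw [← ofReal_sub, cnr]; exact h1 x a)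
  have n2 := comm_GGR hB bR hκ' (fun x a c => by
    rw [← ofReal_sub, ← ofReal_sub, ← ofReal_sub, cnr]; exact h2 x a c)
  obtain ⟨β, hβ', hβ⟩ : ∃ β : ℂ, β = (oC (b⁻¹)) ∧ ‖β‖ = b⁻¹ := ⟨_, rfl, by simp [abs_of_pos hb]⟩
  have e1 : β • MM (fun x => (R x : ℂ)) = MM fun x => (oC (R x / b)) := by
    rw [MM_smul bR]; congr 1; funext x; rw [hβ']; push_cast; ring
  have e2 : β • (Gop B : HL d) = FM (MM fun x => (oC (GG B x / b))) := by
    rw [Gop]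
    have : FM (β • MM fun ξ : VV d => (GG B ξ : ℂ)) = β • FM (MM fun ξ : VV d => (GG B ξ : ℂ)) := by
      ext1 f; simp [FM_apply]
    rw [← this, MM_smul (GG_BM hB)]; congr 2; funext x; rw [hβ']; push_cast; ring
  have key := phi_OB (c := 1 / b) (hR.div_const b) ((GG_cont B).div_const b)
    (fun x => by rw [abs_div, abs_of_pos hb]; exact div_le_div_of_nonneg_right (hR1 x) hb.le)
    (fun x => by rw [abs_div, abs_of_pos hb, abs_of_pos (GG_pos B x)]; exact div_le_div_of_nonneg_right (GG_le hB x) hb.le)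
    e1 e2 (smul3 hb hβ _ _ _ n1 c1) (smul3 hb hβ _ _ _ n2 c2)
  convert key using 5; ring
end N3d

section N4
variable {d : ℕ}
variable {ρ t r w q : ℝ}

def Rr (ρ t r : ℝ) : ℝ := rE (1 / ρ ^ 2) * expNegInvGlue (ρ ^ 2 * (1 - r ^ 2 / t ^ 2))
def RV (ρ t : ℝ) (x : VV d) : ℝ := Rr ρ t ‖x‖
def Dl (ρ t : ℝ) : ℝ := t * ρ / (max 1 ρ) ^ 3

lemma Dl_pos (hρ : 0 < ρ) (ht : 0 < t) : 0 < Dl ρ t := by unfold Dl; positivity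

lemma eG1 (y : ℝ) : HasDerivAt expNegInvGlue (y⁻¹ ^ 2 * expNegInvGlue y) y := by
  simpa using expNegInvGlue.hasDerivAt_polynomial_eval_inv_mul 1 y

lemma eG2 (y : ℝ) : HasDerivAt (fun y => y⁻¹ ^ 2 * expNegInvGlue y) (y⁻¹ ^ 2 * (y⁻¹ ^ 2 - 2 * y⁻¹) * expNegInvGlue y) y := by
  have := expNegInvGlue.hasDerivAt_polynomial_eval_inv_mul (Polynomial.X ^ 2) y
  simpa [one_add_one_eq_two] using this

lemma Rr_nonneg (ρ t r : ℝ) : 0 ≤ Rr ρ t r := mul_nonneg (rxp _).le (expNegInvGlue.nonneg _)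

/-- trichotomy: either `y ≤ 0` or parameters `w`, `q`. -/
lemma Rr_w (hρ : 0 < ρ) (ht : 0 < t) (hv : 0 < 1 - r ^ 2 / t ^ 2) :
    ∃ w q : ℝ, 0 ≤ w ∧ q = 1 + ρ ^ 2 * w ∧ (ρ ^ 2 * (1 - r ^ 2 / t ^ 2))⁻¹ = q / ρ ^ 2 ∧ r ^ 2 / t ^ 2 = ρ ^ 2 * w / q ∧
      Rr ρ t r = rE (-w) := by
  set v := 1 - r ^ 2 / t ^ 2 with hv'
  have hv1 : v ≤ 1 := by rw [hv']; have : 0 ≤ r ^ 2 / t ^ 2 := by positivity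
                         linarith
  have hr : r ^ 2 / t ^ 2 = 1 - v := by rw [hv']; ring
  refine ⟨(1 - v) / (ρ ^ 2 * v), 1 / v, by apply div_nonneg <;> [linarith; positivity], by field_simp; ring, by field_simp, ?_, ?_⟩
  · rw [hr]; field_simp
  · rw [Rr, ← hv', expNegInvGlue, if_neg (not_le.2 pO), ← Real.exp_add]
    congr 1; field_simp; ring

lemma Rr_zero (hρ : 0 < ρ) (hv : ¬ 0 < 1 - r ^ 2 / t ^ 2) : Rr ρ t r = 0 := by
  rw [Rr, expNegInvGlue.zero_of_nonpos, mul_zero]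
  push Not at hv
  exact mul_nonpos_of_nonneg_of_nonpos pO hv

lemma Rr_le_one (hρ : 0 < ρ) (ht : 0 < t) : Rr ρ t r ≤ 1 := by
  by_cases hv : 0 < 1 - r ^ 2 / t ^ 2
  · obtain ⟨w, q, hw, -, -, -, h⟩ := Rr_w hρ ht hv
    rw [h]; exact exp_le_one_iff.2 lI
  · rw [Rr_zero hρ hv]; exact zero_le_one

lemma Rr_cont (ρ t : ℝ) : Continuous (Rr ρ t) := by
  unfold Rr
  exact continuous_const.mul ((expNegInvGlue.contDiff (n := 0)).continuous.comp fP)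

lemma RV_cont (ρ t : ℝ) : Continuous (RV ρ t : VV d → ℝ) := (Rr_cont ρ t).comp continuous_norm

lemma Rr_iff {s : ℝ} (hρ : 0 < ρ) (ht : 0 < t) (hr : 0 ≤ r) (hs : 0 ≤ s) :
    Rr ρ t r < rE (-(s ^ 2 / ρ ^ 2)) ↔ t * (s / √(1 + s ^ 2)) < r := by
  have e : t * (s / √(1 + s ^ 2)) < r ↔ t ^ 2 * s ^ 2 < r ^ 2 * (1 + s ^ 2) := by
    rw [← mul_div_assoc, div_lt_iff₀ pO, ← pow_lt_pow_iff_left₀ (n := 2) pO pO two_ne_zero,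
      mul_pow, mul_pow, sq_sqrt pO]
  rw [e]
  by_cases hv : 0 < 1 - r ^ 2 / t ^ 2
  · obtain ⟨w, q, hw, hq, -, h1, h⟩ := Rr_w hρ ht hv
    have hq0 : 0 < q := by rw [hq]; positivity
    have h2 : r ^ 2 = t ^ 2 * (ρ ^ 2 * w / q) := by rw [← h1]; field_simp
    rw [h, Real.exp_lt_exp, neg_lt_neg_iff, div_lt_iff₀ pO, h2]
    rw [show t ^ 2 * (ρ ^ 2 * w / q) * (1 + s ^ 2) = t ^ 2 * (ρ ^ 2 * w * (1 + s ^ 2)) / q by ring, lt_div_iff₀ hq0, mul_assoc,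
      mul_lt_mul_iff_right₀ pO, hq]
    constructor <;> intro _ <;> linarith
  · rw [Rr_zero hρ hv]
    push Not at hv
    have : t ^ 2 ≤ r ^ 2 := by
      have h : 1 ≤ r ^ 2 / t ^ 2 := by linarith
      rwa [le_div_iff₀ pO, one_mul] at h
    exact ⟨fun _ => by linarith [mlr this (sq_nonneg s), pow_pos ht 2], fun _ => rxp _⟩

lemma w_poly2 (hw : 0 ≤ w) : rE (-w) * (1 + w) ^ 2 ≤ 6 := by
  have h := pow_div_factorial_le_exp (1 + w) lI 2
  rw [Real.exp_add, div_le_iff₀ pO] at h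
  rw [exp_neg, inv_mul_le_iff₀ (rxp _)]
  have e := exp_one_lt_d9
  have : ((2).factorial : ℝ) = 2 := by norm_num [Nat.factorial]
  rw [this] at h
  nlinarith [rxp w]

lemma w_poly4 (hw : 0 ≤ w) : rE (-w) * (1 + w) ^ 4 ≤ 66 := by
  have h := pow_div_factorial_le_exp (1 + w) lI 4
  rw [Real.exp_add, div_le_iff₀ pO] at h
  rw [exp_neg, inv_mul_le_iff₀ (rxp _)]
  have e := exp_one_lt_d9
  have : ((4).factorial : ℝ) = 24 := by norm_num [Nat.factorial]
  rw [this] at h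
  nlinarith [rxp w]

lemma q_le (hρ : 0 < ρ) (hw : 0 ≤ w) (hq : q = 1 + ρ ^ 2 * w) : q ≤ (max 1 ρ) ^ 2 * (1 + w) := by
  have h1 : 1 ≤ max 1 ρ := le_max_left _ _
  have h2 : ρ ≤ max 1 ρ := le_max_right _ _
  have h3 : ρ ^ 2 ≤ (max 1 ρ) ^ 2 := by gcongr
  have h4 : 1 ≤ (max 1 ρ) ^ 2 := by nlinarith
  rw [hq]; nlinarith

/-- first derivative size, in abstract form -/
def D1 (ρ t r : ℝ) : ℝ := rE (1 / ρ ^ 2) * ((ρ ^ 2 * (1 - r ^ 2 / t ^ 2))⁻¹ ^ 2 * expNegInvGlue (ρ ^ 2 * (1 - r ^ 2 / t ^ 2)))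
def D2 (ρ t r : ℝ) : ℝ := rE (1 / ρ ^ 2) * ((ρ ^ 2 * (1 - r ^ 2 / t ^ 2))⁻¹ ^ 2 * ((ρ ^ 2 * (1 - r ^ 2 / t ^ 2))⁻¹ ^ 2
  - 2 * (ρ ^ 2 * (1 - r ^ 2 / t ^ 2))⁻¹) * expNegInvGlue (ρ ^ 2 * (1 - r ^ 2 / t ^ 2)))

lemma D1_zero (hρ : 0 < ρ) (hv : ¬ 0 < 1 - r ^ 2 / t ^ 2) : D1 ρ t r = 0 ∧ D2 ρ t r = 0 := by
  push Not at hv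
  rw [D1, D2, expNegInvGlue.zero_of_nonpos (mul_nonpos_of_nonneg_of_nonpos pO hv)]; simp

lemma D_eq (h1 : (ρ ^ 2 * (1 - r ^ 2 / t ^ 2))⁻¹ = q / ρ ^ 2) (h : Rr ρ t r = rE (-w)) :
    D1 ρ t r = (q / ρ ^ 2) ^ 2 * rE (-w) ∧ D2 ρ t r = (q / ρ ^ 2) ^ 2 * ((q / ρ ^ 2) ^ 2 - 2 * (q / ρ ^ 2)) * rE (-w) := by
  rw [D1, D2, ← h, Rr, h1]; constructor <;> ring

lemma D1_bd (hρ : 0 < ρ) (ht : 0 < t) (hr : 0 ≤ r) : 2 * (ρ ^ 2 * r / t ^ 2) * |D1 ρ t r| ≤ 12 / Dl ρ t := by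
  by_cases hv : 0 < 1 - r ^ 2 / t ^ 2
  · obtain ⟨w, q, hw, hq, h1, h2, h⟩ := Rr_w hρ ht hv
    rw [(D_eq h1 h).1]
    have hq0 : 0 < q := by rw [hq]; positivity
    have hq2 := q_le hρ hw hq
    rw [abs_of_nonneg pO]
    have hm : 0 < max 1 ρ := by positivity
    have key : q ^ 2 * (r / t) ≤ ρ * (max 1 ρ) ^ 3 * (1 + w) ^ 2 := by
      refine le_of_sq_le_sq ?_ pO
      have : (q ^ 2 * (r / t)) ^ 2 = ρ ^ 2 * w * q ^ 3 := by
        rw [mul_pow, div_pow, h2]; field_simp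
      rw [this]
      calc ρ ^ 2 * w * q ^ 3 ≤ ρ ^ 2 * (1 + w) * ((max 1 ρ) ^ 2 * (1 + w)) ^ 3 := by gcongr; linarith
        _ = _ := by ring
    have : 2 * (ρ ^ 2 * r / t ^ 2) * ((q / ρ ^ 2) ^ 2 * rE (-w)) = 2 / (ρ ^ 2 * t) * (q ^ 2 * (r / t)) * rE (-w) := by
      field_simp
    rw [this, Dl]
    calc _ ≤ 2 / (ρ ^ 2 * t) * (ρ * (max 1 ρ) ^ 3 * (1 + w) ^ 2) * rE (-w) := by gcongr
      _ = 2 * (max 1 ρ) ^ 3 / (ρ * t) * (rE (-w) * (1 + w) ^ 2) := by field_simp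
      _ ≤ 2 * (max 1 ρ) ^ 3 / (ρ * t) * 6 := by gcongr; exact w_poly2 hw
      _ = _ := by field_simp; ring
  · rw [(D1_zero hρ hv).1, abs_zero, mul_zero]
    exact (div_pos nU (Dl_pos hρ ht)).le

lemma D2_bd (hρ : 0 < ρ) (ht : 0 < t) (hr : 0 ≤ r) :
    4 * (ρ ^ 4 * r ^ 2 / t ^ 4) * |D2 ρ t r| + 2 * (ρ ^ 2 / t ^ 2) * |D1 ρ t r| ≤ 924 / Dl ρ t ^ 2 := by
  by_cases hv : 0 < 1 - r ^ 2 / t ^ 2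
  · obtain ⟨w, q, hw, hq, h1, h2, h⟩ := Rr_w hρ ht hv
    rw [(D_eq h1 h).1, (D_eq h1 h).2]
    have hq0 : 0 < q := by rw [hq]; positivity
    have hq2 := q_le hρ hw hq
    have hm : 1 ≤ max 1 ρ := le_max_left _ _
    rw [abs_of_nonneg (show 0 ≤ (q / ρ ^ 2) ^ 2 * rE (-w) by positivity)]
    have a1 : |(q / ρ ^ 2) ^ 2 * ((q / ρ ^ 2) ^ 2 - 2 * (q / ρ ^ 2)) * rE (-w)| ≤
        (q / ρ ^ 2) ^ 2 * ((q / ρ ^ 2) ^ 2 + 2 * (q / ρ ^ 2)) * rE (-w) := by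
      rw [abs_mul, abs_mul, abs_of_nonneg (rxp _).le, abs_of_nonneg (sq_nonneg (q / ρ ^ 2))]
      gcongr
      rw [abs_le]; constructor <;> nlinarith [show 0 < q / ρ ^ 2 by positivity]
    have h3 : r ^ 2 = t ^ 2 * (ρ ^ 2 * w / q) := by rw [← h2]; field_simp
    calc _ ≤ 4 * (ρ ^ 4 * r ^ 2 / t ^ 4) * ((q / ρ ^ 2) ^ 2 * ((q / ρ ^ 2) ^ 2 + 2 * (q / ρ ^ 2)) * rE (-w)) +
        2 * (ρ ^ 2 / t ^ 2) * ((q / ρ ^ 2) ^ 2 * rE (-w)) := by gcongr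
      _ = rE (-w) / (ρ ^ 2 * t ^ 2) * (4 * (w * q ^ 3) + 8 * (q ^ 2 * (ρ ^ 2 * w)) + 2 * q ^ 2) := by
        rw [h3]; field_simp; ring
      _ ≤ rE (-w) / (ρ ^ 2 * t ^ 2) * (14 * ((max 1 ρ) ^ 6 * (1 + w) ^ 4)) := by
        gcongr
        have b1 : q ^ 3 ≤ ((max 1 ρ) ^ 2 * (1 + w)) ^ 3 := by gcongr
        have b2 : 1 ≤ q := by rw [hq]; linarith [mul_nonneg (sq_nonneg ρ) hw]
        have b3 : ρ ^ 2 * w ≤ q := by rw [hq]; linarith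
        have b4 : q ^ 2 * (ρ ^ 2 * w) ≤ q ^ 3 := by rw [pow_succ q 2]; gcongr
        have b5 : q ^ 2 ≤ q ^ 3 := pow_le_pow_right₀ b2 nU
        have b6 : (max 1 ρ) ^ 6 * (1 + w) ^ 4 = (1 + w) * ((max 1 ρ) ^ 2 * (1 + w)) ^ 3 := by ring
        have b7 : 0 ≤ ((max 1 ρ) ^ 2 * (1 + w)) ^ 3 := by positivity
        have b8 : w * q ^ 3 ≤ w * ((max 1 ρ) ^ 2 * (1 + w)) ^ 3 := by gcongr
        rw [b6]; linarith [mul_nonneg hw b7]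
      _ = 14 * (max 1 ρ) ^ 6 / (ρ ^ 2 * t ^ 2) * (rE (-w) * (1 + w) ^ 4) := by ring
      _ ≤ 14 * (max 1 ρ) ^ 6 / (ρ ^ 2 * t ^ 2) * 66 := by gcongr; exact w_poly4 hw
      _ = _ := by rw [Dl]; field_simp; ring
  · rw [(D1_zero hρ hv).1, (D1_zero hρ hv).2, abs_zero, mul_zero, mul_zero, add_zero]
    exact (div_pos nU (pow_pos (Dl_pos hρ ht) 2)).le

lemma hd_y (ρ t : ℝ) (x a : VV d) (s : ℝ) : HasDerivAt (fun s : ℝ => ρ ^ 2 * (1 - ‖x + s • a‖ ^ 2 / t ^ 2))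
    (ρ ^ 2 * (-(2 * ⟪x + s • a, a⟫ / t ^ 2))) s := by
  have h1 : HasDerivAt (fun s : ℝ => x + s • a) a s := by
    simpa using ((hasDerivAt_id s).smul_const a).const_add x
  exact (((h1.norm_sq.div_const (t ^ 2)).const_sub 1).const_mul (ρ ^ 2))

lemma hd_R (ρ t : ℝ) (x a : VV d) (s : ℝ) : HasDerivAt (fun s : ℝ => RV ρ t (x + s • a))
    (D1 ρ t ‖x + s • a‖ * (ρ ^ 2 * (-(2 * ⟪x + s • a, a⟫ / t ^ 2)))) s := by
  have := ((eG1 _).comp s (hd_y ρ t x a s)).const_mul (rE (1 / ρ ^ 2))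
  exact this.congr_deriv (by rw [D1]; ring)

lemma hd_R2 (ρ t : ℝ) (x a c : VV d) (s : ℝ) :
    HasDerivAt (fun s : ℝ => D1 ρ t ‖x + s • c‖ * (ρ ^ 2 * (-(2 * ⟪x + s • c, a⟫ / t ^ 2))))
    (D2 ρ t ‖x + s • c‖ * (ρ ^ 2 * (-(2 * ⟪x + s • c, c⟫ / t ^ 2))) * (ρ ^ 2 * (-(2 * ⟪x + s • c, a⟫ / t ^ 2)))
      + D1 ρ t ‖x + s • c‖ * (ρ ^ 2 * (-(2 * ⟪c, a⟫ / t ^ 2)))) s := by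
  have h0 := ((eG2 _).comp s (hd_y ρ t x c s)).const_mul (rE (1 / ρ ^ 2))
  have h1 : HasDerivAt (fun s : ℝ => x + s • c) c s := by
    simpa using ((hasDerivAt_id s).smul_const c).const_add x
  have h2 : HasDerivAt (fun s : ℝ => ⟪x + s • c, a⟫) ⟪c, a⟫ s := by
    simpa using h1.inner ℝ (hasDerivAt_const s a)
  have h3 := (((h2.const_mul 2).div_const (t ^ 2)).neg).const_mul (ρ ^ 2)
  exact (h0.mul h3).congr_deriv (by rw [D1, D2]; simp only [Function.comp, Pi.neg_apply]; ring)

lemma mvt_abs {f f' : ℝ → ℝ} {C : ℝ} (h : ∀ s, HasDerivAt f (f' s) s) (hC : ∀ s, |f' s| ≤ C) : |f 1 - f 0| ≤ C := by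
  have := Convex.norm_image_sub_le_of_norm_hasDerivWithin_le (f := f) (f' := f') (s := univ) (C := C) (x := 0) (y := 1)
    (fun s _ => (h s).hasDerivWithinAt) (fun s _ => hC s) convex_univ trivial trivial
  simpa using this

lemma RV_lip (hρ : 0 < ρ) (ht : 0 < t) (x a : VV d) : |RV ρ t (x + a) - RV ρ t x| ≤ 12 / Dl ρ t * ‖a‖ := by
  have := mvt_abs (fun s => hd_R ρ t x a s) (C := 12 / Dl ρ t * ‖a‖) fun s => by
    rw [abs_mul, abs_mul, abs_neg, abs_div, abs_mul, abs_of_pos (pow_pos hρ 2), abs_of_pos (pow_pos ht 2), abs_two]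
    calc _ ≤ |D1 ρ t ‖x + s • a‖| * (ρ ^ 2 * (2 * (‖x + s • a‖ * ‖a‖) / t ^ 2)) := by
          gcongr; exact abs_real_inner_le_norm _ _
      _ = 2 * (ρ ^ 2 * ‖x + s • a‖ / t ^ 2) * |D1 ρ t ‖x + s • a‖| * ‖a‖ := by ring
      _ ≤ _ := by gcongr; exact D1_bd hρ ht nN
  simpa using this

lemma RV_lip2 (hρ : 0 < ρ) (ht : 0 < t) (x a c : VV d) :
    |(RV ρ t (x + a + c) - RV ρ t (x + a)) - (RV ρ t (x + c) - RV ρ t x)| ≤ 924 / Dl ρ t ^ 2 * (‖a‖ * ‖c‖) := by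
  have key : ∀ y : VV d, |D1 ρ t ‖y + c‖ * (ρ ^ 2 * (-(2 * ⟪y + c, a⟫ / t ^ 2))) - D1 ρ t ‖y‖ * (ρ ^ 2 * (-(2 * ⟪y, a⟫ / t ^ 2)))|
      ≤ 924 / Dl ρ t ^ 2 * (‖a‖ * ‖c‖) := fun y => by
    have := mvt_abs (fun s => hd_R2 ρ t y a c s) (C := 924 / Dl ρ t ^ 2 * (‖a‖ * ‖c‖)) fun s => by
      refine (abs_add_le _ _).trans ?_
      simp only [abs_mul, abs_neg, abs_div, abs_of_pos (pow_pos hρ 2), abs_of_pos (pow_pos ht 2), abs_two]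
      set z := y + s • c
      calc _ ≤ |D2 ρ t ‖z‖| * (ρ ^ 2 * (2 * (‖z‖ * ‖c‖) / t ^ 2)) * (ρ ^ 2 * (2 * (‖z‖ * ‖a‖) / t ^ 2)) +
            |D1 ρ t ‖z‖| * (ρ ^ 2 * (2 * (‖c‖ * ‖a‖) / t ^ 2)) := by
            gcongr <;> exact abs_real_inner_le_norm _ _
        _ = (4 * (ρ ^ 4 * ‖z‖ ^ 2 / t ^ 4) * |D2 ρ t ‖z‖| + 2 * (ρ ^ 2 / t ^ 2) * |D1 ρ t ‖z‖|) * (‖a‖ * ‖c‖) := by ring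
        _ ≤ _ := by gcongr; exact D2_bd hρ ht nN
    simpa using this
  have h : ∀ s, HasDerivAt (fun s : ℝ => RV ρ t (x + c + s • a) - RV ρ t (x + s • a)) _ s := fun s =>
    (hd_R ρ t (x + c) a s).sub (hd_R ρ t x a s)
  have := mvt_abs h (C := 924 / Dl ρ t ^ 2 * (‖a‖ * ‖c‖)) fun s => by
    have := key (x + s • a)
    rwa [show x + s • a + c = x + c + s • a by abel] at this
  simp only [one_smul, zero_smul, add_zero] at this
  rw [show x + a + c = x + c + a by abel]
  convert this using 2

lemma hd_Rr (ρ t r : ℝ) : HasDerivAt (Rr ρ t) (-(2 * (ρ ^ 2 * r / t ^ 2) * D1 ρ t r)) r := by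
  have h1 : HasDerivAt (fun r : ℝ => ρ ^ 2 * (1 - r ^ 2 / t ^ 2)) (ρ ^ 2 * (-(2 * r / t ^ 2))) r := by
    have := ((((hasDerivAt_id r).pow 2).div_const (t ^ 2)).const_sub 1).const_mul (ρ ^ 2)
    exact this.congr_deriv (by simp)
  exact (((eG1 _).comp r h1).const_mul (rE (1 / ρ ^ 2))).congr_deriv (by rw [D1]; ring)

/-- on `E` -/
lemma Rr_E (hρ : 0 < ρ) (ht : 0 < t) (hr : 0 ≤ r) (h4 : rE (-4) ≤ Rr ρ t r) (h1' : Rr ρ t r ≤ rE (-1)) :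
    Dl ρ t / 2 ≤ r ∧ 2 * rE (-4) / Dl ρ t ≤ 2 * (ρ ^ 2 * r / t ^ 2) * D1 ρ t r ∧ r ≤ t := by
  by_cases hv : 0 < 1 - r ^ 2 / t ^ 2
  · obtain ⟨w, q, hw, hq, h1, h2, h⟩ := Rr_w hρ ht hv
    rw [h, exp_le_exp] at h4 h1'
    have w1 : 1 ≤ w := by linarith
    have w4 : w ≤ 4 := by linarith
    have hq0 : 0 < q := by rw [hq]; positivity
    have hm1 : 1 ≤ max 1 ρ := le_max_left _ _
    have hm0 : 0 < max 1 ρ := by linarith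
    have hmq : (max 1 ρ) ^ 2 ≤ q := by
      rw [hq]; rcases max_cases 1 ρ with ⟨e, _⟩ | ⟨e, _⟩ <;> rw [e] <;> linarith [mul_nonneg (sq_nonneg ρ) (sub_nonneg.2 w1), sq_nonneg ρ]
    have hqm : q ≤ 2 * (max 1 ρ) ^ 2 * w := by
      have h2 : ρ ≤ max 1 ρ := le_max_right _ _
      have h3 : ρ ^ 2 ≤ (max 1 ρ) ^ 2 := by gcongr
      have h4 : 1 ≤ (max 1 ρ) ^ 2 := by nlinarith
      rw [hq]; nlinarith
    have hr2 : (r / t) ^ 2 = ρ ^ 2 * w / q := by rw [div_pow, h2]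
    refine ⟨?_, ?_, ?_⟩
    · have : ρ / (max 1 ρ) ^ 3 / 2 ≤ r / t := by
        refine le_of_sq_le_sq ?_ pO
        rw [hr2, le_div_iff₀ hq0]
        have m4 : 1 ≤ (max 1 ρ) ^ 4 := one_le_pow₀ hm1
        calc (ρ / (max 1 ρ) ^ 3 / 2) ^ 2 * q ≤ (ρ / (max 1 ρ) ^ 3 / 2) ^ 2 * (2 * (max 1 ρ) ^ 2 * w) := by gcongr
          _ = (ρ ^ 2 * w) * (1 / (2 * (max 1 ρ) ^ 4)) := by field_simp
          _ ≤ (ρ ^ 2 * w) * 1 := by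
            gcongr; rw [div_le_one pO]; linarith
          _ = _ := by ring
      rw [le_div_iff₀ ht] at this
      rw [show Dl ρ t / 2 = ρ / (max 1 ρ) ^ 3 / 2 * t by rw [Dl]; ring]; exact this
    · rw [(D_eq h1 h).1]
      have key : ρ * (max 1 ρ) ^ 3 ≤ q ^ 2 * (r / t) := by
        refine le_of_sq_le_sq ?_ pO
        have : (q ^ 2 * (r / t)) ^ 2 = ρ ^ 2 * w * q ^ 3 := by rw [mul_pow, hr2]; field_simp
        rw [this]
        calc (ρ * (max 1 ρ) ^ 3) ^ 2 = ρ ^ 2 * 1 * ((max 1 ρ) ^ 2) ^ 3 := by ring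
          _ ≤ ρ ^ 2 * w * q ^ 3 := by gcongr
      have : 2 * (ρ ^ 2 * r / t ^ 2) * ((q / ρ ^ 2) ^ 2 * rE (-w)) = 2 / (ρ ^ 2 * t) * (q ^ 2 * (r / t)) * rE (-w) := by
        field_simp
      rw [this, Dl]
      calc _ = 2 / (ρ ^ 2 * t) * (ρ * (max 1 ρ) ^ 3) * rE (-4) := by field_simp
        _ ≤ _ := by gcongr
    · have : r ^ 2 / t ^ 2 < 1 := by linarith
      rw [div_lt_one pO] at this
      exact le_of_sq_le_sq this.le ht.le
  · rw [Rr_zero hρ hv] at h4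
    exact absurd (rxp (-4)) (not_lt.2 h4)
end N4

section N5
variable {d : ℕ}
variable {f : VV d → ℝ≥0∞}

def sg (d : ℕ) : Measure (VV d) := (volume : Measure (VV d)).toSphere.map Subtype.val
def rm (d : ℕ) : Measure ℝ := (volume.restrict (Ioi zR)).withDensity fun r => eR (r ^ (d - 1))

instance : IsFiniteMeasure (sg d) := by unfold sg; infer_instance
instance : SFinite (rm d) := by unfold rm; infer_instance

lemma sg_ae : ∀ᵐ θ ∂(sg d), ‖θ‖ = 1 := by
  rw [sg, ae_map_iff measurable_subtype_coe.aemeasurable (measurableSet_eq_fun measurable_norm mCst)]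
  exact aea fun θ => by simpa using θ.2

lemma rm_ae : ∀ᵐ r ∂(rm d), 0 < r :=
  (withDensity_absolutelyContinuous _ _).ae_le (ae_restrict_mem measurableSet_Ioi)

lemma lint_rm {f : ℝ → ℝ≥0∞} (hf : Measurable f) : ∫⁻ r, f r ∂(rm d) = ∫⁻ r in Ioi zR, eR (r ^ (d - 1)) * f r := by
  rw [rm, lintegral_withDensity_eq_lintegral_mul _ fP hf]; rfl

lemma polar_aux (hd : 1 ≤ d) (hf : Measurable f) :
    ∫⁻ x, f x = ∫⁻ r, ∫⁻ θ, f (r • θ) ∂(sg d) ∂(rm d) := by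
  have : Nontrivial (VV d) := by
    haveI : Nonempty (Fin d) := ⟨⟨0, hd⟩⟩
    infer_instance
  have h1 : ∫⁻ x, f x = ∫⁻ x : ({0}ᶜ : Set (VV d)), f x ∂(volume.comap Subtype.val) := by
    rw [lintegral_subtype_comap (measurableSet_singleton _).compl, restrict_compl_singleton]
  have h2 := (Measure.measurePreserving_homeomorphUnitSphereProd (volume : Measure (VV d))).lintegral_comp
    (f := fun p => f (p.2.1 • p.1.1)) fP
  have h3 : ∀ x : ({0}ᶜ : Set (VV d)), (homeomorphUnitSphereProd (VV d) x).2.1 • (homeomorphUnitSphereProd (VV d) x).1.1 = x.1 := fun x => by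
    have h0 : (x.1 : VV d) ≠ 0 := x.2
    simp [h0]
  simp only [h3] at h2
  have hm : Measurable fun r : ℝ => ∫⁻ θ, f (r • θ) ∂(sg d) :=
    Measurable.lintegral_prod_right' (f := fun p : ℝ × VV d => f (p.1 • p.2)) fP
  rw [h1, h2, lintegral_prod_symm _ fP, lint_rm hm, finrank_euclideanSpace_fin, Measure.volumeIoiPow,
    lintegral_withDensity_eq_lintegral_mul _ fP (by
      exact Measurable.lintegral_prod_left' (f := fun p : Metric.sphere (0:VV d) 1 × Ioi zR => f (p.2.1 • p.1.1)) fP),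
    ← lintegral_subtype_comap measurableSet_Ioi]
  refine lintegral_congr fun r => ?_
  rw [Pi.mul_apply, sg, lintegral_map fP measurable_subtype_coe]

lemma polar_mp (hd : 1 ≤ d) : MeasurePreserving (fun p : ℝ × VV d => p.1 • p.2) ((rm d).prod (sg d)) volume := by
  have hm : Measurable (fun p : ℝ × VV d => p.1 • p.2) := by fun_prop
  refine ⟨hm, Measure.ext_of_lintegral _ fun f hf => ?_⟩
  rw [lintegral_map hf hm, lintegral_prod _ fP, polar_aux hd hf]

lemma rm_I (hd : 1 ≤ d) : ∫⁻ r, (if r ≤ 1 then 1 else 0) ∂(rm d) ≠ 0 ∧ ∫⁻ r, (if r ≤ 1 then 1 else 0) ∂(rm d) ≠ ⊤ := by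
  have hm : Measurable fun r : ℝ => if r ≤ 1 then (1:ℝ≥0∞) else 0 := Measurable.ite measurableSet_Iic mCst mCst
  rw [lint_rm hm]
  have e : ∫⁻ r in Ioi zR, eR (r ^ (d - 1)) * (if r ≤ 1 then (1:ℝ≥0∞) else 0) = ∫⁻ r in Ioc zR 1, eR (r ^ (d - 1)) := by
    rw [← Ioi_inter_Iic, Set.inter_comm, ← setLIntegral_indicator measurableSet_Iic]
    refine lintegral_congr fun r => ?_
    by_cases h : r ≤ 1 <;> simp [h, indicator]
  rw [e]
  have h0 : 0 ≤ᵐ[volume.restrict (Ioc zR 1)] fun r => r ^ (d - 1) := (ae_restrict_iff' measurableSet_Ioc).2 (aea fun r hr => pow_nonneg hr.1.le _)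
  rw [← ofReal_integral_eq_lintegral_ofReal (intervalIntegral.intervalIntegrable_pow _).1 h0,
    ← integral_of_le zero_le_one, integral_pow]
  refine ⟨?_, ofReal_ne_top⟩
  simp only [ne_eq, ofReal_eq_zero, not_le]
  have : zR ^ (d - 1 + 1) = 0 := by simp
  rw [this]; simp; positivity

lemma sg_rot_aux (hd : 1 ≤ d) (hf : Measurable f) :
    ∫⁻ x : VV d, (if ‖x‖ ≤ 1 then f (‖x‖⁻¹ • x) else 0) = (∫⁻ r, (if r ≤ 1 then 1 else 0) ∂(rm d)) * ∫⁻ θ, f θ ∂(sg d) := by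
  have hm : Measurable fun x : VV d => if ‖x‖ ≤ 1 then f (‖x‖⁻¹ • x) else 0 :=
    Measurable.ite (measurableSet_le measurable_norm mCst) fP mCst
  rw [polar_aux hd hm, ← lintegral_mul_const _ (Measurable.ite measurableSet_Iic mCst mCst)]
  refine lintegral_congr_ae (rm_ae.mono fun r hr => ?_)
  beta_reduce
  rw [← lintegral_const_mul _ hf]
  refine lintegral_congr_ae (sg_ae.mono fun θ hθ => ?_)
  simp only [norm_smul, hθ, mul_one, rno hr.le, smul_smul, inv_mul_cancel₀ hr.ne', one_smul]
  split_ifs <;> simp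

lemma sg_rot (hd : 1 ≤ d) (L : VV d ≃ₗᵢ[ℝ] VV d) : (sg d).map L = sg d := by
  refine Measure.ext_of_lintegral _ fun f hf => ?_
  have hL : Measurable L := L.continuous.measurable
  rw [lintegral_map hf hL]
  have h1 := sg_rot_aux hd hf
  have h2 := sg_rot_aux hd (hf.comp hL)
  have h3 := L.measurePreserving.lintegral_comp (f := fun x : VV d => if ‖x‖ ≤ 1 then f (‖x‖⁻¹ • x) else 0)
    (Measurable.ite (measurableSet_le measurable_norm mCst) fP mCst)
  simp only [LinearIsometryEquiv.norm_map] at h3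
  simp only [Function.comp, map_smul] at h2
  rw [h2] at h3
  rw [h1] at h3
  exact (ENNReal.mul_right_inj (rm_I hd).1 (rm_I hd).2).1 h3

/-- total mass -/
def sm (d : ℕ) : ℝ := (sg d).real univ

/-- Gaussian bound on the sphere -/
lemma sg_gauss (hd : 1 ≤ d) {k : ℝ} (hk : 1 ≤ k) {e : VV d} :
    ∫ θ, rE (-(k * ‖θ - e‖ ^ 2 / 2)) ∂(sg d) ≤ 2 * (4 * rpi) ^ (d / 2 : ℝ) * k ^ (-((d - 1 : ℝ) / 2)) := by
  have k0 : 0 < k := by linarith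
  have hi : Integrable (fun x : VV d => rE (-(k / 4) * ‖x - e‖ ^ 2)) volume := by
    have := (GaussianFourier.integrable_cexp_neg_mul_sq_norm_add (V := VV d) (b := (oC (k / 4))) (by simpa using k0) 0 0).re
    have h2 : Integrable (fun x : VV d => rE (-(k / 4) * ‖x‖ ^ 2)) volume := by
      refine this.congr (aea fun x => ?_)
      simp only [zero_mul, add_zero]
      rw [show -(oC (k / 4)) * (‖x‖ : ℂ) ^ 2 = (oC (-(k / 4) * ‖x‖ ^ 2)) by push_cast; ring, ← ofReal_exp]
      exact ofReal_re _
    exact h2.comp_sub_right e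
  have hv : ∫ x : VV d, rE (-(k / 4) * ‖x - e‖ ^ 2) = (rpi / (k / 4)) ^ (d / 2 : ℝ) := by
    rw [integral_sub_right_eq_self (fun x : VV d => rE (-(k / 4) * ‖x‖ ^ 2)) e,
      GaussianFourier.integral_rexp_neg_mul_sq_norm pO]
    simp
  set J := ∫ θ, rE (-(k * ‖θ - e‖ ^ 2 / 2)) ∂(sg d) with hJ
  have hJi : Integrable (fun θ => rE (-(k * ‖θ - e‖ ^ 2 / 2))) (sg d) := by
    refine Integrable.of_bound (C := 1) fP (aea fun θ => ?_)
    rw [rno (rxp _).le]; exact exp_le_one_iff.2 (by have : 0 ≤ k * ‖θ - e‖ ^ 2 / 2 := (by positivity); linarith)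
  have J0 : 0 ≤ J := integral_nonneg fun θ => (rxp _).le
  have key : eR (k ^ (-(1/2) : ℝ) * (rE (-(1/2)) * J)) ≤ eR ((rpi / (k / 4)) ^ (d / 2 : ℝ)) := by
    rw [← hv, ofReal_integral_eq_lintegral_ofReal hi (aea fun x => (rxp _).le), polar_aux hd fP,
      lint_rm (Measurable.lintegral_prod_right' (f := fun p : ℝ × VV d => eR (rE (-(k / 4) * ‖p.1 • p.2 - e‖ ^ 2))) fP)]
    have s : Ioc oR (1 + k ^ (-(1/2) : ℝ)) ⊆ Ioi 0 := fun r hr => lt_trans zero_lt_one hr.1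
    refine le_trans ?_ (lintegral_mono_set s)
    calc _ = ∫⁻ r in Ioc oR (1 + k ^ (-(1/2) : ℝ)), eR (rE (-(1/2)) * J) := by
          rw [setLIntegral_const, Real.volume_Ioc, add_sub_cancel_left, mul_comm, ENNReal.ofReal_mul pO]
      _ ≤ _ := by
        refine setLIntegral_mono' measurableSet_Ioc fun r hr => ?_
        have r1 : 1 ≤ r ^ (d - 1) := one_le_pow₀ hr.1.le
        have : eR (rE (-(1/2)) * J) ≤ ∫⁻ θ, eR (rE (-(k / 4) * ‖r • θ - e‖ ^ 2)) ∂(sg d) := by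
          rw [hJ, ← icm, ofReal_integral_eq_lintegral_ofReal (hJi.const_mul _) (aea fun x => by positivity)]
          refine lintegral_mono_ae (sg_ae.mono fun θ hθ => ofReal_le_ofReal ?_)
          rw [← Real.exp_add, exp_le_exp]
          have a1 : ‖r • θ - e‖ ≤ (r - 1) + ‖θ - e‖ := by
            calc ‖r • θ - e‖ = ‖(r - 1) • θ + (θ - e)‖ := by rw [sub_smul, one_smul]; congr 1; abel
              _ ≤ ‖(r - 1) • θ‖ + ‖θ - e‖ := norm_add_le _ _
              _ = _ := by rw [norm_smul, hθ, mul_one, rno (by linarith [hr.1])]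
          have a2 : k * (r - 1) ^ 2 ≤ 1 := by
            have : (r - 1) ^ 2 ≤ (k ^ (-(1/2) : ℝ)) ^ 2 := pow_le_pow_left₀ (by linarith [hr.1]) (by linarith [hr.2]) 2
            rw [show (k ^ (-(1/2) : ℝ)) ^ 2 = k⁻¹ by
              rw [← rpow_natCast, ← Real.rpow_mul k0.le]; norm_num [rpow_neg_one]] at this
            calc k * (r - 1) ^ 2 ≤ k * k⁻¹ := by gcongr
              _ = 1 := mul_inv_cancel₀ k0.ne'
          have a3 : ‖r • θ - e‖ ^ 2 ≤ 2 * (r - 1) ^ 2 + 2 * ‖θ - e‖ ^ 2 := by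
            calc _ ≤ ((r - 1) + ‖θ - e‖) ^ 2 := by gcongr
              _ ≤ _ := by linarith [sq_nonneg ((r - 1) - ‖θ - e‖)]
          linarith [mll a3 k0.le]
        calc _ = 1 * eR (rE (-(1/2)) * J) := (one_mul _).symm
          _ ≤ _ := mul_le_mul' (by rw [← ENNReal.ofReal_one]; exact ofReal_le_ofReal r1) this
  rw [ENNReal.ofReal_le_ofReal_iff pO] at key
  have e1 : oR ≤ 2 * rE (-(1/2)) := by linarith [add_one_le_exp (-(1/2) : ℝ)]
  have e2 : (rpi / (k / 4)) ^ (d / 2 : ℝ) = (4 * rpi) ^ (d / 2 : ℝ) * k ^ (-(d / 2 : ℝ)) := by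
    rw [show rpi / (k / 4) = 4 * rpi * k⁻¹ by field_simp, mul_rpow pO pO, Real.inv_rpow k0.le, rpow_neg k0.le]
  rw [e2] at key
  have e3 : k ^ (-(d / 2 : ℝ)) = k ^ (-(1/2) : ℝ) * k ^ (-((d - 1 : ℝ) / 2)) := by rw [← rpow_add k0]; congr 1; ring
  rw [e3] at key
  have p : 0 < k ^ (-(1/2) : ℝ) := rpow_pos_of_pos k0 _
  have key2 : rE (-(1/2)) * J ≤ (4 * rpi) ^ (d / 2 : ℝ) * k ^ (-((d - 1 : ℝ) / 2)) := by
    refine le_of_mul_le_mul_left ?_ p; linarith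
  nlinarith
end N5

section N5b
variable {d : ℕ}
variable {e θ f u v : VV d}

def II (e f : VV d) (p q : ℂ) : ℂ := ∫ θ, cE (p * (⟪e, θ⟫ : ℝ) + q * (⟪f, θ⟫ : ℝ)) ∂(sg d)

lemma in_le (he : ‖e‖ = 1) (hθ : ‖θ‖ = 1) : ‖(oC (⟪e, θ⟫))‖ ≤ 1 := by
  rw [cnr]
  exact (abs_real_inner_le_norm _ _).trans (by rw [he, hθ, mul_one])

lemma II_exp_bd (he : ‖e‖ = 1) (hf : ‖f‖ = 1) (hθ : ‖θ‖ = 1) {p q : ℂ} {M : ℝ} (hp : ‖p‖ ≤ M) (hq : ‖q‖ ≤ M) :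
    ‖p * (⟪e, θ⟫ : ℝ) + q * (⟪f, θ⟫ : ℝ)‖ ≤ 2 * M := by
  have h1 := in_le he hθ
  have h2 := in_le hf hθ
  have M0 : 0 ≤ M := (norm_nonneg _).trans hp
  refine (norm_add_le _ _).trans ?_
  rw [norm_mul, norm_mul]
  linarith [mul_le_mul hp h1 nN M0, mul_le_mul hq h2 nN M0]

lemma II_meas (e f : VV d) (p q : ℂ) : AEStronglyMeasurable (fun θ : VV d => cE (p * (⟪e, θ⟫ : ℝ) + q * (⟪f, θ⟫ : ℝ))) (sg d) := by
  have : Continuous (fun θ : VV d => cE (p * (⟪e, θ⟫ : ℝ) + q * (⟪f, θ⟫ : ℝ))) := by fun_prop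
  exact this.aestronglyMeasurable

lemma II_int (he : ‖e‖ = 1) (hf : ‖f‖ = 1) (p q : ℂ) :
    Integrable (fun θ : VV d => cE (p * (⟪e, θ⟫ : ℝ) + q * (⟪f, θ⟫ : ℝ))) (sg d) := by
  refine Integrable.of_bound (C := rE (2 * max ‖p‖ ‖q‖)) (II_meas e f p q) (sg_ae.mono fun θ hθ => ?_)
  refine (norm_exp_le_exp_norm _).trans (exp_le_exp.2 ?_)
  exact II_exp_bd he hf hθ (le_max_left _ _) (le_max_right _ _)

lemma II_deriv (he : ‖e‖ = 1) (hf : ‖f‖ = 1) {p q p' q' : ℝ → ℂ} (hp : ∀ z, HasDerivAt p (p' z) z)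
    (hq : ∀ z, HasDerivAt q (q' z) z) (hp' : Continuous p') (hq' : Continuous q') (z : ℝ) :
    HasDerivAt (fun z => II e f (p z) (q z)) (∫ θ, cE (p z * (⟪e, θ⟫ : ℝ) + q z * (⟪f, θ⟫ : ℝ)) *
      (p' z * (⟪e, θ⟫ : ℝ) + q' z * (⟪f, θ⟫ : ℝ)) ∂(sg d)) z := by
  have cp : Continuous p := continuous_iff_continuousAt.2 fun z => (hp z).continuousAt
  have cq : Continuous q := continuous_iff_continuousAt.2 fun z => (hq z).continuousAt
  obtain ⟨M, hM⟩ := (isCompact_closedBall z 1).exists_bound_of_continuousOn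
    (f := fun z => ‖p z‖ + ‖q z‖ + ‖p' z‖ + ‖q' z‖) fP
  have hM' : ∀ y ∈ closedBall z 1, ‖p y‖ ≤ M ∧ ‖q y‖ ≤ M ∧ ‖p' y‖ ≤ M ∧ ‖q' y‖ ≤ M := fun y hy => by
    have := hM y hy
    rw [rno pO] at this
    have := norm_nonneg (p y); have := norm_nonneg (q y); have := norm_nonneg (p' y); have := norm_nonneg (q' y)
    refine ⟨?_, ?_, ?_, ?_⟩ <;> linarith
  refine (hasDerivAt_integral_of_dominated_loc_of_deriv_le (μ := sg d)
    (F := fun z θ => cE (p z * (⟪e, θ⟫ : ℝ) + q z * (⟪f, θ⟫ : ℝ)))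
    (F' := fun z θ => cE (p z * (⟪e, θ⟫ : ℝ) + q z * (⟪f, θ⟫ : ℝ)) * (p' z * (⟪e, θ⟫ : ℝ) + q' z * (⟪f, θ⟫ : ℝ)))
    (s := closedBall z 1) (bound := fun _ => rE (2 * M) * (2 * M)) (Metric.closedBall_mem_nhds z one_pos)
    (Eventually.of_forall fun z => II_meas _ _ _ _) (II_int he hf _ _) ?_ (sg_ae.mono fun θ hθ y hy => ?_) (integrable_const _)
    (aea fun θ y _ => ?_)).2
  · exact (II_meas _ _ _ _).mul (by
      have : Continuous fun θ : VV d => p' z * (⟪e, θ⟫ : ℝ) + q' z * (⟪f, θ⟫ : ℝ) := by fun_prop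
      exact this.aestronglyMeasurable)
  · obtain ⟨h1, h2, h3, h4⟩ := hM' y hy
    rw [norm_mul]
    refine mul_le_mul ((norm_exp_le_exp_norm _).trans (exp_le_exp.2 (II_exp_bd he hf hθ h1 h2)))
      (II_exp_bd he hf hθ h3 h4) nN (rxp _).le
  · exact (((hp y).mul_const _).add ((hq y).mul_const _)).cexp

lemma pair_iso (he : ‖e‖ = 1) (hf : ‖f‖ = 1) (hef : ⟪e, f⟫ = 0) (hu : ‖u‖ = 1) (hv : ‖v‖ = 1) (huv : ⟪u, v⟫ = 0) :
    ∃ L : VV d ≃ₗᵢ[ℝ] VV d, L e = u ∧ L f = v := by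
  set L1 := (ℝ ∙ (e - u))ᗮ.reflection
  have h1 : L1 e = u := Submodule.reflection_sub (by rw [he, hu])
  set L2 := (ℝ ∙ (L1 f - v))ᗮ.reflection
  have h2 : L2 (L1 f) = v := Submodule.reflection_sub (by rw [L1.norm_map, hf, hv])
  have h3 : L2 u = u := by
    refine Submodule.reflection_mem_subspace_eq_self ?_
    rw [Submodule.mem_orthogonal_singleton_iff_inner_right, inner_sub_left, real_inner_comm u v, huv, sub_zero]
    rw [← h1, L1.inner_map_map, real_inner_comm, hef]
  exact ⟨L1.trans L2, by simp [h1, h3], by simpa using h2⟩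

lemma II_rot (hd : 1 ≤ d) (he : ‖e‖ = 1) (hf : ‖f‖ = 1) (hef : ⟪e, f⟫ = 0) (hu : ‖u‖ = 1) (hv : ‖v‖ = 1)
    (huv : ⟪u, v⟫ = 0) (p q : ℂ) : II u v p q = II e f p q := by
  obtain ⟨L, rfl, rfl⟩ := pair_iso he hf hef hu hv huv
  rw [II]
  conv_lhs => rw [← sg_rot hd L]
  rw [(show MeasurableEmbedding L from L.toHomeomorph.measurableEmbedding).integral_map]
  refine ica (aea fun θ => ?_)
  show cE (p * (⟪L e, L θ⟫ : ℝ) + q * (⟪L f, L θ⟫ : ℝ)) = _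
  rw [L.inner_map_map, L.inner_map_map]

lemma II_gen (hd : 1 ≤ d) (he : ‖e‖ = 1) (hf : ‖f‖ = 1) (hef : ⟪e, f⟫ = 0) (p q : ℂ) :
    ∫ θ, cE (p * (⟪e, θ⟫ : ℝ) + q * (⟪f, θ⟫ : ℝ)) * (q * (⟪e, θ⟫ : ℝ) + (-p) * (⟪f, θ⟫ : ℝ)) ∂(sg d) = 0 := by
  have hc : ∀ z : ℝ, HasDerivAt (fun z : ℝ => (oC (cos z))) (oC (-rSin z)) z := fun z => (Real.hasDerivAt_cos z).ofReal_comp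
  have hs : ∀ z : ℝ, HasDerivAt (fun z : ℝ => (oC (rSin z))) (oC (cos z)) z := fun z => (Real.hasDerivAt_sin z).ofReal_comp
  have h := II_deriv he hf (p := fun z => p * cos z + q * rSin z) (q := fun z => (-p) * rSin z + q * cos z)
    (p' := fun z => p * (oC (-rSin z)) + q * cos z) (q' := fun z => (-p) * cos z + q * (oC (-rSin z)))
    (fun z => ((hc z).const_mul p).add ((hs z).const_mul q)) (fun z => ((hs z).const_mul (-p)).add ((hc z).const_mul q))
    fP fP 0
  have hconst : ∀ z : ℝ, II e f (p * cos z + q * rSin z) ((-p) * rSin z + q * cos z) = II e f p q := fun z => by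
    have ee : ⟪e, e⟫ = 1 := by rw [real_inner_self_eq_norm_sq, he]; norm_num
    have ff : ⟪f, f⟫ = 1 := by rw [real_inner_self_eq_norm_sq, hf]; norm_num
    have fe : ⟪f, e⟫ = 0 := by rw [real_inner_comm, hef]
    have n1 : ∀ w : VV d, ⟪w, w⟫ = 1 → ‖w‖ = 1 := fun w h => by
      rw [real_inner_self_eq_norm_sq] at h; nlinarith [norm_nonneg w]
    have cs := Real.sin_sq_add_cos_sq z
    refine Eq.trans ?_ (II_rot hd he hf hef (u := cos z • e - rSin z • f) (v := rSin z • e + cos z • f)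
      (n1 _ (by simp only [inner_sub_left, inner_sub_right, inner_smul_left, inner_smul_right, ee, ff, fe, hef, conj_trivial]; linarith))
      (n1 _ (by simp only [inner_add_left, inner_add_right, inner_smul_left, inner_smul_right, ee, ff, fe, hef, conj_trivial]; linarith))
      (by simp only [inner_sub_left, inner_add_right, inner_smul_left, inner_smul_right, ee, ff, fe, hef, conj_trivial]; ring) p q)
    refine ica (aea fun θ => ?_)
    simp only [inner_sub_left, inner_add_left, inner_smul_left, conj_trivial]
    congr 1; push_cast; ring
  simp only [hconst] at h
  have := h.unique (hasDerivAt_const _ _)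
  simpa using this

lemma II_hyp (hd : 1 ≤ d) (he : ‖e‖ = 1) (hf : ‖f‖ = 1) (hef : ⟪e, f⟫ = 0) (A B y : ℝ) :
    II e f A (iI * B) = II e f (oC (A * Real.cosh y - B * Real.sinh y)) (iI * (oC (B * Real.cosh y - A * Real.sinh y))) := by
  have hc : ∀ z : ℝ, HasDerivAt (fun z : ℝ => (oC (A * Real.cosh z - B * Real.sinh z))) (oC (A * Real.sinh z - B * Real.cosh z)) z := fun z =>
    (((hasDerivAt_cosh z).const_mul A).sub ((hasDerivAt_sinh z).const_mul B)).ofReal_comp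
  have hs : ∀ z : ℝ, HasDerivAt (fun z : ℝ => iI * (oC (B * Real.cosh z - A * Real.sinh z))) (iI * (oC (B * Real.sinh z - A * Real.cosh z))) z := fun z =>
    (((hasDerivAt_cosh z).const_mul B).sub ((hasDerivAt_sinh z).const_mul A)).ofReal_comp.const_mul _
  have ch : Continuous Real.cosh := Real.continuous_cosh
  have sh : Continuous Real.sinh := Real.continuous_sinh
  have h := II_deriv he hf hc hs fP fP
  have h0 : ∀ z, deriv (fun z : ℝ => II e f (oC (A * Real.cosh z - B * Real.sinh z)) (iI * (oC (B * Real.cosh z - A * Real.sinh z)))) z = 0 := fun z => by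
    rw [(h z).deriv]
    have := II_gen hd he hf hef (oC (A * Real.cosh z - B * Real.sinh z)) (iI * (oC (B * Real.cosh z - A * Real.sinh z)))
    have h2 := congrArg (fun w => iI * w) this
    simp only [mul_zero, ← icm] at h2
    rw [← h2]
    refine ica (aea fun θ => ?_)
    beta_reduce
    push_cast
    linear_combination (-(cE ((A * Complex.cosh z - B * Complex.sinh z) * (⟪e, θ⟫ : ℝ) + iI * (B * Complex.cosh z - A * Complex.sinh z) * (⟪f, θ⟫ : ℝ)))
      * ((B * Complex.cosh z - A * Complex.sinh z) * (⟪e, θ⟫ : ℝ))) * I_sq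
  have := is_const_of_deriv_eq_zero (fun z => (h z).differentiableAt) h0 0 y
  rw [← this]; simp

lemma II_norm (k l : ℝ) :
    ‖II e f k (iI * l)‖ ≤ ∫ θ, rE (k * ⟪e, θ⟫) ∂(sg d) := by
  refine (norm_integral_le_integral_norm _).trans (le_of_eq (ica (aea fun θ => ?_)))
  beta_reduce
  rw [norm_exp]
  congr 1; simp
end N5b

section N5c
variable {d : ℕ}
variable {P Q u v : VV d} {Z : ℂ}

def Kf (P Q : VV d) : ℂ := ∫ θ, cE ((⟪P, θ⟫ : ℝ) + iI * (⟪Q, θ⟫ : ℝ)) ∂(sg d)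

lemma Kf_norm (P Q : VV d) : ‖Kf P Q‖ ≤ ∫ θ, rE ⟪P, θ⟫ ∂(sg d) := by
  refine (norm_integral_le_integral_norm _).trans (le_of_eq (ica (aea fun θ => ?_)))
  beta_reduce
  rw [norm_exp]
  congr 1; simp

lemma int_exp_le (P : VV d) : ∫ θ, rE ⟪P, θ⟫ ∂(sg d) ≤ sm d * rE ‖P‖ := by
  have : ∫ θ, rE ⟪P, θ⟫ ∂(sg d) ≤ ∫ θ, rE ‖P‖ ∂(sg d) := by
    refine integral_mono_of_nonneg (aea fun θ => (rxp _).le) (integrable_const _) (sg_ae.mono fun θ hθ => ?_)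
    refine exp_le_exp.2 ((real_inner_le_norm _ _).trans ?_)
    rw [hθ, mul_one]
  simpa [sm, smul_eq_mul] using this

lemma int_exp_unit (hd : 1 ≤ d) {e : VV d} (he : ‖e‖ = 1) {k : ℝ} (hk : 1 ≤ k) :
    ∫ θ, rE (k * ⟪e, θ⟫) ∂(sg d) ≤ rE k * (2 * (4 * rpi) ^ ((d : ℝ) / 2) * k ^ (-(((d : ℝ) - 1) / 2))) := by
  refine le_trans (le_of_eq ?_) (mll (sg_gauss hd hk (e := e)) (rxp k).le)
  rw [← icm]
  refine ica (sg_ae.mono fun θ hθ => ?_)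
  beta_reduce
  rw [← Real.exp_add, @norm_sub_sq_real, hθ, he, real_inner_comm]
  congr 1; ring

lemma Kf_II (hP : P ≠ 0) (hQ : Q ≠ 0) : Kf P Q = II (‖P‖⁻¹ • P) (‖Q‖⁻¹ • Q) (‖P‖ : ℝ) (iI * (‖Q‖ : ℝ)) := by
  have h1 := norm_ne_zero_iff.2 hP
  have h2 := norm_ne_zero_iff.2 hQ
  refine ica (aea fun θ => ?_)
  simp only [inner_smul_left, conj_trivial]
  have h1' : (‖P‖ : ℂ) ≠ 0 := by exact_mod_cast h1
  have h2' : (‖Q‖ : ℂ) ≠ 0 := by exact_mod_cast h2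
  congr 1; push_cast; field_simp

lemma Kf_big (hd : 1 ≤ d) (hPQ : ⟪P, Q⟫ = 0) (h : ‖P‖ < ‖Q‖) : ‖Kf P Q‖ ≤ sm d := by
  by_cases hP : P = 0
  · simpa [hP, sm] using Kf_norm P Q
  have hQ : Q ≠ 0 := fun h0 => by rw [h0, norm_zero] at h; exact absurd h (norm_nonneg _).not_gt
  have A0 := norm_pos_iff.2 hP
  have B0 := norm_pos_iff.2 hQ
  have he : ‖‖P‖⁻¹ • P‖ = 1 := norm_smul_inv_norm hP
  have hf : ‖‖Q‖⁻¹ • Q‖ = 1 := norm_smul_inv_norm hQ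
  have hef : ⟪‖P‖⁻¹ • P, ‖Q‖⁻¹ • Q⟫ = 0 := by rw [inner_smul_left, inner_smul_right, hPQ]; simp
  rw [Kf_II hP hQ]
  generalize ‖P‖ = A at *
  generalize ‖Q‖ = B at *
  have hD : 0 < B ^ 2 - A ^ 2 := by nlinarith
  set D := sqrt (B ^ 2 - A ^ 2) with hDd
  have D0 : 0 < D := sqrt_pos.2 hD
  have D2 : D ^ 2 = B ^ 2 - A ^ 2 := sq_sqrt hD.le
  rw [II_hyp hd he hf hef A B (arsinh (A / D))]
  refine (II_norm _ _).trans (le_of_eq ?_)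
  have hc : Real.cosh (arsinh (A / D)) = B / D := by
    rw [cosh_arsinh, show 1 + (A / D) ^ 2 = (B / D) ^ 2 by field_simp; linarith]
    exact sqrt_sq pO
  rw [hc, sinh_arsinh, show A * (B / D) - B * (A / D) = 0 by ring]
  simp [sm]

lemma Kf_small (hd : 1 ≤ d) (hPQ : ⟪P, Q⟫ = 0) (h : ‖Q‖ ≤ ‖P‖) (hA : 5 / 2 ≤ ‖P‖) :
    ‖Kf P Q‖ ≤ rE (‖P‖ - ‖Q‖ ^ 2 / (2 * ‖P‖)) * (2 * (4 * rpi) ^ ((d : ℝ) / 2) * (2 / 5 * ‖P‖) ^ (-(((d : ℝ) - 1) / 2))) := by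
  have hP : P ≠ 0 := fun h0 => by rw [h0, norm_zero] at hA; linarith
  have A0 := norm_pos_iff.2 hP
  have he : ‖‖P‖⁻¹ • P‖ = 1 := norm_smul_inv_norm hP
  have d1 : oR ≤ d := by exact_mod_cast hd
  have key : ∀ k : ℝ, 2 / 5 * ‖P‖ ≤ k → k ≤ ‖P‖ - ‖Q‖ ^ 2 / (2 * ‖P‖) → ∫ θ, rE (k * ⟪‖P‖⁻¹ • P, θ⟫) ∂(sg d) ≤
      rE (‖P‖ - ‖Q‖ ^ 2 / (2 * ‖P‖)) * (2 * (4 * rpi) ^ ((d : ℝ) / 2) * (2 / 5 * ‖P‖) ^ (-(((d : ℝ) - 1) / 2))) := fun k h1 h2 => by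
    refine (int_exp_unit hd he lI).trans ?_
    have := rpow_le_rpow_of_nonpos pO h1 (show -(((d : ℝ) - 1) / 2) ≤ 0 by linarith)
    have := exp_le_exp.2 h2
    have k0 : 0 < k := by linarith
    gcongr
  by_cases hQ : Q = 0
  · refine (Kf_norm P Q).trans (le_trans (le_of_eq ?_) (key ‖P‖ lI (by simp [hQ])))
    refine ica (aea fun θ => ?_)
    simp only [inner_smul_left, conj_trivial]
    congr 1; field_simp
  have B0 := norm_pos_iff.2 hQ
  have hf : ‖‖Q‖⁻¹ • Q‖ = 1 := norm_smul_inv_norm hQ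
  have hef : ⟪‖P‖⁻¹ • P, ‖Q‖⁻¹ • Q⟫ = 0 := by rw [inner_smul_left, inner_smul_right, hPQ]; simp
  rw [Kf_II hP hQ, II_hyp hd he hf hef ‖P‖ ‖Q‖ (arsinh (‖Q‖ / ‖P‖))]
  refine (II_norm _ _).trans (key _ ?_ ?_)
  all_goals
    rw [cosh_arsinh, sinh_arsinh]
    generalize ‖P‖ = A at *
    generalize ‖Q‖ = B at *
    obtain ⟨s, rfl⟩ : ∃ s, B = A * s := ⟨B / A, by field_simp⟩
    rw [mul_div_cancel_left₀ _ A0.ne']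
    have s0 : 0 < s := by nlinarith
    have s1 : s ≤ 1 := by nlinarith
    have q1 : 0 ≤ s ^ 2 := sq_nonneg s
    have q2 : s ^ 2 ≤ 1 := by nlinarith
  · have := le_sqrt_of_sq_le (x := 1 + 2 / 5 * s ^ 2) (y := 1 + s ^ 2) (by nlinarith)
    nlinarith [mll this A0.le]
  · have := sqrt_le_iff.2 (⟨by nlinarith, by nlinarith⟩ : 0 ≤ 1 + s ^ 2 / 2 ∧ 1 + s ^ 2 ≤ (1 + s ^ 2 / 2) ^ 2)
    have e : A - (A * s) ^ 2 / (2 * A) = A - A * s ^ 2 / 2 := by field_simp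
    rw [e]
    linarith [mll this A0.le]

def kk (Z : ℂ) (θ φ : VV d) : ℂ := cE (-(Z * (oC (‖θ - φ‖ ^ 2 / 2))))

lemma kk_cont (Z : ℂ) : Continuous fun p : VV d × VV d => kk Z p.1 p.2 := by unfold kk; fun_prop

lemma kk_le (hZ : 0 ≤ Z.re) (θ φ : VV d) : ‖kk Z θ φ‖ ≤ 1 := by
  rw [kk, norm_exp]
  refine exp_le_one_iff.2 ?_
  have : 0 ≤ Z.re * (‖θ - φ‖ ^ 2 / 2) := by positivity
  rw [Complex.neg_re, re_mul_ofReal]; linarith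

lemma kk_Kf (hu : ‖u‖ = 1) (hv : ‖v‖ = 1) :
    ∫ θ, kk Z θ u * (cjj) (kk Z θ v) ∂(sg d) = (oC (rE (-(2 * Z.re)))) * Kf (Z.re • (u + v)) (Z.im • (u - v)) := by
  rw [Kf, ← icm]
  refine ica (sg_ae.mono fun θ hθ => ?_)
  beta_reduce
  rw [kk, kk, ← exp_conj, ← Complex.exp_add, ofReal_exp, ← Complex.exp_add, @norm_sub_sq_real, @norm_sub_sq_real, hθ, hu, hv]
  simp only [inner_smul_left, inner_add_left, inner_sub_left, conj_trivial, real_inner_comm θ u, real_inner_comm θ v, map_neg, map_mul, conj_ofReal]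
  congr 1
  rw [← Complex.re_add_im Z]
  apply Complex.ext <;> simp <;> ring

lemma kk_M (hd : 1 ≤ d) (hZ : 5 / 2 ≤ Z.re) (hu : ‖u‖ = 1) (hv : ‖v‖ = 1) :
    ‖∫ θ, kk Z θ u * (cjj) (kk Z θ v) ∂(sg d)‖ ≤
      2 * (4 * rpi) ^ ((d : ℝ) / 2) * (2 / 5 * Z.re) ^ (-(((d : ℝ) - 1) / 2)) * rE (-(‖Z‖ ^ 2 / (2 * Z.re) * ‖v - u‖ ^ 2 / 2)) + sm d * rE (-Z.re) := by
  have d1 : oR ≤ d := by exact_mod_cast hd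
  have s0 : 0 ≤ sm d := measureReal_nonneg
  rw [kk_Kf hu hv, norm_mul, cnr, rno (rxp _).le]
  set a := Z.re with ha
  have a0 : 0 < a := by linarith
  have nZ : ‖Z‖ ^ 2 = a ^ 2 + Z.im ^ 2 := by rw [← normSq_eq_norm_sq, normSq_apply]; ring
  have hP : ‖a • (u + v)‖ = a * ‖u + v‖ := by rw [norm_smul, rno a0.le]
  have hQ : ‖Z.im • (u - v)‖ ^ 2 = Z.im ^ 2 * ‖v - u‖ ^ 2 := by rw [norm_smul, mul_pow, norm_eq_abs, sq_abs, norm_sub_rev]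
  have hpar : ‖u + v‖ ^ 2 = 4 - ‖v - u‖ ^ 2 := by
    rw [@norm_add_sq_real, @norm_sub_sq_real, hu, hv, real_inner_comm]; ring
  have hPQ : ⟪a • (u + v), Z.im • (u - v)⟫ = 0 := by
    rw [inner_smul_left, inner_smul_right, inner_add_left, inner_sub_right, inner_sub_right, real_inner_self_eq_norm_sq, real_inner_self_eq_norm_sq, hu, hv, real_inner_comm]
    simp
  have hs2 : ‖u + v‖ ≤ 2 - ‖v - u‖ ^ 2 / 4 := by
    refine le_of_sq_le_sq ?_ (by linarith [sq_nonneg ‖u + v‖])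
    rw [hpar]; linarith [sq_nonneg (‖v - u‖ ^ 2)]
  have t2 : 0 ≤ sm d * rE (-a) := by positivity
  have t1 : 0 ≤ 2 * (4 * rpi) ^ ((d : ℝ) / 2) * (2 / 5 * a) ^ (-(((d : ℝ) - 1) / 2)) * rE (-(‖Z‖ ^ 2 / (2 * a) * ‖v - u‖ ^ 2 / 2)) := by positivity
  by_cases h1 : ‖a • (u + v)‖ < ‖Z.im • (u - v)‖
  · have := Kf_big hd hPQ h1
    have h3 : rE (-(2 * a)) ≤ rE (-a) := exp_le_exp.2 lI
    linarith [mul_le_mul h3 this nN (rxp _).le]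
  push Not at h1
  by_cases h2 : ‖a • (u + v)‖ < a
  · have := ((Kf_norm (a • (u + v)) (Z.im • (u - v))).trans (int_exp_le _)).trans (mll (exp_le_exp.2 h2.le) s0)
    have h4 := mll this (rxp (-(2 * a))).le
    have : rE (-(2 * a)) * (sm d * rE a) = sm d * rE (-a) := by
      rw [mul_left_comm, ← Real.exp_add]; congr 2; ring
    linarith
  push Not at h2
  have h3 := Kf_small hd hPQ h1 (hZ.trans h2)
  have h4 := mll h3 (rxp (-(2 * a))).le
  refine h4.trans (le_trans ?_ (le_add_of_nonneg_right t2))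
  rw [← mul_assoc, ← Real.exp_add, mul_comm]
  have A0 : 0 < ‖a • (u + v)‖ := by linarith
  refine mul_le_mul ?_ (exp_le_exp.2 ?_) (rxp _).le pO
  · have := rpow_le_rpow_of_nonpos pO (show 2 / 5 * a ≤ 2 / 5 * ‖a • (u + v)‖ by linarith) (show -(((d : ℝ) - 1) / 2) ≤ 0 by linarith)
    gcongr
  · have hA2 : ‖a • (u + v)‖ ≤ 2 * a - a * ‖v - u‖ ^ 2 / 4 := by rw [hP]; linarith [mll hs2 a0.le]
    have hA3 : ‖a • (u + v)‖ ≤ 2 * a := by linarith [mul_nonneg a0.le (sq_nonneg ‖v - u‖)]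
    have h5 : ‖Z.im • (u - v)‖ ^ 2 / (4 * a) ≤ ‖Z.im • (u - v)‖ ^ 2 / (2 * ‖a • (u + v)‖) :=
      div_le_div_of_nonneg_left pO pO lI
    rw [hQ] at h5 ⊢
    have h6 : ‖Z‖ ^ 2 / (2 * a) * ‖v - u‖ ^ 2 / 2 = a * ‖v - u‖ ^ 2 / 4 + Z.im ^ 2 * ‖v - u‖ ^ 2 / (4 * a) := by
      rw [nZ]; field_simp; ring
    linarith

set_option maxHeartbeats 1000000 in
lemma schur_TT {X : Type*} [MeasurableSpace X] {μ : Measure X} [IsFiniteMeasure μ] {k : X → X → ℂ} (hk : Measurable fun p : X × X => k p.1 p.2)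
    (hk1 : ∀ x y, ‖k x y‖ ≤ 1) {M : X → X → ℝ} (hM : Measurable fun p : X × X => M p.1 p.2) {D N : ℝ} (N0 : 0 ≤ N) (hMD : ∀ x y, |M x y| ≤ D)
    (hMs : ∀ x y, M x y = M y x) (hKM : ∀ᵐ u ∂μ, ∀ᵐ v ∂μ, ‖∫ θ, k θ u * (cjj) (k θ v) ∂μ‖ ≤ M u v)
    (hN : ∀ᵐ u ∂μ, ∫ v, M u v ∂μ ≤ N ^ 2) {F : X → ℂ} (hF : MemLp F 2 μ) :
    ‖∫ θ, (cjj) (F θ) * ∫ u, k θ u * F u ∂μ ∂μ‖ ≤ N * ∫ θ, ‖F θ‖ ^ 2 ∂μ := by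
  have F1 : Integrable F μ := hF.integrable nU
  have F2 : Integrable (fun θ => ‖F θ‖ ^ 2) μ := hF.integrable_norm_pow nU
  have hk2 : ∀ θ, Measurable fun u => k θ u := fun θ => hk.comp (measurable_const.prodMk measurable_id)
  have hk3 : ∀ u, Measurable fun θ => k θ u := fun θ => hk.comp (measurable_id.prodMk mCst)
  have ikF : ∀ θ, Integrable (fun u => k θ u * F u) μ := fun θ =>
    F1.bdd_mul (hk2 θ).aestronglyMeasurable (aea fun u => hk1 θ u)
  set T : X → ℂ := fun θ => ∫ u, k θ u * F u ∂μ with hT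
  have sF2 : AEStronglyMeasurable (fun p : X × X => F p.2) (μ.prod μ) := F1.1.comp_snd
  have sF1 : AEStronglyMeasurable (fun p : X × X => F p.1) (μ.prod μ) := F1.1.comp_fst
  have Tm : AEStronglyMeasurable T μ := (hk.aestronglyMeasurable.mul sF2).integral_prod_right'
  have Tb : ∀ θ, ‖T θ‖ ≤ ∫ u, ‖F u‖ ∂μ := fun θ => norm_integral_le_of_norm_le F1.norm (aea fun u => by
    rw [norm_mul]; exact mul_le_of_le_one_left nN (hk1 _ _))
  have T2 : MemLp T 2 μ := MemLp.of_bound Tm _ (aea Tb)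

  have key : ∫ θ, ‖T θ‖ ^ 2 ∂μ ≤ N ^ 2 * ∫ θ, ‖F θ‖ ^ 2 ∂μ := by
    have i3 : Integrable (fun q : X × (X × X) => (k q.1 q.2.1 * F q.2.1) * (cjj) (k q.1 q.2.2 * F q.2.2)) (μ.prod (μ.prod μ)) := by
      have hb : Integrable (fun q : X × (X × X) => (1 : ℂ) * (F q.2.1 * F q.2.2)) (μ.prod (μ.prod μ)) := (integrable_const (1:ℂ)).mul_prod (F1.mul_prod F1)
      have m1 : Measurable fun q : X × (X × X) => k q.1 q.2.1 := hk.comp (by fun_prop : Measurable fun q : X × (X × X) => (q.1, q.2.1))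
      have m2 : Measurable fun q : X × (X × X) => k q.1 q.2.2 := hk.comp (by fun_prop : Measurable fun q : X × (X × X) => (q.1, q.2.2))
      refine hb.mono ((m1.aestronglyMeasurable.mul sF1.comp_snd).mul (continuous_conj.comp_aestronglyMeasurable (m2.aestronglyMeasurable.mul sF2.comp_snd))) (aea fun q => ?_)
      simp only [norm_mul, norm_conj, one_mul]
      have := hk1 q.1 q.2.1; have := hk1 q.1 q.2.2
      exact mul_le_mul (mul_le_of_le_one_left nN (hk1 _ _)) (mul_le_of_le_one_left nN (hk1 _ _)) pO nN
    have e1 : (oC (∫ θ, ‖T θ‖ ^ 2 ∂μ)) = ∫ p : X × X, (F p.1 * (cjj) (F p.2)) * ∫ θ, k θ p.1 * (cjj) (k θ p.2) ∂μ ∂(μ.prod μ) := by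
      rw [← integral_complex_ofReal]
      have : ∀ θ, (oC (‖T θ‖ ^ 2)) = ∫ p : X × X, (k θ p.1 * F p.1) * (cjj) (k θ p.2 * F p.2) ∂(μ.prod μ) := fun θ => by
        rw [integral_prod_mul (μ := μ) (ν := μ) (fun u => k θ u * F u) (fun v => (cjj) (k θ v * F v))]
        rw [show ∫ v, (cjj) (k θ v * F v) ∂μ = (cjj) (T θ) from integral_conj (f := fun v => k θ v * F v)]
        show _ = T θ * _
        rw [mul_conj, normSq_eq_norm_sq]
      simp_rw [this]
      rw [integral_integral_swap (μ := μ) (ν := μ.prod μ) (f := fun (θ : X) (p : X × X) => (k θ p.1 * F p.1) * (cjj) (k θ p.2 * F p.2)) i3]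
      refine ica (aea fun p => ?_)
      beta_reduce
      rw [← icm]
      refine ica (aea fun θ => ?_)
      simp only [map_mul]; ring
    have iM1 : Integrable (fun p : X × X => ‖F p.1‖ ^ 2 * M p.1 p.2) (μ.prod μ) :=
      ((F2.comp_fst μ).mul_bdd hM.aestronglyMeasurable (aea fun p => hMD p.1 p.2))
    have iM2 : Integrable (fun p : X × X => ‖F p.2‖ ^ 2 * M p.1 p.2) (μ.prod μ) :=
      ((F2.comp_snd μ).mul_bdd hM.aestronglyMeasurable (aea fun p => hMD p.1 p.2))
    have v1 : ∫ p : X × X, ‖F p.1‖ ^ 2 * M p.1 p.2 ∂(μ.prod μ) ≤ N ^ 2 * ∫ θ, ‖F θ‖ ^ 2 ∂μ := by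
      rw [integral_prod _ iM1, ← icm]
      refine integral_mono_ae iM1.integral_prod_left (F2.const_mul _) (hN.mono fun u hu => ?_)
      show ∫ y, ‖F u‖ ^ 2 * M u y ∂μ ≤ N ^ 2 * ‖F u‖ ^ 2
      rw [icm, mul_comm]
      exact mlr hu pO
    have v2 : ∫ p : X × X, ‖F p.2‖ ^ 2 * M p.1 p.2 ∂(μ.prod μ) ≤ N ^ 2 * ∫ θ, ‖F θ‖ ^ 2 ∂μ := by
      rw [← integral_prod_swap]
      refine le_trans (le_of_eq (ica (aea fun p => ?_))) v1
      show ‖F p.1‖ ^ 2 * M p.2 p.1 = _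
      rw [hMs]
    have hKM' : ∀ᵐ p : X × X ∂(μ.prod μ), ‖∫ θ, k θ p.1 * (cjj) (k θ p.2) ∂μ‖ ≤ M p.1 p.2 := by
      refine (Measure.ae_prod_iff_ae_ae ?_).2 hKM
      refine measurableSet_le ?_ hM
      refine Measurable.norm ?_
      have m1 : Measurable fun q : (X × X) × X => k q.2 q.1.1 := hk.comp (by fun_prop : Measurable fun q : (X × X) × X => (q.2, q.1.1))
      have m2 : Measurable fun q : (X × X) × X => k q.2 q.1.2 := hk.comp (by fun_prop : Measurable fun q : (X × X) × X => (q.2, q.1.2))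
      exact (StronglyMeasurable.integral_prod_right (f := fun (p : X × X) (θ : X) => k θ p.1 * (cjj) (k θ p.2))
        (m1.mul (continuous_conj.measurable.comp m2)).stronglyMeasurable).measurable
    have e2 : ‖(oC (∫ θ, ‖T θ‖ ^ 2 ∂μ))‖ ≤ ∫ p : X × X, (2⁻¹ * (‖F p.1‖ ^ 2 * M p.1 p.2) + 2⁻¹ * (‖F p.2‖ ^ 2 * M p.1 p.2)) ∂(μ.prod μ) := by
      rw [e1]
      refine norm_integral_le_of_norm_le ((iM1.const_mul _).add (iM2.const_mul _)) (hKM'.mono fun p hp => ?_)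
      rw [norm_mul, norm_mul, norm_conj]
      refine (mll hp pO).trans ?_
      have := (norm_nonneg _).trans hp
      linarith [mul_nonneg this (sq_nonneg (‖F p.1‖ - ‖F p.2‖))]
    rw [cnr, integral_add (iM1.const_mul _) (iM2.const_mul _), icm, icm] at e2
    have := le_abs_self (∫ θ, ‖T θ‖ ^ 2 ∂μ)
    rw [← norm_eq_abs] at this
    linarith
  set f2 := ∫ θ, ‖F θ‖ ^ 2 ∂μ with hf2
  have f0 : 0 ≤ f2 := integral_nonneg fun θ => by positivity
  have T2' : Integrable (fun θ => ‖T θ‖ ^ 2) μ := T2.integrable_norm_pow nU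

  rcases N0.eq_or_lt with h0 | Npos
  · rw [← h0] at key ⊢
    have hz : ∫ θ, ‖T θ‖ ^ 2 ∂μ = 0 := le_antisymm (by simpa using key) (integral_nonneg fun θ => by positivity)
    have := (integral_eq_zero_iff_of_nonneg (fun θ => by positivity) T2').1 hz
    have h2 : (fun θ => (cjj) (F θ) * T θ) =ᵐ[μ] 0 := this.mono fun θ hθ => by
      have : T θ = 0 := by simpa using hθ
      simp [this]
    show ‖∫ θ, (cjj) (F θ) * T θ ∂μ‖ ≤ _
    rw [ica h2]; simp
  · have : ‖∫ θ, (cjj) (F θ) * T θ ∂μ‖ ≤ ∫ θ, (N / 2 * ‖F θ‖ ^ 2 + 1 / (2 * N) * ‖T θ‖ ^ 2) ∂μ := by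
      refine norm_integral_le_of_norm_le ((F2.const_mul _).add (T2'.const_mul _)) (aea fun θ => ?_)
      rw [norm_mul, norm_conj]
      have e : N / 2 * ‖F θ‖ ^ 2 + 1 / (2 * N) * ‖T θ‖ ^ 2 - ‖F θ‖ * ‖T θ‖ = 1 / (2 * N) * (N * ‖F θ‖ - ‖T θ‖) ^ 2 := by
        field_simp; ring
      have : 0 ≤ 1 / (2 * N) * (N * ‖F θ‖ - ‖T θ‖) ^ 2 := by positivity
      linarith
    rw [integral_add (F2.const_mul _) (T2'.const_mul _), icm, icm] at this
    have h3 : 1 / (2 * N) * ∫ θ, ‖T θ‖ ^ 2 ∂μ ≤ 1 / (2 * N) * (N ^ 2 * f2) := by gcongr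
    have h4 : 1 / (2 * N) * (N ^ 2 * f2) = N / 2 * f2 := by field_simp
    linarith
end N5c

section N5d
variable {d : ℕ}

def CS (d : ℕ) : ℝ := (2 * (4 * rpi) ^ ((d : ℝ) / 2)) ^ 2 * 5 ^ (d - 1) + (sm d) ^ 2 * ((2 * (d - 1)).factorial + (5 / 2) ^ (2 * (d - 1)))

lemma CS_nonneg (d : ℕ) : 0 ≤ CS d := by unfold CS; positivity

lemma lemS (hd : 1 ≤ d) {Z : ℂ} (hZ : 0 < Z.re) {F : VC d} (hF : MemLp F 2 (sg d)) :
    ‖∫ θ, (cjj) (F θ) * ∫ u, kk Z θ u * F u ∂(sg d) ∂(sg d)‖ ≤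
      sqrt (CS d * (1 + (‖Z‖ / Z.re ^ 2) ^ (d - 1)) / ‖Z‖ ^ (d - 1)) * ∫ θ, ‖F θ‖ ^ 2 ∂(sg d) := by
  set n := d - 1 with hn
  have dn : (d : ℝ) - 1 = n := by rw [hn, Nat.cast_sub hd]; simp
  set a := Z.re with ha
  have haZ : a ≤ ‖Z‖ := re_le_norm Z
  have z0 : 0 < ‖Z‖ := by linarith
  set Cg := 2 * (4 * rpi) ^ ((d : ℝ) / 2) with hCg
  have Cg0 : 0 ≤ Cg := by positivity
  have s0 : 0 ≤ sm d := measureReal_nonneg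
  have an : (‖Z‖ / a ^ 2) ^ n / ‖Z‖ ^ n = 1 / a ^ (2 * n) := by
    rw [div_pow, pow_mul]; field_simp
  have hCSe : CS d * (1 + (‖Z‖ / a ^ 2) ^ n) / ‖Z‖ ^ n = CS d * (1 / ‖Z‖ ^ n) + CS d * (1 / a ^ (2 * n)) := by
    rw [← an]; ring
  have p1 : 0 ≤ 1 / ‖Z‖ ^ n := by positivity
  have p2 : 0 ≤ 1 / a ^ (2 * n) := by positivity
  have c1 : Cg ^ 2 * 5 ^ n ≤ CS d := le_add_of_nonneg_right pO
  have c2 : (sm d) ^ 2 * (2 * n).factorial ≤ CS d := by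
    unfold CS; rw [mul_add]
    have : 0 ≤ Cg ^ 2 * 5 ^ n := by positivity
    have : 0 ≤ sm d ^ 2 * (5 / 2) ^ (2 * n) := by positivity
    linarith
  have c3 : (sm d) ^ 2 * (5 / 2) ^ (2 * n) ≤ CS d := by
    unfold CS; rw [mul_add]
    have : 0 ≤ Cg ^ 2 * 5 ^ n := by positivity
    have : 0 ≤ sm d ^ 2 * (2 * n).factorial := by positivity
    linarith
  have cc := CS_nonneg d
  have hsq : sqrt (CS d * (1 + (‖Z‖ / a ^ 2) ^ n) / ‖Z‖ ^ n) ^ 2 = CS d * (1 / ‖Z‖ ^ n) + CS d * (1 / a ^ (2 * n)) := by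
    rw [sq_sqrt pO, hCSe]
  have kcont := kk_cont (d := d) Z
  rcases lt_or_ge a (5 / 2) with h | h
  · refine schur_TT (M := fun _ _ => sm d) (D := sm d) kcont.measurable (kk_le hZ.le) mCst (sqrt_nonneg _)
      (fun _ _ => (abs_of_nonneg s0).le) (fun _ _ => rfl) (aea fun u => aea fun v => ?_) (aea fun u => ?_) hF
    · refine (norm_integral_le_of_norm_le (integrable_const oR) (aea fun θ => ?_)).trans (by simp [sm])
      rw [norm_mul, norm_conj]
      exact mul_le_one₀ (kk_le hZ.le _ _) nN (kk_le hZ.le _ _)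
    · rw [hsq, integral_const, smul_eq_mul]
      show sm d * sm d ≤ _
      have : 1 ≤ (5 / 2) ^ (2 * n) * (1 / a ^ (2 * n)) := by
        rw [mul_one_div, ← div_pow]
        exact one_le_pow₀ ((one_le_div hZ).2 h.le)
      linarith [mlr c3 p2, mul_nonneg cc p1, mll this (sq_nonneg (sm d))]
  · set M : VV d → VV d → ℝ := fun u v => Cg * (2 / 5 * a) ^ (-(((d : ℝ) - 1) / 2)) * rE (-(‖Z‖ ^ 2 / (2 * a) * ‖v - u‖ ^ 2 / 2)) + sm d * rE (-a) with hMd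
    have hMc : Continuous fun p : VV d × VV d => M p.1 p.2 := by rw [hMd]; fun_prop
    refine schur_TT (M := M) (D := Cg * (2 / 5 * a) ^ (-(((d : ℝ) - 1) / 2)) * 1 + sm d * 1) kcont.measurable (kk_le hZ.le) hMc.measurable (sqrt_nonneg _)
      (fun u v => ?_) (fun u v => ?_) (sg_ae.mono fun u hu => sg_ae.mono fun v hv => kk_M hd h hu hv) (aea fun u => ?_) hF
    · rw [abs_of_nonneg pO]
      refine add_le_add (mll (exp_le_one_iff.2 ?_) pO) (mll (exp_le_one_iff.2 lI) s0)
      have : 0 ≤ ‖Z‖ ^ 2 / (2 * a) * ‖v - u‖ ^ 2 / 2 := by positivity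
      linarith
    · simp only [hMd]; rw [norm_sub_rev]
    · have hk : 1 ≤ ‖Z‖ ^ 2 / (2 * a) := by rw [le_div_iff₀ pO]; nlinarith
      have hg := sg_gauss hd hk (e := u)
      have i1 : Integrable (fun v : VV d => Cg * (2 / 5 * a) ^ (-(((d : ℝ) - 1) / 2)) * rE (-(‖Z‖ ^ 2 / (2 * a) * ‖v - u‖ ^ 2 / 2))) (sg d) := by
        refine Integrable.const_mul (Integrable.of_bound (C := 1) (by
          have : Continuous fun v : VV d => rE (-(‖Z‖ ^ 2 / (2 * a) * ‖v - u‖ ^ 2 / 2)) := by fun_prop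
          exact this.aestronglyMeasurable) (aea fun v => ?_)) _
        rw [rno (rxp _).le]
        refine exp_le_one_iff.2 ?_
        have : 0 ≤ ‖Z‖ ^ 2 / (2 * a) * ‖v - u‖ ^ 2 / 2 := by positivity
        linarith
      simp only [hMd]
      rw [integral_add i1 (integrable_const _), icm, integral_const, smul_eq_mul, hsq]
      refine add_le_add ?_ ?_
      · refine (mll hg pO).trans ?_
        have e1 : (2 / 5 * a) ^ (-(((d : ℝ) - 1) / 2)) * (‖Z‖ ^ 2 / (2 * a)) ^ (-(((d : ℝ) - 1) / 2)) ≤ 5 ^ n * (1 / ‖Z‖ ^ n) := by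
          rw [← mul_rpow pO pO, show 2 / 5 * a * (‖Z‖ ^ 2 / (2 * a)) = ‖Z‖ ^ 2 / 5 by field_simp]
          refine (rpow_le_rpow_of_nonpos (x := (‖Z‖ / 5) ^ 2) pO (by linarith [sq_nonneg ‖Z‖]) (by rw [dn]; have : zR ≤ n := n.cast_nonneg; linarith)).trans (le_of_eq ?_)
          rw [dn, ← rpow_natCast (‖Z‖ / 5) 2, ← Real.rpow_mul pO, show ((2:ℕ):ℝ) * (-(n / 2)) = -(n:ℝ) by push_cast; ring, rpow_neg pO, rpow_natCast, div_pow]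
          field_simp
        calc _ = Cg ^ 2 * ((2 / 5 * a) ^ (-(((d : ℝ) - 1) / 2)) * (‖Z‖ ^ 2 / (2 * a)) ^ (-(((d : ℝ) - 1) / 2))) := by ring
          _ ≤ Cg ^ 2 * (5 ^ n * (1 / ‖Z‖ ^ n)) := mll e1 pO
          _ = Cg ^ 2 * 5 ^ n * (1 / ‖Z‖ ^ n) := by ring
          _ ≤ _ := mlr c1 p1
      · show sm d * (sm d * rE (-a)) ≤ _
        have e2 : rE (-a) ≤ (2 * n).factorial * (1 / a ^ (2 * n)) := by
          have := pow_div_factorial_le_exp a hZ.le (2 * n)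
          rw [exp_neg, mul_one_div, inv_le_comm₀ (rxp _) pO, inv_div]
          exact this
        linarith [mlr c2 p2, mll e2 (sq_nonneg (sm d))]
end N5d

section N6a
variable {d : ℕ}
variable {ζ : ℂ} {F : VC d}

def qq (ξ : VV d) : ℝ := (2 * rpi * ‖ξ‖) ^ 2
def pz (d : ℕ) (ζ : ℂ) : ℂ := ((rpi : ℂ) / (4 * rpi ^ 2 * ζ)) ^ ((d : ℂ) / 2)

lemma pz_norm (hζ : 0 < ζ.re) : ‖pz d ζ‖ ^ 2 = (1 / (4 * rpi * ‖ζ‖)) ^ d := by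
  have z0 : ζ ≠ 0 := fun h => by rw [h] at hζ; simp at hζ
  have hp := pi_pos
  rw [← norm_pow, pz, ← Complex.cpow_nat_mul, show ((2 : ℕ) : ℂ) * ((d : ℂ) / 2) = (d : ℂ) by push_cast; ring, Complex.cpow_natCast, norm_pow]
  congr 1
  have := norm_ne_zero_iff.2 z0
  simp only [norm_div, norm_mul, norm_pow, cnr, rno hp.le]
  norm_num
  field_simp

lemma gi_int (hζ : 0 < ζ.re) : Integrable fun ξ : VV d => cE (-(ζ * (qq ξ : ℝ))) := by
  have := GaussianFourier.integrable_cexp_neg_mul_sq_norm_add (V := VV d) (b := 4 * rpi ^ 2 * ζ) (by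
    have : 0 < 4 * rpi ^ 2 * ζ.re := by have := pi_pos; positivity
    rw [show (4 * (rpi:ℂ) ^ 2 * ζ) = (oC (4 * rpi ^ 2)) * ζ by push_cast; ring, re_ofReal_mul]; exact this) 0 0
  refine this.congr (aea fun ξ => ?_)
  simp only [qq]; congr 1; push_cast; ring

lemma gauss_ex (hζ : 0 < ζ.re) (v : VV d) :
    ∫ ξ, cE (-(ζ * (qq ξ : ℝ))) * ex v ξ = pz d ζ * cE (-((oC (‖v‖ ^ 2)) / (4 * ζ))) := by
  have z0 : ζ ≠ 0 := fun h => by rw [h] at hζ; simp at hζ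
  have p0 : (rpi : ℂ) ≠ 0 := by exact_mod_cast pi_pos.ne'
  have := GaussianFourier.integral_cexp_neg_mul_sq_norm_add (V := VV d) (b := 4 * rpi ^ 2 * ζ) (by
    have : 0 < 4 * rpi ^ 2 * ζ.re := by have := pi_pos; positivity
    rw [show (4 * (rpi:ℂ) ^ 2 * ζ) = (oC (4 * rpi ^ 2)) * ζ by push_cast; ring, re_ofReal_mul]; exact this) (2 * rpi * iI) v
  rw [finrank_euclideanSpace, Fintype.card_fin] at this
  rw [pz, show -((oC (‖v‖ ^ 2)) / (4 * ζ)) = (2 * rpi * iI) ^ 2 * (‖v‖ : ℂ) ^ 2 / (4 * (4 * rpi ^ 2 * ζ)) by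
    rw [mul_pow, I_sq]; push_cast; field_simp; ring, ← this]
  refine ica (aea fun ξ => ?_)
  simp only [ex, qq]
  rw [← Complex.exp_add]; congr 1; push_cast; ring

def Fr (F : VC d) (r : ℝ) (ξ : VV d) : ℂ := ∫ θ, F θ * ex (r • θ) ξ ∂(sg d)

lemma ex_conj (x ξ : VV d) : (cjj) (ex x ξ) = ex (-x) ξ := by
  rw [ex, ex, ← exp_conj, map_mul, conj_ofReal, conj_I, inner_neg_left]; congr 1; push_cast; ring

lemma Fr_le (hF : Integrable F (sg d)) (r : ℝ) (ξ : VV d) : ‖Fr F r ξ‖ ≤ ∫ θ, ‖F θ‖ ∂(sg d) :=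
  norm_integral_le_of_norm_le hF.norm (aea fun θ => by rw [norm_mul, ex_norm, mul_one])

lemma Fr_cont (hF : Integrable F (sg d)) (r : ℝ) : Continuous (Fr F r) := by
  refine continuous_of_dominated (bound := fun θ => ‖F θ‖) (fun ξ => hF.1.mul ?_) (fun ξ => aea fun θ => by rw [norm_mul, ex_norm, mul_one])
    hF.norm (aea fun θ => ?_)
  · have : Continuous fun θ : VV d => ex (r • θ) ξ := by unfold ex; fun_prop
    exact this.aestronglyMeasurable
  · have : Continuous fun ξ : VV d => ex (r • θ) ξ := by unfold ex; fun_prop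
    exact continuous_const.mul this

set_option maxHeartbeats 800000 in
lemma inner_z (hζ : 0 < ζ.re) (hF : MemLp F 2 (sg d)) (r : ℝ) :
    ∫ ξ, cE (-(ζ * (qq ξ : ℝ))) * (oC (‖Fr F r ξ‖ ^ 2)) =
      pz d ζ * ∫ θ, (cjj) (F θ) * ∫ u, kk ((oC (r ^ 2)) / (2 * ζ)) θ u * F u ∂(sg d) ∂(sg d) := by
  have F1 : Integrable F (sg d) := hF.integrable nU
  have z0 : ζ ≠ 0 := fun h => by rw [h] at hζ; simp at hζ
  set Z : ℂ := (oC (r ^ 2)) / (2 * ζ) with hZ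
  have F1c : Integrable (fun θ => (cjj) (F θ)) (sg d) := by
    refine F1.mono (continuous_conj.comp_aestronglyMeasurable F1.1) (aea fun θ => by rw [norm_conj])
  have iFF : Integrable (fun p : VV d × VV d => (cjj) (F p.1) * F p.2) ((sg d).prod (sg d)) := F1c.mul_prod F1
  have e1 : ∀ ξ, (oC (‖Fr F r ξ‖ ^ 2)) = ∫ p : VV d × VV d, ((cjj) (F p.1) * F p.2) * ex (r • (p.2 - p.1)) ξ ∂((sg d).prod (sg d)) := fun ξ => by
    have : (oC (‖Fr F r ξ‖ ^ 2)) = (cjj) (Fr F r ξ) * Fr F r ξ := by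
      rw [mul_comm, mul_conj, normSq_eq_norm_sq]
    rw [this]
    have h2 : (cjj) (Fr F r ξ) = ∫ θ, (cjj) (F θ * ex (r • θ) ξ) ∂(sg d) := integral_conj.symm
    rw [h2, Fr, ← integral_prod_mul (μ := sg d) (ν := sg d) (fun θ => (cjj) (F θ * ex (r • θ) ξ)) (fun u => F u * ex (r • u) ξ)]
    refine ica (aea fun p => ?_)
    simp only [map_mul, ex_conj]
    rw [smul_sub, sub_eq_add_neg, ex_add]; ring
  simp_rw [e1]
  have i3 : Integrable (fun q : VV d × (VV d × VV d) => cE (-(ζ * (qq q.1 : ℝ))) * (((cjj) (F q.2.1) * F q.2.2) * ex (r • (q.2.2 - q.2.1)) q.1)) (volume.prod ((sg d).prod (sg d))) := by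
    have := ((gi_int (d := d) hζ).mul_prod iFF).mul_bdd (c := 1) (g := fun q : VV d × (VV d × VV d) => ex (r • (q.2.2 - q.2.1)) q.1)
      (ex_cont.comp (by fun_prop : Continuous fun q : VV d × (VV d × VV d) => (r • (q.2.2 - q.2.1), q.1))).aestronglyMeasurable
      (aea fun q => (ex_norm _ _).le)
    refine this.congr (aea fun q => ?_)
    simp only []; ring
  simp_rw [← icm]
  rw [integral_integral_swap (μ := volume) (ν := (sg d).prod (sg d))
    (f := fun (ξ : VV d) (p : VV d × VV d) => cE (-(ζ * (qq ξ : ℝ))) * (((cjj) (F p.1) * F p.2) * ex (r • (p.2 - p.1)) ξ)) i3]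
  have e2 : ∀ p : VV d × VV d, ∫ ξ, cE (-(ζ * (qq ξ : ℝ))) * (((cjj) (F p.1) * F p.2) * ex (r • (p.2 - p.1)) ξ)
      = pz d ζ * ((cjj) (F p.1) * (kk Z p.1 p.2 * F p.2)) := fun p => by
    have h2 := congrArg (fun w => ((cjj) (F p.1) * F p.2) * w) (gauss_ex hζ (r • (p.2 - p.1)))
    simp only [← icm] at h2
    refine Eq.trans (ica (aea fun ξ => ?_)) (h2.trans ?_)
    · simp only []; ring
    · have : cE (-((oC (‖r • (p.2 - p.1)‖ ^ 2)) / (4 * ζ))) = kk Z p.1 p.2 := by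
        rw [kk, hZ, norm_smul, mul_pow, norm_eq_abs, sq_abs, norm_sub_rev]
        congr 1; push_cast; field_simp; ring
      rw [this]; ring
  simp_rw [e2]
  rw [icm]
  have i4 : Integrable (fun p : VV d × VV d => (cjj) (F p.1) * (kk Z p.1 p.2 * F p.2)) ((sg d).prod (sg d)) := by
    by_cases hp : pz d ζ = 0
    · have := pz_norm (d := d) hζ
      rw [hp, norm_zero, zero_pow two_ne_zero] at this
      have h3 : 0 < (1 / (4 * rpi * ‖ζ‖)) ^ d := by have := norm_pos_iff.2 z0; have := pi_pos; positivity
      linarith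
    · have := i3.integral_prod_right
      simp only [e2] at this
      exact (integrable_const_mul_iff (IsUnit.mk0 _ hp) _).1 this
  rw [integral_prod _ i4]
  simp only [icm]
end N6a

section N6b
variable {d : ℕ}
variable {ε ω c r : ℝ} {F : VC d}

lemma z_bound (hd : 1 ≤ d) {τ : ℝ} (hε : 0 < ε) (hω : 0 < ω) (hr : 0 < r) (hτ : 0 < τ) (h1 : ε ≤ c) (h2 : 1 / ω ≤ c)
    (h3 : c ^ 3 ≤ 4 * (r ^ 2 * ε ^ 2)) {ζ : ℂ} (hz1 : ζ.re = ε) (hz2 : ζ.im = -(τ / ω)) (hF : MemLp F 2 (sg d)) :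
    ‖∫ ξ, cE (-(ζ * (qq ξ : ℝ))) * (oC (‖Fr F r ξ‖ ^ 2))‖ ≤
      sqrt (CS d) * (1 + (8 * (1 + τ) ^ 3) ^ (d - 1)) * (sqrt ω * τ ^ (-(1/2) : ℝ)) / r ^ (d - 1) * ∫ θ, ‖F θ‖ ^ 2 ∂(sg d) := by
  have hζ : 0 < ζ.re := by rw [hz1]; exact hε
  have z0 : ζ ≠ 0 := fun h => by rw [h] at hζ; simp at hζ
  set x := ‖ζ‖ with hx
  have x0 : 0 < x := norm_pos_iff.2 z0
  have x1 : τ / ω ≤ x := by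
    have := Complex.abs_im_le_norm ζ
    rw [hz2, abs_neg, abs_of_pos pO] at this; exact this
  have x2 : x ≤ c * (1 + τ) := by
    have := Complex.norm_le_abs_re_add_abs_im ζ
    rw [hz1, hz2, abs_neg, abs_of_pos hε, abs_of_pos pO] at this
    have h4 : τ / ω = τ * (1 / ω) := by ring
    linarith [mll h2 hτ.le]
  have c0 : 0 < c := by linarith
  have x3 : x ^ 3 ≤ 4 * (r ^ 2 * ε ^ 2) * (1 + τ) ^ 3 := by
    have := pow_le_pow_left₀ x0.le x2 3
    rw [mul_pow] at this
    exact this.trans (mlr h3 pO)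
  set Z : ℂ := (oC (r ^ 2)) / (2 * ζ) with hZ
  have nZ : ‖Z‖ = r ^ 2 / (2 * x) := by
    rw [hZ, norm_div, norm_mul, cnr, rno pO]; norm_num [hx]
  have rZ : Z.re = r ^ 2 / 2 * (ε / x ^ 2) := by
    have : Z = (oC (r ^ 2 / 2)) * ζ⁻¹ := by rw [hZ]; push_cast; field_simp
    rw [this, re_ofReal_mul, Complex.inv_re, normSq_eq_norm_sq, hz1]
  have rZ0 : 0 < Z.re := by rw [rZ]; positivity
  rw [inner_z hζ hF, norm_mul]
  have hS := lemS hd rZ0 hF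
  have f0 : 0 ≤ ∫ θ, ‖F θ‖ ^ 2 ∂(sg d) := integral_nonneg fun θ => by positivity
  refine (mll hS nN).trans ?_
  rw [← mul_assoc]
  refine mlr ?_ f0
  have hp := pz_norm (d := d) hζ
  have C0 := CS_nonneg d
  set n := d - 1 with hn
  have dn : d = n + 1 := by omega
  have key : ‖pz d ζ‖ ^ 2 * (CS d * (1 + (‖Z‖ / Z.re ^ 2) ^ n) / ‖Z‖ ^ n) ≤ CS d * (1 + (8 * (1 + τ) ^ 3) ^ n) * (ω / τ) / (r ^ n) ^ 2 := by
    have k1 : ‖Z‖ / Z.re ^ 2 ≤ 8 * (1 + τ) ^ 3 := by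
      rw [nZ, rZ, show r ^ 2 / (2 * x) / (r ^ 2 / 2 * (ε / x ^ 2)) ^ 2 = 2 * x ^ 3 / (r ^ 2 * ε ^ 2) by field_simp]
      rw [div_le_iff₀ pO]; linarith
    have k2 : ‖pz d ζ‖ ^ 2 / ‖Z‖ ^ n ≤ (ω / τ) / (r ^ n) ^ 2 := by
      have p1 : oR ≤ 2 * rpi := by linarith [pi_gt_three]
      have e : ‖pz d ζ‖ ^ 2 / ‖Z‖ ^ n = 1 / x * (1 / (4 * rpi) * (1 / tPi) ^ n) / (r ^ n) ^ 2 := by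
        rw [hp, nZ, dn, pow_succ, ← hx, ← pow_mul, mul_comm n 2, pow_mul, show (1 / (4 * rpi * x)) = (1 / tPi) * (1 / (2 * x)) by field_simp; ring, mul_pow (1 / tPi), div_pow (r ^ 2), div_pow 1 (2 * x)]
        field_simp; ring
      rw [e]
      have k3 : (1 / tPi) ^ n ≤ 1 := pow_le_one₀ pO ((div_le_one pO).2 p1)
      have k4 : 1 / (4 * rpi) ≤ 1 := (div_le_one pO).2 lI
      have k5 : 1 / x ≤ ω / τ := by
        rw [div_le_div_iff₀ x0 hτ]; rw [div_le_iff₀ hω] at x1; linarith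
      have k6 : 1 / (4 * rpi) * (1 / tPi) ^ n ≤ 1 := mul_le_one₀ k4 pO k3
      refine div_le_div_of_nonneg_right ?_ pO
      calc _ ≤ 1 / x * 1 := mll k6 pO
        _ ≤ _ := by rw [mul_one]; exact k5
    have k7 : (‖Z‖ / Z.re ^ 2) ^ n ≤ (8 * (1 + τ) ^ 3) ^ n := pow_le_pow_left₀ pO k1 n
    calc _ = CS d * (1 + (‖Z‖ / Z.re ^ 2) ^ n) * (‖pz d ζ‖ ^ 2 / ‖Z‖ ^ n) := by ring
      _ ≤ CS d * (1 + (8 * (1 + τ) ^ 3) ^ n) * ((ω / τ) / (r ^ n) ^ 2) := by gcongr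
      _ = _ := by ring
  have sq : (τ ^ (-(1/2) : ℝ)) ^ 2 = 1 / τ := by
    rw [← rpow_natCast, ← Real.rpow_mul hτ.le]; norm_num
    exact rpow_neg_one τ
  refine le_of_sq_le_sq ?_ pO
  rw [mul_pow, sq_sqrt pO]
  refine key.trans ?_
  have e9 : (√(CS d) * (1 + (8 * (1 + τ) ^ 3) ^ n) * (√ω * τ ^ (-(1/2) : ℝ)) / r ^ n) ^ 2 = CS d * (1 + (8 * (1 + τ) ^ 3) ^ n) ^ 2 * (ω * (1 / τ)) / (r ^ n) ^ 2 := by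
    rw [← sq, div_pow, mul_pow (√(CS d) * _), mul_pow √(CS d), mul_pow √ω, sq_sqrt C0, sq_sqrt hω.le]
  rw [e9]
  have u1 : 1 + (8 * (1 + τ) ^ 3) ^ n ≤ (1 + (8 * (1 + τ) ^ 3) ^ n) ^ 2 := by
    have : 0 ≤ (8 * (1 + τ) ^ 3) ^ n := by positivity
    clear * - this; nlinarith
  rw [← mul_one_div ω τ]
  gcongr

def Jt (d : ℕ) (τ : ℝ) : ℝ := rE (-τ) * ((1 + (8 * (1 + τ) ^ 3) ^ (d - 1)) * τ ^ (-(1/2) : ℝ))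

lemma Jt_int (d : ℕ) : IntegrableOn (Jt d) (Ioi 0) := by
  have h := integrableOn_rpow_mul_exp_neg_mul_rpow (s := -(1/2)) (p := 1) (b := 1/2) nU nU nU
  set n := d - 1 with hn
  have hb : ∀ τ : ℝ, 0 < τ → Jt d τ ≤ (1 + 8 ^ n * ((3 * n).factorial * (2 ^ (3 * n) * rE (1/2)))) * (τ ^ (-(1/2) : ℝ) * rE (-(1/2) * τ ^ oR)) := fun τ hτ => by
    rw [Real.rpow_one, Jt, ← hn]
    have h1 := pow_div_factorial_le_exp ((1 + τ) / 2) pO (3 * n)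
    rw [div_le_iff₀ pO, div_pow, div_le_iff₀ pO] at h1
    have h2 : rE ((1 + τ) / 2) = rE (1/2) * rE (τ/2) := by rw [← Real.exp_add]; congr 1; ring
    have h3 : rE (-τ) = rE (-(1/2) * τ) * rE (-(1/2) * τ) := by rw [← Real.exp_add]; congr 1; ring
    have h4 : rE (-(1/2) * τ) * rE (τ/2) = 1 := by rw [← Real.exp_add, show -(1/2)*τ + τ/2 = 0 by ring, Real.exp_zero]
    have h5 : rE (-(1/2) * τ) ≤ 1 := exp_le_one_iff.2 lI
    rw [h2] at h1
    set E := rE (-(1/2) * τ)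
    have E0 : 0 < E := rxp _
    have h6 : E * (1 + τ) ^ (3 * n) ≤ (3 * n).factorial * (2 ^ (3 * n) * rE (1/2)) := by
      refine (mll h1 E0.le).trans (le_of_eq ?_)
      linear_combination (2 ^ (3 * n) * rE (1/2) * ((3 * n).factorial : ℝ)) * h4
    have h7 : E * (1 + (8 * (1 + τ) ^ 3) ^ n) ≤ 1 + 8 ^ n * ((3 * n).factorial * (2 ^ (3 * n) * rE (1/2))) := by
      rw [mul_pow, ← pow_mul]
      linarith [mll h6 (show zR ≤ 8 ^ n by positivity)]
    rw [h3]
    have t0 : 0 ≤ E * τ ^ (-(1/2) : ℝ) := by positivity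
    linarith [mlr h7 t0]
  refine Integrable.mono' (h.const_mul (1 + 8 ^ n * ((3 * n).factorial * (2 ^ (3 * n) * rE (1/2))))) ?_ ((ae_restrict_mem measurableSet_Ioi).mono fun τ hτ => ?_)
  · refine Measurable.aestronglyMeasurable ?_
    unfold Jt; fun_prop
  · have τ0 : zR < τ := hτ
    rw [rno (by unfold Jt; positivity)]
    exact hb τ hτ

def CW (d : ℕ) : ℝ := sqrt (CS d) * ∫ τ in Ioi zR, Jt d τ

lemma CW_nonneg (d : ℕ) : 0 ≤ CW d := mul_nonneg (sqrt_nonneg _) (setIntegral_nonneg measurableSet_Ioi fun τ hτ => by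
  have τ0 : zR < τ := hτ
  unfold Jt; positivity)

lemma lorentz (y : ℝ) : ((1 / (1 + y ^ 2) : ℝ)) = (∫ τ in Ioi zR, cE ((-1 + y * iI) * τ)).re := by
  rw [integral_exp_mul_complex_Ioi (by simp)]
  simp [Complex.div_re, normSq_apply]
  field_simp

def Wt (ε ω E0 : ℝ) (ξ : VV d) : ℝ := rE (-(ε * qq ξ)) * (1 / (1 + ((qq ξ - E0) / ω) ^ 2))

set_option maxHeartbeats 800000 in
lemma star_r (hd : 1 ≤ d) {E0 : ℝ} (hε : 0 < ε) (hω : 0 < ω) (hr : 0 < r) (h1 : ε ≤ c) (h2 : 1 / ω ≤ c)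
    (h3 : c ^ 3 ≤ 4 * (r ^ 2 * ε ^ 2)) (hF : MemLp F 2 (sg d)) :
    Integrable (fun ξ => Wt ε ω E0 ξ * ‖Fr F r ξ‖ ^ 2) ∧
    ∫ ξ, Wt ε ω E0 ξ * ‖Fr F r ξ‖ ^ 2 ≤ CW d * (sqrt ω / r ^ (d - 1)) * ∫ θ, ‖F θ‖ ^ 2 ∂(sg d) := by
  have F1 : Integrable F (sg d) := hF.integrable nU
  have fc := Fr_cont F1 r
  have qc : Continuous (qq : VV d → ℝ) := by unfold qq; fun_prop
  have gi : Integrable fun ξ : VV d => rE (-(ε * qq ξ)) := by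
    refine (gi_int (d := d) (ζ := (ε : ℂ)) (by simpa)).norm.congr (aea fun ξ => ?_)
    beta_reduce; rw [norm_exp]; congr 1; simp
  have gF : Integrable fun ξ : VV d => rE (-(ε * qq ξ)) * ‖Fr F r ξ‖ ^ 2 := by
    refine gi.mul_bdd (c := (∫ θ, ‖F θ‖ ∂(sg d)) ^ 2) fP (aea fun ξ => ?_)
    rw [rno pO]
    exact pow_le_pow_left₀ nN (Fr_le F1 r ξ) 2
  have iW : Integrable (fun ξ => Wt ε ω E0 ξ * ‖Fr F r ξ‖ ^ 2) := by
    have : Continuous fun ξ : VV d => 1 / (1 + ((qq ξ - E0) / ω) ^ 2) := by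
      refine continuous_const.div fP fun ξ => by positivity
    refine (gF.mul_bdd (c := 1) this.aestronglyMeasurable (aea fun ξ => ?_)).congr (aea fun ξ => by simp only [Wt]; ring)
    rw [rno pO, div_le_one pO]
    linarith [sq_nonneg ((qq ξ - E0) / ω)]
  refine ⟨iW, ?_⟩
  set H : VV d → ℝ → ℂ := fun ξ τ => (oC (rE (-(ε * qq ξ)) * ‖Fr F r ξ‖ ^ 2)) * cE ((-1 + ((qq ξ - E0) / ω : ℝ) * iI) * τ) with hH
  have nH : ∀ ξ τ, ‖H ξ τ‖ = rE (-(ε * qq ξ)) * ‖Fr F r ξ‖ ^ 2 * rE (-τ) := fun ξ τ => by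
    rw [hH]; simp only []
    rw [norm_mul, cnr, rno pO, norm_exp]
    congr 2
    rw [re_mul_ofReal]; simp
  have iH : Integrable (fun z : VV d × ℝ => H z.1 z.2) (volume.prod (volume.restrict (Ioi 0))) := by
    refine (gF.mul_prod (integrableOn_exp_neg_Ioi 0)).mono (Continuous.aestronglyMeasurable ?_) (aea fun z => ?_)
    · rw [hH]
      fun_prop
    · rw [nH, rno pO]
  have e0 : ∀ ξ, Wt ε ω E0 ξ * ‖Fr F r ξ‖ ^ 2 = (∫ τ in Ioi zR, H ξ τ).re := fun ξ => by
    rw [hH]; simp only []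
    rw [icm, re_ofReal_mul, ← lorentz, Wt]; ring
  have e1 : ∫ ξ, Wt ε ω E0 ξ * ‖Fr F r ξ‖ ^ 2 = (∫ ξ, ∫ τ in Ioi zR, H ξ τ).re := by
    simp_rw [e0]
    exact integral_re iH.integral_prod_left
  rw [e1, integral_integral_swap iH]
  refine (re_le_norm _).trans ?_
  set f2 := ∫ θ, ‖F θ‖ ^ 2 ∂(sg d)
  have hb : ∀ τ ∈ Ioi zR, ‖∫ ξ, H ξ τ‖ ≤ sqrt (CS d) * (sqrt ω / r ^ (d - 1)) * f2 * Jt d τ := fun τ hτ => by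
    have hz := z_bound hd hε hω hr hτ h1 h2 h3 (ζ := ⟨ε, -(τ / ω)⟩) rfl rfl hF
    have e2 : ∫ ξ, H ξ τ = cE ((-1 - (E0 / ω : ℝ) * iI) * τ) * ∫ ξ, cE (-((⟨ε, -(τ / ω)⟩ : ℂ) * (qq ξ : ℝ))) * (oC (‖Fr F r ξ‖ ^ 2)) := by
      rw [← icm]
      refine ica (aea fun ξ => ?_)
      rw [hH]; simp only []
      rw [Complex.ofReal_mul, ofReal_exp, mul_right_comm, ← mul_assoc, ← Complex.exp_add, ← Complex.exp_add]
      congr 2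
      rw [Complex.mk_eq_add_mul_I]
      push_cast; field_simp; ring
    rw [e2, norm_mul, norm_exp]
    have e3 : (((-1 - (E0 / ω : ℝ) * iI) * τ : ℂ)).re = -τ := by rw [re_mul_ofReal]; simp
    rw [e3]
    refine (mll hz (rxp _).le).trans (le_of_eq ?_)
    rw [Jt]; ring
  refine (norm_integral_le_of_norm_le ((Jt_int d).const_mul _) ((ae_restrict_mem measurableSet_Ioi).mono hb)).trans (le_of_eq ?_)
  rw [icm, CW]; ring
end N6b

section N6c
variable {d : ℕ}

lemma eL2 (h : VC d) : (∫⁻ x, ‖h x‖ₑ ^ wR) ^ (1/wR) = eLpNorm h 2 volume := by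
  rw [eLpNorm_eq_lintegral_rpow_enorm_toReal nU nU]; norm_num

lemma sharp_abs (hd : 1 ≤ d) {a : ℝ → VC d} {v : ℝ → VV d → ℝ≥0∞} {A B P c : ℝ}
    (ha : Measurable fun p : ℝ × VV d => a p.1 p.2) (hv : Measurable fun p : VV d × ℝ => v p.2 p.1)
    (hc : ∀ r ξ, ‖a r ξ‖ ≤ c)
    (hav : ∀ r ξ, ‖a r ξ‖ₑ ≤ v r ξ ^ wR) (hA0 : 0 ≤ A) (hB0 : 0 < B) (hP : 0 ≤ P) (hAB : A * B ≤ P ^ 2)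
    (hA : ∀ ξ, ∫⁻ r in Ioi zR, v r ξ ^ wR ≤ eR A)
    (hB : ∀ r, 0 < r → ∀ F : VC d, MemLp F 2 (sg d) → eR (r ^ (d - 1)) * ∫⁻ ξ, v r ξ ^ wR * ‖Fr F r ξ‖ₑ ^ wR ≤
      eR B * ∫⁻ θ, ‖F θ‖ₑ ^ wR ∂(sg d)) :
    OB (fun x ξ => a ‖x‖ ξ) P := by
  have bs : BS (fun x ξ : VV d => a ‖x‖ ξ) := ⟨ha.comp (by fun_prop : Measurable fun z : VV d × VV d => (‖z.1‖, z.2)), c, fun x ξ => hc _ _⟩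
  refine ⟨bs, fun h g hh hg => ?_⟩
  have hm := hh.m
  have gm := hg.m
  set Φ : VV d → ℝ → ℂ := fun ξ r => Fr (fun θ => h (r • θ)) r ξ with hΦ
  have Φm : Measurable fun p : VV d × ℝ => Φ p.1 p.2 := by
    have : StronglyMeasurable fun q : (VV d × ℝ) × VV d => h (q.1.2 • q.2) * ex (q.1.2 • q.2) q.1.1 := by
      refine Measurable.stronglyMeasurable (Measurable.mul (hm.comp fP) (Continuous.measurable ?_))
      unfold ex; fun_prop
    exact (this.integral_prod_right (ν := sg d)).measurable
  have s1 : ∀ ξ, ‖∫ x, a ‖x‖ ξ * ex x ξ * h x‖ₑ ≤ ∫⁻ r, v r ξ ^ wR * ‖Φ ξ r‖ₑ ∂(rm d) := fun ξ => by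
    have mp := polar_mp hd
    have i0 : Integrable (fun x => a ‖x‖ ξ * ex x ξ * h x) := by
      refine hh.i.bdd_mul (c := c) ?_ (aea fun x => ?_)
      · refine (Measurable.aestronglyMeasurable (ha.comp (by fun_prop : Measurable fun z : VV d => (‖z‖, ξ)))).mul (Continuous.aestronglyMeasurable ?_)
        unfold ex; fun_prop
      · rw [norm_mul, ex_norm, mul_one]; exact hc _ _
    have i1 : Integrable (fun p : ℝ × VV d => a ‖p.1 • p.2‖ ξ * ex (p.1 • p.2) ξ * h (p.1 • p.2)) ((rm d).prod (sg d)) := mp.integrable_comp i0.1 |>.2 i0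
    rw [← mp.map_eq, integral_map mp.measurable.aemeasurable (by rw [mp.map_eq]; exact i0.1), integral_prod _ i1]
    refine (enorm_integral_le_lintegral_enorm _).trans (lintegral_mono_ae (rm_ae.mono fun r hr => ?_))
    have e : ∫ θ, a ‖r • θ‖ ξ * ex (r • θ) ξ * h (r • θ) ∂(sg d) = a r ξ * Φ ξ r := by
      rw [hΦ]; simp only [Fr]
      rw [← icm]
      refine ica (sg_ae.mono fun θ hθ => ?_)
      simp only []
      rw [norm_smul, hθ, mul_one, rno hr.le]; ring
    simp only []
    rw [e, enorm_mul]
    exact mul_le_mul_left (hav r ξ) _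
  have s2 : ‖BF (fun x ξ => a ‖x‖ ξ) h g‖ₑ ≤ ∫⁻ ξ, ∫⁻ r, ‖g ξ‖ₑ * (v r ξ ^ wR * ‖Φ ξ r‖ₑ) ∂(rm d) := by
    rw [BF_iter' bs hh.i hg.i]
    refine (enorm_integral_le_lintegral_enorm _).trans (lintegral_mono fun ξ => ?_)
    rw [enorm_mul, lintegral_const_mul' _ _ (by simp)]
    exact mul_le_mul_right (s1 ξ) _
  set W : ℝ → ℝ≥0∞ := fun r => eR (r ^ (d - 1)) with hW
  have Wm : Measurable W := by rw [hW]; fun_prop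
  set f : VV d × ℝ → ℝ≥0∞ := fun p => v p.2 p.1 * (W p.2 ^ (1/2:ℝ))⁻¹ * ‖g p.1‖ₑ with hf
  set k : VV d × ℝ → ℝ≥0∞ := fun p => v p.2 p.1 * W p.2 ^ (1/2:ℝ) * ‖Φ p.1 p.2‖ₑ with hk
  have fm : Measurable f := (hv.mul ((Wm.comp measurable_snd).pow_const _).inv).mul (gm.comp measurable_fst).enorm
  have km : Measurable k := (hv.mul ((Wm.comp measurable_snd).pow_const _)).mul Φm.enorm
  have W0 : ∀ r : ℝ, 0 < r → W r ≠ 0 := fun r hr => by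
    rw [hW]; simp only [ne_eq, ofReal_eq_zero, not_le]; positivity
  have Wt : ∀ r : ℝ, W r ≠ ⊤ := fun r => by rw [hW]; simp
  have Wh : ∀ r, (W r ^ (1/2:ℝ)) ^ wR = W r := fun r => by rw [← ENNReal.rpow_mul]; norm_num
  have s3 : ∫⁻ ξ, ∫⁻ r, ‖g ξ‖ₑ * (v r ξ ^ wR * ‖Φ ξ r‖ₑ) ∂(rm d) = ∫⁻ p, (f * k) p ∂(volume.prod (rm d)) := by
    rw [lintegral_prod _ (fm.mul km).aemeasurable]
    refine lintegral_congr fun ξ => lintegral_congr_ae (rm_ae.mono fun r hr => ?_)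
    have c1 : W r ^ (1/2:ℝ) ≠ 0 := by simp [W0 r hr]
    have c2 : W r ^ (1/2:ℝ) ≠ ⊤ := by simp [Wt r]
    show _ = v r ξ * (W r ^ (1/2:ℝ))⁻¹ * ‖g ξ‖ₑ * (v r ξ * W r ^ (1/2:ℝ) * ‖Φ ξ r‖ₑ)
    calc _ = v r ξ ^ wR * ‖g ξ‖ₑ * ‖Φ ξ r‖ₑ * 1 := by ring
      _ = v r ξ ^ wR * ‖g ξ‖ₑ * ‖Φ ξ r‖ₑ * (W r ^ (1/2:ℝ) * (W r ^ (1/2:ℝ))⁻¹) := by rw [ENNReal.mul_inv_cancel c1 c2]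
      _ = _ := by rw [ENNReal.rpow_two]; ring
  have s4 : ∫⁻ p, f p ^ wR ∂(volume.prod (rm d)) ≤ eR A * ∫⁻ ξ, ‖g ξ‖ₑ ^ wR := by
    rw [lintegral_prod _ (fm.pow_const _).aemeasurable, ← lintegral_const_mul _ fP]
    refine lintegral_mono fun ξ => ?_
    have vm : Measurable fun r => v r ξ := hv.comp (by fun_prop : Measurable fun r : ℝ => (ξ, r))
    rw [lint_rm (f := fun y => f (ξ, y) ^ wR) ((fm.pow_const _).comp (by fun_prop : Measurable fun r : ℝ => (ξ, r)))]
    have : ∫⁻ r in Ioi zR, eR (r ^ (d - 1)) * f (ξ, r) ^ wR = (∫⁻ r in Ioi zR, v r ξ ^ wR) * ‖g ξ‖ₑ ^ wR := by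
      rw [← lintegral_mul_const' _ _ (by simp)]
      refine setLIntegral_congr_fun measurableSet_Ioi fun r hr => ?_
      simp only [hf]
      rw [mul_rpow_of_nonneg _ _ nU, mul_rpow_of_nonneg _ _ nU, ENNReal.inv_rpow, Wh]
      calc _ = v r ξ ^ wR * ‖g ξ‖ₑ ^ wR * (W r * (W r)⁻¹) := by rw [hW]; ring
        _ = _ := by rw [ENNReal.mul_inv_cancel (W0 r hr) (Wt r), mul_one]
    exact this.le.trans (mul_le_mul_left (hA ξ) _)
  have s5 : ∫⁻ p, k p ^ wR ∂(volume.prod (rm d)) ≤ eR B * ∫⁻ x, ‖h x‖ₑ ^ wR := by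
    rw [lintegral_prod_symm _ (km.pow_const _).aemeasurable, polar_aux hd fP, ← lintegral_const_mul]
    · refine lintegral_mono_ae (rm_ae.mono fun r hr => ?_)
      have e : ∫⁻ ξ, k (ξ, r) ^ wR = W r * ∫⁻ ξ, v r ξ ^ wR * ‖Φ ξ r‖ₑ ^ wR := by
        rw [← lintegral_const_mul' _ _ (Wt r)]
        refine lintegral_congr fun ξ => ?_
        simp only [hk]
        rw [mul_rpow_of_nonneg _ _ nU, mul_rpow_of_nonneg _ _ nU, Wh]; ring
      rw [e]
      have m1 : Measurable fun θ => h (r • θ) := hm.comp fP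
      by_cases hL : ∫⁻ θ, ‖h (r • θ)‖ₑ ^ wR ∂(sg d) = ⊤
      · rw [hL, ENNReal.mul_top (by simpa using hB0)]; exact le_top
      · refine hB r hr _ ⟨m1.aestronglyMeasurable, ?_⟩
        rw [eLpNorm_lt_top_iff_lintegral_rpow_enorm_lt_top nU nU]
        exact lt_top_iff_ne_top.2 (by simpa using hL)
    · exact Measurable.lintegral_prod_right' (f := fun p : ℝ × VV d => ‖h (p.1 • p.2)‖ₑ ^ wR) (((hm.comp fP).enorm).pow_const _)
  have s6 := ENNReal.lintegral_mul_le_Lp_mul_Lq (volume.prod (rm d)) HolderConjugate.two_two fm.aemeasurable km.aemeasurable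
  have s7 : ‖BF (fun x ξ => a ‖x‖ ξ) h g‖ₑ ≤ eR P * (eLpNorm h 2 volume * eLpNorm g 2 volume) := by
    rw [← s3] at s6
    refine (s2.trans s6).trans ?_
    refine (mul_le_mul' (rpow_le_rpow s4 nU) (rpow_le_rpow s5 nU)).trans ?_
    rw [mul_rpow_of_nonneg _ _ nU, mul_rpow_of_nonneg _ _ nU, eL2, eL2]
    have : eR A ^ (1/wR) * eR B ^ (1/wR) ≤ eR P := by
      rw [← mul_rpow_of_nonneg _ _ nU, ← ENNReal.ofReal_mul hA0, ENNReal.ofReal_rpow_of_nonneg pO nU, ← sqrt_eq_rpow]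
      exact ofReal_le_ofReal (sqrt_le_iff.2 ⟨hP, hAB⟩)
    calc _ = (eR A ^ (1/wR) * eR B ^ (1/wR)) * (eLpNorm h 2 volume * eLpNorm g 2 volume) := by ring
      _ ≤ _ := mul_le_mul_left this _
  have := toReal_mono (mul_ne_top (by simp) (mul_ne_top hh.l.2.ne hg.l.2.ne)) s7
  rw [toReal_mul, toReal_mul, toReal_ofReal hP, toReal_enorm] at this
  exact this
end N6c

section N6d
variable {d : ℕ}
variable {y ρ t b r : ℝ} {ξ : VV d}

def psi (y : ℝ) : ℝ := (if y < 0 then 1 else 0) - 1 / 2 + phi y / rpi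

lemma phi_odd (y : ℝ) : phi (-y) = - phi y := by
  unfold phi; rw [Real.arctan_neg]; ring

lemma phi_bd (hy : 0 ≤ y) : |phi y / rpi - 1 / 2| ≤ 1 / (1 + y ^ 2) := by
  have hp := pi_gt_three
  have p0 := pi_pos
  have h1 : arctan y < rpi / 2 := arctan_lt_pi_div_two y
  have h0 : 0 ≤ arctan y := Real.arctan_nonneg.2 hy
  have hq : 0 < 1 + y ^ 2 := by positivity
  set w := 1 / (1 + y ^ 2) with hw
  have w0 : 0 < w := by positivity
  have w1 : w * (1 + y ^ 2) = 1 := by rw [hw]; field_simp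
  have hphi : phi y = arctan y + y * w := by rw [phi, hw]; ring
  suffices h : |phi y - rpi / 2| ≤ rpi * w by
    rw [show phi y / rpi - 1 / 2 = (phi y - rpi / 2) / rpi by field_simp, abs_div, abs_of_pos p0, div_le_iff₀ p0]
    linarith
  rw [hphi, abs_le]
  have yw : y * w ≤ 1 / 2 := by nlinarith [sq_nonneg (y - 1)]
  rcases le_or_gt 1 y with h | h
  · have y0 : 0 < y := by linarith
    have e : arctan y = rpi / 2 - arctan y⁻¹ := by
      rw [Real.arctan_inv_of_pos y0]; ring
    have u0 : 0 < y⁻¹ := by positivity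
    have a1 : arctan y⁻¹ ≤ y⁻¹ := by
      have := Real.lt_tan (arctan_pos.2 u0) (arctan_lt_pi_div_two _)
      rw [tan_arctan] at this; exact this.le
    have a2 : y * w ≤ arctan y⁻¹ := by
      set α := arctan y⁻¹ with hα
      have s1 : rSin (2 * α) ≤ 2 * α := Real.sin_le (by have := arctan_pos.2 u0; linarith)
      have s2 : rSin (2 * α) = 2 * (y * w) := by
        rw [Real.sin_two_mul, hα]
        have c2 := Real.cos_sq_arctan y⁻¹
        have c0 := Real.cos_arctan_pos y⁻¹
        have t1 := tan_arctan y⁻¹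
        rw [Real.tan_eq_sin_div_cos, div_eq_iff c0.ne'] at t1
        rw [t1]
        have : 2 * (y⁻¹ * cos (arctan y⁻¹)) * cos (arctan y⁻¹) = 2 * y⁻¹ * cos (arctan y⁻¹) ^ 2 := by ring
        rw [this, c2, hw]; field_simp; ring
      linarith
    have a3 : y⁻¹ - y * w ≤ w := by
      have : y⁻¹ - y * w = y⁻¹ * w := by rw [hw]; field_simp; ring
      rw [this]
      have : y⁻¹ ≤ 1 := inv_le_one_of_one_le₀ h
      nlinarith
    constructor <;> nlinarith
  · have w2 : 1 / 2 ≤ w := by nlinarith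
    have : 0 ≤ y * w := by positivity
    constructor <;> nlinarith

lemma psi_bd (y : ℝ) : |psi y| ≤ 1 / (1 + y ^ 2) := by
  rcases lt_or_ge y 0 with h | h
  · have := phi_bd (y := -y) lI
    rw [phi_odd, neg_sq] at this
    rw [psi, if_pos h, ← abs_neg]
    convert this using 2; ring
  · rw [psi, if_neg (not_lt.2 h)]
    convert phi_bd h using 2; ring

lemma psi_meas : Measurable psi := by
  unfold psi phi
  refine ((Measurable.ite measurableSet_Iio mCst mCst).sub mCst).add ?_
  fun_prop

lemma D1_nonneg (ρ t r : ℝ) : 0 ≤ D1 ρ t r := by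
  unfold D1
  have := expNegInvGlue.nonneg (ρ ^ 2 * (1 - r ^ 2 / t ^ 2))
  positivity

def Eset (ρ t : ℝ) : Set ℝ := {r | rE (-4) ≤ Rr ρ t r ∧ Rr ρ t r < rE (-1)}
def Qset (ρ : ℝ) : Set (VV d) := {ξ | ρ ≤ 2 * rpi * ‖ξ‖ ∧ 2 * rpi * ‖ξ‖ < 2 * ρ}

lemma Eset_m (ρ t : ℝ) : MeasurableSet (Eset ρ t) :=
  (measurableSet_le mCst (Rr_cont ρ t).measurable).inter (measurableSet_lt (Rr_cont ρ t).measurable mCst)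
lemma Qset_m (ρ : ℝ) : MeasurableSet (Qset ρ : Set (VV d)) :=
  MeasurableSet.inter (s₁ := {ξ : VV d | ρ ≤ 2 * rpi * ‖ξ‖}) (s₂ := {ξ : VV d | 2 * rpi * ‖ξ‖ < 2 * ρ})
    (measurableSet_le mCst fP) (measurableSet_lt fP mCst)

lemma boundA (hρ : 0 < ρ) (ht : 0 < t) (hb : 0 < b) (y : ℝ) :
    ∫⁻ r in Ioi zR, (Eset ρ t).indicator (fun r => eR (1 / (1 + ((Rr ρ t r - y) / b) ^ 2))) r ≤
      eR (2 * rE 4 * (b * Dl ρ t)) := by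
  have Δ0 := Dl_pos hρ ht
  set K := rE 4 / 2 * Dl ρ t with hK
  set J : ℝ → ℝ := fun r => -(K * b * arctan ((Rr ρ t r - y) / b)) with hJ
  set J' : ℝ → ℝ := fun r => K * (2 * (ρ ^ 2 * r / t ^ 2) * D1 ρ t r) * (1 / (1 + ((Rr ρ t r - y) / b) ^ 2)) with hJ'
  have hd : ∀ r, HasDerivAt J (J' r) r := fun r => by
    have h1 : HasDerivAt (fun r => (Rr ρ t r - y) / b) (-(2 * (ρ ^ 2 * r / t ^ 2) * D1 ρ t r) / b) r := ((hd_Rr ρ t r).sub_const y).div_const b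
    have h2 : HasDerivAt J _ r := ((h1.arctan).const_mul (K * b)).neg
    exact h2.congr_deriv (by rw [hJ']; simp only []; field_simp)
  have J0 : ∀ r, 0 ≤ r → 0 ≤ J' r := fun r hr => by
    have := D1_nonneg ρ t r
    rw [hJ']; positivity
  have ci : IntervalIntegrable J' volume 0 t := by
    rw [intervalIntegrable_iff_integrableOn_Ioc_of_le ht.le]
    exact intervalIntegral.integrableOn_deriv_of_nonneg (fun r _ => (hd r).continuousAt.continuousWithinAt) (fun r _ => hd r) fun r hr => J0 r hr.1.le
  have e1 := integral_eq_sub_of_hasDerivAt (fun r _ => hd r) ci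
  have e2 : ∫⁻ r in Ioc zR t, eR (J' r) ≤ eR (2 * rE 4 * (b * Dl ρ t)) := by
    rw [← ofReal_integral_eq_lintegral_ofReal ((intervalIntegrable_iff_integrableOn_Ioc_of_le ht.le).1 ci) ((ae_restrict_mem measurableSet_Ioc).mono fun r hr => J0 r hr.1.le),
      ← integral_of_le ht.le, e1]
    refine ofReal_le_ofReal ?_
    have a1 := arctan_lt_pi_div_two ((Rr ρ t 0 - y) / b)
    have a2 := Real.neg_pi_div_two_lt_arctan ((Rr ρ t t - y) / b)
    have a3 := Real.pi_le_four
    rw [hJ]; simp only []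
    have Kb : 0 < K * b := by positivity
    have : -(K * b * arctan ((Rr ρ t t - y) / b)) - -(K * b * arctan ((Rr ρ t 0 - y) / b)) ≤ K * b * 4 := by nlinarith
    refine this.trans (le_of_eq ?_)
    rw [hK]; ring
  refine le_trans ?_ e2
  have hsub : Ioc zR t ⊆ Ioi 0 := fun r hr => hr.1
  rw [← Set.inter_eq_self_of_subset_left hsub, ← setLIntegral_indicator measurableSet_Ioc]
  refine setLIntegral_mono' measurableSet_Ioi fun r hr => ?_
  have r0 : zR < r := hr
  by_cases hE : r ∈ Eset ρ t
  · obtain ⟨-, h2, h3⟩ := Rr_E hρ ht r0.le hE.1 hE.2.le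
    rw [indicator_of_mem hE, indicator_of_mem (show r ∈ Ioc 0 t from ⟨r0, h3⟩)]
    refine ofReal_le_ofReal ?_
    rw [hJ']; simp only []
    refine le_mul_of_one_le_left pO ?_
    have : K * (2 * rE (-4) / Dl ρ t) = 1 := by
      rw [hK, exp_neg]; field_simp
    rw [← this]
    exact mll h2 pO
  · rw [indicator_of_notMem hE]; exact zero_le

lemma exp_gap {x : ℝ} (hx : -4 ≤ x) (hy : -4 ≤ y) : rE (-4) * |x - y| ≤ |rE x - rE y| := by
  have key : ∀ {x y : ℝ}, -4 ≤ y → y ≤ x → rE (-4) * |x - y| ≤ |rE x - rE y| := fun {x y} hy hxy => by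
    have h1 := add_one_le_exp (x - y)
    have h2 : rE x = rE y * rE (x - y) := by rw [← Real.exp_add]; congr 1; ring
    have h3 : rE (-4) ≤ rE y := exp_le_exp.2 hy
    have h4 := rxp y
    rw [abs_of_nonneg (a := x - y) lI, abs_of_nonneg (by linarith [exp_le_exp.2 hxy]), h2]
    nlinarith
  rcases le_total y x with h | h
  · exact key hy h
  · rw [abs_sub_comm x y, abs_sub_comm (rE x)]; exact key hx h

lemma GG_qq (hρ : 0 < ρ) (ξ : VV d) : GG (ρ ^ 2 / 4) ξ = rE (-(qq ξ / ρ ^ 2)) := by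
  rw [GG, qq]; congr 2; field_simp; ring

lemma qq_Q (hρ : 0 < ρ) (h : ξ ∈ (Qset ρ : Set (VV d))) : ρ ^ 2 ≤ qq ξ ∧ qq ξ < 4 * ρ ^ 2 := by
  obtain ⟨h1, h2⟩ := h
  unfold qq
  constructor <;> nlinarith

lemma w_Wt (hρ : 0 < ρ) (hb : 0 < b) (hE : r ∈ Eset ρ t) (hQ : ξ ∈ (Qset ρ : Set (VV d))) :
    1 / (1 + ((Rr ρ t r - GG (ρ ^ 2 / 4) ξ) / b) ^ 2) ≤ rE 12 * Wt (1 / ρ ^ 2) (b * ρ ^ 2) (-(ρ ^ 2 * log (Rr ρ t r))) ξ := by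
  have R0 : 0 < Rr ρ t r := (rxp _).trans_le hE.1
  obtain ⟨q1, q2⟩ := qq_Q hρ hQ
  have p2 : 0 < ρ ^ 2 := by positivity
  have l4 : -4 ≤ log (Rr ρ t r) := (Real.le_log_iff_exp_le R0).2 hE.1
  have q3 : qq ξ / ρ ^ 2 ≤ 4 := by rw [div_le_iff₀ p2]; linarith
  have g := exp_gap l4 (show -4 ≤ -(qq ξ / ρ ^ 2) by linarith)
  rw [Real.exp_log R0, ← GG_qq hρ] at g
  have e : (qq ξ - -(ρ ^ 2 * log (Rr ρ t r))) / (b * ρ ^ 2) = (log (Rr ρ t r) - -(qq ξ / ρ ^ 2)) / b := by field_simp; ring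
  rw [Wt, e]
  set D := log (Rr ρ t r) - -(qq ξ / ρ ^ 2)
  set M := Rr ρ t r - GG (ρ ^ 2 / 4) ξ
  have g2 : rE (-8) * (D / b) ^ 2 ≤ (M / b) ^ 2 := by
    have := pow_le_pow_left₀ pO g 2
    rw [mul_pow, sq_abs, sq_abs, ← exp_nat_mul] at this
    norm_num at this
    rw [div_pow, div_pow, ← mul_div_assoc]
    exact div_le_div_of_nonneg_right this pO
  have e8 : rE (-8) ≤ 1 := exp_le_one_iff.2 nU
  have e8' : rE 8 * rE (-8) = 1 := by rw [← Real.exp_add]; norm_num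
  have e8p := rxp 8
  have h1 : 1 / (1 + (M / b) ^ 2) ≤ rE 8 * (1 / (1 + (D / b) ^ 2)) := by
    rw [mul_one_div, div_le_div_iff₀ pO pO]
    nlinarith
  have h2 : rE 8 ≤ rE 12 * rE (-(1 / ρ ^ 2 * qq ξ)) := by
    rw [← Real.exp_add]
    refine exp_le_exp.2 ?_
    have : 1 / ρ ^ 2 * qq ξ = qq ξ / ρ ^ 2 := by ring
    linarith
  refine h1.trans ?_
  rw [← mul_assoc]
  exact mlr h2 pO

lemma boundB (hd : 1 ≤ d) (hρ : 0 < ρ) (ht : 0 < t) (hb : 0 < b) (hr : 0 < r) (h1 : 1 ≤ Dl ρ t * ρ)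
    (h2 : 1 ≤ b ^ 3 * (Dl ρ t * ρ) ^ 2) {F : VC d} (hF : MemLp F 2 (sg d)) (hE : r ∈ Eset ρ t) :
    eR (r ^ (d - 1)) * ∫⁻ ξ, (Qset ρ).indicator (fun ξ => eR (1 / (1 + ((Rr ρ t r - GG (ρ ^ 2 / 4) ξ) / b) ^ 2))) ξ * ‖Fr F r ξ‖ₑ ^ wR ≤
      eR (rE 12 * (CW d + 1) * (√b * ρ)) * ∫⁻ θ, ‖F θ‖ₑ ^ wR ∂(sg d) := by
  obtain ⟨r1, -, -⟩ := Rr_E hρ ht hr.le hE.1 hE.2.le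
  have Δ0 := Dl_pos hρ ht
  have hm : zR < max 1 (1 / b) := lt_of_lt_of_le one_pos (le_max_left _ _)
  obtain ⟨i1, i2⟩ := star_r (d := d) (ε := 1 / ρ ^ 2) (ω := b * ρ ^ 2) (c := 1 / ρ ^ 2 * max 1 (1 / b)) (r := r) (E0 := -(ρ ^ 2 * log (Rr ρ t r)))
    hd pO pO hr (le_mul_of_one_le_right pO (le_max_left _ _))
    (by rw [show 1 / (b * ρ ^ 2) = 1 / ρ ^ 2 * (1 / b) by field_simp]; exact mll (le_max_right _ _) pO)
    (by
      have k1 : (max 1 (1 / b)) ^ 3 ≤ (Dl ρ t * ρ) ^ 2 := by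
        rcases max_cases 1 (1 / b) with ⟨h, -⟩ | ⟨h, -⟩
        · rw [h]; nlinarith
        · rw [h, div_pow, div_le_iff₀ pO]; linarith
      have k2 : Dl ρ t ^ 2 ≤ 4 * r ^ 2 := by nlinarith
      rw [mul_pow]
      calc _ ≤ (1 / ρ ^ 2) ^ 3 * (Dl ρ t * ρ) ^ 2 := mll k1 pO
        _ = (1 / ρ ^ 2) ^ 2 * Dl ρ t ^ 2 := by field_simp
        _ ≤ (1 / ρ ^ 2) ^ 2 * (4 * r ^ 2) := mll k2 pO
        _ = _ := by ring) hF
  set E0 := -(ρ ^ 2 * log (Rr ρ t r))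
  have W0 : ∀ ξ : VV d, 0 ≤ Wt (1 / ρ ^ 2) (b * ρ ^ 2) E0 ξ := fun ξ => by unfold Wt; positivity
  have m1 : ∫⁻ ξ, (Qset ρ).indicator (fun ξ => eR (1 / (1 + ((Rr ρ t r - GG (ρ ^ 2 / 4) ξ) / b) ^ 2))) ξ * ‖Fr F r ξ‖ₑ ^ wR ≤
      eR (rE 12) * ∫⁻ ξ, eR (Wt (1 / ρ ^ 2) (b * ρ ^ 2) E0 ξ * ‖Fr F r ξ‖ ^ 2) := by
    rw [← lintegral_const_mul' _ _ (by simp)]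
    refine lintegral_mono fun ξ => ?_
    by_cases hQ : ξ ∈ (Qset ρ : Set (VV d))
    · rw [indicator_of_mem hQ, ENNReal.ofReal_mul (W0 ξ), ← mul_assoc, ← ENNReal.ofReal_mul (rxp _).le]
      refine mul_le_mul' (ofReal_le_ofReal (w_Wt hρ hb hE hQ)) (le_of_eq ?_)
      rw [← ofReal_norm, ENNReal.rpow_two, ofReal_pow nN]
    · rw [indicator_of_notMem hQ, zero_mul]; exact zero_le
  rw [← ofReal_integral_eq_lintegral_ofReal i1 (aea fun ξ => mul_nonneg (W0 ξ) pO)] at m1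
  have e2 : ∫⁻ θ, ‖F θ‖ₑ ^ wR ∂(sg d) = eR (∫ θ, ‖F θ‖ ^ 2 ∂(sg d)) := by
    rw [ofReal_integral_eq_lintegral_ofReal (hF.integrable_norm_pow nU) (aea fun ξ => by positivity)]
    refine lintegral_congr fun θ => ?_
    rw [← ofReal_norm, ENNReal.rpow_two, ofReal_pow nN]
  rw [e2]
  refine (mul_le_mul_right m1 _).trans ?_
  have C0 := CW_nonneg d
  rw [← ENNReal.ofReal_mul (rxp _).le, ← ENNReal.ofReal_mul pO, ← ENNReal.ofReal_mul pO]
  refine ofReal_le_ofReal ?_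
  have f0 : 0 ≤ ∫ θ, ‖F θ‖ ^ 2 ∂(sg d) := integral_nonneg fun θ => by positivity
  have es : √(b * ρ ^ 2) = √b * ρ := by rw [sqrt_mul hb.le, sqrt_sq hρ.le]
  rw [es] at i2
  calc _ ≤ r ^ (d - 1) * (rE 12 * (CW d * (√b * ρ / r ^ (d - 1)) * ∫ θ, ‖F θ‖ ^ 2 ∂(sg d))) := by gcongr
    _ = rE 12 * CW d * (√b * ρ) * ∫ θ, ‖F θ‖ ^ 2 ∂(sg d) := by field_simp
    _ ≤ _ := by gcongr; linarith

def CP (d : ℕ) (K : ℝ) : ℝ := √(2 * rE 16 * (CW d + 1) * √K)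

lemma sharp_OB (hd : 1 ≤ d) {K : ℝ} (hρ : 0 < ρ) (ht : 0 < t) (hb : 0 < b) (h1 : 1 ≤ Dl ρ t * ρ) (hK : 1 ≤ K)
    (h2 : b ^ 3 * (Dl ρ t * ρ) ^ 2 = K) :
    OB (fun x ξ : VV d => (Eset ρ t).indicator 1 ‖x‖ * (oC (psi ((Rr ρ t ‖x‖ - GG (ρ ^ 2 / 4) ξ) / b))) * (Qset ρ).indicator 1 ξ) (CP d K) := by
  have C0 := CW_nonneg d
  have Δ0 := Dl_pos hρ ht
  have gc := GG_cont (d := d) (ρ ^ 2 / 4)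
  have rc := Rr_cont ρ t
  set w : ℝ → VV d → ℝ≥0∞ := fun r ξ => (Eset ρ t).indicator (fun r => (Qset ρ).indicator (fun ξ => eR (1 / (1 + ((Rr ρ t r - GG (ρ ^ 2 / 4) ξ) / b) ^ 2))) ξ) r with hw
  have sq : ∀ r ξ, (w r ξ ^ (1/2:ℝ)) ^ wR = w r ξ := fun r ξ => by rw [← ENNReal.rpow_mul]; norm_num
  have mE : MeasurableSet {p : VV d × ℝ | p.2 ∈ Eset ρ t} := measurable_snd (Eset_m ρ t)
  have mQ : MeasurableSet {p : VV d × ℝ | p.1 ∈ (Qset ρ : Set (VV d))} := measurable_fst (Qset_m ρ)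
  have mE' : MeasurableSet {p : ℝ × VV d | p.1 ∈ Eset ρ t} := measurable_fst (Eset_m ρ t)
  have mQ' : MeasurableSet {p : ℝ × VV d | p.2 ∈ (Qset ρ : Set (VV d))} := measurable_snd (Qset_m ρ)
  have iE : Measurable fun p : ℝ × VV d => (Eset ρ t).indicator (1 : ℝ → ℂ) p.1 := (measurable_one.indicator (Eset_m ρ t)).comp measurable_fst
  have iQ : Measurable fun p : ℝ × VV d => (Qset ρ).indicator (1 : VC d) p.2 := (measurable_one.indicator (Qset_m ρ)).comp measurable_snd
  have nE : ∀ r, ‖(Eset ρ t).indicator (1 : ℝ → ℂ) r‖ ≤ 1 := fun r => by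
    by_cases h : r ∈ Eset ρ t <;> simp [h]
  have nQ : ∀ r, ‖(Qset ρ).indicator (1 : VC d) r‖ ≤ 1 := fun r => by
    by_cases h : r ∈ (Qset ρ : Set (VV d)) <;> simp [h]
  refine sharp_abs hd (a := fun r ξ => (Eset ρ t).indicator 1 r * (oC (psi ((Rr ρ t r - GG (ρ ^ 2 / 4) ξ) / b))) * (Qset ρ).indicator 1 ξ)
    (v := fun r ξ => w r ξ ^ (1/2:ℝ)) (c := 1) (A := 2 * rE 4 * (b * Dl ρ t)) (B := rE 12 * (CW d + 1) * (√b * ρ)) ?_ ?_ ?_ ?_ pO pO (sqrt_nonneg _) ?_ ?_ ?_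
  · refine (iE.mul (Complex.measurable_ofReal.comp (psi_meas.comp (Continuous.measurable ?_)))).mul iQ
    fun_prop
  · refine Measurable.pow_const ?_ _
    have e : (fun p : VV d × ℝ => w p.2 p.1) = {p : VV d × ℝ | p.2 ∈ Eset ρ t}.indicator ({p : VV d × ℝ | p.1 ∈ (Qset ρ : Set (VV d))}.indicator (fun p => eR (1 / (1 + ((Rr ρ t p.2 - GG (ρ ^ 2 / 4) p.1) / b) ^ 2)))) := by
      funext p; simp only [hw, indicator]; rfl
    rw [e]
    refine (Measurable.indicator ?_ mQ).indicator mE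
    refine ENNReal.measurable_ofReal.comp (Continuous.measurable ?_)
    exact continuous_const.div fP fun p => by positivity
  · intro r ξ
    rw [norm_mul, norm_mul, cnr]
    have := psi_bd ((Rr ρ t r - GG (ρ ^ 2 / 4) ξ) / b)
    have h3 : 1 / (1 + ((Rr ρ t r - GG (ρ ^ 2 / 4) ξ) / b) ^ 2) ≤ 1 := by
      rw [div_le_one pO]; linarith [sq_nonneg ((Rr ρ t r - GG (ρ ^ 2 / 4) ξ) / b)]
    exact mul_le_one₀ (mul_le_one₀ (nE r) nN (this.trans h3)) nN (nQ ξ)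
  · intro r ξ
    rw [sq]
    by_cases hE : r ∈ Eset ρ t
    · by_cases hQ : ξ ∈ (Qset ρ : Set (VV d))
      · simp only [hw, indicator_of_mem hE, indicator_of_mem hQ, Pi.one_apply, one_mul, mul_one]
        rw [← ofReal_norm, cnr]
        exact ofReal_le_ofReal (psi_bd _)
      · simp [indicator_of_notMem hQ]
    · simp [indicator_of_notMem hE]
  · rw [CP, sq_sqrt pO, ← h2, sqrt_mul pO, sqrt_sq pO]
    refine le_of_eq ?_
    have eb : √(b ^ 3) = b * √b := by
      rw [show b ^ 3 = b ^ 2 * b by ring, sqrt_mul pO, sqrt_sq hb.le]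
    have e16 : rE 16 = rE 4 * rE 12 := by rw [← Real.exp_add]; norm_num
    rw [eb, e16]; ring
  · intro ξ
    simp_rw [sq]
    refine le_trans (lintegral_mono fun r => ?_) (boundA hρ ht hb (GG (ρ ^ 2 / 4) ξ))
    simp only [hw]
    refine indicator_le_indicator ?_
    exact Set.indicator_le_self _ _ _
  · intro r hr F hF
    simp_rw [sq]
    by_cases hE : r ∈ Eset ρ t
    · simp only [hw, indicator_of_mem hE]
      exact boundB hd hρ ht hb hr h1 (by rw [h2]; exact hK) hF hE
    · simp [hw, indicator_of_notMem hE]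
end N6d

section N7a
variable {d : ℕ}
variable {h : VC d} {N : ℕ}

def K0 (d : ℕ) : ℝ := 3696 * cd d ^ 2
def CB (d : ℕ) : ℝ := CP d (K0 d) + (1 + CL)

lemma CL_nonneg : 0 ≤ CL := by
  unfold CL
  have : 0 ≤ ∫ η in Ioi zR, |nk η| := integral_nonneg fun _ => abs_nonneg _
  linarith

lemma CB_nonneg (d : ℕ) : 0 ≤ CB d := by
  unfold CB
  have := CL_nonneg
  have : 0 ≤ CP d (K0 d) := sqrt_nonneg _
  linarith

lemma block_OB (hd : 1 ≤ d) {ρ t : ℝ} (hρ : 0 < ρ) (ht : 0 < t) (h1 : 1 ≤ Dl ρ t * ρ) :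
    OB (fun x ξ : VV d => (Eset ρ t).indicator 1 ‖x‖ * (if Rr ρ t ‖x‖ < GG (ρ ^ 2 / 4) ξ then 1 else 0) * (Qset ρ).indicator 1 ξ) (CB d) := by
  have Δ0 := Dl_pos hρ ht
  have c1 := cd_ge d
  have hK : 1 ≤ K0 d := by unfold K0; nlinarith
  have hK0 : 0 < K0 d := by linarith
  set Λ := Dl ρ t * ρ with hΛ
  have Λ0 : 0 < Λ := by linarith
  set b := (K0 d / Λ ^ 2) ^ (1/3 : ℝ) with hb
  have b0 : 0 < b := by positivity
  have b3 : b ^ 3 = K0 d / Λ ^ 2 := by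
    rw [hb, ← rpow_natCast, ← Real.rpow_mul pO]; norm_num
  have mE : Measurable fun x : VV d => (Eset ρ t).indicator (1 : ℝ → ℂ) ‖x‖ := (measurable_one.indicator (Eset_m ρ t)).comp measurable_norm
  have mQ : Measurable ((Qset ρ).indicator (1 : VC d)) := measurable_one.indicator (Qset_m ρ)
  have nE : ∀ x : VV d, ‖(Eset ρ t).indicator (1 : ℝ → ℂ) ‖x‖‖ ≤ 1 := fun x => by
    by_cases h : ‖x‖ ∈ Eset ρ t <;> simp [h]
  have nQ : ∀ r, ‖(Qset ρ).indicator (1 : VC d) r‖ ≤ 1 := fun r => by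
    by_cases h : r ∈ (Qset ρ : Set (VV d)) <;> simp [h]
  have sB : √(ρ ^ 2 / 4) = ρ / 2 := by
    rw [show ρ ^ 2 / 4 = (ρ / 2) ^ 2 by ring, sqrt_sq pO]
  have low := low_OB (d := d) (R := RV ρ t) (b := b) (B := ρ ^ 2 / 4) (κ := 12 / Dl ρ t) (κ' := 924 / Dl ρ t ^ 2) (RV_cont ρ t)
    (fun x => by rw [RV, abs_of_nonneg (Rr_nonneg _ _ _)]; exact Rr_le_one hρ ht) b0 pO pO pO
    (RV_lip hρ ht) (RV_lip2 hρ ht)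
    (by
      rw [b3, show (12 / Dl ρ t) ^ 2 * (cd d * (2 / (ρ ^ 2 / 4))) = 1152 * cd d / Λ ^ 2 by rw [hΛ]; field_simp; norm_num]
      refine div_le_div_of_nonneg_right ?_ pO
      unfold K0; nlinarith)
    (by
      rw [b3, sB, show 924 / Dl ρ t ^ 2 * (cd d * (1 / (ρ / 2))) * (cd d * (1 / (ρ / 2))) = K0 d / Λ ^ 2 by rw [hΛ, K0]; field_simp; norm_num])
  have low' := (low.smul (-(1 / rpi : ℝ) : ℂ)).lr (by have := CL_nonneg; positivity) mE mQ nE nQ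
  have half := ((OB_one (d := d)).smul (1/2)).lr pO mE mQ nE nQ
  have sh := sharp_OB (d := d) hd hρ ht b0 h1 hK (by rw [b3, ← hΛ]; field_simp)
  have tot := (sh.add (half.add low')).nonneg_mono (C' := CB d) (by
    unfold CB
    have n1 : ‖(1/2 : ℂ)‖ * 1 ≤ 1 := by norm_num
    have n2 : ‖(-(1 / rpi : ℝ) : ℂ)‖ * CL ≤ CL := by
      refine mul_le_of_le_one_left CL_nonneg ?_
      rw [norm_neg, cnr, rno pO, div_le_one pi_pos]
      linarith [pi_gt_three]
    linarith)
  refine (congrArg (fun f => OB f (CB d)) ?_).mpr tot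
  funext x ξ
  have e : (Rr ρ t ‖x‖ < GG (ρ ^ 2 / 4) ξ) ↔ (Rr ρ t ‖x‖ - GG (ρ ^ 2 / 4) ξ) / b < 0 := by
    rw [div_neg_iff]; constructor
    · intro h; right; exact ⟨by linarith, b0⟩
    · rintro (⟨_, h⟩ | ⟨h, _⟩) <;> linarith
  simp only [psi, RV]
  by_cases h : Rr ρ t ‖x‖ < GG (ρ ^ 2 / 4) ξ
  · rw [if_pos h, if_pos (e.1 h)]; push_cast; ring
  · rw [if_neg h, if_neg (fun h' => h (e.2 h'))]; push_cast; ring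

/-! block diagonal sums -/
lemma nn_sq (hh : MemLp h 2 volume) : nn h ^ 2 = ∫ x, ‖h x‖ ^ 2 := by
  have h1 : ‖hh.toLp‖ ^ 2 = ∫ x, ‖h x‖ ^ 2 := by
    have := congrArg Complex.re (inner_self_eq_norm_sq_to_K (𝕜 := ℂ) hh.toLp)
    rw [L2.inner_def] at this
    have e : ∫ a, inner ℂ ((hh.toLp : VC d) a) ((hh.toLp : VC d) a) = (oC (∫ x, ‖h x‖ ^ 2)) := by
      rw [← integral_complex_ofReal]
      refine ica (hh.coeFn_toLp.mono fun x hx => ?_)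
      simp only [hx]
      rw [inner_self_eq_norm_sq_to_K]; push_cast; rfl
    rw [e, ofReal_re] at this
    rw [this, ← ofReal_re (‖hh.toLp‖ ^ 2)]; push_cast; rfl
  rw [← nn_toLp hh, h1]

lemma nn_sum {p : ℕ → VC d} (hp : ∀ k, Measurable (p k)) (hp1 : ∀ k x, ‖p k x‖ ≤ 1)
    (hs : ∀ x, ∑ k ∈ range N, ‖p k x‖ ^ 2 ≤ 1) (hh : Nice h) :
    ∑ k ∈ range N, nn (fun x => p k x * h x) ^ 2 ≤ nn h ^ 2 := by
  have hn : ∀ k, Nice (fun x => p k x * h x) := fun k => hh.bmul ⟨hp k, 1, hp1 k⟩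
  have e : ∀ k ∈ range N, nn (fun x => p k x * h x) ^ 2 = ∫ x, ‖p k x * h x‖ ^ 2 := fun k _ => nn_sq (hn k).l
  have i : ∀ k ∈ range N, Integrable (fun x => ‖p k x * h x‖ ^ 2) := fun k _ => (hn k).l.integrable_norm_pow nU
  rw [Finset.sum_congr rfl e, ← integral_finset_sum _ i, nn_sq hh.l]
  refine integral_mono (integrable_finset_sum _ i) (hh.l.integrable_norm_pow nU) fun x => ?_
  simp only [norm_mul, mul_pow]
  rw [← Finset.sum_mul]
  exact mul_le_of_le_one_left pO (hs x)

lemma BS_sum {a : ℕ → VV d → VC d} (ha : ∀ k < N, BS (a k)) : BS (fun x ξ => ∑ k ∈ range N, a k x ξ) := by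
  induction N with
  | zero => simpa using BS.const (d := d) 0
  | succ n ih =>
    simp_rw [Finset.sum_range_succ]
    exact (ih fun k hk => ha k (by omega)).add (ha n (by omega))

lemma BF_sum {a : ℕ → VV d → VC d} (ha : ∀ k < N, BS (a k)) {g : VC d} (hh : Nice h) (hg : Nice g) :
    BF (fun x ξ => ∑ k ∈ range N, a k x ξ) h g = ∑ k ∈ range N, BF (a k) h g := by
  induction N with
  | zero => simp [BF]
  | succ n ih =>
    simp_rw [Finset.sum_range_succ]
    rw [BF_add (BS_sum fun k hk => ha k (by omega)) (ha n (by omega)) hh hg, ih fun k hk => ha k (by omega)]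

lemma OB_diag {a : ℕ → VV d → VC d} {C : ℝ} (hC : 0 ≤ C) (ha : ∀ k < N, OB (a k) C) {p q : ℕ → VC d}
    (hp : ∀ k, Measurable (p k)) (hp1 : ∀ k x, ‖p k x‖ ≤ 1) (hps : ∀ x, ∑ k ∈ range N, ‖p k x‖ ^ 2 ≤ 1)
    (hq : ∀ k, Measurable (q k)) (hq1 : ∀ k x, ‖q k x‖ ≤ 1) (hqs : ∀ x, ∑ k ∈ range N, ‖q k x‖ ^ 2 ≤ 1) :
    OB (fun x ξ => ∑ k ∈ range N, p k x * a k x ξ * q k ξ) C := by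
  have hb : ∀ k < N, BS (fun x ξ => p k x * a k x ξ * q k ξ) := fun k hk => ((ha k hk).lr hC (hp k) (hq k) (hp1 k) (hq1 k)).1
  refine ⟨BS_sum hb, fun h g hh hg => ?_⟩
  rw [BF_sum hb hh hg]
  have h1 : ∀ k ∈ range N, ‖BF (fun x ξ => p k x * a k x ξ * q k ξ) h g‖ ≤ C * (nn (fun x => p k x * h x) * nn (fun x => q k x * g x)) := fun k hk => by
    rw [BF_lr]
    exact (ha k (Finset.mem_range.1 hk)).2 _ _ (hh.bmul ⟨hp k, 1, hp1 k⟩) (hg.bmul ⟨hq k, 1, hq1 k⟩)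
  refine (norm_sum_le_of_le _ h1).trans ?_
  rw [← Finset.mul_sum]
  refine mll ?_ hC
  refine (Real.sum_mul_le_sqrt_mul_sqrt _ _ _).trans ?_
  refine mul_le_mul ?_ ?_ (sqrt_nonneg _) (nn_nonneg _)
  · exact sqrt_le_iff.2 ⟨nn_nonneg _, nn_sum hp hp1 hps hh⟩
  · exact sqrt_le_iff.2 ⟨nn_nonneg _, nn_sum hq hq1 hqs hg⟩
end N7a

section N7b
variable {d : ℕ}
variable {c a b : ℝ} {ρ : ℕ → ℝ}

lemma stair_abs {H : Type*} [NormedAddCommGroup H] [InnerProductSpace ℂ H] (M : ℕ → H →L[ℂ] H) (q : ℕ → H) (e : ℕ → ℝ) (F : ℝ)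
    (hs : ∀ k u v, inner ℂ (M k u) v = inner ℂ u (M k v)) (h1 : ∀ k, ‖M k‖ ≤ 1) (hm : ∀ j k u, j < k → M j (M k u) = M k u)
    (he0 : 0 ≤ e 0 * F) (he : ∀ k, ‖inner ℂ (∑ j ∈ range k, q j) (M (k+1) (q (k+1)))‖ ≤ e (k+1) * F) (N : ℕ) :
    ‖∑ k ∈ range (N+1), M k (q k)‖ ^ 2 ≤ 3 * ∑ k ∈ range N, ‖q k‖ ^ 2 + 2 * ‖q N‖ ^ 2 + 2 * ((∑ k ∈ range (N+1), e k) * F) := by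
  have hMq : ∀ k, ‖M k (q k)‖ ≤ ‖q k‖ := fun k => ((M k).le_opNorm _).trans (mul_le_of_le_one_left nN (h1 k))
  induction N with
  | zero =>
    simp only [Finset.range_one, Finset.sum_singleton, Finset.range_zero, Finset.sum_empty, zero_add]
    have := hMq 0
    nlinarith [norm_nonneg (M 0 (q 0)), norm_nonneg (q 0)]
  | succ n ih =>
    rw [Finset.sum_range_succ _ (n+1), norm_add_sq (𝕜 := ℂ), Finset.sum_range_succ e (n+1), Finset.sum_range_succ (fun k => ‖q k‖ ^ 2) n]
    have e1 : inner ℂ (∑ k ∈ range (n+1), M k (q k)) (M (n+1) (q (n+1))) = inner ℂ (∑ k ∈ range (n+1), q k) (M (n+1) (q (n+1))) := by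
      rw [sum_inner, sum_inner]
      refine Finset.sum_congr rfl fun j hj => ?_
      rw [hs, hm j (n+1) _ (Finset.mem_range.1 hj)]
    rw [e1, Finset.sum_range_succ q, inner_add_left]
    have r1 := (re_le_norm _).trans (he n)
    have r2 : (inner ℂ (q n) (M (n+1) (q (n+1)))).re ≤ ‖q n‖ * ‖q (n+1)‖ :=
      (re_le_norm _).trans ((norm_inner_le_norm _ _).trans (mll (hMq _) nN))
    have r3 := pow_le_pow_left₀ nN (hMq (n+1)) 2
    have r4 : RCLike.re (inner ℂ (∑ k ∈ range n, q k) (M (n+1) (q (n+1))) + inner ℂ (q n) (M (n+1) (q (n+1)))) ≤ e (n+1) * F + ‖q n‖ * ‖q (n+1)‖ := by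
      rw [map_add]; exact add_le_add r1 r2
    linarith [sq_nonneg (‖q n‖ - ‖q (n+1)‖)]

lemma sylv {A : Type*} [NormedRing A] {P Q G m Gi : A} {α β : ℝ} (h1 : Gi * G = P) (h2 : Gi * P = Gi) (h3 : G * Q = Q * (G * Q))
    (hG : ‖Gi‖ ≤ α) (hα : α ≤ 2) (hQ : ‖Q‖ ≤ 1) (hGQ : ‖G * Q‖ ≤ β) (hαβ : α * β ≤ 4 / 7) (hc : ‖G * m - m * G‖ ≤ c) :
    ‖P * m * Q‖ ≤ 5 * c := by
  have e : P * m * Q = Gi * (G * m - m * G) * Q + Gi * (P * m * Q) * (G * Q) := by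
    have : Gi * (P * m * Q) * (G * Q) = Gi * m * (G * Q) := by
      rw [show Gi * (P * m * Q) * (G * Q) = (Gi * P) * m * (Q * (G * Q)) by simp only [mul_assoc], h2, ← h3]
    rw [this, mul_sub, sub_mul, show Gi * (G * m) * Q = (Gi * G) * m * Q by simp only [mul_assoc], h1]
    simp only [mul_assoc, sub_add_cancel]
  have c0 : 0 ≤ c := (norm_nonneg _).trans hc
  have a0 : 0 ≤ α := (norm_nonneg _).trans hG
  have b0 : 0 ≤ β := (norm_nonneg _).trans hGQ
  have n1 : ‖Gi * (G * m - m * G) * Q‖ ≤ 2 * c := by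
    refine (norm_mul_le _ _).trans ?_
    refine (mul_le_mul ((norm_mul_le _ _).trans (mul_le_mul (hG.trans hα) hc nN nU)) hQ nN pO).trans (mul_one _).le
  have n2 : ‖Gi * (P * m * Q) * (G * Q)‖ ≤ 4 / 7 * ‖P * m * Q‖ := by
    refine (norm_mul_le _ _).trans ?_
    refine (mul_le_mul ((norm_mul_le _ _).trans (mlr hG nN)) hGQ nN pO).trans ?_
    nlinarith [norm_nonneg (P * m * Q)]
  have n3 : ‖P * m * Q‖ ≤ 2 * c + 4 / 7 * ‖P * m * Q‖ := by
    have := norm_add_le (Gi * (G * m - m * G) * Q) (Gi * (P * m * Q) * (G * Q))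
    rw [← e] at this; linarith
  linarith

def In (a b : ℝ) (ξ : VV d) : ℝ := if a ≤ 2 * rpi * ‖ξ‖ ∧ 2 * rpi * ‖ξ‖ < b then 1 else 0

lemma In_meas (a b : ℝ) : Measurable (In a b : VV d → ℝ) := by
  unfold In
  refine Measurable.ite ?_ mCst mCst
  have h : Measurable fun ξ : VV d => 2 * rpi * ‖ξ‖ := by fun_prop
  exact (measurableSet_le mCst h).inter (measurableSet_lt h mCst)

lemma In_norm (a b : ℝ) (ξ : VV d) : ‖(In a b ξ : ℂ)‖ ≤ 1 := by
  unfold In; split_ifs <;> simp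

lemma In_BM (a b : ℝ) : BM (fun ξ : VV d => (In a b ξ : ℂ)) := ⟨Complex.measurable_ofReal.comp (In_meas a b), 1, In_norm a b⟩

lemma In_sq (a b : ℝ) (ξ : VV d) : In a b ξ * In a b ξ = In a b ξ := by
  unfold In; split_ifs <;> simp

lemma In_add (h : a ≤ b) (h' : b ≤ c) (ξ : VV d) : In a b ξ + In b c ξ = In a c ξ := by
  unfold In
  by_cases h1 : a ≤ 2 * rpi * ‖ξ‖ <;> by_cases h2 : 2 * rpi * ‖ξ‖ < b <;> by_cases h3 : 2 * rpi * ‖ξ‖ < c <;>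
    simp [h1, h2, h3, not_le.2, not_lt.1] <;> first | linarith | (intros; linarith) | skip

def Iop (a b : ℝ) : HL d := FM (MM fun ξ => (In a b ξ : ℂ))

lemma Iop_norm (a b : ℝ) : ‖(Iop a b : HL d)‖ ≤ 1 := (FM_norm _).trans (MM_norm_le zero_le_one (In_norm a b))

lemma Iop_add (h : a ≤ b) (h' : b ≤ c) (f : HH d) : Iop a b f + Iop b c f = Iop a c f := by
  have e : MM (fun ξ : VV d => (In a b ξ : ℂ)) + MM (fun ξ : VV d => (In b c ξ : ℂ)) = MM (fun ξ : VV d => (In a c ξ : ℂ)) := by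
    refine (MM_add (In_BM _ _) (In_BM _ _)).trans ?_
    congr 1; funext ξ; rw [← In_add h h' ξ]; push_cast; rfl
  have e2 := (FL d).symm.map_add (MM (fun ξ : VV d => (In a b ξ : ℂ)) (FL d f)) (MM (fun ξ : VV d => (In b c ξ : ℂ)) (FL d f))
  exact e2.symm.trans (congrArg (fun T : HL d => (FL d).symm (T (FL d f))) e)

lemma Iop_sum (h : Monotone ρ) (f : HH d) (N : ℕ) : ∑ k ∈ range N, Iop (ρ k) (ρ (k+1)) f = Iop (ρ 0) (ρ N) f := by
  induction N with
  | zero =>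
    have : (fun ξ : VV d => (In (ρ 0) (ρ 0) ξ : ℂ)) = fun _ => 0 := by
      funext ξ; unfold In; rw [if_neg]; · simp
      · rintro ⟨a, b⟩; linarith
    simp only [Finset.range_zero, Finset.sum_empty]
    rw [Iop, this, MM_const, zero_smul, FM_apply]; simp
  | succ n ih =>
    rw [Finset.sum_range_succ, ih]
    exact Iop_add (h (Nat.zero_le n)) (h (Nat.le_succ n)) f

lemma Iop_idem (a b : ℝ) : (Iop a b : HL d) * Iop a b = Iop a b := by
  rw [Iop, FM_mul, MM_mul (In_BM _ _) (In_BM _ _)]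
  congr 2; funext ξ; rw [← Complex.ofReal_mul, In_sq]

lemma Iop_sa (a b : ℝ) : SA (Iop a b : HL d) := FM_sa (MM_sa (In_BM _ _))

lemma sa_inner {T : HL d} (h : SA T) (u v : HH d) : inner ℂ (T u) v = inner ℂ u (T v) := by
  rw [← ContinuousLinearMap.adjoint_inner_right, h.adjoint_eq]

lemma pmq {P M Q : HL d} (hP : SA P) {C : ℝ} (h : ‖P * M * Q‖ ≤ C) (f : HH d) :
    ‖inner ℂ (P f) (M (Q f))‖ ≤ C * ‖f‖ ^ 2 := by
  have e : inner ℂ (P f) (M (Q f)) = inner ℂ f ((P * M * Q) f) := sa_inner hP _ _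
  rw [e]
  refine (norm_inner_le_norm _ _).trans ?_
  have h2 := ((P * M * Q).le_opNorm f).trans (mlr h nN)
  exact (mll h2 nN).trans (le_of_eq (by ring))

lemma Iop_sq (a b : ℝ) (f : HH d) : ‖Iop a b f‖ ^ 2 = (inner ℂ f (Iop a b f)).re := by
  have h := inner_self_eq_norm_sq (𝕜 := ℂ) (Iop a b f)
  have e : inner ℂ (Iop a b f) (Iop a b f) = inner ℂ f ((Iop a b * Iop a b : HL d) f) := sa_inner (Iop_sa a b) _ _
  refine h.symm.trans (congrArg Complex.re (e.trans ?_))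
  exact congrArg (fun T : HL d => inner ℂ f (T f)) (Iop_idem a b)

lemma Iop_sumsq (h : Monotone ρ) (f : HH d) (N : ℕ) : ∑ k ∈ range N, ‖Iop (ρ k) (ρ (k+1)) f‖ ^ 2 ≤ ‖f‖ ^ 2 := by
  simp_rw [Iop_sq]
  rw [← Complex.re_sum, ← inner_sum, Iop_sum h]
  refine (re_le_norm _).trans ((norm_inner_le_norm _ _).trans ?_)
  rw [sq]
  exact mll (((Iop _ _).le_opNorm f).trans (mul_le_of_le_one_left nN (Iop_norm _ _))) nN

lemma GG_In {ρ : ℝ} (hρ : 0 < ρ) (ξ : VV d) : GG (ρ ^ 2 / 4) ξ * In ρ (2 * ρ) ξ ≤ rE (-1) := by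
  unfold In; split_ifs with h
  · rw [mul_one, GG_qq hρ]
    have : ρ ^ 2 ≤ qq ξ := by unfold qq; exact pow_le_pow_left₀ hρ.le h.1 2
    refine exp_le_exp.2 (neg_le_neg ?_)
    rw [le_div_iff₀ pO]; linarith
  · rw [mul_zero]; positivity

lemma GG_In' {ρ : ℝ} (hρ : 0 < ρ) (ξ : VV d) : In a (ρ / 2) ξ * (GG (ρ ^ 2 / 4) ξ)⁻¹ ≤ rE (1/4) := by
  unfold In; split_ifs with h
  · rw [one_mul, GG_qq hρ, ← exp_neg, neg_neg]
    have : qq ξ ≤ (ρ / 2) ^ 2 := by unfold qq; exact pow_le_pow_left₀ pO h.2.le 2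
    refine exp_le_exp.2 ?_
    rw [div_le_iff₀ pO]; linarith
  · rw [zero_mul]; positivity

lemma In_nonneg (a b : ℝ) (ξ : VV d) : 0 ≤ In a b ξ := by unfold In; split_ifs <;> simp

lemma sylv_conc {ρ : ℝ} (hρ : 0 < ρ) {m : VC d} (hm : BM m) {κ : ℝ} (hκ : 0 ≤ κ)
    (h : ∀ x a : VV d, ‖m (x + a) - m x‖ ≤ κ * ‖a‖) :
    ‖Iop a (ρ / 2) * MM m * Iop ρ (2 * ρ)‖ ≤ 5 * (κ * (cd d * (2 / ρ))) := by
  have hB : 0 < ρ ^ 2 / 4 := by positivity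
  have sB : 1 / √(ρ ^ 2 / 4) = 2 / ρ := by
    rw [show ρ ^ 2 / 4 = (ρ / 2) ^ 2 by ring, sqrt_sq pO]; field_simp
  have hc := comm_G_MM hB hm hκ h
  rw [sB] at hc
  have gm : Measurable (GG (ρ ^ 2 / 4) : VV d → ℝ) := (GG_cont _).measurable
  have giB : BM (fun ξ : VV d => (oC (In a (ρ / 2) ξ * (GG (ρ ^ 2 / 4) ξ)⁻¹))) :=
    ⟨Complex.measurable_ofReal.comp ((In_meas _ _).mul gm.inv), rE (1/4), fun ξ => by
      rw [cnr, rno (mul_nonneg (In_nonneg _ _ _) (inv_nonneg.2 (GG_pos _ _).le))]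
      exact GG_In' hρ ξ⟩
  have gB : BM (fun ξ : VV d => (GG (ρ ^ 2 / 4) ξ : ℂ)) := GG_BM hB
  refine sylv (Gi := FM (MM fun ξ => (oC (In a (ρ / 2) ξ * (GG (ρ ^ 2 / 4) ξ)⁻¹)))) (α := rE (1/4)) (β := rE (-1)) ?_ ?_ ?_ ?_ ?_ (Iop_norm _ _) ?_ ?_ hc
  · rw [Gop, FM_mul, MM_mul giB gB, Iop]
    congr 2; funext ξ
    rw [← Complex.ofReal_mul, mul_assoc, inv_mul_cancel₀ (GG_pos _ _).ne', mul_one]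
  · rw [Iop, FM_mul, MM_mul giB (In_BM _ _)]
    congr 2; funext ξ
    rw [← Complex.ofReal_mul, mul_right_comm, In_sq]
  · rw [Gop, Iop, FM_mul, MM_mul gB (In_BM _ _), FM_mul, MM_mul (In_BM _ _) (gB.mul (In_BM _ _))]
    congr 2; funext ξ
    simp only [← Complex.ofReal_mul]
    rw [mul_left_comm, In_sq]
  · refine (FM_norm _).trans (MM_norm_le pO fun ξ => ?_)
    rw [cnr, rno (mul_nonneg (In_nonneg _ _ _) (inv_nonneg.2 (GG_pos _ _).le))]
    exact GG_In' hρ ξ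
  · have h2 : rE (1/4) ^ 4 = rE 1 := by rw [← exp_nat_mul]; norm_num
    have := exp_one_lt_d9
    by_contra hh
    push Not at hh
    have : wR ^ 4 ≤ rE (1/4) ^ 4 := pow_le_pow_left₀ nU hh.le 4
    linarith
  · rw [Gop, Iop, FM_mul, MM_mul gB (In_BM _ _)]
    refine (FM_norm _).trans (MM_norm_le pO fun ξ => ?_)
    rw [← Complex.ofReal_mul, cnr, rno (mul_nonneg (GG_pos _ _).le (In_nonneg _ _ _))]
    exact GG_In hρ ξ
  · rw [← Real.exp_add, show (1/4 + -1 : ℝ) = -(3/4) by norm_num, exp_neg]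
    have := add_one_le_exp (3/4 : ℝ)
    rw [inv_le_comm₀ (rxp _) nU]; linarith

lemma stair_OB (hρ0 : ∀ k, 0 < ρ k) (hρ2 : ∀ k, ρ (k+1) = 2 * ρ k) {m : ℕ → VV d → ℝ} (hm : ∀ k, Measurable (m k))
    (hm0 : ∀ k x, 0 ≤ m k x) (hm1 : ∀ k x, m k x ≤ 1) (hmm : ∀ j k x, j < k → m j x * m k x = m k x) {κ : ℕ → ℝ} (hκ : ∀ k, 0 ≤ κ k)
    (hl : ∀ k x a, |m k (x + a) - m k x| ≤ κ k * ‖a‖) {N : ℕ}     (hc : ∑ k ∈ range N, κ k / ρ k ≤ c) (hc0 : 0 ≤ c) :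
    OB (fun x ξ => ∑ k ∈ range N, (m k x : ℂ) * (In (ρ k) (ρ (k+1)) ξ : ℂ)) (√(3 + 20 * cd d * c)) := by
  have mono : Monotone ρ := monotone_nat_of_le_succ fun k => by rw [hρ2]; linarith [hρ0 k]
  have nb : ∀ k x, ‖(m k x : ℂ)‖ ≤ 1 := fun k x => by
    rw [cnr, rno (hm0 k x)]; exact hm1 k x
  have mB : ∀ k, BM (fun x => (m k x : ℂ)) := fun k => ⟨Complex.measurable_ofReal.comp (hm k), 1, nb k⟩
  have hbs : ∀ k < N, BS (fun x ξ => (m k x : ℂ) * (In (ρ k) (ρ (k+1)) ξ : ℂ)) := fun k _ => (BS.left (mB k)).mul (BS.right (In_BM _ _))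
  refine ⟨BS_sum hbs, fun h g hh hg => ?_⟩
  rw [BF_sum hbs hh hg]
  set f := (FL d).symm hg.l.toLp with hf
  have e1 : ∀ k ∈ range N, BF (fun x ξ => (m k x : ℂ) * (In (ρ k) (ρ (k+1)) ξ : ℂ)) h g =
      inner ℂ ((hh.l.star).toLp) (MM (fun x => (m k x : ℂ)) (Iop (ρ k) (ρ (k+1)) f)) := fun k _ => by
    rw [BF_op (mB k) (In_BM _ _) hh hg, Iop, FM_apply, hf, LinearIsometryEquiv.apply_symm_apply]
  rw [Finset.sum_congr rfl e1, ← inner_sum]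
  refine (norm_inner_le_norm _ _).trans ?_
  have n1 : ‖(hh.l.star).toLp‖ = nn h := by
    rw [Lp.norm_toLp, nn]; congr 1
    exact eLpNorm_congr_norm_ae (aea fun x => by simp)
  have n2 : ‖f‖ = nn g := by rw [hf, LinearIsometryEquiv.norm_map, nn_toLp]
  rw [n1, mul_left_comm]
  refine mll ?_ (nn_nonneg _)
  rw [← n2]
  have cd0 := cd_pos d
  refine le_of_sq_le_sq ?_ pO
  rw [mul_pow, sq_sqrt pO]
  rcases N with _ | N
  · simp; positivity
  have key := stair_abs (fun k => MM (fun x => (m k x : ℂ))) (fun k => Iop (ρ k) (ρ (k+1)) f) (fun k => 10 * cd d * (κ k / ρ k)) (‖f‖ ^ 2)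
    (fun k u v => sa_inner (MM_sa (mB k)) u v) (fun k => MM_norm_le zero_le_one (nb k))
    (fun j k u hjk => by
      refine congrArg (fun T : HL d => T u) ((MM_mul (mB j) (mB k)).trans ?_)
      congr 1; funext x; rw [← Complex.ofReal_mul, hmm j k x hjk])
    (by have := hκ 0; have := hρ0 0; positivity)
    (fun k => by
      rw [Iop_sum mono]
      have h1 := sylv_conc (a := ρ 0) (hρ0 (k+1)) (mB (k+1)) (hκ (k+1)) (fun x a => by
        rw [← ofReal_sub, cnr]; exact hl (k+1) x a)
      rw [show ρ (k+1) / 2 = ρ k by rw [hρ2]; ring, ← hρ2 (k+1)] at h1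
      exact (pmq (Iop_sa _ _) h1 f).trans (le_of_eq (by ring))) N
  refine key.trans ?_
  have s1 := Iop_sumsq mono f (N+1)
  rw [Finset.sum_range_succ] at s1
  rw [← Finset.mul_sum]
  have s2 : 10 * cd d * (∑ k ∈ range (N+1), κ k / ρ k) * ‖f‖ ^ 2 ≤ 10 * cd d * c * ‖f‖ ^ 2 := by gcongr
  linarith [sq_nonneg ‖Iop (ρ N) (ρ (N+1)) f‖]
end N7b

section N7c
variable {d : ℕ}
variable {t r ρ : ℝ} {x : VV d}

def vb (d : ℕ) : ℝ := (volume (Metric.ball (0 : VV d) 1)).toReal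

lemma ball_CS {A : ℝ} (hA : 0 ≤ A) {h : VC d} (hh : Nice h) :
    ∫ x in closedBall (0 : VV d) A, ‖h x‖ ≤ √(A ^ d * vb d) * nn h := by
  have fin : IsFiniteMeasure ((volume : Measure (VV d)).restrict (closedBall 0 A)) :=
    ⟨by rw [Measure.restrict_apply_univ]; exact measure_closedBall_lt_top⟩
  have h2 : MemLp (fun x => ‖h x‖) (eR 2) ((volume : Measure (VV d)).restrict (closedBall 0 A)) := by
    have := hh.l.norm.restrict (closedBall 0 A)
    simpa using this
  have key := integral_mul_le_Lp_mul_Lq_of_nonneg (μ := (volume : Measure (VV d)).restrict (closedBall 0 A))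
    (p := 2) (q := 2) (f := fun _ => oR) (g := fun x => ‖h x‖) HolderConjugate.two_two
    (aea fun _ => zero_le_one) (aea fun _ => norm_nonneg _) (memLp_const 1) h2
  simp only [one_mul, Real.one_rpow, integral_const, smul_eq_mul, mul_one] at key
  refine key.trans ?_
  rw [← sqrt_eq_rpow, ← sqrt_eq_rpow]
  refine mul_le_mul (le_of_eq ?_) ?_ (sqrt_nonneg _) (sqrt_nonneg _)
  · rw [Measure.real, Measure.restrict_apply_univ, Measure.addHaar_closedBall _ _ hA, toReal_mul, toReal_ofReal pO, vb]
    simp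
  · refine sqrt_le_iff.2 ⟨nn_nonneg _, ?_⟩
    rw [nn_sq hh.l]
    simp only [Real.rpow_two]
    exact setIntegral_le_integral (hh.l.integrable_norm_pow nU) (aea fun _ => by positivity)

lemma OB_HS {a : VD d} (ha : BS a) {A B : ℝ} (hA : 0 ≤ A) (hB : 0 ≤ B) (hAB : A * B ≤ 1)
    (h1 : ∀ x ξ, ‖a x ξ‖ ≤ 1) (h0 : ∀ x ξ, a x ξ ≠ 0 → ‖x‖ ≤ A ∧ ‖ξ‖ ≤ B) : OB a (vb d) := by
  refine ⟨ha, fun h g hh hg => ?_⟩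
  have v0 : 0 ≤ vb d := toReal_nonneg
  have mA : MeasurableSet (closedBall (0 : VV d) A) := Metric.isClosed_closedBall.measurableSet
  have mB : MeasurableSet (closedBall (0 : VV d) B) := Metric.isClosed_closedBall.measurableSet
  have i1 := (hh.i.norm).indicator mA
  have i2 := (hg.i.norm).indicator mB
  have b1 : ‖BF a h g‖ ≤ ∫ z : VV d × VV d, (closedBall (0 : VV d) A).indicator (fun x => ‖h x‖) z.1 * (closedBall (0 : VV d) B).indicator (fun x => ‖g x‖) z.2 := by
    unfold BF
    refine (norm_integral_le_integral_norm _).trans ?_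
    refine integral_mono (BF_int ha hh.i hg.i).norm (i1.mul_prod i2) fun z => ?_
    simp only [norm_mul, ex_norm, mul_one]
    by_cases hz : a z.1 z.2 = 0
    · rw [hz, norm_zero, mul_zero, zero_mul]
      exact mul_nonneg (Set.indicator_nonneg (fun _ _ => norm_nonneg _) _) (Set.indicator_nonneg (fun _ _ => norm_nonneg _) _)
    · obtain ⟨ha1, hb1⟩ := h0 _ _ hz
      rw [indicator_of_mem (by simpa using ha1), indicator_of_mem (by simpa using hb1)]
      exact mlr (mul_le_of_le_one_right nN (h1 _ _)) nN
  refine b1.trans ?_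
  rw [show (volume : Measure (VV d × VV d)) = volume.prod volume from rfl, integral_prod_mul, integral_indicator mA, integral_indicator mB]
  refine (mul_le_mul (ball_CS hA hh) (ball_CS hB hg) (integral_nonneg fun _ => norm_nonneg _) (mul_nonneg (sqrt_nonneg _) (nn_nonneg _))).trans ?_
  have : √(A ^ d * vb d) * √(B ^ d * vb d) ≤ vb d := by
    rw [← sqrt_mul pO]
    refine sqrt_le_iff.2 ⟨v0, ?_⟩
    rw [show A ^ d * vb d * (B ^ d * vb d) = (A * B) ^ d * vb d ^ 2 by rw [mul_pow]; ring]
    exact mul_le_of_le_one_left pO (pow_le_one₀ pO hAB)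
  calc _ = √(A ^ d * vb d) * √(B ^ d * vb d) * (nn h * nn g) := by ring
    _ ≤ _ := mlr this (mul_nonneg (nn_nonneg _) (nn_nonneg _))

/-! the sharp set -/
def gt (t s : ℝ) : ℝ := t * (s / √(1 + s ^ 2))

lemma gt_anti {s s' : ℝ} (ht : 0 < t) (hr : 0 ≤ r) (hs : 0 ≤ s) (h : s ≤ s') (h' : gt t s' < r) : gt t s < r := by
  have h1 := (Rr_iff one_pos ht hr (hs.trans h)).2 h'
  refine (Rr_iff one_pos ht hr hs).1 (h1.trans_le ?_)
  gcongr

def aS (t : ℝ) (x ξ : VV d) : ℂ := if gt t (2 * rpi * ‖ξ‖) < ‖x‖ then 1 else 0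

lemma aS_meas (t : ℝ) : Measurable (fun z : VV d × VV d => aS t z.1 z.2) := by
  unfold aS gt
  refine Measurable.ite (measurableSet_lt ?_ ?_) mCst mCst
  · fun_prop
  · fun_prop

lemma aS_le (t : ℝ) (x ξ : VV d) : ‖aS t x ξ‖ ≤ 1 := by unfold aS; split_ifs <;> simp

lemma low_part (ht : 1 ≤ t) : OB (fun x ξ : VV d => aS t x ξ * (In 0 (1 / √t) ξ : ℂ)) (1 + vb d) := by
  have st : 0 < √t := sqrt_pos.2 lI
  have p0 := pi_pos
  have o1 := OB_pq (d := d) (p := fun _ => 1) (q := fun ξ => (In 0 (1 / √t) ξ : ℂ)) mCst (In_BM _ _).1 (fun _ => by simp) (In_norm _ _)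
  have hBS : BS (fun x ξ : VV d => (-1 + aS t x ξ) * (In 0 (1 / √t) ξ : ℂ)) :=
    ((BS.const (-1)).add ⟨aS_meas t, 1, aS_le t⟩).mul (BS.right (In_BM _ _))
  have o2 := OB_HS hBS (A := √t) (B := 1 / √t) st.le pO (by field_simp; exact le_rfl) (fun x ξ => by
      rw [norm_mul]
      refine mul_le_one₀ ?_ nN (In_norm _ _ _)
      unfold aS; split_ifs <;> simp) (fun x ξ hne => by
      have hI : (In 0 (1 / √t) ξ : ℂ) ≠ 0 := right_ne_zero_of_mul hne
      have ha : -1 + aS t x ξ ≠ 0 := left_ne_zero_of_mul hne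
      have hI' : 0 ≤ 2 * rpi * ‖ξ‖ ∧ 2 * rpi * ‖ξ‖ < 1 / √t := by
        by_contra hc; exact hI (by rw [In, if_neg hc]; simp)
      have ha' : ¬ gt t (2 * rpi * ‖ξ‖) < ‖x‖ := fun hc => ha (by rw [aS, if_pos hc]; simp)
      push Not at ha'
      constructor
      · refine ha'.trans ?_
        unfold gt
        have h1 : 2 * rpi * ‖ξ‖ / √(1 + (2 * rpi * ‖ξ‖) ^ 2) ≤ 2 * rpi * ‖ξ‖ := by
          refine div_le_self hI'.1 (Real.one_le_sqrt.2 ?_)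
          linarith [sq_nonneg (2 * rpi * ‖ξ‖)]
        calc _ ≤ t * (1 / √t) := mll (h1.trans hI'.2.le) lI
          _ = √t := by rw [mul_one_div, Real.div_sqrt]
      · have := hI'.2
        have h3 := pi_gt_three
        nlinarith [norm_nonneg ξ])
  refine (congrArg (fun f => OB f (1 + vb d)) ?_).mpr (o1.add o2)
  funext x ξ; ring

/-! profile functions -/
def mkk (ρ t : ℝ) (x : VV d) : ℝ := max 0 (min 1 ((rE (-1) - RV ρ t x) / (rE (-1) - rE (-4))))

lemma e14 : 1 / 4 ≤ rE (-1) - rE (-4) := by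
  have h1 : wR⁻¹ ^ 4 ≥ rE (-4) := by
    rw [show (-4:ℝ) = ((4:ℕ):ℝ) * (-1) by norm_num, exp_nat_mul, exp_neg]
    refine pow_le_pow_left₀ pO ?_ 4
    refine inv_anti₀ nU ?_
    have := add_one_le_exp oR; linarith
  have h2 : rE (-1) ≥ 0.36 := by
    have := Real.exp_neg_one_gt_d9; linarith
  norm_num at h1; linarith

lemma mkk_cont (ρ t : ℝ) : Continuous (mkk ρ t : VV d → ℝ) := by
  have := RV_cont (d := d) ρ t
  unfold mkk; fun_prop

lemma mkk_nonneg (ρ t : ℝ) (x : VV d) : 0 ≤ mkk ρ t x := le_max_left _ _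
lemma mkk_le (ρ t : ℝ) (x : VV d) : mkk ρ t x ≤ 1 := max_le zero_le_one (min_le_left _ _)

lemma mkk_lip (hρ : 0 < ρ) (ht : 0 < t) (x a : VV d) : |mkk ρ t (x + a) - mkk ρ t x| ≤ 48 / Dl ρ t * ‖a‖ := by
  have e := e14
  have e0 : 0 < rE (-1) - rE (-4) := by linarith
  unfold mkk
  refine (abs_max_sub_max_le_max _ _ _ _).trans ?_
  rw [sub_self, abs_zero, max_eq_right (abs_nonneg _)]
  refine (abs_min_sub_min_le_max _ _ _ _).trans ?_
  rw [sub_self, abs_zero, max_eq_right (abs_nonneg _), ← sub_div, abs_div, abs_of_pos e0, div_le_iff₀ e0]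
  have := RV_lip hρ ht x a
  rw [abs_sub_comm] at this
  rw [show rE (-1) - RV ρ t (x + a) - (rE (-1) - RV ρ t x) = RV ρ t x - RV ρ t (x + a) by ring]
  have D0 := Dl_pos hρ ht
  refine this.trans ?_
  calc 12 / Dl ρ t * ‖a‖ = 48 / Dl ρ t * ‖a‖ * (1 / 4) := by ring
    _ ≤ _ := mll e pO

lemma R_e1 (hρ : 0 < ρ) (ht : 0 < t) (hr : 0 ≤ r) : Rr ρ t r < rE (-1) ↔ gt t ρ < r := by
  have := Rr_iff hρ ht hr hρ.le
  rwa [div_self pO] at this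

lemma R_e4 (hρ : 0 < ρ) (ht : 0 < t) (hr : 0 ≤ r) : Rr ρ t r < rE (-4) ↔ gt t (2 * ρ) < r := by
  have := Rr_iff hρ ht hr (by positivity : 0 ≤ 2 * ρ)
  rwa [show (2 * ρ) ^ 2 / ρ ^ 2 = 4 by field_simp; norm_num] at this

lemma mkk_zero (hρ : 0 < ρ) (ht : 0 < t) (h : ¬ gt t ρ < ‖x‖) : mkk ρ t x = 0 := by
  rw [← R_e1 hρ ht nN] at h
  unfold mkk RV
  refine max_eq_left ((min_le_right _ _).trans ?_)
  have := e14
  exact div_nonpos_of_nonpos_of_nonneg lI lI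

lemma mkk_one (hρ : 0 < ρ) (ht : 0 < t) (h : gt t (2 * ρ) < ‖x‖) : mkk ρ t x = 1 := by
  rw [← R_e4 hρ ht nN] at h
  have := e14
  unfold mkk RV
  rw [min_eq_left, max_eq_right zero_le_one]
  rw [le_div_iff₀ lI]; linarith

lemma mkk_mul {ρ' : ℝ} (hρ : 0 < ρ) (hρ' : 2 * ρ ≤ ρ') (ht : 0 < t) (x : VV d) : mkk ρ t x * mkk ρ' t x = mkk ρ' t x := by
  by_cases h : gt t ρ' < ‖x‖
  · rw [mkk_one hρ ht (gt_anti ht nN lI hρ' h), one_mul]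
  · rw [mkk_zero lI ht h, mul_zero]

lemma E_iff (hρ : 0 < ρ) (ht : 0 < t) (hr : 0 ≤ r) : r ∈ Eset ρ t ↔ gt t ρ < r ∧ ¬ gt t (2 * ρ) < r := by
  rw [← R_e1 hρ ht hr, ← R_e4 hρ ht hr, not_lt]
  exact and_comm

lemma E_tel (hρ : 0 < ρ) (ht : 0 < t) (hr : 0 ≤ r) :
    (Eset ρ t).indicator (1 : ℝ → ℝ) r = (if gt t ρ < r then 1 else 0) - (if gt t (2 * ρ) < r then 1 else 0) := by
  have e := E_iff hρ ht hr
  by_cases h1 : gt t ρ < r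
  · by_cases h2 : gt t (2 * ρ) < r
    · rw [indicator_of_notMem (fun h => (e.1 h).2 h2), if_pos h1, if_pos h2]; simp
    · rw [indicator_of_mem (e.2 ⟨h1, h2⟩), if_pos h1, if_neg h2]; simp
  · have h2 : ¬ gt t (2 * ρ) < r := fun h => h1 (gt_anti ht hr hρ.le lI h)
    rw [indicator_of_notMem (fun h => h1 (e.1 h).1), if_neg h1, if_neg h2]; simp

/-- the pointwise decomposition on a dyadic block -/
lemma block_dec (hρ : 0 < ρ) (ht : 0 < t) (x ξ : VV d) :
    aS t x ξ * (In ρ (2 * ρ) ξ : ℂ) =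
      (Eset ρ t).indicator 1 ‖x‖ * ((Eset ρ t).indicator 1 ‖x‖ * (if Rr ρ t ‖x‖ < GG (ρ ^ 2 / 4) ξ then 1 else 0) * (Qset ρ).indicator 1 ξ) * (In ρ (2 * ρ) ξ : ℂ)
      + ((mkk ρ t x : ℂ) * (In ρ (2 * ρ) ξ : ℂ) + -1 * (((Eset ρ t).indicator 1 ‖x‖ * mkk ρ t x) * 1 * (In ρ (2 * ρ) ξ : ℂ))) := by
  by_cases hQ : ρ ≤ 2 * rpi * ‖ξ‖ ∧ 2 * rpi * ‖ξ‖ < 2 * ρ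
  · have hI : In ρ (2 * ρ) ξ = 1 := by rw [In, if_pos hQ]
    have hQ' : ξ ∈ (Qset ρ : Set (VV d)) := hQ
    have s0 : 0 ≤ 2 * rpi * ‖ξ‖ := by positivity
    have hR : (Rr ρ t ‖x‖ < GG (ρ ^ 2 / 4) ξ) ↔ gt t (2 * rpi * ‖ξ‖) < ‖x‖ := by
      rw [GG_qq hρ]; exact Rr_iff hρ ht nN s0
    rw [hI, indicator_of_mem hQ']
    simp only [hR]
    by_cases hE : ‖x‖ ∈ Eset ρ t
    · rw [indicator_of_mem hE]; unfold aS; simp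
    · rw [indicator_of_notMem hE]
      rw [E_iff hρ ht nN] at hE
      unfold aS
      by_cases h1 : gt t ρ < ‖x‖
      · have h2 : gt t (2 * ρ) < ‖x‖ := by by_contra h; exact hE ⟨h1, h⟩
        rw [mkk_one hρ ht h2, if_pos (gt_anti ht nN s0 hQ.2.le h2)]; simp
      · rw [mkk_zero hρ ht h1, if_neg fun h => h1 (gt_anti ht nN hρ.le hQ.1 h)]; simp
  · have hI : In ρ (2 * ρ) ξ = 0 := by rw [In, if_neg hQ]
    rw [hI]; simp
end N7c

section N7d
variable {d : ℕ}
variable {t : ℝ}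

lemma Lam_bd {ρ : ℝ} (hρ : 0 < ρ) (hρt : ρ ≤ t) (h1 : 1 ≤ t * ρ ^ 2) (ht : 0 < t) :
    1 ≤ Dl ρ t * ρ ∧ 1 / (Dl ρ t * ρ) ≤ 1 / (t * ρ ^ 2) + ρ / t := by
  unfold Dl
  rcases le_total ρ 1 with h | h
  · rw [max_eq_left h]
    have e : t * ρ / 1 ^ 3 * ρ = t * ρ ^ 2 := by ring
    rw [e]
    exact ⟨h1, by have : 0 < ρ / t := by positivity
                  linarith⟩
  · rw [max_eq_right h]
    have e : t * ρ / ρ ^ 3 * ρ = t / ρ := by field_simp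
    rw [e]
    refine ⟨by rw [le_div_iff₀ hρ]; linarith, ?_⟩
    rw [one_div_div]
    have : 0 < 1 / (t * ρ ^ 2) := by positivity
    linarith

def rk (t : ℝ) (k : ℕ) : ℝ := 2 ^ k * (1 / √t)

lemma geo4 (N : ℕ) : ∑ k ∈ range N, 1 / (4:ℝ) ^ k ≤ 2 := by
  have : ∑ k ∈ range N, 1 / (4:ℝ) ^ k = 4 / 3 - (4 / 3) / 4 ^ N := by
    induction N with
    | zero => simp
    | succ n ih => rw [Finset.sum_range_succ, ih, pow_succ]; field_simp; ring
  rw [this]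
  have : zR < 4 / 3 / 4 ^ N := by positivity
  linarith

def Cst (d : ℕ) : ℝ := CB d + √(3 + 20 * cd d * 192) + 1

def Ccore (d : ℕ) : ℝ := 1 + vb d + Cst d

lemma Ccore_pos (d : ℕ) : 0 < Ccore d := by
  have := CB_nonneg d
  have := cd_pos d
  have : 0 ≤ vb d := toReal_nonneg
  have := sqrt_nonneg (3 + 20 * cd d * 192)
  unfold Ccore Cst; linarith

lemma dyad (hd : 1 ≤ d) (ht : 1 ≤ t) {N : ℕ} (hN : ∀ k < N, rk t k ≤ t) :
    OB (fun x ξ : VV d => aS t x ξ * (In (rk t 0) (rk t N) ξ : ℂ)) (Cst d) := by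
  have t0 : 0 < t := by linarith
  have st : 0 < √t := sqrt_pos.2 t0
  have r0 : ∀ k, 0 < rk t k := fun k => by unfold rk; positivity
  have r2 : ∀ k, rk t (k+1) = 2 * rk t k := fun k => by unfold rk; ring
  have mono : Monotone (rk t) := monotone_nat_of_le_succ fun k => by rw [r2]; linarith [r0 k]
  have r2' : ∀ j k, j < k → 2 * rk t j ≤ rk t k := fun j k h => by rw [← r2]; exact mono h
  have sqr : ∀ k, t * rk t k ^ 2 = 4 ^ k := fun k => by
    unfold rk
    rw [mul_pow, div_pow, sq_sqrt t0.le, ← pow_mul, mul_comm k 2, pow_mul]; field_simp; norm_num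
  have lam := fun k (hk : k < N) => Lam_bd (r0 k) (hN k hk) (by rw [sqr]; exact one_le_pow₀ nU) t0
  have tele : ∀ n ≤ N, ∑ k ∈ range n, rk t k / t ≤ 2 := fun n hn => by
    rw [← Finset.sum_div, div_le_iff₀ t0]
    have : ∑ k ∈ range n, rk t k = rk t n - rk t 0 := by
      rw [← Finset.sum_range_sub]
      refine Finset.sum_congr rfl fun k _ => ?_
      rw [r2]; ring
    rw [this]
    rcases n with _ | n
    · rw [sub_self]; linarith
    · rw [r2]; linarith [hN n (by omega), r0 0]
  have hκ : ∑ k ∈ range N, (48 / Dl (rk t k) t) / rk t k ≤ 192 := by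
    calc ∑ k ∈ range N, (48 / Dl (rk t k) t) / rk t k ≤ ∑ k ∈ range N, 48 * (1 / (4:ℝ) ^ k + rk t k / t) := by
          refine Finset.sum_le_sum fun k hk => ?_
          have := (lam k (Finset.mem_range.1 hk)).2
          rw [sqr] at this
          rw [div_div, show 48 / (Dl (rk t k) t * rk t k) = 48 * (1 / (Dl (rk t k) t * rk t k)) by ring]
          linarith
      _ ≤ 192 := by
          rw [← Finset.mul_sum, Finset.sum_add_distrib]
          linarith [geo4 N, tele N le_rfl]
  have o2 := stair_OB (d := d) r0 r2 (m := fun k => mkk (rk t k) t) (fun k => (mkk_cont _ _).measurable) (fun k => mkk_nonneg _ _) (fun k => mkk_le _ _)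
    (fun j k x h => mkk_mul (r0 j) (r2' j k h) t0 x) (κ := fun k => 48 / Dl (rk t k) t) (fun k => by have := Dl_pos (r0 k) t0; positivity)
    (fun k => mkk_lip (r0 k) t0) hκ nU
  have mE : ∀ k, Measurable fun x : VV d => (Eset (rk t k) t).indicator (1 : ℝ → ℂ) ‖x‖ := fun k => (measurable_one.indicator (Eset_m _ t)).comp measurable_norm
  have nE : ∀ k (x : VV d), ‖(Eset (rk t k) t).indicator (1 : ℝ → ℂ) ‖x‖‖ = (Eset (rk t k) t).indicator (1 : ℝ → ℝ) ‖x‖ := fun k x => by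
    by_cases h : ‖x‖ ∈ Eset (rk t k) t <;> simp [h]
  have nE0 : ∀ k (x : VV d), (Eset (rk t k) t).indicator (1 : ℝ → ℝ) ‖x‖ ≤ 1 := fun k x => by
    by_cases h : ‖x‖ ∈ Eset (rk t k) t <;> simp [h]
  have nE1 : ∀ k (x : VV d), ‖(Eset (rk t k) t).indicator (1 : ℝ → ℂ) ‖x‖‖ ≤ 1 := fun k x => by rw [nE]; exact nE0 k x
  have sE : ∀ x : VV d, ∑ k ∈ range N, ‖(Eset (rk t k) t).indicator (1 : ℝ → ℂ) ‖x‖‖ ^ 2 ≤ 1 := fun x => by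
    have : ∀ k ∈ range N, ‖(Eset (rk t k) t).indicator (1 : ℝ → ℂ) ‖x‖‖ ^ 2 ≤
        -(if gt t (rk t (k+1)) < ‖x‖ then 1 else 0) - -(if gt t (rk t k) < ‖x‖ then oR else 0) := fun k _ => by
      rw [r2]
      refine (pow_le_of_le_one nN (nE1 k x) two_ne_zero).trans ?_
      rw [nE, E_tel (r0 k) t0 nN]; linarith
    refine (Finset.sum_le_sum this).trans ?_
    rw [Finset.sum_range_sub (fun k => -(if gt t (rk t k) < ‖x‖ then oR else 0))]
    split_ifs <;> norm_num
  have sI : ∀ (ξ : VV d) n, ∑ k ∈ range n, In (rk t k) (rk t (k+1)) ξ = In (rk t 0) (rk t n) ξ := fun ξ n => by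
    induction n with
    | zero => rw [Finset.range_zero, Finset.sum_empty, In, if_neg]; rintro ⟨a, b⟩; linarith
    | succ n ih => rw [Finset.sum_range_succ, ih, In_add (mono (Nat.zero_le n)) (mono (Nat.le_succ n))]
  have sQ : ∀ ξ : VV d, ∑ k ∈ range N, ‖(In (rk t k) (rk t (k+1)) ξ : ℂ)‖ ^ 2 ≤ 1 := fun ξ => by
    have : ∀ k ∈ range N, ‖(In (rk t k) (rk t (k+1)) ξ : ℂ)‖ ^ 2 = In (rk t k) (rk t (k+1)) ξ := fun k _ => by
      rw [cnr, rno (In_nonneg _ _ _), sq, In_sq]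
    rw [Finset.sum_congr rfl this, sI]
    unfold In; split_ifs <;> norm_num
  have o1 := OB_diag (d := d) (N := N) (CB_nonneg d) (fun k hk => block_OB hd (r0 k) t0 (lam k hk).1) mE nE1 sE
    (q := fun k ξ => (In (rk t k) (rk t (k+1)) ξ : ℂ)) (fun k => (In_BM _ _).1) (fun k => In_norm _ _) sQ
  have mkn : ∀ k (x : VV d), ‖(mkk (rk t k) t x : ℂ)‖ ≤ 1 := fun k x => by
    rw [cnr, rno (mkk_nonneg _ _ _)]; exact mkk_le _ _ _
  have o3 := OB_diag (d := d) (N := N) zero_le_one (fun k hk => OB_one) (p := fun k x => (Eset (rk t k) t).indicator (1 : ℝ → ℂ) ‖x‖ * (mkk (rk t k) t x : ℂ))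
    (fun k => (mE k).mul (Complex.measurable_ofReal.comp (mkk_cont _ _).measurable))
    (fun k x => by rw [norm_mul]; exact mul_le_one₀ (nE1 k x) nN (mkn k x))
    (fun x => (Finset.sum_le_sum fun k _ => by
      rw [norm_mul]
      exact pow_le_pow_left₀ (mul_nonneg nN nN) (mul_le_of_le_one_right nN (mkn k x)) 2).trans (sE x))
    (q := fun k ξ => (In (rk t k) (rk t (k+1)) ξ : ℂ)) (fun k => (In_BM _ _).1) (fun k => In_norm _ _) sQ
  have tot := (o1.add (o2.add (o3.smul (-1)))).nonneg_mono (C' := Cst d) (by unfold Cst; rw [norm_neg, norm_one]; linarith)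
  refine (congrArg (fun f => OB f (Cst d)) ?_).mpr tot
  funext x ξ
  rw [← sI ξ N, Complex.ofReal_sum, Finset.mul_sum, Finset.mul_sum, ← Finset.sum_add_distrib, ← Finset.sum_add_distrib]
  refine Finset.sum_congr rfl fun k _ => ?_
  rw [r2]
  exact block_dec (r0 k) t0 x ξ

theorem core (hd : 1 ≤ d) (ht : 1 ≤ t) : OB (fun x ξ : VV d => aS t x ξ * (In 0 t ξ : ℂ)) (Ccore d) := by
  have t0 : 0 < t := by linarith
  have st : 0 < √t := sqrt_pos.2 t0
  have ex : ∃ N, t ≤ rk t N := by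
    obtain ⟨n, hn⟩ := pow_unbounded_of_one_lt (t * √t) (one_lt_two : oR < 2)
    refine ⟨n, ?_⟩
    unfold rk; rw [mul_one_div, le_div_iff₀ st]; exact hn.le
  classical
  have hN := Nat.find_spec ex
  have hN' := fun k (hk : k < Nat.find ex) => (not_le.1 (Nat.find_min ex hk)).le
  set N := Nat.find ex
  have o := (low_part (d := d) ht).add (dyad hd ht hN')
  have o' := o.lr (Ccore_pos d).le (p := fun _ => 1) (q := fun ξ => (In 0 t ξ : ℂ)) mCst (In_BM _ _).1 (fun _ => by simp) (In_norm _ _)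
  refine (congrArg (fun f => OB f (Ccore d)) ?_).mpr o'
  funext x ξ
  have r00 : rk t 0 = 1 / √t := by unfold rk; simp
  rw [r00, ← mul_add, ← Complex.ofReal_add, In_add pO, one_mul, mul_assoc, ← Complex.ofReal_mul]
  · congr 2
    unfold In
    by_cases h : 0 ≤ 2 * rpi * ‖ξ‖ ∧ 2 * rpi * ‖ξ‖ < t
    · rw [if_pos h, if_pos ⟨h.1, h.2.trans_le hN⟩, mul_one]
    · rw [if_neg h, mul_zero]
  · rw [← r00]; unfold rk; gcongr; · norm_num
    · exact Nat.zero_le _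
end N7d

section N8a
open scoped FourierTransform SchwartzMap ContDiff
variable {d : ℕ}
variable {g : VC d}

lemma dual_bound {b : VD d} {C : ℝ} (hb : OB b C) (hC : 0 ≤ C) (hg : Nice g) :
    eLpNorm (fun x => ∫ ζ, b x ζ * ex x ζ * g ζ) 2 volume ≤ eR (C * nn g) := by
  obtain ⟨⟨hm, c, hc⟩, hB⟩ := hb
  set u : VC d := fun x => ∫ ζ, b x ζ * ex x ζ * g ζ with hu
  have um : Measurable u := by
    have : StronglyMeasurable (fun z : VV d × VV d => b z.1 z.2 * ex z.1 z.2 * g z.2) :=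
      ((hm.mul ex_cont.measurable).mul (hg.m.comp measurable_snd)).stronglyMeasurable
    exact (this.integral_prod_right (ν := (volume : Measure (VV d)))).measurable
  have ub : ∀ x, ‖u x‖ ≤ ∫ ζ, c * ‖g ζ‖ := fun x => by
    refine norm_integral_le_of_norm_le (hg.i.norm.const_mul c) (aea fun ζ => ?_)
    rw [norm_mul, norm_mul, ex_norm, mul_one]
    exact mlr (hc _ _) nN
  let s : ℕ → Set (VV d) := fun n => closedBall 0 n
  have sm : ∀ n, MeasurableSet (s n) := fun n => Metric.isClosed_closedBall.measurableSet
  have sf : ∀ n, volume (s n) ≠ ⊤ := fun n => measure_closedBall_lt_top.ne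
  let h : ℕ → VC d := fun n => (s n).indicator (fun x => cjj (u x))
  have hN : ∀ n, Nice (h n) := fun n => by
    have m : Measurable (h n) := (continuous_conj.measurable.comp um).indicator (sm n)
    have key : ∀ p : ℝ≥0∞, MemLp (h n) p volume := fun p => by
      refine MemLp.mono (memLp_indicator_const p (sm n) (∫ ζ, c * ‖g ζ‖) (Or.inr (sf n))) m.aestronglyMeasurable (aea fun x => ?_)
      rw [norm_indicator_eq_indicator_norm, norm_indicator_eq_indicator_norm]
      refine indicator_le_indicator ?_
      rw [norm_conj]
      exact (ub x).trans (le_abs_self _)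
    exact ⟨m, memLp_one_iff_integrable.1 (key 1), key 2⟩
  have hb2 : ∀ n, nn (h n) ≤ C * nn g := fun n => by
    have e : BF b (h n) g = (oC (nn (h n) ^ 2)) := by
      rw [BF_iter ⟨hm, c, hc⟩ (hN n).i hg.i, nn_sq (hN n).l, ← integral_complex_ofReal]
      refine ica (aea fun x => ?_)
      show h n x * u x = (oC (‖h n x‖ ^ 2))
      by_cases hx : x ∈ s n
      · have : h n x = cjj (u x) := indicator_of_mem hx _
        rw [this, norm_conj, mul_comm, mul_conj, normSq_eq_norm_sq]
      · have : h n x = 0 := indicator_of_notMem hx _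
        rw [this]; simp
    have h1 := hB (h n) g (hN n) hg
    rw [e, cnr, rno (sq_nonneg _)] at h1
    rcases (nn_nonneg (h n)).eq_or_lt with h0 | h0
    · rw [← h0]; exact mul_nonneg hC (nn_nonneg _)
    · refine le_of_mul_le_mul_left ?_ h0
      linarith
  have hb3 : ∀ n, eLpNorm ((s n).indicator u) 2 volume ≤ eR (C * nn g) := fun n => by
    have e : eLpNorm ((s n).indicator u) 2 volume = eLpNorm (h n) 2 volume := by
      refine eLpNorm_congr_norm_ae (aea fun x => ?_)
      rw [norm_indicator_eq_indicator_norm, norm_indicator_eq_indicator_norm]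
      simp only [norm_conj]
    rw [e, ← ENNReal.ofReal_toReal (hN n).l.2.ne]
    exact ofReal_le_ofReal (hb2 n)
  refine (Lp.eLpNorm_lim_le_liminf_eLpNorm (f := fun n => (s n).indicator u) (fun n => (um.indicator (sm n)).aestronglyMeasurable) u (aea fun x => ?_)).trans ?_
  · refine tendsto_const_nhds.congr' ?_
    obtain ⟨N, hN⟩ := exists_nat_ge ‖x‖
    filter_upwards [eventually_ge_atTop N] with n hn
    refine (indicator_of_mem ?_ _).symm
    have : (N:ℝ) ≤ n := by exact_mod_cast hn
    show x ∈ closedBall 0 (n:ℝ)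
    rw [mem_closedBall_zero_iff]; linarith
  · exact liminf_le_of_frequently_le' (Frequently.of_forall hb3)

lemma FT_ex (φ : VC d) (x : VV d) :
    ∫ y : VV d, cE (-(iI * (oC (⟪y, x⟫)))) * φ (tPi⁻¹ • y)
      = (oC (tPi ^ d)) * 𝓕 φ x := by
  have p : zR < 2 * rpi := by positivity
  have := Measure.integral_comp_smul (volume : Measure (VV d)) (fun y => cE (-(iI * (oC (⟪y, x⟫)))) * φ (tPi⁻¹ • y)) tPi
  rw [finrank_euclideanSpace_fin, abs_of_nonneg pO] at this
  have e : 𝓕 φ x = (tPi ^ d)⁻¹ • ∫ y : VV d, cE (-(iI * (oC (⟪y, x⟫)))) * φ (tPi⁻¹ • y) := by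
    rw [← this, Real.fourier_eq']
    refine ica (aea fun ξ => ?_)
    simp only [smul_eq_mul]
    rw [smul_smul, inv_mul_cancel₀ p.ne', one_smul, inner_smul_left]
    congr 2
    simp; ring
  rw [e, real_smul, ← mul_assoc, ← Complex.ofReal_mul, mul_inv_cancel₀ pO, Complex.ofReal_one, one_mul]

lemma G_eq {f : VC d} (hf : MemLp f 2 volume) (hG : MemLp (fun ζ : VV d => g (tPi • ζ)) 2 volume)
    (hfg : ∀ ψ : 𝓢(VV d, ℂ), ∫ ξ, g ξ * ψ ξ = ∫ x, f x * ∫ y : VV d, cE (-(iI * (oC (⟪y, x⟫)))) * ψ y) :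
    eLpNorm (fun ζ : VV d => g (tPi • ζ)) 2 volume = eLpNorm f 2 volume := by
  have p : zR < 2 * rpi := by positivity
  have key : ∀ᵐ ζ, (FL d hf.toLp : VC d) ζ = g (tPi • ζ) := by
    refine ae_eq_of_integral_contDiff_smul_eq ((Lp.memLp _).locallyIntegrable nU)
      (hG.locallyIntegrable nU) fun φ hφ hφc => ?_
    let Φ : 𝓢(VV d, ℂ) := (hφc.comp_left (g := fun r : ℝ => (r : ℂ)) (by simp)).toSchwartzMap
      (ofRealCLM.contDiff.comp hφ)
    have hΦ : ∀ x, Φ x = (φ x : ℂ) := fun x => rfl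
    have hφ2 : ContDiff ℝ ∞ (fun y : VV d => φ (tPi⁻¹ • y)) := hφ.comp (contDiff_const_smul _)
    have hφc2 : HasCompactSupport (fun y : VV d => φ (tPi⁻¹ • y)) :=
      hφc.comp_homeomorph (Homeomorph.smulOfNeZero tPi⁻¹ (inv_pos.2 p).ne')
    let Ψ : 𝓢(VV d, ℂ) := (hφc2.comp_left (g := fun r : ℝ => (r : ℂ)) (by simp)).toSchwartzMap
      (ofRealCLM.contDiff.comp hφ2)
    have hΨ : ∀ x, Ψ x = Φ (tPi⁻¹ • x) := fun x => rfl
    have h1 := congrArg (fun T => T Φ) (Lp.fourier_toTemperedDistribution_eq hf.toLp)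
    simp only [TemperedDistribution.fourier_apply, Lp.toTemperedDistribution_apply, smul_eq_mul] at h1
    have h2 := hfg Ψ
    simp only [hΨ, FT_ex] at h2
    have h3 := Measure.integral_comp_smul (volume : Measure (VV d)) (fun ξ => g ξ * Φ (tPi⁻¹ • ξ)) tPi
    rw [finrank_euclideanSpace_fin, abs_of_nonneg pO, h2] at h3
    simp only [smul_smul, inv_mul_cancel₀ p.ne', one_smul] at h3
    have e1 : ∫ x, φ x • g (tPi • x) = ∫ x, g (tPi • x) * Φ x :=
      ica (aea fun x => by simp only [hΦ, real_smul]; ring)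
    rw [e1, h3]
    have e2 : ∫ x, φ x • (FL d hf.toLp : VC d) x = ∫ x, Φ x * (FL d hf.toLp : VC d) x :=
      ica (aea fun x => by simp only [hΦ, real_smul])
    refine e2.trans (Eq.trans h1.symm ?_)
    rw [real_smul, ← icm]
    refine ica ?_
    filter_upwards [hf.coeFn_toLp] with x hx
    rw [hx, SchwartzMap.fourier_coe]
    have : (oC (tPi ^ d)) ≠ 0 := Complex.ofReal_ne_zero.2 pO
    rw [Complex.ofReal_inv]
    field_simp
  rw [← eLpNorm_congr_ae key]
  have h4 : ‖FL d hf.toLp‖ = ‖hf.toLp‖ := (FL d).norm_map _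
  rw [Lp.norm_toLp, Lp.norm_def] at h4
  exact (ENNReal.toReal_eq_toReal_iff' (Lp.eLpNorm_lt_top _).ne hf.2.ne).1 h4

end N8a

section N8b
open scoped FourierTransform SchwartzMap ContDiff
variable {d : ℕ}
variable {g : VC d} {C : ℝ} {χ : VV d → ℝ}

lemma G_mem (hg : MemLp g 2 volume) : MemLp (fun ζ : VV d => g (tPi • ζ)) 2 volume := by
  have p : tPi ≠ 0 := by positivity
  have h := Measure.map_addHaar_smul (volume : Measure (VV d)) p
  refine MemLp.comp_of_map (f := fun ζ : VV d => tPi • ζ) (g := g) ?_ (measurable_const_smul _).aemeasurable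
  rw [h]
  exact hg.smul_measure ofReal_ne_top

lemma OpF_resc (a : VC d) (g : VC d) (x : VV d) :
    (oC (tPi ^ d))⁻¹ * ∫ ξ : VV d, cE (iI * (oC (⟪x, ξ⟫))) * a ξ * g ξ
      = ∫ ζ, a (tPi • ζ) * ex x ζ * g (tPi • ζ) := by
  have := Measure.integral_comp_smul (volume : Measure (VV d)) (fun ξ => cE (iI * (oC (⟪x, ξ⟫))) * a ξ * g ξ) tPi
  rw [finrank_euclideanSpace_fin, abs_of_nonneg pO, real_smul, Complex.ofReal_inv] at this
  rw [← this]
  refine ica (aea fun ζ => ?_)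
  simp only [ex, inner_smul_right]
  rw [mul_comm iI]
  ring

lemma red {a : VD d} {R : ℝ} (hb : OB (fun x ζ => a x (tPi • ζ)) C) (hC : 0 ≤ C)
    (hs : ∀ x ζ, R < ‖ζ‖ → a x (tPi • ζ) = 0) {f : VC d} (hf : MemLp f 2 volume) (hg : MemLp g 2 volume)
    (hfg : ∀ ψ : 𝓢(VV d, ℂ), ∫ ξ, g ξ * ψ ξ = ∫ x, f x * ∫ y : VV d, cE (-(iI * (oC (⟪y, x⟫)))) * ψ y) :
    eLpNorm (fun x => (oC (tPi ^ d))⁻¹ * ∫ ξ : VV d, cE (iI * (oC (⟪x, ξ⟫))) * a x ξ * g ξ) 2 volume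
      ≤ eR C * eLpNorm f 2 volume := by
  have hG := G_mem hg
  rw [← G_eq hf hG hfg]
  set G : VC d := fun ζ : VV d => g (tPi • ζ) with hGd
  let B : Set (VV d) := closedBall 0 R
  have mB : MeasurableSet B := Metric.isClosed_closedBall.measurableSet
  have fB : volume B ≠ ⊤ := measure_closedBall_lt_top.ne
  let G' : VC d := B.indicator (hG.1.mk G)
  have hmk : MemLp (hG.1.mk G) 2 volume := hG.ae_eq hG.1.ae_eq_mk
  have l2 : MemLp G' 2 volume := hmk.indicator mB
  have hN : Nice G' := by
    refine ⟨hG.1.stronglyMeasurable_mk.measurable.indicator mB, ?_, l2⟩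
    rw [integrable_indicator_iff mB]
    have : IsFiniteMeasure ((volume : Measure (VV d)).restrict B) := ⟨by rw [Measure.restrict_apply_univ]; exact fB.lt_top⟩
    exact (hmk.restrict B).integrable nU
  have e : (fun x => (oC (tPi ^ d))⁻¹ * ∫ ξ : VV d, cE (iI * (oC (⟪x, ξ⟫))) * a x ξ * g ξ)
      = fun x => ∫ ζ, a x (tPi • ζ) * ex x ζ * G' ζ := by
    funext x
    rw [OpF_resc]
    refine ica ?_
    filter_upwards [hG.1.ae_eq_mk] with ζ hζ
    by_cases h : ζ ∈ B
    · have : G' ζ = G ζ := (indicator_of_mem h _).trans hζ.symm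
      rw [this]
    · have h' : R < ‖ζ‖ := by
        rw [mem_closedBall_zero_iff] at h; exact not_le.1 h
      rw [hs x ζ h']; simp
  rw [e]
  refine (dual_bound hb hC hN).trans ?_
  rw [ENNReal.ofReal_mul hC]
  refine mul_le_mul_right ?_ _
  rw [nn, ENNReal.ofReal_toReal l2.2.ne, eLpNorm_congr_ae hG.1.ae_eq_mk]
  exact eLpNorm_indicator_le _

lemma chi_inv (h1 : ContDiff ℝ ∞ χ) (h2 : HasCompactSupport χ) :
    ∃ F : VC d, Measurable F ∧ Integrable F volume ∧ ∀ y, (χ y : ℂ) = ∫ η, ex y η * F η := by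
  let Φ : 𝓢(VV d, ℂ) := (h2.comp_left (g := fun r : ℝ => (r : ℂ)) (by simp)).toSchwartzMap
      (ofRealCLM.contDiff.comp h1)
  let Ψ : 𝓢(VV d, ℂ) := 𝓕 Φ
  refine ⟨Ψ, Ψ.continuous.measurable, Ψ.integrable, fun y => ?_⟩
  have : 𝓕⁻ Ψ = Φ := FourierTransform.fourierInv_fourier_eq Φ
  have h := congrArg (fun T : 𝓢(VV d, ℂ) => T y) this
  beta_reduce at h
  rw [SchwartzMap.fourierInv_coe, finv_eq] at h
  exact h.symm

lemma main_OB (hd : 1 ≤ d) {t : ℝ} (ht : 1 ≤ t) {q : VC d} (hq : Measurable q) {K : ℝ} (hK : 0 < K)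
    (hqK : ∀ ζ, ‖q ζ‖ ≤ K) (hs : ∀ ζ, t ≤ 2 * rpi * ‖ζ‖ → q ζ = 0) :
    OB (fun x ζ : VV d => aS t x ζ * q ζ) (K * Ccore d) := by
  have h := ((core hd ht).lr (Ccore_pos d).le (p := fun _ => 1) (q := fun ζ => (K:ℂ)⁻¹ * q ζ) mCst fP
    (fun _ => by simp) (fun ζ => by
      rw [norm_mul, norm_inv, cnr, rno hK.le, inv_mul_le_iff₀ hK, mul_one]
      exact hqK ζ)).smul (K : ℂ)
  rw [cnr, rno hK.le] at h
  refine (congrArg (fun f => OB f (K * Ccore d)) ?_).mpr h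
  funext x ζ
  have hK' : (K:ℂ) ≠ 0 := Complex.ofReal_ne_zero.2 hK.ne'
  by_cases hz : t ≤ 2 * rpi * ‖ζ‖
  · rw [hs ζ hz]; simp
  · have : In 0 t ζ = 1 := if_pos ⟨by positivity, not_le.1 hz⟩
    rw [this]; field_simp; simp

lemma ex_meas {Y : Type*} [MeasurableSpace Y] {f g : Y → VV d} (hf : Measurable f) (hg : Measurable g) :
    Measurable fun y => ex (f y) (g y) := by
  have h : Measurable (fun z : VV d × VV d => ex z.1 z.2) := ex_cont.measurable
  exact Measurable.comp (g := fun z : VV d × VV d => ex z.1 z.2) (f := fun y => (f y, g y)) h (hf.prodMk hg)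

lemma pm_OB {b : VD d} (hb : OB b C) (hC : 0 ≤ C) {F : VC d} (hF : Measurable F)
    (hFi : Integrable F volume) (hχ : ∀ y, (χ y : ℂ) = ∫ η, ex y η * F η) (hχc : Continuous χ) (hχb : ∃ K, ∀ y, ‖χ y‖ ≤ K)
    (T : ℝ) {w : VV d → VV d} (hw : Measurable w) :
    OB (fun x ζ => (χ (T • (x + w ζ)) : ℂ) * b x ζ) (C * ∫ η, ‖F η‖) := by
  obtain ⟨⟨hm, c, hc⟩, _⟩ := id hb
  rw [← icm]
  refine OB_integral (Y := VV d) (μ := volume) (a := fun η x ζ => (F η) * (ex (T • x) η * b x ζ * ex (T • w ζ) η)) (n := fun η => c * ‖F η‖) ?_ (hFi.norm.const_mul c) ?_ (hFi.norm.const_mul C) ?_ ?_ ?_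
  · have m1 : Measurable fun z : VV d × (VV d × VV d) => ex (T • z.2.1) z.1 := ex_meas ((measurable_fst.comp measurable_snd).const_smul T) measurable_fst
    have m2 : Measurable fun z : VV d × (VV d × VV d) => ex (T • w z.2.2) z.1 := ex_meas ((hw.comp (measurable_snd.comp measurable_snd)).const_smul T) measurable_fst
    have m3 : Measurable fun z : VV d × (VV d × VV d) => b z.2.1 z.2.2 := hm.comp measurable_snd
    exact (hF.comp measurable_fst).mul ((m1.mul m3).mul m2)
  · refine aea fun η x ζ => ?_
    rw [norm_mul, norm_mul, norm_mul, ex_norm, ex_norm, one_mul, mul_one, mul_comm]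
    exact mlr (hc _ _) nN
  · refine aea fun η => ?_
    have m1 : Measurable fun z : VV d => ex (T • z) η := ex_meas (measurable_id.const_smul T) mCst
    have m2 : Measurable fun z : VV d => ex (T • w z) η := ex_meas (hw.const_smul T) mCst
    have := (hb.lr hC (p := fun x => ex (T • x) η) (q := fun x => ex (T • w x) η) m1 m2 (fun x => (ex_norm _ _).le) (fun x => (ex_norm _ _).le)).smul (F η)
    rw [mul_comm] at this
    exact this
  · obtain ⟨K, hK⟩ := hχb
    refine BS.mul ⟨?_, K, fun x ζ => ?_⟩ hb.1
    · have : Measurable fun z : VV d × VV d => χ (T • (z.1 + w z.2)) := hχc.measurable.comp ((measurable_fst.add (hw.comp measurable_snd)).const_smul T)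
      exact Complex.measurable_ofReal.comp this
    · rw [cnr]; exact hK _
  · intro x ζ
    rw [hχ, ← integral_mul_const]
    refine ica (aea fun η => ?_)
    simp only []
    rw [smul_add, ex_add]
    ring

end N8b


section N9
variable {d : ℕ}
variable {t : ℝ}

lemma aKG_eq (χ : Euc d → ℝ) (ε : ℝ) (ht : 0 < t) (x ζ : Euc d) :
    aKG χ ε t x (tPi • ζ) = aS t x ζ * (oC (χ ((t ^ ε)⁻¹ • (tPi • ζ)))) := by
  have p : ‖tPi • ζ‖ = 2 * rpi * ‖ζ‖ := by
    rw [norm_smul, rno pO]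
  unfold aKG aS gt jap
  rw [abs_of_pos ht, p]

lemma aKGpm_eq (χ : Euc d → ℝ) (δ ε s : ℝ) (ht : 0 < t) (x ζ : Euc d) :
    aKGpm χ δ ε s t x (tPi • ζ) =
      (oC (χ ((t ^ (oR/2 + δ))⁻¹ • (x + (s * t / jap (tPi • ζ)) • (tPi • ζ))))) *
        aKG χ ε t x (tPi • ζ) := by
  unfold aKGpm aKG
  rw [abs_of_pos ht, mul_assoc]

lemma chi_facts {χ : Euc d → ℝ} (h : Continuous χ) (hc : HasCompactSupport χ) :
    ∃ K M : ℝ, 0 < K ∧ (∀ y, ‖χ y‖ ≤ K) ∧ 0 < M ∧ ∀ y, M < ‖y‖ → χ y = 0 := by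
  obtain ⟨K, hK⟩ := h.bounded_above_of_compact_support hc
  obtain ⟨M, hM⟩ := hc.isCompact.isBounded.exists_norm_le
  refine ⟨max K 1, max M 1, by positivity, fun y => (hK y).trans (le_max_left _ _), by positivity, fun y hy => ?_⟩
  by_contra h0
  have := hM y (subset_tsupport _ h0)
  exact absurd (le_max_left M 1) lI

end N9

/-- Lemma 5.1: the Klein–Gordon truncation operators `A(t)`, `A_±(t)`
are bounded on `L²`, uniformly for `t > t₀ ≫ 1`. An `L²` function `f` is fed to the
operator through any representative `g` of its Fourier transform. -/
theorem statement14
    (d : ℕ) (hd : 1 ≤ d)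
    (δ : ℝ) (hδ0 : 0 < δ) (hδ1 : δ < 1/2) (ε : ℝ) (hε0 : 0 < ε) (hε1 : ε < 1)
    (χ : Euc d → ℝ) (hχsm : ContDiff ℝ (⊤ : ℕ∞) χ) (hχc : HasCompactSupport χ)
    (hχrad : IsRadial χ) (hχ1 : EqOneNearZero χ) :
    ∃ C t₀ : ℝ, 0 < C ∧ 1 ≤ t₀ ∧ ∀ t : ℝ, t₀ < t →
      ∀ f g : Euc d → ℂ, MemLp f 2 (volume : Measure (Euc d)) →
        MemLp g 2 (volume : Measure (Euc d)) → IsFourierTransformOf f g →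
        (eLpNorm (OpF (aKG χ ε t) g) 2 (volume : Measure (Euc d))
            ≤ ENNReal.ofReal C * eLpNorm f 2 (volume : Measure (Euc d))) ∧
        (eLpNorm (OpF (aKGpm χ δ ε 1 t) g) 2 (volume : Measure (Euc d))
            ≤ ENNReal.ofReal C * eLpNorm f 2 (volume : Measure (Euc d))) ∧
        (eLpNorm (OpF (aKGpm χ δ ε (-1) t) g) 2 (volume : Measure (Euc d))
            ≤ ENNReal.ofReal C * eLpNorm f 2 (volume : Measure (Euc d))) := by
  have hcont : Continuous χ := hχsm.continuous
  obtain ⟨K, M, hK, hχK, hM, hχM⟩ := chi_facts hcont hχc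
  obtain ⟨F, hF, hFi, hinv⟩ := chi_inv hχsm hχc
  have hev : ∀ᶠ t : ℝ in atTop, M < t ^ (1 - ε) := (tendsto_rpow_atTop lI).eventually_gt_atTop M
  obtain ⟨t₁, ht₁⟩ := eventually_atTop.1 hev
  have hC0 := Ccore_pos d
  have hI : 0 ≤ ∫ η, ‖F η‖ := integral_nonneg fun _ => norm_nonneg _
  have hKC : 0 < K * Ccore d := mul_pos hK hC0
  refine ⟨K * Ccore d * (1 + ∫ η, ‖F η‖), max t₁ 1, mul_pos hKC lI, le_max_right _ _, fun t ht f g hf hg hfg => ?_⟩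
  have t1 : 1 ≤ t := (le_max_right _ _).trans ht.le
  have t0 : 0 < t := by linarith
  have p : zR < 2 * rpi := by positivity
  have hMt : M * t ^ ε < t := by
    have h := ht₁ t ((le_max_left _ _).trans ht.le)
    have e : t ^ (1 - ε) * t ^ ε = t := by rw [← rpow_add t0]; simp
    calc M * t ^ ε < t ^ (1 - ε) * t ^ ε := mul_lt_mul_of_pos_right h (rpow_pos_of_pos t0 _)
      _ = t := e
  have hte : 0 < t ^ ε := rpow_pos_of_pos t0 _
  let q : Euc d → ℂ := fun ζ => (oC (χ ((t ^ ε)⁻¹ • (tPi • ζ))))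
  have hqc : Continuous q := by
    refine continuous_ofReal.comp (hcont.comp ?_)
    fun_prop
  have hq0 : ∀ ζ : Euc d, t ≤ 2 * rpi * ‖ζ‖ → q ζ = 0 := fun ζ hζ => by
    have : χ ((t ^ ε)⁻¹ • (tPi • ζ)) = 0 := by
      refine hχM _ ?_
      rw [norm_smul, norm_smul, rno p.le, rno (inv_pos.2 hte).le, lt_inv_mul_iff₀ hte]
      linarith
    show (oC (χ ((t ^ ε)⁻¹ • (tPi • ζ)))) = 0
    rw [this]; simp
  have o1 : OB (fun x ζ : Euc d => aKG χ ε t x (tPi • ζ)) (K * Ccore d) := by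
    refine (congrArg (fun a => OB a (K * Ccore d)) ?_).mpr
      (main_OB hd t1 hqc.measurable hK (fun ζ => by rw [cnr]; exact hχK _) hq0)
    funext x ζ
    exact aKG_eq χ ε t0 x ζ
  have z1 : ∀ x ζ : Euc d, t / tPi < ‖ζ‖ → aKG χ ε t x (tPi • ζ) = 0 := fun x ζ h => by
    rw [div_lt_iff₀ p] at h
    have := hq0 ζ lI
    rw [aKG_eq χ ε t0]
    exact mul_eq_zero_of_right _ this
  have hpm : ∀ s : ℝ, eLpNorm (OpF (aKGpm χ δ ε s t) g) 2 (volume : Measure (Euc d))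
            ≤ eR (K * Ccore d * (1 + ∫ η, ‖F η‖)) * eLpNorm f 2 (volume : Measure (Euc d)) := fun s => by
    have hw : Measurable fun ζ : Euc d => (s * t / jap (tPi • ζ)) • (tPi • ζ) := by
      unfold jap; fun_prop
    have o2 := pm_OB o1 hKC.le hF hFi hinv hcont ⟨K, hχK⟩ (t ^ (oR/2 + δ))⁻¹ hw
    have o3 : OB (fun x ζ : Euc d => aKGpm χ δ ε s t x (tPi • ζ)) (K * Ccore d * (1 + ∫ η, ‖F η‖)) := by
      refine (congrArg (fun a => OB a (K * Ccore d * (1 + ∫ η, ‖F η‖))) ?_).mpr (o2.nonneg_mono (mll lI hKC.le))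
      funext x ζ
      exact aKGpm_eq χ δ ε s t0 x ζ
    refine red o3 (mul_pos hKC lI).le (R := t / tPi) (fun x ζ h => ?_) hf hg hfg
    rw [aKGpm_eq χ δ ε s t0, z1 x ζ h, mul_zero]
  refine ⟨?_, hpm 1, hpm (-1)⟩
  exact red (o1.nonneg_mono (le_mul_of_one_le_right hKC.le lI)) (mul_pos hKC lI).le
    (R := t / tPi) z1 hf hg hfg
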